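/- Let d ≥ 4, let (ρ_n)_{n∈ℕ} be an appropriate family, and let ε ∈ (0,1/2). Then for all sufficiently large n, with positive probability ℐ^{(1+ε)u_n, ρ_n} contains an infinite cluster; in particular u_*(ρ_n) ≤ (1+ε)·u_n. -/

import Mathlib

open MeasureTheory ProbabilityTheory Filter Topology
open scoped ENNReal NNReal Classical

noncomputable section

namespace FRIPaper

/-- The lattice `ℤ^d`. -/
abbrev Zd (d : ℕ) := Fin d → ℤ

/-- `x` and `y` are nearest neighbours in `ℤ^d` (`ℓ¹`-distance one). -/
def IsNN {d : ℕ} (x y : Zd d) : Prop := (∑ i, (x i - y i).natAbs) = 1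

/-- Event that a one-sided path never visits `A` at a positive time
(i.e. `H̃_A = ∞` for the path started anywhere). -/
def NoReturn {d : ℕ} (A : Set (Zd d)) : Set (ℕ → Zd d) := {ω | ∀ t : ℕ, 0 < t → ω t ∉ A}

/-- Event that a one-sided path does not visit `A` at a positive time `t ≤ s`
(i.e. `H̃_A > s`). -/
def NoReturnUpTo {d : ℕ} (A : Set (Zd d)) (s : ℝ) : Set (ℕ → Zd d) :=
  {ω | ∀ t : ℕ, 0 < t → (t : ℝ) ≤ s → ω t ∉ A}

/-- Specification of the law `P^x` of the discrete-time simple random walk on `ℤ^d`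
started at `x`, as a measure on the path space `ℕ → ℤ^d`: it is the unique probability
measure giving each nearest-neighbour cylinder of length `T` based at `x`
probability `(2d)^{-T}`. -/
def IsSRW (d : ℕ) (x : Zd d) (P : Measure (ℕ → Zd d)) : Prop :=
  IsProbabilityMeasure P ∧
    ∀ (T : ℕ) (w : ℕ → Zd d),
      P {ω | ∀ t ≤ T, ω t = w t} =
        if w 0 = x ∧ ∀ t < T, IsNN (w t) (w (t + 1)) then
          (((2 * d : ℕ) : ℝ≥0∞))⁻¹ ^ T else 0

/-- A family `P x`, `x ∈ ℤ^d`, of simple random walk laws. -/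
def IsSRWFamily (d : ℕ) (P : Zd d → Measure (ℕ → Zd d)) : Prop := ∀ x, IsSRW d x (P x)

/-- Equilibrium measure `e_A(x) = P^x[H̃_A = ∞] 1_{x ∈ A}`. -/
def equil {d : ℕ} (P : Zd d → Measure (ℕ → Zd d)) (A : Set (Zd d)) (x : Zd d) : ℝ :=
  if x ∈ A then (P x (NoReturn A)).toReal else 0

/-- Capacity `cap(A) = Σ_{x∈A} e_A(x)`. -/
def capacity {d : ℕ} (P : Zd d → Measure (ℕ → Zd d)) (A : Finset (Zd d)) : ℝ :=
  ∑ x ∈ A, equil P (↑A) x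

/-- Truncated capacity `cap(A,T) = Σ_{x∈A} P^x[H̃_A > T·(log T)^{-10}]`. -/
def capTrunc {d : ℕ} (P : Zd d → Measure (ℕ → Zd d)) (A : Finset (Zd d)) (T : ℝ) : ℝ :=
  ∑ x ∈ A, (P x (NoReturnUpTo (↑A) (T / (Real.log T) ^ (10 : ℕ)))).toReal

/-- `X[a,b]`, the set of points visited by the path between times `a` and `b`. -/
def walkRange {d : ℕ} (ω : ℕ → Zd d) (a b : ℕ) : Finset (Zd d) := (Finset.Icc a b).image ω

/-- `E^0[cap(X[0,T])]`. -/
def capExpect {d : ℕ} (P : Zd d → Measure (ℕ → Zd d)) (T : ℕ) : ℝ :=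
  ∫ ω, capacity P (walkRange ω 0 T) ∂ (P 0)

/-- `1 + log x · 1_{d = 4}`. -/
def logFour (d : ℕ) (x : ℝ) : ℝ := 1 + if d = 4 then Real.log x else 0

/-- `ε` is the constant `ε_d = lim_{T→∞} E^0[cap(X[0,T])]·T^{-1}·(1 + log T·1_{d=4})`,
which lies in `(0,∞)`. -/
def IsCapLimit (d : ℕ) (P : Zd d → Measure (ℕ → Zd d)) (ε : ℝ) : Prop :=
  0 < ε ∧ Tendsto (fun T : ℕ => capExpect P T * logFour d T / (T : ℝ)) atTop (𝓝 ε)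

/-! ### Distributions on `ℕ` -/

/-- `ρ` is a probability distribution on `ℕ`. -/
def IsDist (ρ : ℕ → ℝ) : Prop := (∀ k, 0 ≤ ρ k) ∧ HasSum ρ 1

/-- `k`-th moment `μ_k(ρ)`. -/
def mu (k : ℕ) (ρ : ℕ → ℝ) : ℝ := ∑' l : ℕ, (l : ℝ) ^ k * ρ l

/-- Tail `μ_k^{(m)}(ρ) = Σ_{l ≥ m} l^k ρ(l)`. -/
def muTail (k m : ℕ) (ρ : ℕ → ℝ) : ℝ := ∑' l : ℕ, if m ≤ l then (l : ℝ) ^ k * ρ l else 0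

/-- An appropriate family of distributions on `ℕ`. -/
def Appropriate (ρ : ℕ → ℕ → ℝ) : Prop :=
  (∀ n, IsDist (ρ n)) ∧
  (∀ n, Summable fun l : ℕ => (l : ℝ) ^ 2 * ρ n l) ∧
  Tendsto (fun n => mu 1 (ρ n)) atTop atTop ∧
  ∀ ε : ℝ, 0 < ε → ∃ C : ℝ,
    ∀ n, (∑' L : ℕ, if C * mu 1 (ρ n) ≤ (L : ℝ) then (L : ℝ) ^ 2 * ρ n L / mu 2 (ρ n) else 0) ≤ ε

/-- Geometric distribution `Geo(λ)(k) = λ (1-λ)^k`. -/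
def geo (lam : ℝ) (k : ℕ) : ℝ := lam * (1 - lam) ^ k

/-! ### Trajectories and finitary random interlacements -/

/-- A finite trajectory in `ℤ^d`, recorded as the list of its positions. -/
abbrev Traj (d : ℕ) := List (Zd d)

/-- A point configuration: the multiplicity of each trajectory. -/
abbrev Config (d : ℕ) := Traj d → ℕ

/-- A valid trajectory: a nonempty nearest-neighbour path. -/
def ValidTraj {d : ℕ} (η : Traj d) : Prop := η ≠ [] ∧ η.Chain' IsNN

/-- The time length `T(η)` of a trajectory. -/
def len {d : ℕ} (η : Traj d) : ℕ := η.length - 1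

/-- The range of a trajectory, as a set. -/
def rangeSet {d : ℕ} (η : Traj d) : Set (Zd d) := {y | y ∈ η}

/-- The trajectory `η` visits the set `A`. -/
def hits {d : ℕ} (η : Traj d) (A : Set (Zd d)) : Prop := ∃ y ∈ η, y ∈ A

/-- Poisson probability mass `e^{-r} r^n / n!`. -/
def poissonProb (r : ℝ) (n : ℕ) : ℝ≥0∞ :=
  ENNReal.ofReal (Real.exp (-r) * r ^ n / n.factorial)

/-- The intensity `u·π({η})` that FRI with parameters `(u,ρ)` puts on a single
trajectory `η`: trajectories of length `l` from each starting point carry mass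
`u·ρ(l)/(μ₁(ρ)+1)·(2d)^{-l}` each. -/
def friIntensity (d : ℕ) (u : ℝ) (ρ : ℕ → ℝ) (η : Traj d) : ℝ :=
  if ValidTraj η then u * ρ (len η) / (mu 1 ρ + 1) * (1 / (2 * (d : ℝ))) ^ (len η) else 0

/-- `P` is the law of a Poisson point process on the countable set of trajectories
with intensity function `ι`: the multiplicities of distinct trajectories are
independent Poisson random variables. -/
def IsPoissonPP (d : ℕ) (ι : Traj d → ℝ) (P : Measure (Config d)) : Prop :=
  IsProbabilityMeasure P ∧
    ∀ (F : Finset (Traj d)) (k : Traj d → ℕ),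
      P {ω | ∀ η ∈ F, ω η = k η} = ∏ η ∈ F, poissonProb (ι η) (k η)

/-- `P` is the law of the finitary random interlacements point process `𝒳^{u,ρ}`. -/
def IsFRI (d : ℕ) (u : ℝ) (ρ : ℕ → ℝ) (P : Measure (Config d)) : Prop :=
  IsPoissonPP d (friIntensity d u ρ) P

/-- `J` is the law of an i.i.d. sequence of copies of `𝒳^{u,ρ}`. -/
def IsFRIseq (d : ℕ) (u : ℝ) (ρ : ℕ → ℝ) (J : Measure (ℕ → Config d)) : Prop :=
  IsProbabilityMeasure J ∧
    ∀ (F : Finset (ℕ × Traj d)) (k : ℕ × Traj d → ℕ),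
      J {j | ∀ p ∈ F, j p.1 p.2 = k p} = ∏ p ∈ F, poissonProb (friIntensity d u ρ p.2) (k p)

/-! ### Percolation -/

/-- The edge `{x,y}` is traversed by some trajectory of the configuration `ω`. -/
def EdgeOpen {d : ℕ} (ω : Config d) (x y : Zd d) : Prop :=
  ∃ η : Traj d, 0 < ω η ∧ ∃ i : ℕ,
    (η[i]? = some x ∧ η[i + 1]? = some y) ∨ (η[i]? = some y ∧ η[i + 1]? = some x)

/-- The cluster of `x` in the subgraph `ℐ` induced by the configuration `ω`. -/
def Cluster {d : ℕ} (ω : Config d) (x : Zd d) : Set (Zd d) :=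
  {y | Relation.ReflTransGen (EdgeOpen ω) x y}

/-- The origin lies in an infinite cluster. -/
def PercEvent (d : ℕ) : Set (Config d) := {ω | (Cluster ω 0).Infinite}

/-- The critical intensity `u_*(ρ)`, given the family `u ↦ 𝒳^{u,ρ}`. -/
def uStar (d : ℕ) (X : ℝ → Measure (Config d)) : ℝ :=
  sInf {u : ℝ | 0 ≤ u ∧ 0 < X u (PercEvent d)}

/-- The order `u_n = μ₁(ρ)·(1 + log μ₁(ρ)·1_{d=4}) / (ε_d·μ₂(ρ))` of the
critical intensity. -/
def uN (d : ℕ) (εd : ℝ) (ρ : ℕ → ℝ) : ℝ :=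
  mu 1 ρ * logFour d (mu 1 ρ) / (εd * mu 2 ρ)

/-! ### `ρ`-capacity, Green function, `κ` and `φ` -/

/-- `e_A^{(ρ)}(x) = Σ_m (μ₀^{(m)}(ρ)/(μ₁(ρ)+1))·P^x[H̃_A > m]`. -/
def equilRho {d : ℕ} (P : Zd d → Measure (ℕ → Zd d)) (ρ : ℕ → ℝ) (A : Set (Zd d))
    (x : Zd d) : ℝ :=
  ∑' m : ℕ, (muTail 0 m ρ / (mu 1 ρ + 1)) * (P x (NoReturnUpTo A (m : ℝ))).toReal

/-- `cap^{(ρ)}(A) = Σ_{x∈A} e_A^{(ρ)}(x)`. -/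
def capRho {d : ℕ} (P : Zd d → Measure (ℕ → Zd d)) (ρ : ℕ → ℝ) (A : Finset (Zd d)) : ℝ :=
  ∑ x ∈ A, equilRho P ρ (↑A) x

/-- Green's function `g(x,y) = Σ_t P^x[X_t = y]`. -/
def green {d : ℕ} (P : Zd d → Measure (ℕ → Zd d)) (x y : Zd d) : ℝ :=
  ∑' t : ℕ, (P x {ω | ω t = y}).toReal

/-- `φ^{(ρ)}(A,B) = Σ_{x∈A} Σ_{y∈B} e_A^{(ρ)}(x) e_B^{(ρ)}(y) g(x,y)`. -/
def phiRho {d : ℕ} (P : Zd d → Measure (ℕ → Zd d)) (ρ : ℕ → ℝ) (A B : Finset (Zd d)) : ℝ :=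
  ∑ x ∈ A, ∑ y ∈ B, equilRho P ρ (↑A) x * equilRho P ρ (↑B) y * green P x y

/-- `κ^{(ρ)}(A) = Σ_{x∈A} Σ_m (μ₁^{(m)}(ρ)/μ₂(ρ))·P^x[H̃_A > m]` (real-valued,
for finite `A`). -/
def kappa {d : ℕ} (P : Zd d → Measure (ℕ → Zd d)) (ρ : ℕ → ℝ) (A : Finset (Zd d)) : ℝ :=
  ∑ x ∈ A, ∑' m : ℕ, (muTail 1 m ρ / mu 2 ρ) * (P x (NoReturnUpTo (↑A) (m : ℝ))).toReal

/-- `κ^{(ρ)}(A)` as an extended-real valued quantity, for arbitrary `A`. -/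
def kappaE {d : ℕ} (P : Zd d → Measure (ℕ → Zd d)) (ρ : ℕ → ℝ) (A : Set (Zd d)) : ℝ≥0∞ :=
  ∑' x : Zd d,
    A.indicator (fun x => ∑' m : ℕ,
      ENNReal.ofReal (muTail 1 m ρ / mu 2 ρ) * P x (NoReturnUpTo A (m : ℝ))) x

/-! ### Exploration processes -/

/-- First components: the `k`-th layer `L_k` of vertices; second components:
`∪_{i<k} L_i`.  Layer `L_{k+1}` is spanned by the trajectories of `ω` meeting `L_k`
but not `∪_{i<k} L_i`. -/
def exploreSets {d : ℕ} (ω : Config d) : ℕ → Set (Zd d) × Set (Zd d)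
  | 0 => ({0}, ∅)
  | k + 1 =>
    ({y | ∃ η : Traj d, 0 < ω η ∧ hits η (exploreSets ω k).1 ∧
        ¬ hits η (exploreSets ω k).2 ∧ y ∈ η},
      (exploreSets ω k).1 ∪ (exploreSets ω k).2)

/-- The `i`-th layer `𝓛_i` of trajectories of the exploration of the cluster of the
origin, as a sub-configuration of `ω`. -/
def exploreLayer {d : ℕ} (ω : Config d) : ℕ → Config d
  | 0 => fun _ => 0
  | k + 1 => fun η =>
      if hits η (exploreSets ω k).1 ∧ ¬ hits η (exploreSets ω k).2 then ω η else 0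

/-- The vertex sets `L'_k` of the dominating exploration driven by the i.i.d.
sequence `j`. -/
def exploreSets' {d : ℕ} (j : ℕ → Config d) : ℕ → Set (Zd d)
  | 0 => {0}
  | k + 1 => {y | ∃ η : Traj d, 0 < j (k + 1) η ∧ hits η (exploreSets' j k) ∧ y ∈ η}

/-- The trajectory layers `𝓛'_i` of the dominating exploration. -/
def exploreLayer' {d : ℕ} (j : ℕ → Config d) : ℕ → Config d
  | 0 => fun _ => 0
  | k + 1 => fun η => if hits η (exploreSets' j k) then j (k + 1) η else 0

/-- `W_k = 𝔼[κ^{(ρ)}(L'_k)]`. -/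
def Wexp {d : ℕ} (P : Zd d → Measure (ℕ → Zd d)) (ρ : ℕ → ℝ)
    (J : Measure (ℕ → Config d)) (k : ℕ) : ℝ≥0∞ :=
  ∫⁻ j, kappaE P ρ (exploreSets' j k) ∂ J

/-- `V_k = 𝔼[|L'_k|]`, multiplied by `(log μ₁(ρ))⁻¹` when `d = 4`. -/
def Vexp (d : ℕ) (ρ : ℕ → ℝ) (J : Measure (ℕ → Config d)) (k : ℕ) : ℝ≥0∞ :=
  (if d = 4 then ENNReal.ofReal (1 / Real.log (mu 1 ρ)) else 1) *
    ∫⁻ j, ENat.toENNReal (exploreSets' j k).encard ∂ J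

/-! ### Two-sided finite random walk trajectories -/

/-- `μ(x,m,l)({η})`: the two-sided path `(X_{-m},…,X_l)` of a doubly infinite walk
with `X_0 = x` equals the list `η` (of length `m+l+1`, with `η[m] = x`)
with probability `(2d)^{-(m+l)}` for every admissible nearest-neighbour list. -/
def twoSidedProb (d : ℕ) (x : Zd d) (m l : ℕ) (η : Traj d) : ℝ :=
  if η.length = m + l + 1 ∧ η.Chain' IsNN ∧ η[m]? = some x then
    (1 / (2 * (d : ℝ))) ^ (m + l) else 0

/-- The `ℓ^∞`-diameter of the range of `η` is at most `R`. -/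
def DiamLE {d : ℕ} (η : Traj d) (R : ℝ) : Prop :=
  ∀ a ∈ η, ∀ b ∈ η, ∀ i, |((a i - b i : ℤ) : ℝ)| ≤ R

/-- `P^x[X[-m,-1] ∩ A = ∅]`: the probability that an `m`-step walk from `x`
avoids `A` at all positive times, written combinatorially. -/
def backAvoidProb (d : ℕ) (A : Set (Zd d)) (x : Zd d) (m : ℕ) : ℝ :=
  ∑' w : Traj d,
    if w.length = m + 1 ∧ w.Chain' IsNN ∧ w[0]? = some x ∧
        (∀ i : ℕ, 0 < i → ∀ y, w[i]? = some y → y ∉ A) then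
      (1 / (2 * (d : ℝ))) ^ m else 0

/-- `μ(x,m,l;A)({η}) = P^x[X[-m,l] = η | X[-m,-1] ∩ A = ∅]`. -/
def condTwoSidedProb (d : ℕ) (A : Set (Zd d)) (x : Zd d) (m l : ℕ) (η : Traj d) : ℝ :=
  (if ∀ i < m, ∀ y, η[i]? = some y → y ∉ A then twoSidedProb d x m l η else 0) /
    backAvoidProb d A x m

/-- `π_A({η}) = Σ_{x∈A} Σ_{m,l} (ρ(m+l)/(μ₁(ρ)+1))·P^x[H̃_A > m]·μ(x,m,l;A)({η})`. -/
def piA (d : ℕ) (P : Zd d → Measure (ℕ → Zd d)) (ρ : ℕ → ℝ) (A : Finset (Zd d))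
    (η : Traj d) : ℝ :=
  ∑ x ∈ A, ∑' m : ℕ, ∑' l : ℕ,
    ρ (m + l) / (mu 1 ρ + 1) * (P x (NoReturnUpTo (↑A) (m : ℝ))).toReal *
      condTwoSidedProb d (↑A) x m l η

/-- The sub-configuration of trajectories meeting `A`, i.e. `𝒳[A]`. -/
def restrictConfig {d : ℕ} (A : Finset (Zd d)) (ω : Config d) : Config d :=
  fun η => if hits η (↑A) then ω η else 0

/-! ### Products and geometric laws -/

/-- The geometric measure `Geo(1/(T+1))` on `ℕ`. -/
def geoMeasure (T : ℕ) : Measure ℕ :=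
  Measure.sum fun k : ℕ => (ENNReal.ofReal (geo (1 / ((T : ℝ) + 1)) k)) • Measure.dirac k

/-- `Q` is the product (independent coupling) of `μ` and `ν`. -/
def IsProdOf {α β : Type*} [MeasurableSpace α] [MeasurableSpace β]
    (Q : Measure (α × β)) (μ : Measure α) (ν : Measure β) : Prop :=
  IsProbabilityMeasure Q ∧
    ∀ (A : Set α) (B : Set β), MeasurableSet A → MeasurableSet B → Q (A ×ˢ B) = μ A * ν B

/-! ### Coarse graining quantities -/

/-- The constant `c = 0.01`. -/
def cConst : ℝ := 0.01

/-- `R_n = ⌊√(μ₁(ρ_n))⌋`. -/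
def Rn (ρ : ℕ → ℕ → ℝ) (n : ℕ) : ℕ := ⌊Real.sqrt (mu 1 (ρ n))⌋₊

/-- The mesoscopic scale `L_n`. -/
def Ln (d : ℕ) (ρ : ℕ → ℕ → ℝ) (n : ℕ) : ℝ :=
  if d = 4 then (Rn ρ n : ℝ) * (Real.log (Rn ρ n)) ^ (-cConst)
  else (Rn ρ n : ℝ) ^ ((2 + cConst) / ((d : ℝ) - 2))

/-- The slowly growing factor `I_n`. -/
def In (d : ℕ) (ρ : ℕ → ℕ → ℝ) (n : ℕ) : ℝ :=
  if d = 4 then (Real.log (Rn ρ n)) ^ cConst else (Rn ρ n : ℝ) ^ cConst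

/-- The scale `T'_n`. -/
def Tn' (d : ℕ) (ρ : ℕ → ℕ → ℝ) (n : ℕ) : ℕ :=
  if d = 4 then ⌊(Rn ρ n : ℝ) ^ (2 : ℕ) / Real.log (mu 1 (ρ n))⌋₊
  else ⌊(Rn ρ n : ℝ) ^ ((2 : ℝ) - cConst / 4)⌋₊

/-- The scale `l_n`. -/
def lnPar (d : ℕ) (ρ : ℕ → ℕ → ℝ) (n : ℕ) : ℕ :=
  if d = 4 then ⌊(Rn ρ n : ℝ) * (Real.log (Rn ρ n)) ^ (-(2 * cConst))⌋₊
  else ⌊(Rn ρ n : ℝ) ^ ((1 : ℝ) - cConst / 4)⌋₊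

/-- The scale `t_n`. -/
def tnPar (d : ℕ) (ρ : ℕ → ℕ → ℝ) (n : ℕ) : ℕ :=
  if d = 4 then ⌊(Rn ρ n : ℝ) ^ (2 : ℕ) / (Real.log (Rn ρ n)) ^ (10 : ℕ)⌋₊
  else ⌊(Rn ρ n : ℝ) ^ ((2 : ℝ) - cConst)⌋₊

/-- `y` is within `ℓ^∞`-distance `r` of `z`. -/
def InBall {d : ℕ} (y z : Zd d) (r : ℝ) : Prop := ∀ i, |((y i - z i : ℤ) : ℝ)| ≤ r

/-- The `ℓ^∞` `r`-neighbourhood `B(A,r)`. -/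
def nbhd {d : ℕ} (A : Set (Zd d)) (r : ℝ) : Set (Zd d) := {y | ∃ z ∈ A, InBall y z r}

/-- The sub-path `η[a, b]` of a trajectory. -/
def segment {d : ℕ} (η : Traj d) (a b : ℕ) : Traj d := (η.drop a).take (b - a + 1)

/-- `η` is a typical trajectory (the event `𝒯_n = ℰ₁ ∩ ℰ₂ ∩ ℰ₃ ∩ ℰ₄`). -/
def Typical (d : ℕ) (P : Zd d → Measure (ℕ → Zd d)) (εd : ℝ) (ρ : ℕ → ℕ → ℝ)
    (kk KK M θ1 : ℝ) (n : ℕ) (η : Traj d) : Prop :=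
  ValidTraj η ∧
  -- ℰ₁
  (kk * (Rn ρ n : ℝ) ^ 2 ≤ (len η : ℝ) ∧ (len η : ℝ) ≤ KK * (Rn ρ n : ℝ) ^ 2 ∧
    ∀ y ∈ η, InBall y η.headI (M * (Rn ρ n : ℝ))) ∧
  -- ℰ₂
  (if d = 4 then
    (1 - θ1 ^ 2) * (Real.pi ^ 2 / 8) * (len η : ℝ) / Real.log (mu 1 (ρ n)) <
        capacity P η.toFinset ∧
      capTrunc P η.toFinset ((Rn ρ n : ℝ) ^ 2) <
        (1 + θ1 ^ 2) * (Real.pi ^ 2 / 8) * (len η : ℝ) / Real.log (mu 1 (ρ n))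
  else
    (1 - θ1 ^ 2) * εd * (len η : ℝ) < capacity P η.toFinset ∧
      capacity P η.toFinset < (1 + θ1 ^ 2) * εd * (len η : ℝ)) ∧
  -- ℰ₃
  ((Set.ncard (nbhd (rangeSet η) (Ln d ρ n)) : ℝ) <
    (Rn ρ n : ℝ) ^ 2 * (Ln d ρ n) ^ (d - 2) * (In d ρ n) ^ ((1 : ℝ) / 3)) ∧
  -- ℰ₄
  (∀ j : ℕ, j * Tn' d ρ n ≤ len η →
    if d = 4 then
      capacity P (segment η (j * Tn' d ρ n) (min ((j + 1) * Tn' d ρ n) (len η))).toFinset ≤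
          (1 + θ1 ^ 2) * (Real.pi ^ 2 / 8) * (Tn' d ρ n : ℝ) / Real.log (mu 1 (ρ n)) ∧
        ∀ a ∈ segment η (j * Tn' d ρ n) (min ((j + 1) * Tn' d ρ n) (len η)),
          ∀ b ∈ segment η (j * Tn' d ρ n) (min ((j + 1) * Tn' d ρ n) (len η)),
            ∀ i, |((a i - b i : ℤ) : ℝ)| <
              (1 / 2) * Real.sqrt (len η : ℝ) * (Real.log (mu 1 (ρ n))) ^ (-cConst)
    else
      capacity P (segment η (j * Tn' d ρ n) (min ((j + 1) * Tn' d ρ n) (len η))).toFinset ≤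
        (1 + θ1 ^ 2) * εd * (Tn' d ρ n : ℝ))

/-- `x` belongs to the `*`-proper part `η̂` of the trajectory `η`. -/
def ProperStar (d : ℕ) (P : Zd d → Measure (ℕ → Zd d)) (ρ : ℕ → ℕ → ℝ)
    (θ1 θ2 : ℝ) (n : ℕ) (η : Traj d) (x : Zd d) : Prop :=
  x ∈ rangeSet η ∧
    (if d = 4 then
      θ2 / Real.log (mu 1 (ρ n)) ≤ equil P (rangeSet η) x ∧
        (P x (NoReturnUpTo (rangeSet η)
            ((Rn ρ n : ℝ) ^ 2 / (Real.log (Rn ρ n)) ^ (10 : ℕ)))).toReal ≤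
          (1 + θ1) * equil P (rangeSet η) x
    else θ2 ≤ equil P (rangeSet η) x)

set_option linter.unusedSectionVars false
set_option linter.unusedVariables false

/-! ## F1: walks as lists of directions -/

/-- Directions. -/
abbrev Dir (d : ℕ) := Fin d × Bool

/-- Unit vector of a direction. -/
def dv {d : ℕ} (e : Dir d) : Zd d := Pi.single e.1 (if e.2 then 1 else -1)

/-- Opposite direction. -/
def op {d : ℕ} (e : Dir d) : Dir d := (e.1, !e.2)

lemma op_op {d : ℕ} (e : Dir d) : op (op e) = e := by simp [op]

lemma dv_op {d : ℕ} (e : Dir d) : dv (op e) = - dv e := by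
  unfold dv op
  rw [← Pi.single_neg]
  rcases e with ⟨i, b⟩
  cases b <;> simp

lemma dv_inj {d : ℕ} {e e' : Dir d} (h : dv e = dv e') : e = e' := by
  rcases e with ⟨i, b⟩
  rcases e' with ⟨j, c⟩
  unfold dv at h
  have h1 := congrFun h i
  simp only [Pi.single_eq_same] at h1
  by_cases hij : i = j
  · subst hij
    simp only [Pi.single_eq_same] at h1
    cases b <;> cases c <;> simp at h1 ⊢
  · rw [Pi.single_eq_of_ne hij] at h1
    cases b <;> simp at h1

lemma isNN_dv {d : ℕ} (x : Zd d) (e : Dir d) : IsNN x (x + dv e) := by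
  unfold IsNN
  rw [Finset.sum_eq_single e.1]
  · rcases e with ⟨i, b⟩
    cases b <;> simp [dv]
  · intro j _ hj
    simp [dv, Pi.single_eq_of_ne hj]
  · simp

lemma isNN_iff {d : ℕ} (x y : Zd d) : IsNN x y ↔ ∃ e : Dir d, y = x + dv e := by
  constructor
  · intro h
    unfold IsNN at h
    have hex : ∃ i, (x i - y i).natAbs ≠ 0 := by
      by_contra hc
      push Not at hc
      simp [hc] at h
    obtain ⟨i, hi⟩ := hex
    have hsum := Finset.add_sum_erase Finset.univ (fun i => (x i - y i).natAbs) (Finset.mem_univ i)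
    rw [h] at hsum
    have h1 : (x i - y i).natAbs = 1 := by omega
    have h0 : ∑ j ∈ Finset.univ.erase i, (x j - y j).natAbs = 0 := by omega
    have hz : ∀ j, j ≠ i → x j = y j := by
      intro j hj
      have := (Finset.sum_eq_zero_iff.mp h0) j (by simp [hj])
      omega
    refine ⟨(i, decide (y i - x i = 1)), ?_⟩
    funext j
    by_cases hj : j = i
    · subst hj
      simp only [dv, Pi.add_apply, Pi.single_eq_same]
      by_cases hh : y j - x j = 1
      · simp [hh]; omega
      · simp [hh]; omega
    · simp [dv, Pi.single_eq_of_ne hj, hz j hj]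
  · rintro ⟨e, rfl⟩
    exact isNN_dv x e

/-- end position -/
def pos {d : ℕ} (x : Zd d) : List (Dir d) → Zd d
  | [] => x
  | e :: s => pos (x + dv e) s

/-- positions after the starting point -/
def trT {d : ℕ} (x : Zd d) : List (Dir d) → List (Zd d)
  | [] => []
  | e :: s => (x + dv e) :: trT (x + dv e) s

/-- all positions -/
def tr {d : ℕ} (x : Zd d) (s : List (Dir d)) : List (Zd d) := x :: trT x s

section
variable {d : ℕ}

@[simp] lemma pos_nil (x : Zd d) : pos x [] = x := rfl
@[simp] lemma pos_cons (x : Zd d) (e : Dir d) (s) : pos x (e :: s) = pos (x + dv e) s := rfl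
@[simp] lemma trT_nil (x : Zd d) : trT x [] = [] := rfl
@[simp] lemma trT_cons (x : Zd d) (e : Dir d) (s) :
    trT x (e :: s) = (x + dv e) :: trT (x + dv e) s := rfl

@[simp] lemma trT_length (x : Zd d) (s) : (trT x s).length = s.length := by
  induction s generalizing x with
  | nil => rfl
  | cons e s ih => simp [ih]

@[simp] lemma tr_length (x : Zd d) (s) : (tr x s).length = s.length + 1 := by simp [tr]

lemma pos_append (x : Zd d) (s t) : pos x (s ++ t) = pos (pos x s) t := by
  induction s generalizing x with
  | nil => rfl
  | cons e s ih => simp [ih]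

lemma trT_append (x : Zd d) (s t) : trT x (s ++ t) = trT x s ++ trT (pos x s) t := by
  induction s generalizing x with
  | nil => rfl
  | cons e s ih => simp [ih]

lemma pos_shift (x y : Zd d) (s) : pos (x + y) s = x + pos y s := by
  induction s generalizing y with
  | nil => rfl
  | cons e s ih => simp [add_assoc, ih]

lemma pos_eq (x : Zd d) (s) : pos x s = x + pos 0 s := by
  have := pos_shift x 0 s
  simpa using this

lemma trT_shift (x y : Zd d) (s) : trT (x + y) s = (trT y s).map (fun z => x + z) := by
  induction s generalizing y with
  | nil => rfl
  | cons e s ih => simp [add_assoc, ih]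

lemma tr_shift (x y : Zd d) (s) : tr (x + y) s = (tr y s).map (fun z => x + z) := by
  simp [tr, trT_shift]

lemma trT_drop (x : Zd d) (s) (n : ℕ) : (trT x s).drop n = trT (pos x (s.take n)) (s.drop n) := by
  induction n generalizing x s with
  | zero => simp
  | succ n ih => cases s with
    | nil => simp
    | cons e s => simp [ih]

lemma trT_take (x : Zd d) (s) (n : ℕ) : (trT x s).take n = trT x (s.take n) := by
  induction n generalizing x s with
  | zero => simp
  | succ n ih => cases s with
    | nil => simp
    | cons e s => simp [ih]

lemma tr_take (x : Zd d) (s) (n : ℕ) : (tr x s).take (n + 1) = tr x (s.take n) := by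
  simp [tr, trT_take]

lemma tr_drop (x : Zd d) (s) (n : ℕ) (h : n ≤ s.length) :
    (tr x s).drop n = tr (pos x (s.take n)) (s.drop n) := by
  induction n generalizing x s with
  | zero => simp
  | succ n ih => cases s with
    | nil => simp at h
    | cons e s =>
      simp only [List.length_cons, Nat.add_le_add_iff_right] at h
      have := ih (x + dv e) s h
      simpa [tr] using this

lemma trT_inj (x : Zd d) {s t : List (Dir d)} (h : trT x s = trT x t) : s = t := by
  induction s generalizing x t with
  | nil => cases t with
    | nil => rfl
    | cons e t => simp at h
  | cons e s ih => cases t with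
    | nil => simp at h
    | cons f t =>
      simp only [trT_cons, List.cons.injEq, add_right_inj] at h
      obtain ⟨h1, h2⟩ := h
      have := dv_inj h1
      subst this
      rw [ih _ h2]

lemma tr_chain (x : Zd d) (s) : (tr x s).IsChain IsNN := by
  induction s generalizing x with
  | nil => simp [tr]
  | cons e s ih =>
    have := ih (x + dv e)
    simp only [tr, trT_cons] at this ⊢
    rw [List.isChain_cons_cons]
    exact ⟨isNN_dv x e, this⟩

lemma exists_tr_of_chain (x : Zd d) (l : List (Zd d)) (h : (x :: l).IsChain IsNN) :
    ∃ s, l = trT x s := by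
  induction l generalizing x with
  | nil => exact ⟨[], rfl⟩
  | cons y l ih =>
    rw [List.isChain_cons_cons] at h
    obtain ⟨e, rfl⟩ := (isNN_iff _ _).1 h.1
    obtain ⟨s, hs⟩ := ih _ h.2
    exact ⟨e :: s, by simp [← hs]⟩

lemma isNN_symm {x y : Zd d} (h : IsNN x y) : IsNN y x := by
  unfold IsNN at *
  rw [← h]
  refine Finset.sum_congr rfl fun i _ => ?_
  omega

lemma pos_mem_tr (x : Zd d) (s) : pos x s ∈ tr x s := by
  induction s generalizing x with
  | nil => simp [tr]
  | cons e s ih =>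
    have := ih (x + dv e)
    simp only [tr, pos_cons, trT_cons] at this ⊢
    exact List.mem_cons_of_mem _ this

/-! ### Lists of given length and expectation -/

/-- All direction lists of length `n`. -/
def Lst (d : ℕ) : ℕ → Finset (List (Dir d))
  | 0 => {[]}
  | n + 1 => (Finset.univ ×ˢ Lst d n).image (fun p => p.1 :: p.2)

lemma mem_Lst {n : ℕ} {s : List (Dir d)} : s ∈ Lst d n ↔ s.length = n := by
  induction n generalizing s with
  | zero => simp [Lst]
  | succ n ih =>
    cases s with
    | nil => simp [Lst]
    | cons e s => simp [Lst, ih]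

lemma sum_Lst_succ (n : ℕ) (F : List (Dir d) → ℝ) :
    ∑ s ∈ Lst d (n + 1), F s = ∑ e, ∑ s ∈ Lst d n, F (e :: s) := by
  rw [Lst, Finset.sum_image, Finset.sum_product]
  rintro ⟨a, b⟩ _ ⟨a', b'⟩ _ h
  simpa using h

/-- Expectation over `n` uniform steps. -/
def Ex (n : ℕ) (F : List (Dir d) → ℝ) : ℝ := (∑ s ∈ Lst d n, F s) / (2 * (d : ℝ)) ^ n

@[simp] lemma Ex_zero (F : List (Dir d) → ℝ) : Ex 0 F = F [] := by simp [Ex, Lst]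

lemma Ex_succ (n : ℕ) (F : List (Dir d) → ℝ) :
    Ex (n + 1) F = (∑ e : Dir d, Ex n (fun s => F (e :: s))) / (2 * (d : ℝ)) := by
  simp only [Ex]
  rw [sum_Lst_succ, ← Finset.sum_div, div_div, pow_succ]

lemma Ex_congr {n : ℕ} {F F' : List (Dir d) → ℝ} (h : ∀ s, s.length = n → F s = F' s) :
    Ex n F = Ex n F' := by
  unfold Ex
  rw [Finset.sum_congr rfl fun s hs => h s (mem_Lst.1 hs)]

lemma Ex_mono {n : ℕ} {F F' : List (Dir d) → ℝ} (h : ∀ s, s.length = n → F s ≤ F' s) :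
    Ex n F ≤ Ex n F' := by
  unfold Ex
  gcongr with s hs
  exact h s (mem_Lst.1 hs)

lemma Ex_nonneg {n : ℕ} {F : List (Dir d) → ℝ} (h : ∀ s, s.length = n → 0 ≤ F s) :
    0 ≤ Ex n F := by
  unfold Ex
  refine div_nonneg (Finset.sum_nonneg fun s hs => h s (mem_Lst.1 hs)) (by positivity)

lemma Ex_add_fun (n : ℕ) (F F' : List (Dir d) → ℝ) :
    Ex n (fun s => F s + F' s) = Ex n F + Ex n F' := by
  simp [Ex, Finset.sum_add_distrib, add_div]

lemma Ex_sub_fun (n : ℕ) (F F' : List (Dir d) → ℝ) :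
    Ex n (fun s => F s - F' s) = Ex n F - Ex n F' := by
  simp [Ex, Finset.sum_sub_distrib, sub_div]

lemma Ex_mul_left (n : ℕ) (c : ℝ) (F : List (Dir d) → ℝ) :
    Ex n (fun s => c * F s) = c * Ex n F := by
  simp [Ex, ← Finset.mul_sum, mul_div_assoc]

lemma Ex_mul_right (n : ℕ) (c : ℝ) (F : List (Dir d) → ℝ) :
    Ex n (fun s => F s * c) = Ex n F * c := by
  simp only [mul_comm _ c, Ex_mul_left]

lemma Ex_sum {ι : Type*} (n : ℕ) (I : Finset ι) (F : ι → List (Dir d) → ℝ) :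
    Ex n (fun s => ∑ i ∈ I, F i s) = ∑ i ∈ I, Ex n (F i) := by
  simp only [Ex]
  rw [Finset.sum_comm, Finset.sum_div]

lemma Ex_append (a b : ℕ) (F : List (Dir d) → ℝ) :
    Ex (a + b) F = Ex a (fun s => Ex b (fun t => F (s ++ t))) := by
  induction a generalizing F with
  | zero => simp
  | succ a ih =>
    rw [show a + 1 + b = (a + b) + 1 by ring, Ex_succ, Ex_succ]
    simp [ih]

variable [NeZero d]

lemma twod_pos : (0 : ℝ) < 2 * (d : ℝ) := by
  have : 0 < d := Nat.pos_of_ne_zero (NeZero.ne d)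
  positivity

@[simp] lemma Ex_const (n : ℕ) (c : ℝ) : Ex n (fun _ : List (Dir d) => c) = c := by
  induction n with
  | zero => simp
  | succ n ih =>
    rw [Ex_succ, ih]
    have := twod_pos (d := d)
    simp
    have h2 : (d : ℝ) ≠ 0 := by intro h; simp [h] at this
    field_simp

lemma Ex_le_const {n : ℕ} {F : List (Dir d) → ℝ} {c : ℝ} (h : ∀ s, s.length = n → F s ≤ c) :
    Ex n F ≤ c := by
  have := Ex_mono h
  rwa [Ex_const] at this

lemma const_le_Ex {n : ℕ} {F : List (Dir d) → ℝ} {c : ℝ} (h : ∀ s, s.length = n → c ≤ F s) :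
    c ≤ Ex n F := by
  have := Ex_mono h
  rwa [Ex_const] at this

lemma Ex_tsum {n : ℕ} (F : ℕ → List (Dir d) → ℝ) (h : ∀ s, s.length = n → Summable fun k => F k s) :
    Ex n (fun s => ∑' k, F k s) = ∑' k, Ex n (F k) := by
  simp only [Ex]
  rw [tsum_div_const, Summable.tsum_finsetSum]
  intro s hs
  exact h s (mem_Lst.1 hs)

/-- Expectation is invariant under reversing and flipping. -/
def rf (s : List (Dir d)) : List (Dir d) := (s.map op).reverse

lemma rf_rf (s : List (Dir d)) : rf (rf s) = s := by
  simp [rf, op_op, Function.comp_def]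

lemma Ex_rf (n : ℕ) (F : List (Dir d) → ℝ) : Ex n (fun s => F (rf s)) = Ex n F := by
  unfold Ex
  congr 1
  refine Finset.sum_nbij' rf rf ?_ ?_ ?_ ?_ ?_
  · intro s hs; rw [mem_Lst] at *; simpa [rf] using hs
  · intro s hs; rw [mem_Lst] at *; simpa [rf] using hs
  · intro s _; exact rf_rf s
  · intro s _; exact rf_rf s
  · intro s _; rfl

lemma pos_rf (x : Zd d) (s) : pos x (rf s) = x - (pos 0 s) := by
  induction s generalizing x with
  | nil => simp [rf]
  | cons e s ih =>
    have h : rf (e :: s) = rf s ++ [op e] := by simp [rf]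
    rw [h, pos_append, ih]
    simp only [pos_cons, pos_nil, dv_op, zero_add]
    rw [pos_eq (dv e)]
    abel

/-- Time reversal inside the first `n` steps: expectation of a function of the end point flips. -/
lemma Ex_markov {n : ℕ} {F : List (Dir d) → ℝ} (hF : ∀ s, s.length = n → 0 ≤ F s) {c : ℝ}
    (hc : 0 < c) : Ex n (fun s => if c < F s then (1 : ℝ) else 0) ≤ Ex n F / c := by
  rw [div_eq_mul_inv, ← Ex_mul_right]
  refine Ex_mono fun s hs => ?_
  split_ifs with h
  · rw [← div_eq_mul_inv, le_div_iff₀ hc]; linarith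
  · have := hF s hs; positivity

lemma Ex_take (a b : ℕ) (F : List (Dir d) → ℝ) :
    Ex (a + b) (fun s => F (s.take a)) = Ex a F := by
  rw [Ex_append]
  refine Ex_congr fun s hs => ?_
  have : ∀ t : List (Dir d), (s ++ t).take a = s := by
    intro t
    rw [List.take_append_of_le_length hs.ge, ← hs, List.take_length]
  simp [this]

lemma Ex_drop (a b : ℕ) (F : List (Dir d) → ℝ) :
    Ex (a + b) (fun s => F (s.drop a)) = Ex b F := by
  rw [Ex_append]
  have : Ex a (fun s : List (Dir d) => Ex b (fun t => F ((s ++ t).drop a))) =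
      Ex a (fun _ : List (Dir d) => Ex b F) := by
    refine Ex_congr fun s hs => ?_
    simp [← hs]
  rw [this, Ex_const]

end

/-! ## F2: heat kernel bound -/
section
variable {d : ℕ} [NeZero d]

/-- heat kernel -/
def hk (k : ℕ) (z : Zd d) : ℝ := Ex k (fun s => if pos 0 s = z then (1 : ℝ) else 0)

lemma hk_nonneg (k : ℕ) (z : Zd d) : 0 ≤ hk k z :=
  Ex_nonneg fun s _ => by split_ifs <;> norm_num

lemma hk_le_one (k : ℕ) (z : Zd d) : hk k z ≤ 1 :=
  Ex_le_const fun s _ => by split_ifs <;> norm_num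

/-- dot product with an angle -/
def adot (θ : Fin d → ℝ) (z : Zd d) : ℝ := ∑ i, θ i * (z i : ℝ)

/-- characteristic function -/
def chf (θ : Fin d → ℝ) : ℝ := (∑ i, Real.cos (θ i)) / d

lemma adot_add (θ : Fin d → ℝ) (z w : Zd d) : adot θ (z + w) = adot θ z + adot θ w := by
  simp [adot, mul_add, Finset.sum_add_distrib]

lemma adot_dv (θ : Fin d → ℝ) (e : Dir d) : adot θ (dv e) = if e.2 then θ e.1 else -θ e.1 := by
  unfold adot dv
  rw [Finset.sum_eq_single e.1]
  · split_ifs <;> simp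
  · intro j _ hj; simp [Pi.single_eq_of_ne hj]
  · simp

lemma sum_cos_dv (θ : Fin d → ℝ) (a : ℝ) :
    (∑ e : Dir d, Real.cos (a + adot θ (dv e))) / (2 * (d : ℝ)) = Real.cos a * chf θ := by
  rw [Fintype.sum_prod_type]
  have : ∀ i, ∑ b : Bool, Real.cos (a + adot θ (dv ((i, b) : Dir d))) =
      2 * (Real.cos a * Real.cos (θ i)) := by
    intro i
    simp only [adot_dv, Fintype.sum_bool, Real.cos_add]
    simp
    ring
  rw [Finset.sum_congr rfl fun i _ => this i, ← Finset.mul_sum, ← Finset.mul_sum]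
  unfold chf
  have := twod_pos (d := d)
  have h2 : (d : ℝ) ≠ 0 := by intro h; simp [h] at this
  field_simp

lemma Ex_cos (θ : Fin d → ℝ) (k : ℕ) (a : ℝ) (x : Zd d) :
    Ex k (fun s => Real.cos (a + adot θ (pos x s))) = Real.cos (a + adot θ x) * chf θ ^ k := by
  induction k generalizing x with
  | zero => simp
  | succ k ih =>
    rw [Ex_succ]
    simp only [pos_cons, ih, adot_add]
    rw [← Finset.sum_mul, mul_div_right_comm, pow_succ']
    have := sum_cos_dv θ (a + adot θ x)
    simp only [add_assoc] at this ⊢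
    rw [this]
    ring

/-- uniform (unnormalised) measure on the torus -/
def tor (d : ℕ) : Measure (Fin d → ℝ) :=
  Measure.pi fun _ => (volume.restrict (Set.Ioc (-Real.pi) Real.pi))

instance : IsFiniteMeasure (tor d) := by unfold tor; infer_instance

lemma int_exp_one (n : ℤ) :
    ∫ t in Set.Ioc (-Real.pi) Real.pi, Complex.exp (Complex.I * (t * (n : ℝ))) =
      if n = 0 then (2 * Real.pi : ℂ) else 0 := by
  rw [← intervalIntegral.integral_of_le (by linarith [Real.pi_pos])]
  split_ifs with h
  · subst h; simp; ring
  · have hc : (Complex.I * n : ℂ) ≠ 0 := by simp [h]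
    have := integral_exp_mul_complex (a := -Real.pi) (b := Real.pi) hc
    have h2 : ∀ t : ℝ, Complex.exp (Complex.I * (t * (n : ℝ))) = Complex.exp ((Complex.I * n) * t) := by
      intro t; congr 1; push_cast; ring
    simp only [h2]
    rw [this]
    rw [div_eq_zero_iff]
    left
    rw [sub_eq_zero]
    rw [Complex.exp_eq_exp_iff_exists_int]
    exact ⟨n, by push_cast; ring⟩

lemma int_cos (z : Zd d) :
    ∫ θ, Real.cos (adot θ z) ∂(tor d) = if z = 0 then (2 * Real.pi) ^ d else 0 := by
  have h1 : ∫ θ, (∏ i, Complex.exp (Complex.I * (θ i * (z i : ℝ)))) ∂(tor d) =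
      ∏ i : Fin d, ∫ t in Set.Ioc (-Real.pi) Real.pi, Complex.exp (Complex.I * (t * (z i : ℝ))) := by
    unfold tor
    exact integral_fintype_prod_eq_prod (𝕜 := ℂ) (μ := fun _ : Fin d => volume.restrict (Set.Ioc (-Real.pi) Real.pi))
      (f := fun (i : Fin d) (t : ℝ) => Complex.exp (Complex.I * (t * (z i : ℝ))))
  have h2 : ∀ θ : Fin d → ℝ, Real.cos (adot θ z) =
      (∏ i, Complex.exp (Complex.I * (θ i * (z i : ℝ)))).re := by
    intro θ
    rw [← Complex.exp_sum, ← Finset.mul_sum]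
    have : (∑ i, (θ i : ℂ) * ((z i : ℝ) : ℂ)) = ((adot θ z : ℝ) : ℂ) := by
      simp [adot]
    rw [this, mul_comm, Complex.exp_ofReal_mul_I_re]
  simp only [h2]
  have hIntg : Integrable (fun θ : Fin d → ℝ => ∏ i, Complex.exp (Complex.I * (θ i * (z i : ℝ)))) (tor d) := by
    refine Integrable.of_bound (C := 1) ?_ ?_
    · refine Continuous.aestronglyMeasurable ?_
      fun_prop
    · refine ae_of_all _ fun θ => ?_
      rw [norm_prod]
      refine Finset.prod_le_one (fun i _ => norm_nonneg _) fun i _ => ?_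
      rw [show Complex.I * (θ i * (z i : ℝ)) = ((θ i * (z i : ℝ) : ℝ) : ℂ) * Complex.I by push_cast; ring,
        Complex.norm_exp_ofReal_mul_I]
  have h3 := integral_re hIntg
  simp only [RCLike.re_to_complex] at h3
  rw [h3, h1]
  simp only [int_exp_one]
  split_ifs with hz
  · subst hz
    simp
    norm_cast
  · have : ∃ i, z i ≠ 0 := by
      by_contra hc; push Not at hc; exact hz (funext hc)
    obtain ⟨i, hi⟩ := this
    rw [Finset.prod_eq_zero (Finset.mem_univ i)]
    · simp
    · simp [hi]

lemma hk_fourier (k : ℕ) (z : Zd d) :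
    (2 * Real.pi) ^ d * hk k z = ∫ θ, Real.cos (adot θ (-z)) * chf θ ^ k ∂(tor d) := by
  have h : ∀ θ : Fin d → ℝ, Real.cos (adot θ (-z)) * chf θ ^ k =
      (∑ s ∈ Lst d k, Real.cos (adot θ (-z + pos 0 s))) / (2 * (d : ℝ)) ^ k := by
    intro θ
    have := Ex_cos θ k (adot θ (-z)) (0 : Zd d)
    simp only [Ex, ← adot_add, add_zero] at this
    rw [← this]
  simp only [h]
  rw [integral_div, integral_finsetSum]
  · simp only [int_cos]
    unfold hk Ex
    rw [← mul_div_assoc, Finset.mul_sum]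
    congr 1
    refine Finset.sum_congr rfl fun s _ => ?_
    by_cases hs : pos 0 s = z
    · simp [hs]
    · rw [if_neg hs, if_neg]
      · simp
      · intro h0; apply hs
        have : pos 0 s = z + (-z + pos 0 s) := by abel
        rw [this, h0, add_zero]
  · intro s _
    refine Integrable.of_bound (C := 1) ?_ ?_
    · refine Continuous.aestronglyMeasurable ?_
      unfold adot
      fun_prop
    · refine ae_of_all _ fun θ => ?_
      rw [Real.norm_eq_abs]
      exact Real.abs_cos_le_one _

lemma one_sub_abs_cos (t : ℝ) : Real.sin t ^ 2 / 2 ≤ 1 - |Real.cos t| := by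
  have h1 := Real.sin_sq_add_cos_sq t
  have h2 := Real.abs_cos_le_one t
  have h3 := sq_abs (Real.cos t)
  nlinarith [abs_nonneg (Real.cos t)]

lemma sin_sq_lower (t : ℝ) (h1 : -(Real.pi / 2) ≤ t) (h2 : t ≤ Real.pi / 2) :
    4 / Real.pi ^ 2 * t ^ 2 ≤ Real.sin t ^ 2 := by
  have hpi := Real.pi_pos
  have key : ∀ s : ℝ, 0 ≤ s → s ≤ Real.pi / 2 → 4 / Real.pi ^ 2 * s ^ 2 ≤ Real.sin s ^ 2 := by
    intro s h0 hs
    have := Real.mul_le_sin h0 hs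
    have h4 : 4 / Real.pi ^ 2 * s ^ 2 = (2 / Real.pi * s) ^ 2 := by ring
    rw [h4]
    gcongr
  rcases le_total 0 t with h | h
  · exact key t h h2
  · have := key (-t) (by linarith) (by linarith)
    simpa using this

lemma exp_fold (κ : ℝ) (hκ : 0 ≤ κ) (t : ℝ) (ht : t ∈ Set.Ioc (-Real.pi) Real.pi) :
    Real.exp (-(κ * (1 - |Real.cos t|))) ≤
      Real.exp (-(κ * 2 / Real.pi ^ 2) * t ^ 2) + Real.exp (-(κ * 2 / Real.pi ^ 2) * (t - Real.pi) ^ 2)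
       + Real.exp (-(κ * 2 / Real.pi ^ 2) * (t + Real.pi) ^ 2) := by
  have hpi := Real.pi_pos
  have main : ∀ s : ℝ, -(Real.pi / 2) ≤ s → s ≤ Real.pi / 2 → Real.sin s ^ 2 = Real.sin t ^ 2 →
      Real.exp (-(κ * (1 - |Real.cos t|))) ≤ Real.exp (-(κ * 2 / Real.pi ^ 2) * s ^ 2) := by
    intro s h1 h2 h3
    apply Real.exp_le_exp.2
    have h4 := sin_sq_lower s h1 h2
    have h5 := one_sub_abs_cos t
    rw [h3] at h4
    have h6 : 2 / Real.pi ^ 2 * s ^ 2 ≤ 1 - |Real.cos t| := by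
      have : 2 / Real.pi ^ 2 * s ^ 2 = (4 / Real.pi ^ 2 * s ^ 2) / 2 := by ring
      linarith
    have := mul_le_mul_of_nonneg_left h6 hκ
    have h7 : -(κ * 2 / Real.pi ^ 2) * s ^ 2 = -(κ * (2 / Real.pi ^ 2 * s ^ 2)) := by ring
    linarith
  have p1 := Real.exp_pos (-(κ * 2 / Real.pi ^ 2) * t ^ 2)
  have p2 := Real.exp_pos (-(κ * 2 / Real.pi ^ 2) * (t - Real.pi) ^ 2)
  have p3 := Real.exp_pos (-(κ * 2 / Real.pi ^ 2) * (t + Real.pi) ^ 2)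
  obtain ⟨ht1, ht2⟩ := ht
  by_cases hA : t < -(Real.pi / 2)
  · have := main (t + Real.pi) (by linarith) (by linarith) (by simp [Real.sin_add_pi])
    linarith
  · by_cases hB : t ≤ Real.pi / 2
    · have := main t (by linarith) hB rfl
      linarith
    · have := main (t - Real.pi) (by linarith) (by linarith) (by simp [Real.sin_sub_pi])
      linarith

lemma int_exp_cos (κ : ℝ) (hκ : 0 < κ) :
    ∫ t in Set.Ioc (-Real.pi) Real.pi, Real.exp (-(κ * (1 - |Real.cos t|))) ≤
      3 * √(Real.pi / (κ * 2 / Real.pi ^ 2)) := by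
  have hb : 0 < κ * 2 / Real.pi ^ 2 := by positivity
  set b := κ * 2 / Real.pi ^ 2 with hbdef
  have i1 := integrable_exp_neg_mul_sq hb
  have i2 := i1.comp_sub_right Real.pi
  have i3 := i1.comp_add_right Real.pi
  have g1 := integral_gaussian b
  have g2 : ∫ x : ℝ, Real.exp (-b * (x - Real.pi) ^ 2) = √(Real.pi / b) := by
    rw [integral_sub_right_eq_self (fun x : ℝ => Real.exp (-b * x ^ 2)) Real.pi, g1]
  have g3 : ∫ x : ℝ, Real.exp (-b * (x + Real.pi) ^ 2) = √(Real.pi / b) := by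
    rw [integral_add_right_eq_self (fun x : ℝ => Real.exp (-b * x ^ 2)) Real.pi, g1]
  have i12 := i1.add i2
  have i123 := i12.add i3
  calc ∫ t in Set.Ioc (-Real.pi) Real.pi, Real.exp (-(κ * (1 - |Real.cos t|)))
      ≤ ∫ t in Set.Ioc (-Real.pi) Real.pi, (Real.exp (-b * t ^ 2) + Real.exp (-b * (t - Real.pi) ^ 2)
          + Real.exp (-b * (t + Real.pi) ^ 2)) := by
        refine setIntegral_mono_on ?_ ?_ measurableSet_Ioc fun t ht => ?_
        · exact (Continuous.integrableOn_Ioc (by fun_prop))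
        · exact i123.integrableOn
        · have := exp_fold κ hκ.le t ht
          simpa [hbdef] using this
    _ ≤ ∫ t, (Real.exp (-b * t ^ 2) + Real.exp (-b * (t - Real.pi) ^ 2)
          + Real.exp (-b * (t + Real.pi) ^ 2)) := by
        refine setIntegral_le_integral i123 (ae_of_all _ fun t => ?_)
        simp only [Pi.zero_apply]
        positivity
    _ = 3 * √(Real.pi / b) := by
        have e1 := integral_add i12 i3
        have e2 := integral_add i1 i2
        simp only [Pi.add_apply] at e1
        rw [e1, e2, g1, g2, g3]
        ring

lemma abs_chf_pow (θ : Fin d → ℝ) (k : ℕ) :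
    |chf θ| ^ k ≤ ∏ i, Real.exp (-(((k : ℝ) / d) * (1 - |Real.cos (θ i)|))) := by
  have h2d := twod_pos (d := d)
  have hd : (0 : ℝ) < d := by linarith
  have h1 : |chf θ| ≤ Real.exp (-(∑ i, (1 - |Real.cos (θ i)|)) / d) := by
    have h3 : |chf θ| ≤ (∑ i, |Real.cos (θ i)|) / d := by
      unfold chf
      rw [abs_div, abs_of_pos hd]
      gcongr
      exact Finset.abs_sum_le_sum_abs _ _
    have h4 : (∑ i, |Real.cos (θ i)|) / d = -(∑ i, (1 - |Real.cos (θ i)|)) / d + 1 := by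
      rw [Finset.sum_sub_distrib]
      simp
      field_simp
      ring
    calc |chf θ| ≤ -(∑ i, (1 - |Real.cos (θ i)|)) / d + 1 := by rw [← h4]; exact h3
      _ ≤ _ := Real.add_one_le_exp _
  calc |chf θ| ^ k ≤ (Real.exp (-(∑ i, (1 - |Real.cos (θ i)|)) / d)) ^ k := by gcongr
    _ = _ := by
      rw [← Real.exp_nat_mul, ← Real.exp_sum]
      congr 1
      rw [Finset.sum_neg_distrib, ← Finset.mul_sum]
      ring

lemma hk_bound : ∃ C : ℝ, 0 < C ∧ ∀ (k : ℕ) (z : Zd d), 1 ≤ k → hk k z ≤ C / (√(k : ℝ)) ^ d := by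
  have h2d := twod_pos (d := d)
  have hd : (0 : ℝ) < d := by linarith
  have hpi := Real.pi_pos
  refine ⟨(3 * √(Real.pi ^ 3 * d / 2)) ^ d, by positivity, fun k z hk1 => ?_⟩
  have hk0 : (0 : ℝ) < k := by exact_mod_cast hk1
  have hF := hk_fourier k z
  have hκ : (0 : ℝ) < (k : ℝ) / d := by positivity
  have hprod : ∫ θ, ∏ i, Real.exp (-(((k : ℝ) / d) * (1 - |Real.cos (θ i)|))) ∂(tor d) =
      ∏ i : Fin d, ∫ t in Set.Ioc (-Real.pi) Real.pi, Real.exp (-(((k : ℝ) / d) * (1 - |Real.cos t|))) := by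
    unfold tor
    exact integral_fintype_prod_eq_prod (𝕜 := ℝ) (μ := fun _ : Fin d => volume.restrict (Set.Ioc (-Real.pi) Real.pi))
      (f := fun (i : Fin d) (t : ℝ) => Real.exp (-(((k : ℝ) / d) * (1 - |Real.cos t|))))
  have hle : (2 * Real.pi) ^ d * hk k z ≤ (3 * √(Real.pi / (((k : ℝ) / d) * 2 / Real.pi ^ 2))) ^ d := by
    rw [hF]
    calc _ ≤ ∫ θ, ∏ i, Real.exp (-(((k : ℝ) / d) * (1 - |Real.cos (θ i)|))) ∂(tor d) := by
          refine integral_mono ?_ ?_ fun θ => ?_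
          · refine Integrable.of_bound (C := 1) ?_ ?_
            · refine Continuous.aestronglyMeasurable ?_
              unfold adot chf
              fun_prop
            · refine ae_of_all _ fun θ => ?_
              rw [Real.norm_eq_abs, abs_mul, abs_pow]
              refine mul_le_one₀ (Real.abs_cos_le_one _) (by positivity) ?_
              refine (abs_chf_pow θ k).trans ?_
              refine Finset.prod_le_one (fun i _ => (Real.exp_pos _).le) fun i _ => ?_
              rw [Real.exp_le_one_iff]
              have := Real.abs_cos_le_one (θ i)
              have h3 : 0 ≤ (k : ℝ) / d * (1 - |Real.cos (θ i)|) := mul_nonneg hκ.le (by linarith)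
              linarith
          · refine Integrable.of_bound (C := 1) ?_ ?_
            · refine Continuous.aestronglyMeasurable ?_
              fun_prop
            · refine ae_of_all _ fun θ => ?_
              rw [Real.norm_eq_abs, abs_of_nonneg (Finset.prod_nonneg fun i _ => (Real.exp_pos _).le)]
              refine Finset.prod_le_one (fun i _ => (Real.exp_pos _).le) fun i _ => ?_
              rw [Real.exp_le_one_iff]
              have := Real.abs_cos_le_one (θ i)
              have h3 : 0 ≤ (k : ℝ) / d * (1 - |Real.cos (θ i)|) := mul_nonneg hκ.le (by linarith)
              linarith
          · simp only
            refine (le_abs_self _).trans ?_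
            rw [abs_mul, abs_pow]
            refine le_trans ?_ (abs_chf_pow θ k)
            exact mul_le_of_le_one_left (by positivity) (Real.abs_cos_le_one _)
      _ ≤ _ := by
        rw [hprod, Finset.prod_const, Finset.card_univ, Fintype.card_fin]
        gcongr
        exact int_exp_cos _ hκ
  have h6 : (1 : ℝ) ≤ (2 * Real.pi) ^ d := one_le_pow₀ (by linarith [Real.pi_gt_three])
  have h7 : hk k z ≤ (2 * Real.pi) ^ d * hk k z := le_mul_of_one_le_left (hk_nonneg k z) h6
  refine h7.trans (hle.trans (le_of_eq ?_))
  rw [← div_pow, mul_div_assoc 3 (√(Real.pi ^ 3 * d / 2)), ← Real.sqrt_div (by positivity)]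
  congr 3
  field_simp

/-- the extra decay in dimension at least five -/
def rr (d : ℕ) (t : ℝ) : ℝ := if d = 4 then 1 else √t

lemma rr_pos {t : ℝ} (ht : 0 < t) : 0 < rr d t := by
  unfold rr; split_ifs <;> positivity

lemma hk_bound2 (hd4 : 4 ≤ d) : ∃ C : ℝ, 0 < C ∧ ∀ (k : ℕ) (z : Zd d), 1 ≤ k →
    hk k z ≤ C / ((k : ℝ) ^ 2 * rr d k) := by
  obtain ⟨C, hC, h⟩ := hk_bound (d := d)
  refine ⟨C, hC, fun k z hk1 => (h k z hk1).trans ?_⟩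
  have hk0 : (1 : ℝ) ≤ k := by exact_mod_cast hk1
  have hs : (1 : ℝ) ≤ √(k : ℝ) := Real.one_le_sqrt.2 hk0
  have hss : √(k : ℝ) ^ 2 = k := Real.sq_sqrt (by linarith)
  refine div_le_div_of_nonneg_left hC.le ?_ ?_
  · have := rr_pos (d := d) (t := (k : ℝ)) (by linarith)
    positivity
  · unfold rr
    split_ifs with h4
    · rw [h4]
      have : √(k : ℝ) ^ 4 = (k : ℝ) ^ 2 := by rw [show (4 : ℕ) = 2 * 2 from rfl, pow_mul, hss]
      rw [this]; simp
    · have h5 : 5 ≤ d := by omega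
      calc (k : ℝ) ^ 2 * √(k : ℝ) = √(k : ℝ) ^ 5 := by
            rw [pow_succ (√(k : ℝ)) 4, show (4 : ℕ) = 2 * 2 from rfl, pow_mul, hss]
        _ ≤ _ := pow_le_pow_right₀ hs h5

lemma sum_inv_sq (t : ℕ) (ht : 1 ≤ t) (n : ℕ) :
    ∑ k ∈ Finset.range n, 1 / (((k + t : ℕ) : ℝ)) ^ 2 ≤ 2 / t - 2 / ((n + t : ℕ) : ℝ) := by
  induction n with
  | zero => simp
  | succ n ih =>
    rw [Finset.sum_range_succ]
    have hm : (1 : ℝ) ≤ ((n + t : ℕ) : ℝ) := by exact_mod_cast (by omega)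
    have e : ((n + 1 + t : ℕ) : ℝ) = ((n + t : ℕ) : ℝ) + 1 := by push_cast; ring
    rw [e]
    set m := ((n + t : ℕ) : ℝ)
    have : 1 / m ^ 2 ≤ 2 / m - 2 / (m + 1) := by
      rw [div_sub_div _ _ (by positivity) (by positivity), div_le_div_iff₀ (by positivity) (by positivity)]
      nlinarith [sq_nonneg m]
    linarith

/-- Green function tail bound. -/
lemma green_tail (hd4 : 4 ≤ d) : ∃ C : ℝ, 0 < C ∧ ∀ z : Zd d, (Summable fun k => hk k z) ∧
    ∀ t : ℕ, 1 ≤ t → ∑' k, hk (k + t) z ≤ C / ((t : ℝ) * rr d t) := by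
  obtain ⟨C, hC, h⟩ := hk_bound2 (d := d) hd4
  have key : ∀ (z : Zd d) (t : ℕ), 1 ≤ t → ∀ n,
      ∑ k ∈ Finset.range n, hk (k + t) z ≤ (2 * C) / ((t : ℝ) * rr d t) := by
    intro z t ht n
    have ht0 : (1 : ℝ) ≤ t := by exact_mod_cast ht
    have hrt := rr_pos (d := d) (t := (t : ℝ)) (by linarith)
    calc ∑ k ∈ Finset.range n, hk (k + t) z
        ≤ ∑ k ∈ Finset.range n, (C / rr d t) * (1 / (((k + t : ℕ) : ℝ)) ^ 2) := by
          refine Finset.sum_le_sum fun k _ => (h (k + t) z (by omega)).trans ?_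
          have hm : (1 : ℝ) ≤ ((k + t : ℕ) : ℝ) := by exact_mod_cast (by omega)
          have hmt : (t : ℝ) ≤ ((k + t : ℕ) : ℝ) := by exact_mod_cast (by omega)
          have hr : rr d t ≤ rr d ((k + t : ℕ) : ℝ) := by
            unfold rr; split_ifs
            · exact le_refl _
            · exact Real.sqrt_le_sqrt hmt
          rw [div_mul_div_comm, mul_one, mul_comm (rr d t)]
          gcongr
      _ = (C / rr d t) * ∑ k ∈ Finset.range n, (1 / (((k + t : ℕ) : ℝ)) ^ 2) := by
          rw [Finset.mul_sum]
      _ ≤ (C / rr d t) * (2 / t) := by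
          gcongr
          refine (sum_inv_sq t ht n).trans ?_
          have : (0 : ℝ) ≤ 2 / ((n + t : ℕ) : ℝ) := by positivity
          linarith
      _ = _ := by field_simp
  refine ⟨2 * C, by positivity, fun z => ⟨?_, fun t ht => ?_⟩⟩
  · rw [← summable_nat_add_iff 1]
    exact summable_of_sum_range_le (fun k => hk_nonneg _ z) (key z 1 le_rfl)
  · exact Real.tsum_le_of_sum_range_le (fun k => hk_nonneg _ z) (key z t ht)

/-- Chapman--Kolmogorov. -/
lemma hk_ck (t k : ℕ) (x y : Zd d) :
    Ex t (fun s => hk k (y - pos x s)) = hk (k + t) (y - x) := by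
  unfold hk
  rw [add_comm k t, Ex_append]
  refine Ex_congr fun s _ => Ex_congr fun s' _ => ?_
  rw [pos_append, pos_eq (pos 0 s), pos_eq x s]
  congr 1
  apply propext
  constructor
  · intro h; rw [h]; abel
  · intro h
    rw [eq_sub_iff_add_eq] at h ⊢
    rw [← h]; abel

lemma hk_symm (k : ℕ) (z : Zd d) : hk k (-z) = hk k z := by
  unfold hk
  rw [← Ex_rf]
  refine Ex_congr fun s _ => ?_
  rw [pos_rf]
  congr 1
  simp

lemma hk_zero (z : Zd d) : hk 0 z = if z = 0 then 1 else 0 := by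
  simp only [hk, Ex_zero, pos_nil, eq_comm]
  congr

end

/-! ## F3: potential theory -/

instance neZero_of_four {d : ℕ} [h : Fact (4 ≤ d)] : NeZero d := ⟨by have := h.1; omega⟩

section
variable {d : ℕ} [Fact (4 ≤ d)]

/-- the walk avoids `A` at positive times -/
def av (A : Finset (Zd d)) (x : Zd d) (s : List (Dir d)) : Prop := ∀ z ∈ trT x s, z ∉ A

/-- escape probability up to time `T` -/
def esc (A : Finset (Zd d)) (T : ℕ) (x : Zd d) : ℝ := Ex T (fun s => if av A x s then (1 : ℝ) else 0)

lemma esc_nonneg (A : Finset (Zd d)) (T : ℕ) (x : Zd d) : 0 ≤ esc A T x :=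
  Ex_nonneg fun s _ => by split_ifs <;> norm_num

lemma esc_le_one (A : Finset (Zd d)) (T : ℕ) (x : Zd d) : esc A T x ≤ 1 :=
  Ex_le_const fun s _ => by split_ifs <;> norm_num

lemma esc_mono_set {A B : Finset (Zd d)} (h : A ⊆ B) (T : ℕ) (x : Zd d) : esc B T x ≤ esc A T x := by
  refine Ex_mono fun s _ => ?_
  have : av B x s → av A x s := fun hb z hz hzA => hb z hz (h hzA)
  split_ifs with h1 h2 h2
  · exact le_refl _
  · exact absurd (this h1) h2
  · norm_num
  · exact le_refl _

@[simp] lemma esc_zero (A : Finset (Zd d)) (x : Zd d) : esc A 0 x = 1 := by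
  simp [esc, av]

lemma esc_succ (A : Finset (Zd d)) (T : ℕ) (x : Zd d) : esc A (T + 1) x =
    (∑ e : Dir d, if x + dv e ∈ A then 0 else esc A T (x + dv e)) / (2 * (d : ℝ)) := by
  unfold esc
  rw [Ex_succ]
  congr 1
  refine Finset.sum_congr rfl fun e _ => ?_
  split_ifs with h
  · have h0 : Ex T (fun s => if av A x (e :: s) then (1 : ℝ) else 0) = Ex T (fun _ : List (Dir d) => (0 : ℝ)) := by
      refine Ex_congr fun s _ => ?_
      rw [if_neg]
      intro hav
      exact hav (x + dv e) (by simp) h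
    rw [h0, Ex_const]
  · refine Ex_congr fun s _ => ?_
    congr 1
    simp [av, h]

lemma Ex_pos_eq (T : ℕ) (x y : Zd d) :
    Ex T (fun s => if pos x s = y then (1 : ℝ) else 0) = hk T (y - x) := by
  unfold hk
  refine Ex_congr fun s _ => ?_
  rw [pos_eq x]
  congr 1
  apply propext
  rw [eq_sub_iff_add_eq, add_comm]

lemma av_append (A : Finset (Zd d)) (x : Zd d) (s t) :
    av A x (s ++ t) ↔ av A x s ∧ av A (pos x s) t := by
  simp only [av, trT_append, List.mem_append]
  constructor
  · intro h; exact ⟨fun z hz => h z (Or.inl hz), fun z hz => h z (Or.inr hz)⟩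
  · rintro ⟨h1, h2⟩ z (hz | hz)
    · exact h1 z hz
    · exact h2 z hz

lemma esc_add_le (A : Finset (Zd d)) (T S : ℕ) (x : Zd d) : esc A (T + S) x ≤ esc A T x := by
  unfold esc
  rw [Ex_append]
  refine Ex_mono fun s _ => ?_
  split_ifs with h
  · exact Ex_le_const fun t _ => by split_ifs <;> norm_num
  · refine Ex_le_const fun t _ => ?_
    rw [if_neg]
    rw [av_append]; tauto

lemma esc_anti (A : Finset (Zd d)) (x : Zd d) : Antitone (fun T => esc A T x) := by
  intro T S h
  obtain ⟨k, rfl⟩ := Nat.exists_eq_add_of_le h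
  exact esc_add_le A T k x

lemma esc_step (A : Finset (Zd d)) (T : ℕ) (x : Zd d) :
    esc A T x ≤ esc A (T + 1) x + ∑ y ∈ A, hk (T + 1) (y - x) := by
  have h1 : ∑ y ∈ A, hk (T + 1) (y - x) = Ex (T + 1) (fun s => ∑ y ∈ A, if pos x s = y then (1 : ℝ) else 0) := by
    rw [Ex_sum]
    exact Finset.sum_congr rfl fun y _ => (Ex_pos_eq _ _ _).symm
  have h2 : esc A T x = Ex (T + 1) (fun s => if av A x (s.take T) then (1 : ℝ) else 0) := by
    unfold esc
    exact (Ex_take T 1 (fun s => if av A x s then (1 : ℝ) else 0)).symm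
  rw [h1, h2]
  unfold esc
  rw [← Ex_add_fun]
  refine Ex_mono fun s hs => ?_
  have h0 : 0 ≤ ∑ y ∈ A, (if pos x s = y then (1 : ℝ) else 0) :=
    Finset.sum_nonneg fun y _ => by split_ifs <;> norm_num
  by_cases ha : av A x (s.take T)
  · rw [if_pos ha]
    by_cases hb : av A x s
    · rw [if_pos hb]; linarith
    · have hpos : pos x s ∈ A := by
        by_contra hc
        apply hb
        rw [← List.take_append_drop T s, av_append]
        refine ⟨ha, ?_⟩
        have hl : (s.drop T).length = 1 := by simp [hs]
        obtain ⟨e, he⟩ := List.length_eq_one_iff.1 hl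
        have hp : pos x s = pos (pos x (s.take T)) (s.drop T) := by
          rw [← pos_append, List.take_append_drop]
        rw [he] at hp ⊢
        intro z hz
        simp only [trT_cons, trT_nil, List.mem_singleton] at hz
        simp only [pos_cons, pos_nil] at hp
        rw [hz, ← hp]
        exact hc
      rw [Finset.sum_ite_eq, if_pos hpos]
      have : (0 : ℝ) ≤ if av A x s then 1 else 0 := by split_ifs <;> norm_num
      linarith
  · rw [if_neg ha]
    have : (0 : ℝ) ≤ if av A x s then 1 else 0 := by split_ifs <;> norm_num
    linarith

lemma hk_succ (k : ℕ) (x y : Zd d) :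
    hk (k + 1) (y - x) = (∑ e : Dir d, hk k (y - (x + dv e))) / (2 * (d : ℝ)) := by
  rw [← hk_ck 1 k x y, Ex_succ]
  simp

lemma last_exit (A : Finset (Zd d)) (T : ℕ) (x : Zd d) :
    ∑ y ∈ A, ∑ k ∈ Finset.range (T + 1), hk k (y - x) * esc A (T - k) y =
      1 - (if x ∈ A then 0 else esc A T x) := by
  induction T generalizing x with
  | zero =>
    simp only [zero_add, Finset.range_one, Finset.sum_singleton, hk_zero, Nat.sub_self, esc_zero, mul_one]
    simp only [sub_eq_zero]
    rw [Finset.sum_ite_eq']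
    split_ifs <;> norm_num
  | succ T ih =>
    have h1 : ∀ y, ∑ k ∈ Finset.range (T + 1 + 1), hk k (y - x) * esc A (T + 1 - k) y =
        (∑ e : Dir d, ∑ k ∈ Finset.range (T + 1), hk k (y - (x + dv e)) * esc A (T - k) y) / (2 * (d : ℝ))
          + hk 0 (y - x) * esc A (T + 1) y := by
      intro y
      rw [Finset.sum_range_succ' _ (T + 1), Finset.sum_comm, Finset.sum_div]
      congr 1
      refine Finset.sum_congr rfl fun k _ => ?_
      rw [hk_succ, ← Finset.sum_mul, Nat.add_sub_add_right]
      ring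
    simp only [h1]
    rw [Finset.sum_add_distrib, ← Finset.sum_div, Finset.sum_comm]
    simp only [ih]
    have h2 : ∑ y ∈ A, hk 0 (y - x) * esc A (T + 1) y = if x ∈ A then esc A (T + 1) x else 0 := by
      simp only [hk_zero, sub_eq_zero, ite_mul, one_mul, zero_mul]
      rw [Finset.sum_ite_eq']
    rw [h2, Finset.sum_sub_distrib, sub_div, ← esc_succ]
    have h3 : (∑ _e : Dir d, (1 : ℝ)) / (2 * (d : ℝ)) = 1 := by
      have := twod_pos (d := d)
      simp
      rw [mul_comm, div_self this.ne']
    rw [h3]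
    split_ifs <;> ring

/-- equilibrium measure -/
def eqm (A : Finset (Zd d)) (x : Zd d) : ℝ := ⨅ T, esc A T x

lemma esc_bdd (A : Finset (Zd d)) (x : Zd d) : BddBelow (Set.range fun T => esc A T x) :=
  ⟨0, by rintro _ ⟨T, rfl⟩; exact esc_nonneg A T x⟩

lemma eqm_le_esc (A : Finset (Zd d)) (T : ℕ) (x : Zd d) : eqm A x ≤ esc A T x :=
  ciInf_le (esc_bdd A x) T

lemma eqm_nonneg (A : Finset (Zd d)) (x : Zd d) : 0 ≤ eqm A x := le_ciInf fun T => esc_nonneg A T x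

lemma eqm_le_one (A : Finset (Zd d)) (x : Zd d) : eqm A x ≤ 1 := by
  simpa using eqm_le_esc A 0 x

lemma eqm_mono_set {A B : Finset (Zd d)} (h : A ⊆ B) (x : Zd d) : eqm B x ≤ eqm A x :=
  le_ciInf fun T => (eqm_le_esc B T x).trans (esc_mono_set h T x)

lemma esc_tendsto (A : Finset (Zd d)) (x : Zd d) : Tendsto (fun T => esc A T x) atTop (𝓝 (eqm A x)) :=
  tendsto_atTop_ciInf (esc_anti A x) (esc_bdd A x)

/-- constant of the Green tail -/
def GC (d : ℕ) [Fact (4 ≤ d)] : ℝ := (green_tail (d := d) Fact.out).choose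

lemma GC_pos : 0 < GC d := (green_tail (d := d) Fact.out).choose_spec.1

lemma hk_summable (z : Zd d) : Summable fun k => hk k z :=
  ((green_tail (d := d) Fact.out).choose_spec.2 z).1

/-- Green tail bound -/
def Gt (d : ℕ) [Fact (4 ≤ d)] (t : ℕ) : ℝ := GC d / ((t : ℝ) * rr d t)

lemma Gt_nonneg (t : ℕ) : 0 ≤ Gt d t := by
  unfold Gt rr
  have := GC_pos (d := d)
  split_ifs <;> positivity

lemma hk_tail_le (z : Zd d) (t : ℕ) (ht : 1 ≤ t) : ∑' k, hk (k + t) z ≤ Gt d t :=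
  ((green_tail (d := d) Fact.out).choose_spec.2 z).2 t ht

lemma Gt_anti {s t : ℕ} (hs : 1 ≤ s) (h : s ≤ t) : Gt d t ≤ Gt d s := by
  unfold Gt
  have := GC_pos (d := d)
  have h1 : (1 : ℝ) ≤ s := by exact_mod_cast hs
  have h2 : (s : ℝ) ≤ t := by exact_mod_cast h
  have h3 : rr d (s : ℝ) ≤ rr d (t : ℝ) := by
    unfold rr; split_ifs
    · exact le_refl _
    · exact Real.sqrt_le_sqrt h2
  have h4 := rr_pos (d := d) (t := (s : ℝ)) (by linarith)
  gcongr

/-- Green function -/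
def gr (z : Zd d) : ℝ := ∑' k, hk k z

lemma gr_nonneg (z : Zd d) : 0 ≤ gr z := tsum_nonneg fun k => hk_nonneg k z

lemma gr_symm (z : Zd d) : gr (-z) = gr z := by simp only [gr, hk_symm]

lemma Ex_gr (t : ℕ) (x y : Zd d) : Ex t (fun s => gr (y - pos x s)) = ∑' k, hk (k + t) (y - x) := by
  unfold gr
  rw [Ex_tsum (F := fun k s => hk k (y - pos x s)) (fun s _ => hk_summable _)]
  simp only [hk_ck]

lemma Ex_gr_le (t : ℕ) (ht : 1 ≤ t) (x y : Zd d) : Ex t (fun s => gr (y - pos x s)) ≤ Gt d t := by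
  rw [Ex_gr]; exact hk_tail_le _ _ ht

/-- hitting probability -/
def HH (A : Finset (Zd d)) (x : Zd d) : ℝ := ∑ y ∈ A, eqm A y * gr (y - x)

lemma HH_nonneg (A : Finset (Zd d)) (x : Zd d) : 0 ≤ HH A x :=
  Finset.sum_nonneg fun y _ => mul_nonneg (eqm_nonneg _ _) (gr_nonneg _)

lemma HH_tendsto (A : Finset (Zd d)) (x : Zd d) :
    Tendsto (fun T => 1 - (if x ∈ A then 0 else esc A T x)) atTop (𝓝 (HH A x)) := by
  simp only [← last_exit]
  unfold HH
  refine tendsto_finsetSum _ fun y _ => ?_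
  have h1 : ∀ T, ∑ k ∈ Finset.range (T + 1), hk k (y - x) * esc A (T - k) y =
      ∑' k, (if k < T + 1 then hk k (y - x) * esc A (T - k) y else 0) := by
    intro T
    rw [tsum_eq_sum (s := Finset.range (T + 1))]
    · refine Finset.sum_congr rfl fun k hk => ?_
      rw [if_pos (Finset.mem_range.1 hk)]
    · intro k hk
      rw [if_neg]
      simpa using hk
  simp only [h1]
  have h2 : eqm A y * gr (y - x) = ∑' k, hk k (y - x) * eqm A y := by
    rw [tsum_mul_right, mul_comm]; rfl
  rw [h2]
  refine tendsto_tsum_of_dominated_convergence (bound := fun k => hk k (y - x)) (hk_summable _) ?_ ?_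
  · intro k
    have : Tendsto (fun T => hk k (y - x) * esc A (T - k) y) atTop (𝓝 (hk k (y - x) * eqm A y)) := by
      refine Tendsto.const_mul _ ?_
      exact (esc_tendsto A y).comp (tendsto_sub_atTop_nat k)
    refine this.congr' ?_
    filter_upwards [eventually_ge_atTop k] with T hT
    rw [if_pos (by omega)]
  · refine Eventually.of_forall fun T k => ?_
    split_ifs
    · rw [Real.norm_eq_abs, abs_of_nonneg (mul_nonneg (hk_nonneg _ _) (esc_nonneg _ _ _))]
      exact mul_le_of_le_one_right (hk_nonneg _ _) (esc_le_one _ _ _)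
    · simp [hk_nonneg]

lemma HH_eq_one {A : Finset (Zd d)} {x : Zd d} (h : x ∈ A) : HH A x = 1 := by
  refine tendsto_nhds_unique (HH_tendsto A x) ?_
  simp [h]

lemma HH_le_one (A : Finset (Zd d)) (x : Zd d) : HH A x ≤ 1 := by
  refine le_of_tendsto (HH_tendsto A x) (Eventually.of_forall fun T => ?_)
  have := esc_nonneg A T x
  split_ifs <;> linarith

lemma one_sub_esc_le_HH (A : Finset (Zd d)) (T : ℕ) (x : Zd d) (hx : x ∉ A) : 1 - esc A T x ≤ HH A x := by
  refine ge_of_tendsto (HH_tendsto A x) ?_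
  filter_upwards [eventually_ge_atTop T] with S hS
  have := esc_anti A x hS
  simp only [if_neg hx]
  simp only at this
  linarith

/-- capacity -/
def cp (A : Finset (Zd d)) : ℝ := ∑ x ∈ A, eqm A x

lemma cp_nonneg (A : Finset (Zd d)) : 0 ≤ cp A := Finset.sum_nonneg fun x _ => eqm_nonneg _ _

lemma Ex_HH (A : Finset (Zd d)) (t : ℕ) (ht : 1 ≤ t) (x : Zd d) :
    Ex t (fun s => HH A (pos x s)) ≤ cp A * Gt d t := by
  unfold HH cp
  rw [Ex_sum, Finset.sum_mul]
  refine Finset.sum_le_sum fun y _ => ?_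
  rw [Ex_mul_left]
  exact mul_le_mul_of_nonneg_left (Ex_gr_le t ht x y) (eqm_nonneg _ _)

/-- truncated capacity -/
def tc (τ : ℕ) (A : Finset (Zd d)) : ℝ := ∑ x ∈ A, esc A τ x

lemma tc_nonneg (τ : ℕ) (A : Finset (Zd d)) : 0 ≤ tc τ A := Finset.sum_nonneg fun x _ => esc_nonneg _ _ _

lemma cp_le_tc (τ : ℕ) (A : Finset (Zd d)) : cp A ≤ tc τ A :=
  Finset.sum_le_sum fun x _ => eqm_le_esc _ _ _

lemma tc_le_card (τ : ℕ) (A : Finset (Zd d)) : tc τ A ≤ A.card := by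
  unfold tc
  calc _ ≤ ∑ x ∈ A, (1 : ℝ) := Finset.sum_le_sum fun x _ => esc_le_one _ _ _
    _ = _ := by simp

lemma esc_sub_eqm (A : Finset (Zd d)) (τ : ℕ) (hτ : 1 ≤ τ) (x : Zd d) :
    esc A τ x ≤ eqm A x + A.card * Gt d τ := by
  have h1 : ∀ n, esc A τ x ≤ esc A (τ + n) x + ∑ y ∈ A, ∑ k ∈ Finset.range n, hk (k + (τ + 1)) (y - x) := by
    intro n
    induction n with
    | zero => simp
    | succ n ih =>
      have h := esc_step A (τ + n) x
      simp only [Finset.sum_range_succ, Finset.sum_add_distrib]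
      rw [show n + (τ + 1) = τ + n + 1 by ring, show τ + (n + 1) = τ + n + 1 by ring]
      linarith
  have h2 : ∀ n, ∑ y ∈ A, ∑ k ∈ Finset.range n, hk (k + (τ + 1)) (y - x) ≤ A.card * Gt d τ := by
    intro n
    have : ∀ y ∈ A, ∑ k ∈ Finset.range n, hk (k + (τ + 1)) (y - x) ≤ Gt d τ := by
      intro y _
      refine le_trans ?_ (Gt_anti (d := d) (s := τ) (t := τ + 1) hτ (Nat.le_succ τ))
      refine le_trans ?_ (hk_tail_le (y - x) (τ + 1) (by omega))
      have hs : Summable fun k => hk (k + (τ + 1)) (y - x) :=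
        (summable_nat_add_iff (f := fun k => hk k (y - x)) (τ + 1)).2 (hk_summable (y - x))
      exact Summable.sum_le_tsum (f := fun k => hk (k + (τ + 1)) (y - x)) (Finset.range n) (fun k _ => hk_nonneg _ _) hs
    calc _ ≤ ∑ y ∈ A, Gt d τ := Finset.sum_le_sum this
      _ = _ := by simp
  have h3 : Tendsto (fun n => esc A (τ + n) x + A.card * Gt d τ) atTop (𝓝 (eqm A x + A.card * Gt d τ)) := by
    refine Tendsto.add_const _ ?_
    have := (esc_tendsto A x).comp (tendsto_add_atTop_nat τ)
    refine this.congr fun n => ?_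
    simp [add_comm]
  refine ge_of_tendsto h3 (Eventually.of_forall fun n => ?_)
  have := h1 n
  have := h2 n
  linarith

lemma tc_le_cp (A : Finset (Zd d)) (τ : ℕ) (hτ : 1 ≤ τ) : tc τ A ≤ cp A + (A.card : ℝ) ^ 2 * Gt d τ := by
  unfold tc cp
  calc _ ≤ ∑ x ∈ A, (eqm A x + A.card * Gt d τ) := Finset.sum_le_sum fun x _ => esc_sub_eqm A τ hτ x
    _ = _ := by
      rw [Finset.sum_add_distrib]; simp; ring

/-- mutual energy -/
def QQ (A B : Finset (Zd d)) : ℝ := ∑ x ∈ A, eqm A x * HH B x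

/-- truncated mutual energy -/
def Qt (τ : ℕ) (A B : Finset (Zd d)) : ℝ := ∑ x ∈ A, esc A τ x * HH B x

lemma QQ_nonneg (A B : Finset (Zd d)) : 0 ≤ QQ A B :=
  Finset.sum_nonneg fun x _ => mul_nonneg (eqm_nonneg _ _) (HH_nonneg _ _)

lemma Qt_nonneg (τ : ℕ) (A B : Finset (Zd d)) : 0 ≤ Qt τ A B :=
  Finset.sum_nonneg fun x _ => mul_nonneg (esc_nonneg _ _ _) (HH_nonneg _ _)

lemma QQ_le_Qt (τ : ℕ) (A B : Finset (Zd d)) : QQ A B ≤ Qt τ A B :=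
  Finset.sum_le_sum fun x _ => mul_le_mul_of_nonneg_right (eqm_le_esc _ _ _) (HH_nonneg _ _)

lemma QQ_symm (A B : Finset (Zd d)) : QQ A B = QQ B A := by
  unfold QQ HH
  simp only [Finset.mul_sum]
  rw [Finset.sum_comm]
  refine Finset.sum_congr rfl fun y _ => Finset.sum_congr rfl fun x _ => ?_
  rw [← gr_symm (y - x), neg_sub]; ring

/-- `ψ`-weighted capacity -/
def wt (ψ : Zd d → ℝ) (A : Finset (Zd d)) : ℝ := ∑ x ∈ A, eqm A x * ψ x

lemma QQ_eq_cp {A B : Finset (Zd d)} (h : A ⊆ B) : QQ B A = cp A := by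
  rw [QQ_symm]
  unfold QQ cp
  refine Finset.sum_congr rfl fun x hx => ?_
  rw [HH_eq_one (h hx), mul_one]

lemma wt_union (ψ : Zd d → ℝ) (h0 : ∀ x, 0 ≤ ψ x) (h1 : ∀ x, ψ x ≤ 1) (A B : Finset (Zd d)) :
    wt ψ A + wt ψ B - 2 * QQ A B ≤ wt ψ (A ∪ B) := by
  set E := eqm (A ∪ B) with hE
  have hsplit : ∀ f : Zd d → ℝ, ∑ x ∈ A ∪ B, f x = ∑ x ∈ A, f x + ∑ x ∈ B, f x - ∑ x ∈ A ∩ B, f x := by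
    intro f
    have := Finset.sum_union_inter (s₁ := A) (s₂ := B) (f := f)
    linarith
  -- weighted deficit is at most the plain deficit
  have hA : ∀ x, 0 ≤ eqm A x - E x := fun x => by
    have := eqm_mono_set (Finset.subset_union_left (s₁ := A) (s₂ := B)) x; simp only [hE]; linarith
  have hB : ∀ x, 0 ≤ eqm B x - E x := fun x => by
    have := eqm_mono_set (Finset.subset_union_right (s₁ := A) (s₂ := B)) x; simp only [hE]; linarith
  have hE0 : ∀ x, 0 ≤ E x := fun x => eqm_nonneg _ x
  have d1 : wt ψ A + wt ψ B - wt ψ (A ∪ B) ≤ cp A + cp B - cp (A ∪ B) := by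
    have e1 : wt ψ A + wt ψ B - wt ψ (A ∪ B) = ∑ x ∈ A, (eqm A x - E x) * ψ x
        + ∑ x ∈ B, (eqm B x - E x) * ψ x + ∑ x ∈ A ∩ B, E x * ψ x := by
      unfold wt
      rw [hsplit]
      simp only [sub_mul, Finset.sum_sub_distrib]
      ring
    have e2 : cp A + cp B - cp (A ∪ B) = ∑ x ∈ A, (eqm A x - E x)
        + ∑ x ∈ B, (eqm B x - E x) + ∑ x ∈ A ∩ B, E x := by
      unfold cp
      rw [hsplit]
      simp only [Finset.sum_sub_distrib]
      ring
    rw [e1, e2]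
    refine add_le_add (add_le_add ?_ ?_) ?_
    · exact Finset.sum_le_sum fun x _ => mul_le_of_le_one_right (hA x) (h1 x)
    · exact Finset.sum_le_sum fun x _ => mul_le_of_le_one_right (hB x) (h1 x)
    · exact Finset.sum_le_sum fun x _ => mul_le_of_le_one_right (hE0 x) (h1 x)
  have d2 : cp A + cp B - cp (A ∪ B) = ∑ x ∈ A ∪ B, E x * (HH A x + HH B x - 1) := by
    rw [← QQ_eq_cp (Finset.subset_union_left (s₁ := A) (s₂ := B)),
      ← QQ_eq_cp (Finset.subset_union_right (s₁ := A) (s₂ := B))]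
    unfold QQ cp
    rw [← Finset.sum_add_distrib, ← Finset.sum_sub_distrib]
    exact Finset.sum_congr rfl fun x _ => by simp only [hE]; ring
  have d3 : ∑ x ∈ A ∪ B, E x * (HH A x + HH B x - 1) ≤ QQ A B + QQ B A := by
    rw [← Finset.union_sdiff_self_eq_union, Finset.sum_union Finset.disjoint_sdiff]
    refine add_le_add ?_ ?_
    · refine Finset.sum_le_sum fun x hx => ?_
      rw [HH_eq_one hx, add_sub_cancel_left]
      exact mul_le_mul_of_nonneg_right (by linarith [hA x]) (HH_nonneg _ _)
    · refine le_trans (Finset.sum_le_sum (g := fun x => eqm B x * HH A x) fun x hx => ?_)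
        (Finset.sum_le_sum_of_subset_of_nonneg Finset.sdiff_subset
          fun x _ _ => mul_nonneg (eqm_nonneg _ _) (HH_nonneg _ _))
      rw [HH_eq_one (Finset.sdiff_subset hx), add_sub_cancel_right]
      exact mul_le_mul_of_nonneg_right (by linarith [hB x]) (HH_nonneg _ _)
  have := QQ_symm A B
  linarith

/-! translation -/

lemma av_shift (A : Finset (Zd d)) (a x : Zd d) (s) :
    av (A.image (fun z => a + z)) (a + x) s ↔ av A x s := by
  simp [av, trT_shift]

lemma esc_shift (A : Finset (Zd d)) (a x : Zd d) (T : ℕ) :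
    esc (A.image (fun z => a + z)) T (a + x) = esc A T x := by
  unfold esc; simp only [av_shift]

lemma eqm_shift (A : Finset (Zd d)) (a x : Zd d) : eqm (A.image (fun z => a + z)) (a + x) = eqm A x := by
  unfold eqm; simp only [esc_shift]

lemma sum_shift (A : Finset (Zd d)) (a : Zd d) (f : Zd d → ℝ) :
    ∑ x ∈ A.image (fun z => a + z), f x = ∑ x ∈ A, f (a + x) := by
  rw [Finset.sum_image]
  intro x _ y _ h
  simpa using h

lemma cp_shift (A : Finset (Zd d)) (a : Zd d) : cp (A.image (fun z => a + z)) = cp A := by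
  unfold cp; rw [sum_shift]; simp only [eqm_shift]

lemma tc_shift (A : Finset (Zd d)) (a : Zd d) (τ : ℕ) : tc τ (A.image (fun z => a + z)) = tc τ A := by
  unfold tc; rw [sum_shift]; simp only [esc_shift]

lemma tc_union_le (τ : ℕ) (f : Zd d → ℝ) (hf : ∀ x, 0 ≤ f x) (A B : Finset (Zd d)) :
    ∑ x ∈ A ∪ B, esc (A ∪ B) τ x * f x ≤ ∑ x ∈ A, esc A τ x * f x + ∑ x ∈ B, esc B τ x * f x := by
  have h := Finset.sum_union_inter (s₁ := A) (s₂ := B) (f := fun x => esc (A ∪ B) τ x * f x)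
  have h0 : 0 ≤ ∑ x ∈ A ∩ B, esc (A ∪ B) τ x * f x :=
    Finset.sum_nonneg fun x _ => mul_nonneg (esc_nonneg _ _ _) (hf x)
  have h1 : ∑ x ∈ A, esc (A ∪ B) τ x * f x ≤ ∑ x ∈ A, esc A τ x * f x :=
    Finset.sum_le_sum fun x _ => mul_le_mul_of_nonneg_right (esc_mono_set Finset.subset_union_left _ _) (hf x)
  have h2 : ∑ x ∈ B, esc (A ∪ B) τ x * f x ≤ ∑ x ∈ B, esc B τ x * f x :=
    Finset.sum_le_sum fun x _ => mul_le_mul_of_nonneg_right (esc_mono_set Finset.subset_union_right _ _) (hf x)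
  linarith

end

/-! ## F4: bridge between the path measures and the combinatorial expectations -/

section
variable {d : ℕ} [Fact (4 ≤ d)]

/-- the first `T+1` positions -/
def ini (T : ℕ) (ω : ℕ → Zd d) : List (Zd d) := (List.range (T + 1)).map ω

lemma ini_length (T : ℕ) (ω : ℕ → Zd d) : (ini T ω).length = T + 1 := by simp [ini]

lemma ini_meas (T : ℕ) (l : List (Zd d)) : MeasurableSet {ω : ℕ → Zd d | ini T ω = l} := by
  by_cases hl : l.length = T + 1
  · have : {ω : ℕ → Zd d | ini T ω = l} = ⋂ t ∈ Finset.range (T + 1), {ω | ω t = l.getD t 0} := by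
      ext ω
      simp only [Set.mem_ofPred_eq, Set.mem_iInter, Finset.mem_range]
      constructor
      · rintro rfl t ht
        simp [ini, List.getD, ht]
      · intro h
        refine List.ext_getElem (by simp [ini, hl]) fun t h1 h2 => ?_
        have := h t (by omega)
        simp [ini, this, h2]
    rw [this]
    refine Finset.measurableSet_biInter _ fun t _ => ?_
    exact measurableSet_eq_fun (measurable_pi_apply t) measurable_const
  · convert MeasurableSet.empty using 1
    ext ω
    simp only [Set.mem_ofPred_eq, Set.mem_empty_iff_false, iff_false]
    rintro rfl
    exact hl (ini_length T ω)

lemma ini_prob {x : Zd d} {P : Measure (ℕ → Zd d)} (hP : IsSRW d x P) (T : ℕ) (s : List (Dir d))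
    (hs : s.length = T) : P {ω | ini T ω = tr x s} = (((2 * d : ℕ) : ℝ≥0∞))⁻¹ ^ T := by
  have h := hP.2 T (fun t => (tr x s).getD t 0)
  have hlen : (tr x s).length = T + 1 := by rw [tr_length, hs]
  have e : {ω : ℕ → Zd d | ∀ t ≤ T, ω t = (tr x s).getD t 0} = {ω | ini T ω = tr x s} := by
    ext ω
    simp only [Set.mem_ofPred_eq]
    constructor
    · intro h
      refine List.ext_getElem (by simp [ini, hlen]) fun t h1 h2 => ?_
      have := h t (by omega)
      rw [List.getD_eq_getElem _ _ h2] at this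
      simp [ini, this]
    · intro h t ht
      rw [← h]
      simp [ini, List.getD, Nat.lt_succ_of_le ht]
  rw [e] at h
  rw [h, if_pos]
  refine ⟨by simp [tr], ?_⟩
  intro t ht
  have hc := tr_chain x s
  rw [List.isChain_iff_getElem] at hc
  have := hc t (by omega)
  have h1 : t < (tr x s).length := by omega
  have h2 : t + 1 < (tr x s).length := by omega
  rwa [List.getD_eq_getElem _ _ h1, List.getD_eq_getElem _ _ h2]

lemma srw_integral {x : Zd d} {P : Measure (ℕ → Zd d)} (hP : IsSRW d x P) (T : ℕ)
    (F : List (Zd d) → ℝ) : ∫ ω, F (ini T ω) ∂P = Ex T (fun s => F (tr x s)) := by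
  haveI := hP.1
  set C : List (Dir d) → Set (ℕ → Zd d) := fun s => {ω | ini T ω = tr x s} with hC
  have hdisj : Set.Pairwise (↑(Lst d T)) (Function.onFun Disjoint C) := by
    intro s hs t ht hst
    rw [Function.onFun, Set.disjoint_left]
    intro ω h1 h2
    simp only [hC, Set.mem_ofPred_eq] at h1 h2
    apply hst
    have := h1.symm.trans h2
    exact trT_inj x (by simpa [tr] using this)
  have hm : ∀ s ∈ Lst d T, MeasurableSet (C s) := fun s _ => ini_meas T _
  have hp : ∀ s ∈ Lst d T, P (C s) = (((2 * d : ℕ) : ℝ≥0∞))⁻¹ ^ T := fun s hs =>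
    ini_prob hP T s (mem_Lst.1 hs)
  have hreal : ∀ s ∈ Lst d T, P.real (C s) = ((2 * (d : ℝ)) ^ T)⁻¹ := by
    intro s hs
    rw [measureReal_def, hp s hs]
    simp only [ENNReal.toReal_pow, ENNReal.toReal_inv, ENNReal.toReal_natCast]
    push_cast
    rw [inv_pow]
  have htot : P.real (⋃ s ∈ Lst d T, C s) = 1 := by
    rw [measureReal_biUnion_finset hdisj hm, Finset.sum_congr rfl hreal]
    have := Ex_const (d := d) T 1
    unfold Ex at this
    rw [← this]
    simp [div_eq_mul_inv]
  have hm' : MeasurableSet (⋃ s ∈ Lst d T, C s) := Finset.measurableSet_biUnion _ hm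
  have hae : ∀ᵐ ω ∂P, ω ∈ ⋃ s ∈ Lst d T, C s := by
    have h1 : P (⋃ s ∈ Lst d T, C s) = 1 := by
      rw [measureReal_def] at htot
      exact (ENNReal.toReal_eq_one_iff _).1 htot
    exact (prob_compl_eq_zero_iff hm').2 h1
  have hcon : ∀ s ∈ Lst d T, IntegrableOn (fun ω => F (ini T ω)) (C s) P := by
    intro s hs
    refine (integrableOn_const (C := F (tr x s)) (measure_ne_top _ _)).congr_fun ?_ (hm s hs)
    intro ω hω
    simp only [hC, Set.mem_ofPred_eq] at hω
    simp [hω]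
  rw [← setIntegral_eq_integral_of_ae_compl_eq_zero (s := ⋃ s ∈ Lst d T, C s)
    (by filter_upwards [hae] with ω h1 h2; exact absurd h1 h2)]
  rw [integral_biUnion_finset _ hm hdisj hcon]
  unfold Ex
  rw [div_eq_mul_inv, Finset.sum_mul]
  refine Finset.sum_congr rfl fun s hs => ?_
  rw [setIntegral_congr_fun (g := fun _ => F (tr x s)) (hm s hs)]
  · rw [setIntegral_const, hreal s hs, smul_eq_mul, mul_comm]
  · intro ω hω
    simp only [hC, Set.mem_ofPred_eq] at hω
    simp [hω]

lemma noRet_eq {x : Zd d} {P : Measure (ℕ → Zd d)} (hP : IsSRW d x P) (A : Finset (Zd d)) (T : ℕ) :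
    (P {ω | ∀ t : ℕ, 0 < t → t ≤ T → ω t ∉ A}).toReal = esc A T x := by
  haveI := hP.1
  have h := srw_integral hP T (fun l => if ∀ z ∈ l.tail, z ∉ A then (1 : ℝ) else 0)
  have h2 : esc A T x = Ex T (fun s => if ∀ z ∈ (tr x s).tail, z ∉ A then (1 : ℝ) else 0) := by
    unfold esc av
    refine Ex_congr fun s _ => ?_
    congr 1
  rw [h2, ← h]
  have hms : MeasurableSet {ω : ℕ → Zd d | ∀ t : ℕ, 0 < t → t ≤ T → ω t ∉ A} := by
    have : {ω : ℕ → Zd d | ∀ t : ℕ, 0 < t → t ≤ T → ω t ∉ A} =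
      ⋂ t : ℕ, ⋂ _ : 0 < t, ⋂ _ : t ≤ T, {ω | ω t ∉ A} := by ext; simp
    rw [this]
    refine MeasurableSet.iInter fun t => MeasurableSet.iInter fun _ => MeasurableSet.iInter fun _ => ?_
    exact (measurable_pi_apply t : Measurable fun ω : ℕ → Zd d => ω t) (A.measurableSet.compl)
  rw [← measureReal_def, ← integral_indicator_one hms]
  refine integral_congr_ae (Eventually.of_forall fun ω => ?_)
  simp only [Set.indicator_apply, Set.mem_ofPred_eq, Pi.one_apply]
  congr 1
  apply propext
  have : (ini T ω).tail = (List.range' 1 T).map ω := by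
    simp [ini, List.range_succ_eq_map, List.range'_eq_map_range, Function.comp_def, add_comm]
  rw [this]
  simp only [List.mem_map, List.mem_range'_1, forall_exists_index, and_imp]
  constructor
  · rintro h z t h1 h2 rfl; exact h t (by omega) (by omega)
  · intro h t h1 h2; exact h _ t (by omega) (by omega) rfl

lemma equil_eq {Pw : Zd d → Measure (ℕ → Zd d)} (hP : IsSRWFamily d Pw) (A : Finset (Zd d)) (x : Zd d)
    (hx : x ∈ A) : equil Pw (↑A) x = eqm A x := by
  haveI := (hP x).1
  rw [equil, if_pos (by simpa using hx)]
  have h1 : Tendsto (fun T => (Pw x {ω | ∀ t : ℕ, 0 < t → t ≤ T → ω t ∉ A}).toReal) atTop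
      (𝓝 (Pw x (NoReturn ↑A)).toReal) := by
    refine (ENNReal.tendsto_toReal (measure_ne_top _ _)).comp ?_
    have hI : NoReturn (d := d) ↑A = ⋂ T : ℕ, {ω | ∀ t : ℕ, 0 < t → t ≤ T → ω t ∉ A} := by
      ext ω
      simp only [NoReturn, Set.mem_ofPred_eq, Set.mem_iInter, Finset.mem_coe]
      exact ⟨fun h T t h1 _ => h t h1, fun h t h1 => h t t h1 le_rfl⟩
    rw [hI]
    refine tendsto_measure_iInter_atTop ?_ ?_ ⟨0, measure_ne_top _ _⟩
    · intro T
      refine MeasurableSet.nullMeasurableSet ?_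
      have : {ω : ℕ → Zd d | ∀ t : ℕ, 0 < t → t ≤ T → ω t ∉ A} =
        ⋂ t : ℕ, ⋂ _ : 0 < t, ⋂ _ : t ≤ T, {ω | ω t ∉ A} := by ext; simp
      rw [this]
      refine MeasurableSet.iInter fun t => MeasurableSet.iInter fun _ => MeasurableSet.iInter fun _ => ?_
      exact (measurable_pi_apply t : Measurable fun ω : ℕ → Zd d => ω t) (A.measurableSet.compl)
    · intro S T h ω hω t h1 h2
      exact hω t h1 (h2.trans h)
  refine tendsto_nhds_unique h1 ?_
  simp only [noRet_eq (hP x)]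
  exact esc_tendsto A x

lemma capacity_eq {Pw : Zd d → Measure (ℕ → Zd d)} (hP : IsSRWFamily d Pw) (A : Finset (Zd d)) :
    capacity Pw A = cp A := by
  unfold capacity cp
  exact Finset.sum_congr rfl fun x hx => equil_eq hP A x hx

/-- expected capacity of the range -/
def ecap (d : ℕ) [Fact (4 ≤ d)] (T : ℕ) : ℝ := Ex T (fun s => cp (tr (0 : Zd d) s).toFinset)

lemma capExpect_eq {Pw : Zd d → Measure (ℕ → Zd d)} (hP : IsSRWFamily d Pw) (T : ℕ) :
    capExpect Pw T = ecap d T := by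
  unfold capExpect ecap
  rw [← srw_integral (hP 0) T (fun l => cp l.toFinset)]
  refine integral_congr_ae (Eventually.of_forall fun ω => ?_)
  simp only [capacity_eq hP]
  congr 1
  ext z
  simp [walkRange, ini, Nat.lt_succ_iff]

lemma ecap_shift (T : ℕ) (x : Zd d) : Ex T (fun s => cp (tr x s).toFinset) = ecap d T := by
  unfold ecap
  refine Ex_congr fun s _ => ?_
  have h : (tr x s).toFinset = ((tr 0 s).toFinset).image (fun z => x + z) := by
    have := tr_shift x 0 s
    rw [add_zero] at this
    rw [this]
    ext z; simp only [List.mem_toFinset, List.mem_map, Finset.mem_image]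
  rw [h, cp_shift]

end

/-! ## F5: moments, exit estimates and the bump function -/

section
variable {d : ℕ} [Fact (4 ≤ d)]

/-- linear functional -/
def lf (α : Fin d → ℝ) (z : Zd d) : ℝ := ∑ i, α i * (z i : ℝ)

lemma lf_add (α : Fin d → ℝ) (x y : Zd d) : lf α (x + y) = lf α x + lf α y := by
  unfold lf
  rw [← Finset.sum_add_distrib]
  exact Finset.sum_congr rfl fun i _ => by simp; ring

lemma lf_zero (α : Fin d → ℝ) : lf α 0 = 0 := by simp [lf]

lemma lf_dv (α : Fin d → ℝ) (e : Dir d) : lf α (dv e) = if e.2 then α e.1 else - α e.1 := by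
  unfold lf dv
  rw [Finset.sum_eq_single e.1]
  · rcases e with ⟨i, b⟩
    cases b <;> simp
  · intro j _ hj
    rcases e with ⟨i, b⟩
    simp only at hj
    cases b <;> simp [hj]
  · simp

lemma sum_dir (g : ℝ → ℝ) (α : Fin d → ℝ) :
    ∑ e : Dir d, g (lf α (dv e)) = ∑ i, (g (α i) + g (- α i)) := by
  rw [Fintype.sum_prod_type]
  refine Finset.sum_congr rfl fun i _ => ?_
  simp [lf_dv, add_comm]

/-- squared length -/
def a2 (α : Fin d → ℝ) : ℝ := ∑ i, α i ^ 2

lemma a2_nonneg (α : Fin d → ℝ) : 0 ≤ a2 α := Finset.sum_nonneg fun i _ => sq_nonneg _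

lemma dpos : (0 : ℝ) < d := by have := twod_pos (d := d); linarith

lemma card_dir : (∑ _e : Dir d, (1 : ℝ)) = 2 * d := by simp; ring

lemma step1 (α : Fin d → ℝ) : ∑ e : Dir d, lf α (dv e) = 0 := by
  rw [sum_dir (fun t => t)]; simp

lemma step2 (α : Fin d → ℝ) : ∑ e : Dir d, lf α (dv e) ^ 2 = 2 * a2 α := by
  rw [sum_dir (fun t => t ^ 2), a2, Finset.mul_sum]
  exact Finset.sum_congr rfl fun i _ => by ring

lemma step3 (α : Fin d → ℝ) : ∑ e : Dir d, lf α (dv e) ^ 3 = 0 := by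
  rw [sum_dir (fun t => t ^ 3)]
  exact Finset.sum_eq_zero fun i _ => by ring

lemma step4 (α : Fin d → ℝ) : ∑ e : Dir d, lf α (dv e) ^ 4 ≤ 2 * a2 α ^ 2 := by
  rw [sum_dir (fun t => t ^ 4)]
  have h : ∀ i, α i ^ 2 ≤ a2 α := fun i =>
    Finset.single_le_sum (f := fun i => α i ^ 2) (fun i _ => sq_nonneg _) (Finset.mem_univ i)
  calc _ = ∑ i, 2 * (α i ^ 2 * α i ^ 2) := Finset.sum_congr rfl fun i _ => by ring
    _ ≤ ∑ i, 2 * (a2 α * α i ^ 2) := Finset.sum_le_sum fun i _ => by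
        have := mul_le_mul_of_nonneg_right (h i) (sq_nonneg (α i)); linarith
    _ = _ := by rw [← Finset.mul_sum, ← Finset.mul_sum]; unfold a2; ring

lemma mom1 (α : Fin d → ℝ) (T : ℕ) (x : Zd d) : Ex T (fun s => lf α (pos x s)) = lf α x := by
  induction T generalizing x with
  | zero => simp
  | succ T ih =>
    rw [Ex_succ]
    simp only [pos_cons, ih, lf_add]
    rw [Finset.sum_add_distrib, step1, Finset.sum_const, add_zero]
    have hd := dpos (d := d)
    simp
    rw [div_eq_iff (by positivity)]; ring

lemma mom2 (α : Fin d → ℝ) (T : ℕ) (x : Zd d) :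
    Ex T (fun s => lf α (pos x s) ^ 2) = lf α x ^ 2 + T * (a2 α / d) := by
  induction T generalizing x with
  | zero => simp
  | succ T ih =>
    rw [Ex_succ]
    simp only [pos_cons, ih, lf_add]
    have : ∀ e : Dir d, (lf α x + lf α (dv e)) ^ 2 + (T : ℝ) * (a2 α / d) =
        (lf α x ^ 2 + T * (a2 α / d)) * 1 + 2 * lf α x * lf α (dv e) + lf α (dv e) ^ 2 := fun e => by ring
    simp only [this]
    rw [Finset.sum_add_distrib, Finset.sum_add_distrib, ← Finset.mul_sum, ← Finset.mul_sum, step1, step2,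
      card_dir]
    have := dpos (d := d)
    push_cast
    field_simp
    ring

lemma mom4 (α : Fin d → ℝ) (T : ℕ) (x : Zd d) :
    Ex T (fun s => lf α (pos x s) ^ 4) ≤
      lf α x ^ 4 + 6 * T * (a2 α / d) * lf α x ^ 2 + 3 * T ^ 2 * (a2 α / d) ^ 2 + T * (a2 α ^ 2 / d) := by
  induction T generalizing x with
  | zero => simp
  | succ T ih =>
    rw [Ex_succ]
    simp only [pos_cons]
    have hd := dpos (d := d)
    rw [div_le_iff₀ (twod_pos (d := d))]
    refine le_trans (Finset.sum_le_sum fun e _ => ih (x + dv e)) ?_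
    simp only [lf_add]
    set y := lf α x
    set a := a2 α / d with ha
    have haa : a2 α = a * d := by rw [ha]; field_simp
    have : ∀ e : Dir d, (y + lf α (dv e)) ^ 4 + 6 * T * a * (y + lf α (dv e)) ^ 2 + 3 * T ^ 2 * a ^ 2
        + T * (a2 α ^ 2 / d) =
        (y ^ 4 + 6 * T * a * y ^ 2 + 3 * T ^ 2 * a ^ 2 + T * (a2 α ^ 2 / d)) * 1
         + (4 * y ^ 3 + 12 * T * a * y) * lf α (dv e) + (6 * y ^ 2 + 6 * T * a) * lf α (dv e) ^ 2
         + 4 * y * lf α (dv e) ^ 3 + lf α (dv e) ^ 4 := fun e => by ring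
    simp only [this]
    simp only [Finset.sum_add_distrib, ← Finset.mul_sum, step1, step2, step3, card_dir]
    have h4 := step4 α
    rw [haa] at h4 ⊢
    have e1 : (a * (d : ℝ)) ^ 2 / d = a ^ 2 * d := by field_simp
    rw [e1]
    push_cast
    nlinarith [mul_nonneg (sq_nonneg a) hd.le]

/-- lower bound for the first absolute moment -/
lemma mom_abs (α : Fin d → ℝ) (T : ℕ) (hT : 1 ≤ T) :
    Real.sqrt (T * (a2 α / d)) / (2 * Real.sqrt (2 * (3 + d))) ≤ Ex T (fun s => |lf α (pos 0 s)|) := by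
  have hd := dpos (d := d)
  set a := a2 α / d with ha
  have ha0 : 0 ≤ a := div_nonneg (a2_nonneg _) hd.le
  have hT1 : (1 : ℝ) ≤ T := by exact_mod_cast hT
  rcases eq_or_lt_of_le ha0 with h0 | h0
  · rw [← h0]; simp
    exact Ex_nonneg fun s _ => abs_nonneg _
  set w := Real.sqrt (T * a) with hw
  set v := Real.sqrt (2 * (3 + (d : ℝ))) with hv
  have hw0 : 0 < w := Real.sqrt_pos.2 (by positivity)
  have hv0 : 0 < v := Real.sqrt_pos.2 (by positivity)
  have hw2 : w ^ 2 = T * a := Real.sq_sqrt (by positivity)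
  have hv2 : v ^ 2 = 2 * (3 + d) := Real.sq_sqrt (by positivity)
  set l := w * v with hl
  have hl0 : 0 < l := by positivity
  have hpt : ∀ t : ℝ, t ^ 2 / l - t ^ 4 / l ^ 3 ≤ |t| := by
    intro t
    have key : ∀ z : ℝ, 0 ≤ z → z ^ 2 - z ^ 4 ≤ z := by
      intro z hz
      nlinarith [mul_nonneg hz (mul_nonneg hz hz), mul_nonneg hz (sq_nonneg (z - 1)),
        mul_nonneg (mul_nonneg hz hz) (sq_nonneg (z - 1)), sq_nonneg (z^2 - 1 ), mul_nonneg hz (sq_nonneg (z + 1))]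
    have h := key (|t| / l) (by positivity)
    have e1 : t ^ 2 / l - t ^ 4 / l ^ 3 = l * ((|t| / l) ^ 2 - (|t| / l) ^ 4) := by
      rw [div_pow, div_pow, sq_abs, show |t| ^ 4 = t ^ 4 by rw [show (4 : ℕ) = 2 * 2 by norm_num, pow_mul, sq_abs, ← pow_mul]]
      field_simp
    rw [e1]
    calc _ ≤ l * (|t| / l) := mul_le_mul_of_nonneg_left h hl0.le
      _ = |t| := by field_simp
  have h2 := mom2 α T 0
  have h4 := mom4 α T 0
  rw [lf_zero] at h2 h4
  have hh : Ex T (fun s => lf α (pos 0 s) ^ 2 / l - lf α (pos 0 s) ^ 4 / l ^ 3) ≤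
      Ex T (fun s => |lf α (pos 0 s)|) := Ex_mono fun s _ => hpt _
  refine le_trans ?_ hh
  rw [Ex_sub_fun]
  simp only [div_eq_mul_inv (_ ^ _)]
  rw [Ex_mul_right, Ex_mul_right, h2]
  have h4' : Ex T (fun s => lf α (pos 0 s) ^ 4) ≤ (3 + d) * (w ^ 2) ^ 2 := by
    refine h4.trans ?_
    rw [hw2]
    have : a2 α = a * d := by rw [ha]; field_simp
    have e1 : a2 α ^ 2 / d = a ^ 2 * d := by rw [this]; field_simp
    rw [← ha, e1]
    nlinarith [mul_nonneg (mul_nonneg (sq_nonneg a) hd.le) (mul_nonneg (by linarith : (0:ℝ) ≤ T) (by linarith : (0:ℝ) ≤ T - 1))]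
  have hl3 : 0 ≤ (l ^ 3)⁻¹ := by positivity
  have h5 := mul_le_mul_of_nonneg_right h4' hl3
  have e2 : (0 ^ 2 + T * a) * l⁻¹ = w / v := by
    rw [← hw2, hl]; field_simp; simp
  have e3 : (3 + (d : ℝ)) * (w ^ 2) ^ 2 * (l ^ 3)⁻¹ = w / (2 * v) := by
    have : (3 + (d : ℝ)) = v ^ 2 / 2 := by rw [hv2]; ring
    rw [this, hl]; field_simp
  rw [e2]
  rw [e3] at h5
  have e4 : w / (2 * v) = w / v / 2 := by field_simp
  rw [e4] at h5 ⊢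
  linarith

/-- the two projected coordinates -/
def i0 (d : ℕ) [h : Fact (4 ≤ d)] : Fin d := ⟨0, by have := h.1; omega⟩
def i1 (d : ℕ) [h : Fact (4 ≤ d)] : Fin d := ⟨1, by have := h.1; omega⟩
def i2 (d : ℕ) [h : Fact (4 ≤ d)] : Fin d := ⟨2, by have := h.1; omega⟩

lemma i01 : i0 d ≠ i1 d := by simp [i0, i1]
lemma i02 : i0 d ≠ i2 d := by simp [i0, i2]
lemma i12 : i1 d ≠ i2 d := by simp [i1, i2]

lemma lf_single (i : Fin d) (z : Zd d) : lf (Pi.single i 1) z = z i := by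
  unfold lf
  rw [Finset.sum_eq_single i] <;> simp +contextual [Pi.single_apply]

lemma a2_single (i : Fin d) : a2 (Pi.single i (1 : ℝ)) = 1 := by
  unfold a2
  rw [Finset.sum_eq_single i] <;> simp +contextual [Pi.single_apply]

lemma mom_coord2 (i : Fin d) (T : ℕ) (x : Zd d) :
    Ex T (fun s => (pos x s i : ℝ) ^ 2) = (x i : ℝ) ^ 2 + T / d := by
  have := mom2 (Pi.single i 1) T x
  simp only [lf_single, a2_single] at this
  rw [this]; ring

lemma mom_coord_abs (i : Fin d) (T : ℕ) : Ex T (fun s => |(pos (0 : Zd d) s i : ℝ)|) ≤ Real.sqrt T := by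
  rcases Nat.eq_zero_or_pos T with rfl | hT
  · simp
  have h := mom_coord2 i T 0
  have hT1 : (0 : ℝ) < T := by exact_mod_cast hT
  set w := Real.sqrt T with hw
  have hw0 : 0 < w := Real.sqrt_pos.2 hT1
  have hw2 : w ^ 2 = T := Real.sq_sqrt hT1.le
  have hpt : ∀ t : ℝ, |t| ≤ t ^ 2 * (2 * w)⁻¹ + w / 2 := by
    intro t
    have h1 := sq_nonneg (|t| - w)
    have h2 : |t| ^ 2 = t ^ 2 := sq_abs t
    rw [← div_eq_mul_inv, div_add_div _ _ (by positivity) (by norm_num), le_div_iff₀ (by positivity)]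
    nlinarith
  refine le_trans (Ex_mono (F' := fun s => (pos (0 : Zd d) s i : ℝ) ^ 2 * (2 * w)⁻¹ + w / 2) fun s _ => hpt _) ?_
  rw [Ex_add_fun, Ex_mul_right, h, Ex_const]
  have hd1 : (1 : ℝ) ≤ d := by have : 4 ≤ d := Fact.out; exact_mod_cast (by omega : 1 ≤ d)
  have : (T : ℝ) / d ≤ T := div_le_self hT1.le hd1
  have h6 : ((T : ℝ) / d) * (2 * w)⁻¹ ≤ T * (2 * w)⁻¹ := mul_le_mul_of_nonneg_right this (by positivity)
  have h7 : (T : ℝ) * (2 * w)⁻¹ = w / 2 := by rw [← hw2]; field_simp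
  simp
  simp at h6 h7
  linarith

/-- exit estimate -/
lemma exit_le (i : Fin d) (a : ℝ) (ha : 0 < a) (T : ℕ) (c : ℝ) (x : Zd d) :
    Ex T (fun s => if ∃ z ∈ tr x s, a ≤ |(z i : ℝ) - c| then (1 : ℝ) else 0) ≤ (((x i : ℝ) - c) ^ 2 + T / d) / a ^ 2 := by
  induction T generalizing x with
  | zero =>
    simp only [Ex_zero, tr, trT_nil, List.mem_singleton, exists_eq_left]
    rw [le_div_iff₀ (by positivity)]
    split_ifs with h
    · have := sq_le_sq' (by linarith) h
      rw [sq_abs] at this; simp; linarith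
    · simp; positivity
  | succ T ih =>
    rcases le_or_gt a |(x i : ℝ) - c| with h | h
    · refine le_trans (Ex_le_const (c := 1) fun s _ => by split_ifs <;> norm_num) ?_
      rw [le_div_iff₀ (by positivity)]
      have := sq_le_sq' (by linarith) h
      rw [sq_abs] at this
      have hd := dpos (d := d)
      have : 0 ≤ ((T + 1 : ℕ) : ℝ) / d := by positivity
      linarith
    · rw [Ex_succ]
      have e : ∀ e : Dir d, Ex T (fun s => if ∃ z ∈ tr x (e :: s), a ≤ |(z i : ℝ) - c| then (1 : ℝ) else 0) ≤
          (((x i : ℝ) - c + lf (Pi.single i 1) (dv e)) ^ 2 + T / d) / a ^ 2 := by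
        intro e
        refine le_trans (le_of_eq ?_) ((ih (x + dv e)).trans (le_of_eq ?_))
        · refine Ex_congr fun s _ => ?_
          congr 1
          apply propext
          simp only [tr, trT_cons, List.mem_cons]
          constructor
          · rintro ⟨z, hz | hz, hz2⟩
            · subst hz; linarith
            · exact ⟨z, hz, hz2⟩
          · rintro ⟨z, hz, hz2⟩; exact ⟨z, Or.inr hz, hz2⟩
        · rw [lf_single]; simp; ring
      rw [div_le_iff₀ (twod_pos (d := d))]
      refine (Finset.sum_le_sum fun e' _ => e e').trans ?_
      rw [← Finset.sum_div]
      have : ∀ e : Dir d, ((x i : ℝ) - c + lf (Pi.single i 1) (dv e)) ^ 2 + (T : ℝ) / d =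
        (((x i : ℝ) - c) ^ 2 + T / d) * 1 + 2 * ((x i : ℝ) - c) * lf (Pi.single i 1) (dv e)
          + lf (Pi.single i 1) (dv e) ^ 2 := fun e => by ring
      simp only [this]
      simp only [Finset.sum_add_distrib, ← Finset.mul_sum, step1, step2, a2_single, card_dir]
      have hd := dpos (d := d)
      refine le_of_eq ?_
      push_cast
      field_simp
      ring

/-- the bump profile -/
def bf (r y1 y2 : ℝ) : ℝ := max 0 (1 - (y1 ^ 2 + y2 ^ 2) / r ^ 2)

lemma bf_nonneg (r y1 y2 : ℝ) : 0 ≤ bf r y1 y2 := le_max_left _ _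

lemma bf_le_one (r y1 y2 : ℝ) : bf r y1 y2 ≤ 1 := by
  unfold bf
  apply max_le (by norm_num)
  have : 0 ≤ (y1 ^ 2 + y2 ^ 2) / r ^ 2 := by positivity
  linarith

lemma bf_lip1 {r : ℝ} (hr : 0 < r) (y1 y2 z1 z2 : ℝ) :
    bf r y1 y2 - bf r z1 z2 ≤ 3 / r * (|y1 - z1| + |y2 - z2|) := by
  set δ := |y1 - z1| + |y2 - z2| with hδ
  have hδ0 : 0 ≤ δ := by positivity
  rcases eq_or_lt_of_le (bf_nonneg r y1 y2) with h | h
  · rw [← h]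
    have := bf_nonneg r z1 z2
    have : 0 ≤ 3 / r * δ := by positivity
    linarith
  rcases le_or_gt r δ with h1 | h1
  · have a := bf_le_one r y1 y2
    have b := bf_nonneg r z1 z2
    have : 3 ≤ 3 / r * δ := by
      rw [div_mul_eq_mul_div, le_div_iff₀ hr]; linarith
    linarith
  · have hy : bf r y1 y2 = 1 - (y1 ^ 2 + y2 ^ 2) / r ^ 2 := by
      unfold bf at h ⊢
      rcases max_choice 0 (1 - (y1 ^ 2 + y2 ^ 2) / r ^ 2) with h2 | h2
      · rw [h2] at h; exact absurd h (lt_irrefl _)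
      · exact h2
    have hyr : y1 ^ 2 + y2 ^ 2 < r ^ 2 := by
      rw [hy] at h
      have : (y1 ^ 2 + y2 ^ 2) / r ^ 2 < 1 := by linarith
      rwa [div_lt_one (by positivity)] at this
    have hz : 1 - (z1 ^ 2 + z2 ^ 2) / r ^ 2 ≤ bf r z1 z2 := le_max_right _ _
    have a1 : |y1| ≤ r := abs_le_of_sq_le_sq (by nlinarith [sq_nonneg y2]) hr.le
    have a2 : |y2| ≤ r := abs_le_of_sq_le_sq (by nlinarith [sq_nonneg y1]) hr.le
    have key : ∀ y z : ℝ, |y| ≤ r → z ^ 2 - y ^ 2 ≤ |y - z| * (2 * r + |y - z|) := by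
      intro y z hh
      have e : z ^ 2 - y ^ 2 = (y - z) ^ 2 - 2 * (y * (y - z)) := by ring
      have e2 : -(y * (y - z)) ≤ |y| * |y - z| := by rw [← abs_mul]; exact neg_le_abs _
      have e3 : |y - z| ^ 2 = (y - z) ^ 2 := sq_abs _
      have e4 := mul_le_mul_of_nonneg_right hh (abs_nonneg (y - z))
      nlinarith
    have k1 := key y1 z1 a1
    have k2 := key y2 z2 a2
    have p1 := abs_nonneg (y1 - z1)
    have p2 := abs_nonneg (y2 - z2)
    have hb : (z1 ^ 2 + z2 ^ 2) - (y1 ^ 2 + y2 ^ 2) ≤ 3 * r * δ := by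
      nlinarith [mul_nonneg p1 p2]
    have : (z1 ^ 2 + z2 ^ 2) / r ^ 2 - (y1 ^ 2 + y2 ^ 2) / r ^ 2 ≤ 3 / r * δ := by
      rw [← sub_div, div_le_iff₀ (by positivity)]
      refine hb.trans (le_of_eq ?_)
      field_simp
    linarith

lemma bf_lip {r : ℝ} (hr : 0 < r) (y1 y2 z1 z2 : ℝ) :
    |bf r y1 y2 - bf r z1 z2| ≤ 3 / r * (|y1 - z1| + |y2 - z2|) := by
  rw [abs_le]
  have h1 := bf_lip1 hr y1 y2 z1 z2
  have h2 := bf_lip1 hr z1 z2 y1 y2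
  rw [abs_sub_comm z1, abs_sub_comm z2] at h2
  constructor <;> linarith

/-- the bump function on the lattice, at scale `R`, radius `r`, centre `(c1,c2)` -/
def psi (R r c1 c2 : ℝ) (x : Zd d) : ℝ := bf r ((x (i0 d) : ℝ) / R - c1) ((x (i1 d) : ℝ) / R - c2)

lemma psi_nonneg (R r c1 c2 : ℝ) (x : Zd d) : 0 ≤ psi R r c1 c2 x := bf_nonneg _ _ _
lemma psi_le_one (R r c1 c2 : ℝ) (x : Zd d) : psi R r c1 c2 x ≤ 1 := bf_le_one _ _ _

lemma psi_lip {R r : ℝ} (hR : 0 < R) (hr : 0 < r) (c1 c2 : ℝ) (x z : Zd d) :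
    |psi R r c1 c2 x - psi R r c1 c2 z| ≤
      3 / (r * R) * (|(x (i0 d) : ℝ) - z (i0 d)| + |(x (i1 d) : ℝ) - z (i1 d)|) := by
  refine (bf_lip hr _ _ _ _).trans (le_of_eq ?_)
  rw [show (x (i0 d) : ℝ) / R - c1 - ((z (i0 d) : ℝ) / R - c1) = ((x (i0 d) : ℝ) - z (i0 d)) / R by ring,
    show (x (i1 d) : ℝ) / R - c2 - ((z (i1 d) : ℝ) / R - c2) = ((x (i1 d) : ℝ) - z (i1 d)) / R by ring,
    abs_div, abs_div, abs_of_pos hR]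
  field_simp

lemma psi_centre {R r : ℝ} (hr : 0 < r) (c1 c2 e1 e2 : ℝ) (x : Zd d) :
    |psi R r c1 c2 x - psi R r e1 e2 x| ≤ 3 / r * (|c1 - e1| + |c2 - e2|) := by
  refine (bf_lip hr _ _ _ _).trans (le_of_eq ?_)
  rw [show (x (i0 d) : ℝ) / R - c1 - ((x (i0 d) : ℝ) / R - e1) = -(c1 - e1) by ring,
    show (x (i1 d) : ℝ) / R - c2 - ((x (i1 d) : ℝ) / R - e2) = -(c2 - e2) by ring, abs_neg, abs_neg]

lemma psi_pos_bound {R r c1 c2 : ℝ} (hR : 0 < R) (hr : 0 < r) {x : Zd d} (h : psi R r c1 c2 x ≠ 0) :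
    |(x (i0 d) : ℝ) - c1 * R| ≤ r * R ∧ |(x (i1 d) : ℝ) - c2 * R| ≤ r * R := by
  set y1 := (x (i0 d) : ℝ) / R - c1 with hy1
  set y2 := (x (i1 d) : ℝ) / R - c2 with hy2
  have hh : 0 < 1 - (y1 ^ 2 + y2 ^ 2) / r ^ 2 := by
    by_contra hc
    apply h
    unfold psi bf
    exact max_eq_left (not_lt.1 hc)
  have hyr : y1 ^ 2 + y2 ^ 2 < r ^ 2 := by
    have : (y1 ^ 2 + y2 ^ 2) / r ^ 2 < 1 := by linarith
    rwa [div_lt_one (by positivity)] at this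
  have a1 : |y1| ≤ r := abs_le_of_sq_le_sq (by nlinarith [sq_nonneg y2]) hr.le
  have a2 : |y2| ≤ r := abs_le_of_sq_le_sq (by nlinarith [sq_nonneg y1]) hr.le
  have e1 : (x (i0 d) : ℝ) - c1 * R = y1 * R := by rw [hy1]; field_simp
  have e2 : (x (i1 d) : ℝ) - c2 * R = y2 * R := by rw [hy2]; field_simp
  rw [e1, e2, abs_mul, abs_mul, abs_of_pos hR]
  exact ⟨mul_le_mul_of_nonneg_right a1 hR.le, mul_le_mul_of_nonneg_right a2 hR.le⟩

lemma Ex_psi_diff {R r : ℝ} (hR : 0 < R) (hr : 0 < r) (c1 c2 : ℝ) (x : Zd d) (t : ℕ) :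
    Ex t (fun s => |psi R r c1 c2 (pos x s) - psi R r c1 c2 x|) ≤ 6 / (r * R) * Real.sqrt t := by
  have h0 := mom_coord_abs (i0 d) t
  have h1 := mom_coord_abs (i1 d) t
  calc _ ≤ Ex t (fun s => 3 / (r * R) * (|(pos (0 : Zd d) s (i0 d) : ℝ)| + |(pos (0 : Zd d) s (i1 d) : ℝ)|)) := by
        refine Ex_mono fun s _ => (psi_lip hR hr c1 c2 _ _).trans (le_of_eq ?_)
        rw [pos_eq x s]; simp
    _ = 3 / (r * R) * (Ex t (fun s => |(pos (0 : Zd d) s (i0 d) : ℝ)|) + Ex t (fun s => |(pos (0 : Zd d) s (i1 d) : ℝ)|)) := by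
        rw [Ex_mul_left, Ex_add_fun]
    _ ≤ 3 / (r * R) * (Real.sqrt t + Real.sqrt t) := by
        apply mul_le_mul_of_nonneg_left (by linarith) (by positivity)
    _ = _ := by ring

set_option maxHeartbeats 1000000 in
lemma bump (d : ℕ) [Fact (4 ≤ d)] {s s1 K : ℝ} (hs : 0 < s) (hs' : s ≤ 1) (hs1 : 0 < s1) (hK : 0 < K) :
    ∃ r sp : ℝ, 1 ≤ r ∧ 0 < sp ∧ ∀ R : ℝ, 0 < R → ∀ t : ℕ, 1 ≤ t → s1 * R ^ 2 ≤ t → t ≤ K * R ^ 2 →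
      ∀ c1 c2 : ℝ, ∀ x : Zd d, 0 < psi R r c1 c2 x →
        (1 - s) * psi R r c1 c2 x ≤ Ex t (fun w => psi R r c1 c2 (pos x w)) - sp := by
  have hd := dpos (d := d)
  have hd4 : (4 : ℝ) ≤ d := by exact_mod_cast (Fact.out : 4 ≤ d)
  set v := 2 * Real.sqrt (2 * (3 + (d : ℝ))) with hv
  have hv0 : 0 < v := by positivity
  set c := Real.sqrt (s1 / (2 * d)) / v with hc
  have hc0 : 0 < c := by positivity
  set r := 1 + c + 8 * K / (c * s) with hr
  have hr1 : 1 ≤ r := by rw [hr]; have : 0 ≤ 8 * K / (c * s) := by positivity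
                         linarith
  have hrc : c ≤ r := by rw [hr]; have : 0 ≤ 8 * K / (c * s) := by positivity
                         linarith
  have hrK : 8 * K / (c * s) ≤ r := by rw [hr]; linarith
  have hr0 : 0 < r := by linarith
  refine ⟨r, c * s / (8 * r), hr1, by positivity, ?_⟩
  intro R hR t ht1 htl htu c1 c2 x hx
  have hKr : K / r ^ 2 ≤ c * s / (8 * r) := by
    rw [div_le_iff₀ (by positivity)] at hrK
    rw [div_le_div_iff₀ (by positivity) (by positivity)]
    nlinarith
  have hsr : c * s / (8 * r) ≤ c / r / 8 := by
    rw [div_div, div_le_div_iff₀ (by positivity) (by positivity)]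
    nlinarith [mul_pos hc0 hr0]
  set y1 := (x (i0 d) : ℝ) / R - c1 with hy1
  set y2 := (x (i1 d) : ℝ) / R - c2 with hy2
  set q := 1 - (y1 ^ 2 + y2 ^ 2) / r ^ 2 with hq
  have hpq : psi R r c1 c2 x = q := by
    unfold psi bf at hx ⊢
    rcases max_choice 0 q with h2 | h2
    · rw [h2] at hx; exact absurd hx (lt_irrefl _)
    · exact h2
  rw [hpq] at hx ⊢
  -- linear functional
  set α : Fin d → ℝ := fun i => if i = i0 d then y1 / R else if i = i1 d then y2 / R else 0 with hα
  have hlf : ∀ z : Zd d, lf α z = (y1 * z (i0 d) + y2 * z (i1 d)) / R := by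
    intro z
    unfold lf
    rw [Finset.sum_eq_add (i0 d) (i1 d) i01]
    · simp [hα, i01.symm]; ring
    · intro j _ hj
      simp [hα, hj.1, hj.2]
    · simp
    · simp
  have ha2 : a2 α = (y1 ^ 2 + y2 ^ 2) / R ^ 2 := by
    unfold a2
    rw [Finset.sum_eq_add (i0 d) (i1 d) i01]
    · simp [hα, i01.symm]; ring
    · intro j _ hj
      simp [hα, hj.1, hj.2]
    · simp
    · simp
  have hE1 := mom1 α t 0
  rw [lf_zero] at hE1
  have hE0 := mom_coord2 (i0 d) t 0
  have hE2 := mom_coord2 (i1 d) t 0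
  have hEx : Ex t (fun w => ((pos (0 : Zd d) w (i0 d) : ℝ) ^ 2 + (pos (0 : Zd d) w (i1 d) : ℝ) ^ 2) * (1 / (R ^ 2 * r ^ 2))) ≤ K / r ^ 2 := by
    rw [Ex_mul_right, Ex_add_fun, hE0, hE2]
    simp only [Pi.zero_apply, Int.cast_zero]
    rw [mul_one_div, div_le_div_iff₀ (by positivity) (by positivity)]
    have : (t : ℝ) / d ≤ t / 4 := by gcongr
    have h3 : 0 < r ^ 2 := by positivity
    have ht0 : (0 : ℝ) ≤ t := by positivity
    have h4 : ((0 : ℝ) ^ 2 + t / d + (0 ^ 2 + t / d)) ≤ K * R ^ 2 := by linarith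
    nlinarith
  have hexp : ∀ w : List (Dir d), 1 - (((pos x w (i0 d) : ℝ) / R - c1) ^ 2 + ((pos x w (i1 d) : ℝ) / R - c2) ^ 2) / r ^ 2 =
      q - lf α (pos 0 w) * (2 / r ^ 2) -
        ((pos (0 : Zd d) w (i0 d) : ℝ) ^ 2 + (pos (0 : Zd d) w (i1 d) : ℝ) ^ 2) * (1 / (R ^ 2 * r ^ 2)) := by
    intro w
    rw [pos_eq x w, hlf, hq, hy1, hy2]
    simp only [Pi.add_apply, Int.cast_add]
    field_simp
    ring
  have hA : ∀ b : ℝ, Ex t (fun w => lf α (pos 0 w) * b) = Ex t (fun w => lf α (pos 0 w)) * b :=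
    fun b => Ex_mul_right ..
  have hB : ∀ b : ℝ, Ex t (fun w => |lf α (pos 0 w)| * b) = Ex t (fun w => |lf α (pos 0 w)|) * b :=
    fun b => Ex_mul_right ..
  rcases le_or_gt (c / (2 * r)) q with hcase | hcase
  · have : q - K / r ^ 2 ≤ Ex t (fun w => psi R r c1 c2 (pos x w)) := by
      calc _ ≤ Ex t (fun w => q - lf α (pos 0 w) * (2 / r ^ 2) -
        ((pos (0 : Zd d) w (i0 d) : ℝ) ^ 2 + (pos (0 : Zd d) w (i1 d) : ℝ) ^ 2) * (1 / (R ^ 2 * r ^ 2))) := by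
            rw [Ex_sub_fun, Ex_sub_fun, Ex_const, hA, hE1]
            linarith
        _ ≤ _ := Ex_mono fun w _ => by
            rw [← hexp]; exact le_max_right _ _
    have h2 : c / (2 * r) = 4 * (c / (8 * r)) := by field_simp; norm_num
    have h3 : c * s / (8 * r) = s * (c / (8 * r)) := by field_simp
    have h4 : s * (4 * (c / (8 * r))) ≤ s * q := mul_le_mul_of_nonneg_left (by linarith) hs.le
    have h5 : 0 < s * (c / (8 * r)) := by positivity
    linarith
  · have hq2 : q < 1 / 2 := by
      refine hcase.trans_le ?_
      rw [div_le_div_iff₀ (by positivity) (by norm_num)]; linarith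
    have hy : r ^ 2 / 2 ≤ y1 ^ 2 + y2 ^ 2 := by
      have : 1 / 2 ≤ (y1 ^ 2 + y2 ^ 2) / r ^ 2 := by rw [hq] at hq2; linarith
      rw [le_div_iff₀ (by positivity)] at this; linarith
    have hma := mom_abs α t ht1
    have hlow : c * r ≤ Ex t (fun w => |lf α (pos 0 w)|) := by
      refine le_trans ?_ hma
      rw [← hv, hc, div_mul_eq_mul_div]
      apply div_le_div_of_nonneg_right _ hv0.le
      rw [← Real.sqrt_sq hr0.le, ← Real.sqrt_mul (by positivity), ha2]
      apply Real.sqrt_le_sqrt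
      calc s1 / (2 * (d : ℝ)) * r ^ 2 = (s1 * R ^ 2) * ((r ^ 2 / 2) / R ^ 2 / d) := by field_simp
        _ ≤ t * ((y1 ^ 2 + y2 ^ 2) / R ^ 2 / d) := by gcongr
    have hfin : c / r - K / r ^ 2 ≤ Ex t (fun w => psi R r c1 c2 (pos x w)) := by
      calc c / r - K / r ^ 2 ≤ Ex t (fun w => |lf α (pos 0 w)| * (1 / r ^ 2) - lf α (pos 0 w) * (1 / r ^ 2) -
        ((pos (0 : Zd d) w (i0 d) : ℝ) ^ 2 + (pos (0 : Zd d) w (i1 d) : ℝ) ^ 2) * (1 / (R ^ 2 * r ^ 2))) := by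
            rw [Ex_sub_fun, Ex_sub_fun, hB, hA, hE1]
            have : c / r = c * r * (1 / r ^ 2) := by field_simp
            have h3 : c * r * (1 / r ^ 2) ≤ Ex t (fun w => |lf α (pos 0 w)|) * (1 / r ^ 2) :=
              mul_le_mul_of_nonneg_right hlow (by positivity)
            linarith
        _ ≤ _ := Ex_mono fun w _ => by
            have e := hexp w
            have e0 : 0 ≤ psi R r c1 c2 (pos x w) := psi_nonneg _ _ _ _ _
            have e1 : 1 - (((pos x w (i0 d) : ℝ) / R - c1) ^ 2 + ((pos x w (i1 d) : ℝ) / R - c2) ^ 2) / r ^ 2 ≤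
              psi R r c1 c2 (pos x w) := le_max_right _ _
            rw [e] at e1
            set l := lf α (pos 0 w)
            set ξ := ((pos (0 : Zd d) w (i0 d) : ℝ) ^ 2 + (pos (0 : Zd d) w (i1 d) : ℝ) ^ 2) * (1 / (R ^ 2 * r ^ 2))
            have hξ : 0 ≤ ξ := by positivity
            have e2 : l * (2 / r ^ 2) = 2 * (l * (1 / r ^ 2)) := by ring
            rw [e2] at e1
            rcases abs_cases l with ⟨h, _⟩ | ⟨h, _⟩ <;> rw [h] <;> linarith
    have h2 : c / (2 * r) = (c / r) / 2 := by field_simp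
    rw [h2] at hcase
    have h3 : (1 - s) * q ≤ q := by nlinarith
    have h4 : 0 < c / r := by positivity
    linarith

end

/-! ## F6: block estimates -/

section
variable {d : ℕ} [Fact (4 ≤ d)]

/-- range of the path -/
def trF (x : Zd d) (s : List (Dir d)) : Finset (Zd d) := (tr x s).toFinset

lemma mem_trF {x z : Zd d} {s : List (Dir d)} : z ∈ trF x s ↔ z ∈ tr x s := by simp [trF]

lemma trF_nil (x : Zd d) : trF x [] = {x} := by ext z; simp [mem_trF, tr]

lemma trF_append (x : Zd d) (s t : List (Dir d)) : trF x (s ++ t) = trF x s ∪ trF (pos x s) t := by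
  ext z
  simp only [Finset.mem_union, mem_trF]
  have h := pos_mem_tr x s
  simp only [tr, trT_append, List.mem_cons, List.mem_append] at h ⊢
  constructor
  · rintro (h1 | h1 | h1) <;> simp [h1]
  · rintro ((h1 | h1) | (h1 | h1))
    · simp [h1]
    · simp [h1]
    · rw [h1]; rcases h with h | h <;> simp [h]
    · simp [h1]

lemma trF_shift (x y : Zd d) (s) : trF (x + y) s = (trF y s).image (fun z => x + z) := by
  ext z
  simp only [Finset.mem_image, mem_trF, tr_shift, List.mem_map]

lemma trF_shift0 (x : Zd d) (s) : trF x s = (trF 0 s).image (fun z => x + z) := by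
  conv_lhs => rw [← add_zero x]
  exact trF_shift x 0 s

lemma trF_card (x : Zd d) (s) : (trF x s).card ≤ s.length + 1 := by
  have := List.toFinset_card_le (tr x s)
  simpa [trF] using this

lemma tr_box (x : Zd d) (s : List (Dir d)) (z : Zd d) (hz : z ∈ tr x s) (i : Fin d) :
    |(z i : ℝ) - x i| ≤ s.length := by
  induction s generalizing x with
  | nil => simp [tr] at hz; simp [hz]
  | cons e s ih =>
    simp only [tr, trT_cons, List.mem_cons] at hz
    rcases hz with h | h
    · subst h; simp; positivity
    · have h1 := ih (x + dv e) (by simpa [tr] using h)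
      have h2 : |((x + dv e) i : ℝ) - x i| ≤ 1 := by
        simp only [Pi.add_apply, dv, Int.cast_add, add_sub_cancel_left]
        by_cases hi : i = e.1
        · subst hi; simp; split_ifs <;> norm_num
        · simp [hi]
      simp only [List.length_cons]
      push_cast
      calc |(z i : ℝ) - x i| = |((z i : ℝ) - (x + dv e) i) + (((x + dv e) i : ℝ) - x i)| := by ring_nf
        _ ≤ _ := abs_add_le _ _
        _ ≤ _ := by linarith

lemma Ex_swap (a b : ℕ) (F : List (Dir d) → List (Dir d) → ℝ) :
    Ex a (fun s => Ex b (fun t => F s t)) = Ex b (fun t => Ex a (fun s => F s t)) := by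
  unfold Ex
  simp only [Finset.sum_div]
  rw [Finset.sum_comm]
  refine Finset.sum_congr rfl fun s _ => Finset.sum_congr rfl fun t _ => ?_
  rw [div_div, div_div, mul_comm]

/-- weighted truncated capacity -/
def tcf (τ : ℕ) (f : Zd d → ℝ) (A : Finset (Zd d)) : ℝ := ∑ x ∈ A, esc A τ x * f x

lemma tcf_union (τ : ℕ) (f : Zd d → ℝ) (hf : ∀ x, 0 ≤ f x) (A B : Finset (Zd d)) :
    tcf τ f (A ∪ B) ≤ tcf τ f A + tcf τ f B := tc_union_le τ f hf A B

lemma tcf_nonneg (τ : ℕ) (f : Zd d → ℝ) (hf : ∀ x, 0 ≤ f x) (A : Finset (Zd d)) : 0 ≤ tcf τ f A :=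
  Finset.sum_nonneg fun x _ => mul_nonneg (esc_nonneg _ _ _) (hf x)

lemma tcf_one (τ : ℕ) (A : Finset (Zd d)) : tcf τ (fun _ => 1) A = tc τ A := by simp [tcf, tc]

lemma tc_union (τ : ℕ) (A B : Finset (Zd d)) : tc τ (A ∪ B) ≤ tc τ A + tc τ B := by
  simpa [tcf_one] using tcf_union τ (fun _ => 1) (fun _ => zero_le_one) A B

lemma wt_le_tcf (τ : ℕ) (f : Zd d → ℝ) (hf : ∀ x, 0 ≤ f x) (A : Finset (Zd d)) : wt f A ≤ tcf τ f A :=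
  Finset.sum_le_sum fun x _ => mul_le_mul_of_nonneg_right (eqm_le_esc _ _ _) (hf x)

lemma wt_union_le (f : Zd d → ℝ) (hf : ∀ x, 0 ≤ f x) (A B : Finset (Zd d)) :
    wt f (A ∪ B) ≤ wt f A + wt f B := by
  unfold wt
  have h := Finset.sum_union_inter (s₁ := A) (s₂ := B) (f := fun x => eqm (A ∪ B) x * f x)
  have h0 : 0 ≤ ∑ x ∈ A ∩ B, eqm (A ∪ B) x * f x :=
    Finset.sum_nonneg fun x _ => mul_nonneg (eqm_nonneg _ _) (hf x)
  have h1 : ∑ x ∈ A, eqm (A ∪ B) x * f x ≤ ∑ x ∈ A, eqm A x * f x :=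
    Finset.sum_le_sum fun x _ => mul_le_mul_of_nonneg_right (eqm_mono_set Finset.subset_union_left _) (hf x)
  have h2 : ∑ x ∈ B, eqm (A ∪ B) x * f x ≤ ∑ x ∈ B, eqm B x * f x :=
    Finset.sum_le_sum fun x _ => mul_le_mul_of_nonneg_right (eqm_mono_set Finset.subset_union_right _) (hf x)
  linarith

lemma wt_nonneg (f : Zd d → ℝ) (hf : ∀ x, 0 ≤ f x) (A : Finset (Zd d)) : 0 ≤ wt f A :=
  Finset.sum_nonneg fun x _ => mul_nonneg (eqm_nonneg _ _) (hf x)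

lemma wt_le_cp (f : Zd d → ℝ) (hf : ∀ x, f x ≤ 1) (A : Finset (Zd d)) : wt f A ≤ cp A :=
  Finset.sum_le_sum fun x _ => mul_le_of_le_one_right (eqm_nonneg _ _) (hf x)

/-- expected truncated capacity of a block -/
def etc (d : ℕ) [Fact (4 ≤ d)] (τ b : ℕ) : ℝ := Ex b (fun s => tc τ (trF (0 : Zd d) s))

lemma etc_nonneg (τ b : ℕ) : 0 ≤ etc d τ b := Ex_nonneg fun s _ => tc_nonneg _ _

lemma tc_trF (τ : ℕ) (x : Zd d) (s) : tc τ (trF x s) = tc τ (trF 0 s) := by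
  rw [trF_shift0 x s, tc_shift]

lemma cp_trF (x : Zd d) (s) : cp (trF x s) = cp (trF 0 s) := by
  rw [trF_shift0 x s, cp_shift]

lemma Ex_tc_trF (τ b : ℕ) (x : Zd d) : Ex b (fun s => tc τ (trF x s)) = etc d τ b := by
  unfold etc; exact Ex_congr fun s _ => tc_trF τ x s

lemma block1 (τ b m : ℕ) (f : Zd d → ℝ) (x : Zd d) (G : ℝ)
    (hG : ∀ w : Zd d, (∀ i, |(w i : ℝ)| ≤ b) → Ex m (fun s => f (pos (x + w) s)) ≤ G) :
    Ex m (fun s => Ex b (fun t => tcf τ f (trF (pos x s) t))) ≤ etc d τ b * G := by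
  rw [Ex_swap]
  unfold etc
  rw [← Ex_mul_right]
  refine Ex_mono fun t ht => ?_
  have e : ∀ s, tcf τ f (trF (pos x s) t) = ∑ w ∈ trF 0 t, esc (trF 0 t) τ w * f (pos x s + w) := by
    intro s
    unfold tcf
    rw [trF_shift0 (pos x s) t, sum_shift]
    simp only [esc_shift]
  simp only [e]
  rw [Ex_sum]
  unfold tc
  rw [Finset.sum_mul]
  refine Finset.sum_le_sum fun w hw => ?_
  rw [Ex_mul_left]
  refine mul_le_mul_of_nonneg_left ?_ (esc_nonneg _ _ _)
  refine le_trans (le_of_eq ?_) (hG w fun i => ?_)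
  · refine Ex_congr fun s _ => ?_
    rw [add_comm x w, pos_shift, add_comm]
  · have := tr_box 0 t w (mem_trF.1 hw) i
    simpa [ht] using this

lemma BL (τ b : ℕ) (f : Zd d → ℝ) (hf : ∀ x, 0 ≤ f x) (x : Zd d) (G : ℝ) (N m : ℕ)
    (hG : ∀ t, m ≤ t → t ≤ m + N * b → ∀ w : Zd d, (∀ i, |(w i : ℝ)| ≤ b) → Ex t (fun s => f (pos (x + w) s)) ≤ G) :
    Ex m (fun s => Ex (N * b) (fun t => tcf τ f (trF (pos x s) t))) ≤ (N * etc d τ b + 1) * G := by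
  induction N generalizing m with
  | zero =>
    simp only [zero_mul, Ex_zero, trF_nil, Nat.cast_zero, zero_add, one_mul]
    refine le_trans (Ex_mono (F' := fun s => f (pos (x + 0) s)) fun s _ => ?_) (hG m le_rfl (by simp) 0 (by simp))
    simp only [tcf, Finset.sum_singleton, add_zero]
    exact mul_le_of_le_one_left (hf _) (esc_le_one _ _ _)
  | succ N ih =>
    have h1 := block1 τ b m f x G (hG m le_rfl (by simp))
    have h2 := ih (m + b) (fun t ht ht' => hG t (by omega) (by rw [Nat.succ_mul]; omega))
    rw [show (N + 1) * b = b + N * b by ring]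
    calc _ ≤ Ex m (fun s => Ex b (fun t => tcf τ f (trF (pos x s) t)) +
              Ex b (fun t => Ex (N * b) (fun t' => tcf τ f (trF (pos x (s ++ t)) t')))) := by
          refine Ex_mono fun s _ => ?_
          rw [Ex_append, ← Ex_add_fun]
          refine Ex_mono fun t _ => ?_
          calc _ ≤ Ex (N * b) (fun t' => tcf τ f (trF (pos x s) t) + tcf τ f (trF (pos x (s ++ t)) t')) := by
                refine Ex_mono fun t' _ => ?_
                rw [trF_append, pos_append]
                exact tcf_union τ f hf _ _
            _ = _ := by rw [Ex_add_fun, Ex_const]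
      _ = Ex m (fun s => Ex b (fun t => tcf τ f (trF (pos x s) t))) +
          Ex (m + b) (fun s => Ex (N * b) (fun t' => tcf τ f (trF (pos x s) t'))) := by
          rw [Ex_add_fun, Ex_append]
      _ ≤ _ := by push_cast; linarith

lemma tc_mom1 (τ b N : ℕ) (x : Zd d) : Ex (N * b) (fun t => tc τ (trF x t)) ≤ N * etc d τ b + 1 := by
  have := BL τ b (fun _ => 1) (fun _ => zero_le_one) x 1 N 0 (fun t _ _ w _ => by simp)
  simpa [tcf_one] using this

lemma tc_mom2 (τ b N : ℕ) (x : Zd d) :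
    Ex (N * b) (fun t => tc τ (trF x t) ^ 2) ≤ (N * etc d τ b + 1) ^ 2 + N * ((b + 1) * etc d τ b) := by
  induction N generalizing x with
  | zero =>
    simp only [zero_mul, Ex_zero, trF_nil, Nat.cast_zero, zero_add, one_pow, add_zero]
    have h1 := tc_le_card τ ({x} : Finset (Zd d))
    have h0 := tc_nonneg τ ({x} : Finset (Zd d))
    simp at h1
    nlinarith
  | succ N ih =>
    rw [show (N + 1) * b = b + N * b by ring, Ex_append]
    set E := etc d τ b with hE
    have hE0 : 0 ≤ E := etc_nonneg _ _
    have key : ∀ s : List (Dir d), s.length = b →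
        Ex (N * b) (fun t => tc τ (trF x (s ++ t)) ^ 2) ≤
         tc τ (trF x s) * (b + 1) + 2 * (tc τ (trF x s) * (N * E + 1)) + ((N * E + 1) ^ 2 + N * ((b + 1) * E)) := by
      intro s hs
      set a := tc τ (trF x s)
      have ha0 : 0 ≤ a := tc_nonneg _ _
      have ha1 : a ≤ b + 1 := by
        refine (tc_le_card _ _).trans ?_
        have := trF_card x s
        rw [hs] at this
        exact_mod_cast this
      calc _ ≤ Ex (N * b) (fun t => a ^ 2 + 2 * a * tc τ (trF (pos x s) t) + tc τ (trF (pos x s) t) ^ 2) := by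
            refine Ex_mono fun t _ => ?_
            rw [trF_append]
            have h1 := tc_union τ (trF x s) (trF (pos x s) t)
            have h2 := tc_nonneg τ (trF x s ∪ trF (pos x s) t)
            have := pow_le_pow_left₀ h2 h1 2
            nlinarith
        _ = a ^ 2 + 2 * a * Ex (N * b) (fun t => tc τ (trF (pos x s) t)) + Ex (N * b) (fun t => tc τ (trF (pos x s) t) ^ 2) := by
            rw [Ex_add_fun, Ex_add_fun, Ex_mul_left, Ex_const]
        _ ≤ _ := by
            have h1 := mul_le_mul_of_nonneg_left (tc_mom1 τ b N (pos x s)) (by positivity : 0 ≤ 2 * a)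
            have h2 := ih (pos x s)
            nlinarith
    refine (Ex_mono key).trans ?_
    rw [Ex_add_fun, Ex_add_fun, Ex_mul_left, Ex_mul_right, Ex_mul_right, Ex_tc_trF, Ex_const, ← hE]
    push_cast
    nlinarith [mul_nonneg hE0 hE0]

lemma wt_block (β : ℕ) (f : Zd d → ℝ) (hf : ∀ x, 0 ≤ f x) (hf1 : ∀ x, f x ≤ 1) (x : Zd d) (N m : ℕ) :
    Ex m (fun s => Ex (N * β) (fun t => wt f (trF (pos x s) t))) ≤
      ∑ i ∈ Finset.range N, Ex (m + i * β) (fun s => Ex β (fun t => wt f (trF (pos x s) t))) + 1 := by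
  induction N generalizing m with
  | zero =>
    simp only [zero_mul, Ex_zero, trF_nil, Finset.range_zero, Finset.sum_empty, zero_add]
    refine Ex_le_const fun s _ => ?_
    simp only [wt, Finset.sum_singleton]
    exact mul_le_one₀ (eqm_le_one _ _) (hf _) (hf1 _)
  | succ N ih =>
    have h2 := ih (m + β)
    rw [show (N + 1) * β = β + N * β by ring, Finset.sum_range_succ']
    calc _ ≤ Ex m (fun s => Ex β (fun t => wt f (trF (pos x s) t)) +
              Ex β (fun t => Ex (N * β) (fun t' => wt f (trF (pos x (s ++ t)) t')))) := by
          refine Ex_mono fun s _ => ?_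
          rw [Ex_append, ← Ex_add_fun]
          refine Ex_mono fun t _ => ?_
          calc _ ≤ Ex (N * β) (fun t' => wt f (trF (pos x s) t) + wt f (trF (pos x (s ++ t)) t')) := by
                refine Ex_mono fun t' _ => ?_
                rw [trF_append, pos_append]
                exact wt_union_le f hf _ _
            _ = _ := by rw [Ex_add_fun, Ex_const]
      _ = Ex m (fun s => Ex β (fun t => wt f (trF (pos x s) t))) +
          Ex (m + β) (fun s => Ex (N * β) (fun t' => wt f (trF (pos x s) t'))) := by
          rw [Ex_add_fun, Ex_append]
      _ ≤ _ := by
          have : ∀ i, m + (i + 1) * β = m + β + i * β := fun i => by ring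
          simp only [this, zero_mul, add_zero]
          linarith

lemma Ex_cp_trF (T : ℕ) (x : Zd d) : Ex T (fun s => cp (trF x s)) = ecap d T := ecap_shift T x

lemma ecap_nonneg (T : ℕ) : 0 ≤ ecap d T := Ex_nonneg fun s _ => cp_nonneg _

lemma psi_block (τ b Nb : ℕ) {R r : ℝ} (hR : 0 < R) (hr : 0 < r) (c1 c2 : ℝ) (z : Zd d) :
    Ex (Nb * b) (fun t => wt (fun x => 1 - psi R r c1 c2 x) (trF z t)) ≤
      ecap d (Nb * b) * (1 - psi R r c1 c2 z) +
        (Nb * etc d τ b + 1) * (6 / (r * R) * (b + Real.sqrt ((Nb * b : ℕ) : ℝ))) := by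
  set f : Zd d → ℝ := fun x => |psi R r c1 c2 x - psi R r c1 c2 z| with hf
  have hb := BL τ b f (fun _ => abs_nonneg _) z (6 / (r * R) * (b + Real.sqrt ((Nb * b : ℕ) : ℝ))) Nb 0 ?_
  · simp only [Ex_zero, pos_nil] at hb
    rw [← Ex_cp_trF (Nb * b) z, ← Ex_mul_right]
    refine le_trans ?_ (add_le_add_right hb _)
    rw [← Ex_add_fun]
    refine Ex_mono fun t _ => ?_
    refine le_trans ?_ (add_le_add_right (wt_le_tcf τ f (fun _ => abs_nonneg _) _) _)
    unfold wt cp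
    rw [Finset.sum_mul, ← Finset.sum_add_distrib]
    refine Finset.sum_le_sum fun x _ => ?_
    rw [← mul_add]
    refine mul_le_mul_of_nonneg_left ?_ (eqm_nonneg _ _)
    have := neg_abs_le (psi R r c1 c2 x - psi R r c1 c2 z)
    simp only [hf]; linarith
  · intro t _ ht w hw
    have h1 := Ex_psi_diff hR hr c1 c2 (z + w) t
    have h2 := psi_lip hR hr c1 c2 (z + w) z
    simp only [Pi.add_apply, Int.cast_add, add_sub_cancel_left] at h2
    have h3 : Real.sqrt t ≤ Real.sqrt ((Nb * b : ℕ) : ℝ) := Real.sqrt_le_sqrt (by exact_mod_cast (by omega))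
    calc _ ≤ Ex t (fun s => |psi R r c1 c2 (pos (z + w) s) - psi R r c1 c2 (z + w)| +
            |psi R r c1 c2 (z + w) - psi R r c1 c2 z|) := Ex_mono fun s _ => abs_sub_le _ _ _
      _ ≤ 6 / (r * R) * Real.sqrt t + 3 / (r * R) * (b + b) := by
          rw [Ex_add_fun, Ex_const]
          refine add_le_add h1 (h2.trans ?_)
          exact mul_le_mul_of_nonneg_left (add_le_add (hw _) (hw _)) (by positivity)
      _ ≤ _ := by
          have : 6 / (r * R) * Real.sqrt t ≤ 6 / (r * R) * Real.sqrt ((Nb * b : ℕ) : ℝ) :=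
            mul_le_mul_of_nonneg_left h3 (by positivity)
          have e : 3 / (r * R) * ((b : ℝ) + b) = 6 / (r * R) * b := by ring
          rw [e, mul_add]; linarith

/-- core lower bound -/
lemma core1 (τ b Nb N m : ℕ) {R r : ℝ} (hR : 0 < R) (hr : 0 < r) (c1 c2 : ℝ) (x : Zd d) :
    ecap d (N * (Nb * b)) - N * ecap d (Nb * b) +
      ecap d (Nb * b) * ∑ i ∈ Finset.range N, Ex (m + i * (Nb * b)) (fun s => psi R r c1 c2 (pos x s)) -
      N * ((Nb * etc d τ b + 1) * (6 / (r * R) * (b + Real.sqrt ((Nb * b : ℕ) : ℝ)))) - 1 ≤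
    Ex m (fun s => Ex (N * (Nb * b)) (fun t => wt (psi R r c1 c2) (trF (pos x s) t))) := by
  set β := Nb * b with hβ
  set err := (Nb * etc d τ b + 1) * (6 / (r * R) * (b + Real.sqrt (β : ℝ))) with herr
  have h1 := wt_block β (fun x => 1 - psi R r c1 c2 x) (fun x => by have := psi_le_one R r c1 c2 x; linarith)
    (fun x => by have := psi_nonneg R r c1 c2 x; linarith) x N m
  have h2 : Ex m (fun s => Ex (N * β) (fun t => wt (psi R r c1 c2) (trF (pos x s) t))) =
      ecap d (N * β) - Ex m (fun s => Ex (N * β) (fun t => wt (fun x => 1 - psi R r c1 c2 x) (trF (pos x s) t))) := by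
    have : ∀ A : Finset (Zd d), wt (psi R r c1 c2) A = cp A - wt (fun x => 1 - psi R r c1 c2 x) A := by
      intro A
      unfold wt cp
      rw [← Finset.sum_sub_distrib]
      exact Finset.sum_congr rfl fun _ _ => by ring
    simp only [this]
    simp only [Ex_sub_fun, Ex_cp_trF, Ex_const]
  rw [h2]
  have h3 : ∀ i ∈ Finset.range N, Ex (m + i * β) (fun s => Ex β (fun t => wt (fun x => 1 - psi R r c1 c2 x) (trF (pos x s) t)))
      ≤ ecap d β - ecap d β * Ex (m + i * β) (fun s => psi R r c1 c2 (pos x s)) + err := by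
    intro i _
    refine (Ex_mono fun s _ => psi_block τ b Nb hR hr c1 c2 (pos x s)).trans (le_of_eq ?_)
    rw [Ex_add_fun, Ex_mul_left, Ex_sub_fun, Ex_const, Ex_const]
    ring
  have h4 := Finset.sum_le_sum h3
  rw [Finset.sum_add_distrib, Finset.sum_sub_distrib, ← Finset.mul_sum] at h4
  simp only [Finset.sum_const, Finset.card_range, nsmul_eq_mul] at h4
  linarith

/-- child of a path -/
def ch (g β : ℕ) (l : List (Zd d)) : Finset (Zd d) :=
  ((l.drop g).take ((l.length - 1 - g) / β * β + 1)).toFinset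

lemma ch_subset (g β : ℕ) (l : List (Zd d)) : ∀ z ∈ ch g β l, z ∈ l := by
  intro z hz
  simp only [ch, List.mem_toFinset] at hz
  exact List.mem_of_mem_drop (List.mem_of_mem_take hz)

lemma ch_card (g β : ℕ) (l : List (Zd d)) : (ch g β l).card ≤ l.length := by
  refine (List.toFinset_card_le _).trans ?_
  simp

lemma ch_tr (g β : ℕ) (x : Zd d) (s t : List (Dir d)) (hs : s.length = g) :
    ch g β (tr x (s ++ t)) = trF (pos x s) (t.take (t.length / β * β)) := by
  unfold ch trF
  rw [tr_drop x _ g (by simp [hs]), tr_take]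
  simp [← hs]

lemma ch_tr2 (g1 g β : ℕ) (x : Zd d) (s t : List (Dir d)) (hs : s.length = g1) (hg : g1 ≤ g) :
    ch g β (tr x (s ++ t)) = ch (g - g1) β (tr (pos x s) t) := by
  unfold ch
  have h : (tr x (s ++ t)).drop g = (tr (pos x s) t).drop (g - g1) := by
    have e := tr_drop x (s ++ t) g1 (by simp [hs])
    rw [← hs] at e
    simp only [List.take_left, List.drop_left] at e
    rw [← e, List.drop_drop, hs]
    congr 1; omega
  rw [h]
  congr 3
  simp only [tr_length, List.length_append, hs]
  congr 2
  omega

lemma Ex_ch (g β l : ℕ) (hl : g ≤ l) (x : Zd d) (Φ : Finset (Zd d) → ℝ) :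
    Ex l (fun s => Φ (ch g β (tr x s))) =
      Ex g (fun s => Ex ((l - g) / β * β) (fun t => Φ (trF (pos x s) t))) := by
  obtain ⟨k, rfl⟩ := Nat.exists_eq_add_of_le hl
  rw [Ex_append, Nat.add_sub_cancel_left]
  refine Ex_congr fun s hs => ?_
  have hk : k / β * β + (k - k / β * β) = k := by have := Nat.div_mul_le_self k β; omega
  have h2 := Ex_take (k / β * β) (k - k / β * β) (fun t => Φ (trF (pos x s) t))
  rw [hk] at h2
  rw [← h2]
  refine Ex_congr fun t ht => ?_
  rw [ch_tr g β x s t hs, ht]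

end

section
variable {d : ℕ} [Fact (4 ≤ d)]

/-! ## F7: decomposition of trajectories at the first visit of a set -/

/-- part of the trajectory after the first visit to `A` -/
def dW (A : Finset (Zd d)) (η : Traj d) : Traj d := η.dropWhile (fun z => decide (z ∉ A))

/-- two-sided trajectory -/
def Th (x : Zd d) (p s : List (Dir d)) : Traj d := (trT x p).reverse ++ tr x s

/-- index set -/
def idx (A : Finset (Zd d)) (L : ℕ) : Finset ((_ : Zd d × ℕ) × (List (Dir d) × List (Dir d))) :=
  (A ×ˢ Finset.range (L + 1)).sigma
    (fun q => ((Lst d q.2).filter (av A q.1)) ×ˢ Lst d (L - q.2))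

/-- trajectories of length `L` hitting `A` -/
def HP (A : Finset (Zd d)) (L : ℕ) : Finset (Traj d) :=
  (idx A L).image (fun i => Th i.1.1 i.2.1 i.2.2)

lemma dW_Th {A : Finset (Zd d)} {x : Zd d} (hx : x ∈ A) {p : List (Dir d)} (hp : av A x p)
    (s : List (Dir d)) : dW A (Th x p s) = tr x s := by
  unfold dW Th
  rw [List.dropWhile_append_of_pos]
  · simp [tr, hx]
  · intro z hz
    simpa using hp z (by simpa using hz)

lemma Th_length (x : Zd d) (p s : List (Dir d)) : (Th x p s).length = p.length + s.length + 1 := by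
  simp [Th, trT_length, tr_length]; ring

lemma Th_valid (x : Zd d) (p s : List (Dir d)) : ValidTraj (Th x p s) := by
  refine ⟨by simp [Th, tr], ?_⟩
  have h1 := tr_chain x p
  have h2 := tr_chain x s
  have h3 : ((trT x p).reverse ++ [x]).IsChain IsNN := by
    have : (tr x p).reverse.IsChain IsNN := by
      rw [List.isChain_reverse]
      exact h1.imp fun a b h => isNN_symm h
    simpa [tr] using this
  have := h3.append_overlap (l₃ := trT x s) (by simpa [tr] using h2) (by simp)
  show List.IsChain IsNN _
  simpa [Th, tr] using this

lemma mem_HP {A : Finset (Zd d)} {L : ℕ} {η : Traj d} :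
    η ∈ HP A L ↔ ValidTraj η ∧ len η = L ∧ hits η (A : Set (Zd d)) := by
  constructor
  · intro h
    simp only [HP, idx, Finset.mem_image, Finset.mem_sigma, Finset.mem_product, Finset.mem_filter,
      mem_Lst, Finset.mem_range] at h
    obtain ⟨⟨⟨x, m⟩, ⟨p, s⟩⟩, ⟨⟨hx, hm⟩, ⟨hp, hav⟩, hs⟩, rfl⟩ := h
    simp only at *
    refine ⟨Th_valid x p s, ?_, x, ?_, by simpa using hx⟩
    · simp only [len, Th_length]; omega
    · simp [Th, tr]
  · rintro ⟨⟨hne, hch⟩, hl, y, hy, hyA⟩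
    have e : η.takeWhile (fun z => decide (z ∉ A)) ++ dW A η = η := List.takeWhile_append_dropWhile
    have hne' : dW A η ≠ [] := by
      intro h0
      rw [dW, List.dropWhile_eq_nil_iff] at h0
      have h5 := h0 y hy
      simp at h5
      exact h5 hyA
    obtain ⟨x, l, hxl⟩ := List.exists_cons_of_ne_nil hne'
    have hxA : x ∈ A := by
      have := List.head_dropWhile_not (fun z => decide (z ∉ A)) (l := η) (by simpa [dW] using hne')
      have h2 : (List.dropWhile (fun z => decide (z ∉ A)) η).head (by simpa [dW] using hne') = x := by
        have : List.dropWhile (fun z => decide (z ∉ A)) η = x :: l := hxl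
        simp only [this, List.head_cons]
      rw [h2] at this
      simpa using this
    set k := η.takeWhile (fun z => decide (z ∉ A)) with hk
    have hkA : ∀ z ∈ k, z ∉ A := by
      intro z hz
      have := List.mem_takeWhile_imp hz
      simpa using this
    rw [hxl] at e
    have hc : (k ++ x :: l).IsChain IsNN := by rw [e]; exact hch
    have hc1 : (x :: l).IsChain IsNN := hc.right_of_append
    have hc2 : (x :: k.reverse).IsChain IsNN := by
      have h1 : (k ++ [x]).IsChain IsNN := by
        have : (k ++ [x] ++ l).IsChain IsNN := by simpa using hc
        exact this.left_of_append
      have h2 : (k ++ [x]).reverse.IsChain IsNN := by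
        rw [List.isChain_reverse]
        exact h1.imp fun a b h => isNN_symm h
      simpa using h2
    obtain ⟨s, hs⟩ := exists_tr_of_chain x l hc1
    obtain ⟨p, hp⟩ := exists_tr_of_chain x _ hc2
    have hη : Th x p s = η := by
      rw [← e]
      simp [Th, tr, ← hs, ← hp]
    simp only [HP, idx, Finset.mem_image, Finset.mem_sigma, Finset.mem_product, Finset.mem_filter,
      mem_Lst, Finset.mem_range]
    have hlen := Th_length x p s
    rw [hη] at hlen
    simp only [len] at hl
    refine ⟨⟨(x, p.length), (p, s)⟩, ⟨⟨hxA, ?_⟩, ⟨rfl, ?_⟩, ?_⟩, hη⟩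
    · show p.length < L + 1
      omega
    · intro z hz
      rw [← hp] at hz
      exact hkA z (by simpa using hz)
    · show s.length = L - p.length
      omega

lemma sum_HP (A : Finset (Zd d)) (L : ℕ) (f : Traj d → ℝ) :
    ∑ η ∈ HP A L, f η * (1 / (2 * (d : ℝ))) ^ L =
      ∑ x ∈ A, ∑ m ∈ Finset.range (L + 1), Ex m (fun p => if av A x p then
        Ex (L - m) (fun s => f (Th x p s)) else 0) := by
  unfold HP
  rw [Finset.sum_image]
  · unfold idx
    rw [Finset.sum_sigma, Finset.sum_product]
    refine Finset.sum_congr rfl fun x hx => Finset.sum_congr rfl fun m hm => ?_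
    simp only
    rw [Finset.sum_product, Finset.sum_filter, Ex, Finset.sum_div]
    refine Finset.sum_congr rfl fun p hp => ?_
    split_ifs
    · rw [Ex, ← Finset.sum_mul]
      have : L = m + (L - m) := by rw [Finset.mem_range] at hm; omega
      have hd := twod_pos (d := d)
      have h1 : (1 / (2 * (d : ℝ))) ^ L = (1 / (2 * (d : ℝ))) ^ (L - m) * (1 / (2 * (d : ℝ))) ^ m := by
        rw [← pow_add]; congr 1; omega
      rw [h1]
      simp only [one_div, inv_pow]
      rw [div_eq_mul_inv, div_eq_mul_inv, mul_assoc]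
    · simp
  · rintro ⟨⟨x, m⟩, ⟨p, s⟩⟩ h1 ⟨⟨x', m'⟩, ⟨p', s'⟩⟩ h2 heq
    simp only [idx, Finset.coe_sigma, Set.mem_sigma_iff, Finset.mem_coe, Finset.mem_product, Finset.mem_filter,
      mem_Lst, Finset.mem_range] at h1 h2
    obtain ⟨⟨hx, hm⟩, ⟨hp, hav⟩, hs⟩ := h1
    obtain ⟨⟨hx', hm'⟩, ⟨hp', hav'⟩, hs'⟩ := h2
    simp only at *
    have e1 := dW_Th hx hav s
    have e2 := dW_Th hx' hav' s'
    rw [heq, e2] at e1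
    simp only [tr, List.cons.injEq] at e1
    obtain ⟨rfl, e1⟩ := e1
    obtain rfl := trT_inj _ e1
    simp only [Th, List.append_cancel_right_eq, List.reverse_inj] at heq
    obtain rfl := trT_inj _ heq
    subst hp; subst hp'
    rfl

/-- intensity -/
def lam (κ : ℕ → ℝ) (η : Traj d) : ℝ := κ (len η) * (1 / (2 * (d : ℝ))) ^ (len η)

lemma lam_nonneg {κ : ℕ → ℝ} (hκ : ∀ L, 0 ≤ κ L) (η : Traj d) : 0 ≤ lam κ η :=
  mul_nonneg (hκ _) (by positivity)

/-- trajectories with length in `I` hitting `A` -/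
def HPs (I : Finset ℕ) (A : Finset (Zd d)) : Finset (Traj d) := I.biUnion (HP A)

lemma mem_HPs {I : Finset ℕ} {A : Finset (Zd d)} {η : Traj d} :
    η ∈ HPs I A ↔ ValidTraj η ∧ len η ∈ I ∧ hits η (A : Set (Zd d)) := by
  simp only [HPs, Finset.mem_biUnion, mem_HP]
  constructor
  · rintro ⟨L, hL, h1, rfl, h3⟩
    exact ⟨h1, hL, h3⟩
  · rintro ⟨h1, h2, h3⟩
    exact ⟨_, h2, h1, rfl, h3⟩

/-- integrals against the intensity restricted to hitters of `A` -/
def Lam (κ : ℕ → ℝ) (I : Finset ℕ) (A : Finset (Zd d)) (f : Traj d → ℝ) : ℝ :=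
  ∑ η ∈ HPs I A, lam κ η * f η

lemma Lam_eq (κ : ℕ → ℝ) (I : Finset ℕ) (A : Finset (Zd d)) (f : Traj d → ℝ) :
    Lam κ I A f = ∑ L ∈ I, κ L * ∑ x ∈ A, ∑ m ∈ Finset.range (L + 1),
      Ex m (fun p => if av A x p then Ex (L - m) (fun s => f (Th x p s)) else 0) := by
  unfold Lam HPs
  rw [Finset.sum_biUnion]
  · refine Finset.sum_congr rfl fun L hL => ?_
    rw [← sum_HP, Finset.mul_sum]
    refine Finset.sum_congr rfl fun η hη => ?_
    have := (mem_HP.1 hη).2.1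
    simp only [lam, this]
    ring
  · intro a _ b _ hab
    rw [Function.onFun, Finset.disjoint_left]
    intro η h1 h2
    exact hab ((mem_HP.1 h1).2.1.symm.trans (mem_HP.1 h2).2.1)

lemma Lam_mono {κ : ℕ → ℝ} (hκ : ∀ L, 0 ≤ κ L) (I : Finset ℕ) (A : Finset (Zd d)) {f g : Traj d → ℝ}
    (h : ∀ η ∈ HPs I A, f η ≤ g η) : Lam κ I A f ≤ Lam κ I A g :=
  Finset.sum_le_sum fun η hη => mul_le_mul_of_nonneg_left (h η hη) (lam_nonneg hκ η)

lemma Lam_add (κ : ℕ → ℝ) (I : Finset ℕ) (A : Finset (Zd d)) (f g : Traj d → ℝ) :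
    Lam κ I A (fun η => f η + g η) = Lam κ I A f + Lam κ I A g := by
  simp only [Lam, mul_add, Finset.sum_add_distrib]

lemma Lam_mul (κ : ℕ → ℝ) (I : Finset ℕ) (A : Finset (Zd d)) (c : ℝ) (f : Traj d → ℝ) :
    Lam κ I A (fun η => c * f η) = c * Lam κ I A f := by
  simp only [Lam, Finset.mul_sum]
  exact Finset.sum_congr rfl fun η _ => by ring

lemma Lam_sum {ι : Type*} (κ : ℕ → ℝ) (I : Finset ℕ) (A : Finset (Zd d)) (S : Finset ι) (f : ι → Traj d → ℝ) :
    Lam κ I A (fun η => ∑ i ∈ S, f i η) = ∑ i ∈ S, Lam κ I A (f i) := by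
  simp only [Lam, Finset.mul_sum]
  exact Finset.sum_comm

lemma Lam_nonneg {κ : ℕ → ℝ} (hκ : ∀ L, 0 ≤ κ L) (I : Finset ℕ) (A : Finset (Zd d)) {f : Traj d → ℝ}
    (h : ∀ η, 0 ≤ f η) : 0 ≤ Lam κ I A f :=
  Finset.sum_nonneg fun η hη => mul_nonneg (lam_nonneg hκ η) (h η)

lemma valid_rev {η : Traj d} (h : ValidTraj η) : ValidTraj η.reverse := by
  refine ⟨by simpa using h.1, ?_⟩
  show List.IsChain IsNN _
  rw [List.isChain_reverse]
  exact List.IsChain.imp (fun a b h => isNN_symm h) h.2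

lemma len_rev (η : Traj d) : len η.reverse = len η := by simp [len]

lemma lam_rev (κ : ℕ → ℝ) (η : Traj d) : lam κ η.reverse = lam κ η := by simp only [lam, len_rev]

lemma HPs_rev {I : Finset ℕ} {A : Finset (Zd d)} {η : Traj d} (h : η ∈ HPs I A) : η.reverse ∈ HPs I A := by
  rw [mem_HPs] at h ⊢
  refine ⟨valid_rev h.1, by rw [len_rev]; exact h.2.1, ?_⟩
  obtain ⟨y, h1, h2⟩ := h.2.2
  exact ⟨y, by simpa using h1, h2⟩

lemma Lam_rev (κ : ℕ → ℝ) (I : Finset ℕ) (A : Finset (Zd d)) (f : Traj d → ℝ) :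
    Lam κ I A (fun η => f η.reverse) = Lam κ I A f := by
  unfold Lam
  refine Finset.sum_nbij' List.reverse List.reverse (fun η h => HPs_rev h) (fun η h => HPs_rev h)
    (by simp) (by simp) ?_
  intro η _
  rw [lam_rev]

/-- general upper bound -/
lemma Lam_le {κ : ℕ → ℝ} (hκ : ∀ L, 0 ≤ κ L) (I : Finset ℕ) (A : Finset (Zd d)) (f : Traj d → ℝ)
    (hf : ∀ η, f η ≤ 1) (τ : ℕ) (hτ : 1 ≤ τ) (α : Zd d → ℝ) (hα : ∀ x, 0 ≤ α x)
    (h : ∀ x ∈ A, ∀ p, av A x p → ∀ l, p.length + l ∈ I → Ex l (fun s => f (Th x p s)) ≤ α x) :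
    Lam κ I A f ≤ (∑ L ∈ I, κ L * L) * (∑ x ∈ A, esc A τ x * α x) + (∑ L ∈ I, κ L) * (τ * A.card) := by
  rw [Lam_eq, Finset.sum_mul, Finset.sum_mul, ← Finset.sum_add_distrib]
  refine Finset.sum_le_sum fun L hL => ?_
  rw [mul_assoc, ← mul_add]
  refine mul_le_mul_of_nonneg_left ?_ (hκ L)
  have hc : (τ : ℝ) * A.card = ∑ x ∈ A, (τ : ℝ) := by simp [mul_comm]
  rw [hc, Finset.mul_sum, ← Finset.sum_add_distrib]
  refine Finset.sum_le_sum fun x hx => ?_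
  have key : ∀ m ∈ Finset.range (L + 1), Ex m (fun p => if av A x p then Ex (L - m) (fun s => f (Th x p s)) else 0)
      ≤ (if m < τ then 1 else 0) + (if τ ≤ m then esc A τ x * α x else 0) := by
    intro m hm
    rw [Finset.mem_range] at hm
    by_cases hmt : m < τ
    · rw [if_pos hmt, if_neg (by omega), add_zero]
      refine Ex_le_const fun p _ => ?_
      split_ifs
      · exact Ex_le_const fun s _ => hf _
      · norm_num
    · rw [if_neg hmt, if_pos (by omega), zero_add]
      refine le_trans ?_ (mul_le_mul_of_nonneg_right (esc_anti A x (by omega : τ ≤ m)) (hα x))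
      unfold esc
      rw [← Ex_mul_right]
      refine Ex_mono fun p hp => ?_
      split_ifs with hav
      · rw [one_mul]
        exact h x hx p hav _ (by rw [hp]; convert hL using 1; omega)
      · simp
  refine (Finset.sum_le_sum key).trans ?_
  rw [Finset.sum_add_distrib, add_comm]
  refine add_le_add ?_ ?_
  · rw [← Finset.sum_filter, Finset.sum_const, nsmul_eq_mul]
    refine mul_le_mul_of_nonneg_right ?_ (mul_nonneg (esc_nonneg _ _ _) (hα x))
    have : (Finset.filter (fun m => τ ≤ m) (Finset.range (L + 1))).card ≤ (Finset.Icc 1 L).card := by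
      refine Finset.card_le_card fun m hm => ?_
      simp only [Finset.mem_filter, Finset.mem_range, Finset.mem_Icc] at hm ⊢
      omega
    rw [Nat.card_Icc] at this
    exact_mod_cast (by simpa using this)
  · rw [← Finset.sum_filter, Finset.sum_const, nsmul_eq_mul, mul_one]
    have : (Finset.filter (fun m => m < τ) (Finset.range (L + 1))).card ≤ (Finset.range τ).card := by
      refine Finset.card_le_card fun m hm => ?_
      simp only [Finset.mem_filter, Finset.mem_range] at hm ⊢
      omega
    rw [Finset.card_range] at this
    exact_mod_cast this

/-- general lower bound -/
lemma Lam_ge {κ : ℕ → ℝ} (hκ : ∀ L, 0 ≤ κ L) (I : Finset ℕ) (A : Finset (Zd d)) (f : Traj d → ℝ)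
    (φ : ℕ → Zd d → ℝ) (hφ : ∀ l x, 0 ≤ φ l x)
    (h : ∀ x ∈ A, ∀ p, av A x p → ∀ l, p.length + l ∈ I → φ l x ≤ Ex l (fun s => f (Th x p s))) :
    ∑ L ∈ I, κ L * ∑ x ∈ A, eqm A x * ∑ l ∈ Finset.range (L + 1), φ l x ≤ Lam κ I A f := by
  rw [Lam_eq]
  refine Finset.sum_le_sum fun L hL => mul_le_mul_of_nonneg_left ?_ (hκ L)
  refine Finset.sum_le_sum fun x hx => ?_
  rw [← Finset.sum_range_reflect, Finset.mul_sum]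
  refine Finset.sum_le_sum fun m hm => ?_
  rw [Finset.mem_range] at hm
  have e : L + 1 - 1 - m = L - m := by omega
  rw [e]
  refine (mul_le_mul_of_nonneg_right (eqm_le_esc A m x) (hφ _ _)).trans ?_
  unfold esc
  rw [← Ex_mul_right]
  refine Ex_mono fun p hp => ?_
  split_ifs with hav
  · rw [one_mul]
    exact h x hx p hav _ (by rw [hp]; convert hL using 1; omega)
  · simp

end

section
variable {d : ℕ} [Fact (4 ≤ d)]

/-! ## F8: losses -/

/-- indicator -/
def ind (P : Prop) : ℝ := if P then 1 else 0

lemma ind_nonneg (P : Prop) : 0 ≤ ind P := by unfold ind; split_ifs <;> norm_num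
lemma ind_le_one (P : Prop) : ind P ≤ 1 := by unfold ind; split_ifs <;> norm_num
lemma ind_mono {P Q : Prop} (h : P → Q) : ind P ≤ ind Q := by
  unfold ind; split_ifs <;> first | (exfalso; tauto) | norm_num
lemma ind_or (P Q : Prop) : ind (P ∨ Q) ≤ ind P + ind Q := by
  unfold ind; split_ifs <;> first | (exfalso; tauto) | norm_num
lemma ind_pos {P : Prop} (h : P) : ind P = 1 := if_pos h
lemma ind_neg {P : Prop} (h : ¬ P) : ind P = 0 := if_neg h

lemma hit_le (B : Finset (Zd d)) (l : ℕ) (x : Zd d) :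
    Ex l (fun s => ind (¬ av B x s)) ≤ HH B x := by
  by_cases hx : x ∈ B
  · rw [HH_eq_one hx]
    exact Ex_le_const fun s _ => ind_le_one _
  · refine le_trans (le_of_eq ?_) (one_sub_esc_le_HH B l x hx)
    unfold esc
    rw [← Ex_const (d := d) l (1 : ℝ), ← Ex_sub_fun]
    refine Ex_congr fun s _ => ?_
    unfold ind
    split_ifs <;> first | (exfalso; tauto) | norm_num

lemma hit_le2 (B : Finset (Zd d)) (l : ℕ) (x : Zd d) :
    Ex l (fun s => ind (∃ z ∈ tr x s, z ∈ B)) ≤ HH B x := by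
  by_cases hx : x ∈ B
  · rw [HH_eq_one hx]
    exact Ex_le_const fun s _ => ind_le_one _
  · refine le_trans (Ex_mono fun s _ => ind_mono ?_) (hit_le B l x)
    rintro ⟨z, hz, hzB⟩ hav
    simp only [tr, List.mem_cons] at hz
    rcases hz with rfl | hz
    · exact hx hzB
    · exact hav z hz hzB

lemma dW_split (A : Finset (Zd d)) (η : Traj d) :
    ∃ k, k ++ dW A η = η ∧ ∀ z ∈ k, z ∉ A := by
  refine ⟨η.takeWhile (fun z => decide (z ∉ A)), List.takeWhile_append_dropWhile, ?_⟩
  intro z hz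
  have := List.mem_takeWhile_imp hz
  simpa using this

lemma mem_dW {A : Finset (Zd d)} {η : Traj d} {z : Zd d} (hz : z ∈ η) (hA : z ∈ A) : z ∈ dW A η := by
  obtain ⟨k, hk, hk2⟩ := dW_split A η
  rw [← hk, List.mem_append] at hz
  rcases hz with h | h
  · exact absurd hA (hk2 z h)
  · exact h

lemma dW_append {A : Finset (Zd d)} {k l : Traj d} {y : Zd d} (hy : y ∈ k) (hA : y ∈ A) :
    dW A (k ++ l) = dW A k ++ l := by
  have h := mem_dW hy hA
  unfold dW at *
  rw [List.dropWhile_append, if_neg]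
  intro hh
  rw [List.isEmpty_iff] at hh
  rw [hh] at h
  simp at h

lemma dW_sub {A : Finset (Zd d)} {η : Traj d} {z : Zd d} (hz : z ∈ dW A η) : z ∈ η :=
  (List.dropWhile_sublist _).subset hz

lemma dW_head {A : Finset (Zd d)} {η : Traj d} {y : Zd d} (hy : y ∈ η) (hA : y ∈ A) :
    ∃ x l, dW A η = x :: l ∧ x ∈ A ∧ x ∈ η := by
  have hne : dW A η ≠ [] := List.ne_nil_of_mem (mem_dW hy hA)
  obtain ⟨x, l, hxl⟩ := List.exists_cons_of_ne_nil hne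
  have hxA : x ∈ A := by
    have h1 := List.head_dropWhile_not (fun z => decide (z ∉ A)) (l := η) hne
    have h2 : (List.dropWhile (fun z => decide (z ∉ A)) η).head hne = x := by
      have : List.dropWhile (fun z => decide (z ∉ A)) η = x :: l := hxl
      simp only [this, List.head_cons]
    rw [h2] at h1
    simpa using h1
  exact ⟨x, l, hxl, hxA, dW_sub (by rw [hxl]; simp)⟩

lemma loss_hit {κ : ℕ → ℝ} (hκ : ∀ L, 0 ≤ κ L) (I : Finset ℕ) (A B : Finset (Zd d)) (τ : ℕ) (hτ : 1 ≤ τ) :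
    Lam κ I A (fun η => ind (hits η (B : Set (Zd d)))) ≤
      (∑ L ∈ I, κ L * L) * (Qt τ A B + Qt τ B A) + (∑ L ∈ I, κ L) * (τ * (A.card + B.card)) := by
  have one : ∀ A B : Finset (Zd d), Lam κ I A (fun η => ind (∃ z ∈ dW A η, z ∈ B)) ≤
      (∑ L ∈ I, κ L * L) * (Qt τ A B) + (∑ L ∈ I, κ L) * (τ * A.card) := by
    intro A B
    refine Lam_le hκ I A _ (fun η => ind_le_one _) τ hτ (HH B) (HH_nonneg B) ?_
    intro x hx p hp l _
    refine le_trans (le_of_eq (Ex_congr fun s _ => ?_)) (hit_le2 B l x)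
    rw [dW_Th hx hp]
  have h1 : Lam κ I A (fun η => ind (hits η (B : Set (Zd d)))) ≤
      Lam κ I A (fun η => ind (∃ z ∈ dW A η, z ∈ B)) + Lam κ I B (fun η => ind (∃ z ∈ dW B η, z ∈ A)) := by
    have h2 : Lam κ I A (fun η => ind (hits η (B : Set (Zd d)))) ≤
        Lam κ I A (fun η => ind (∃ z ∈ dW A η, z ∈ B) + ind (η ∈ HPs I B ∧ ∃ z ∈ dW B η, z ∈ A)) := by
      refine Lam_mono hκ I A fun η hη => ?_
      refine le_trans (ind_mono ?_) (ind_or _ _)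
      rintro ⟨y, hy, hyB⟩
      have hyB' : y ∈ B := by simpa using hyB
      obtain ⟨hv, hl, w, hw, hwA⟩ := mem_HPs.1 hη
      obtain ⟨x, l, hxl, hxA, hxη⟩ := dW_head hw (by simpa using hwA)
      obtain ⟨k, hk, hkA⟩ := dW_split A η
      by_cases hyd : y ∈ dW A η
      · exact Or.inl ⟨y, hyd, hyB'⟩
      · refine Or.inr ⟨mem_HPs.2 ⟨hv, hl, y, hy, hyB⟩, x, ?_, hxA⟩
        rw [← hk, List.mem_append] at hy
        rw [← hk, dW_append (hy.resolve_right hyd) hyB', hxl]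
        simp
    refine h2.trans ?_
    rw [Lam_add]
    refine add_le_add le_rfl ?_
    unfold Lam
    calc ∑ η ∈ HPs I A, lam κ η * ind (η ∈ HPs I B ∧ ∃ z ∈ dW B η, z ∈ A)
        ≤ ∑ η ∈ HPs I A ∪ HPs I B, lam κ η * ind (η ∈ HPs I B ∧ ∃ z ∈ dW B η, z ∈ A) :=
          Finset.sum_le_sum_of_subset_of_nonneg Finset.subset_union_left
            fun η _ _ => mul_nonneg (lam_nonneg hκ η) (ind_nonneg _)
      _ = ∑ η ∈ HPs I B, lam κ η * ind (η ∈ HPs I B ∧ ∃ z ∈ dW B η, z ∈ A) := by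
          refine (Finset.sum_subset Finset.subset_union_right ?_).symm
          intro η _ h
          rw [ind_neg (fun h2 => h h2.1), mul_zero]
      _ ≤ _ := Finset.sum_le_sum fun η _ => mul_le_mul_of_nonneg_left (ind_mono fun h => h.2) (lam_nonneg hκ η)
  refine h1.trans ((add_le_add (one A B) (one B A)).trans (le_of_eq ?_))
  ring

/-- projected diameter -/
def pdiam (a : ℝ) (η : Traj d) : Prop := ∀ y ∈ η, ∀ z ∈ η,
  |((y (i0 d) : ℝ) - z (i0 d))| ≤ a ∧ |((y (i1 d) : ℝ) - z (i1 d))| ≤ a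

/-- the path goes far from its start -/
def far (h : ℝ) (η : Traj d) : Prop := ∃ x l, η = x :: l ∧ ((∃ z ∈ η, h ≤ |((z (i0 d) : ℝ) - x (i0 d))|) ∨
  ∃ z ∈ η, h ≤ |((z (i1 d) : ℝ) - x (i1 d))|)

lemma mem_dW_or {A : Finset (Zd d)} {η : Traj d} {w z : Zd d} (hw : w ∈ η) (hwA : w ∈ A) (hz : z ∈ η) :
    z ∈ dW A η ∨ z ∈ dW A η.reverse := by
  obtain ⟨x, l, hxl, hxA, hxη⟩ := dW_head hw hwA
  obtain ⟨k, hk, hkA⟩ := dW_split A η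
  by_cases hyd : z ∈ dW A η
  · exact Or.inl hyd
  · right
    rw [← hk, List.mem_append] at hz
    have hz' := hz.resolve_right hyd
    have : dW A η.reverse = dW A ((dW A η).reverse) ++ k.reverse := by
      conv_lhs => rw [← hk, List.reverse_append]
      exact dW_append (y := x) (by simp [hxl]) hxA
    rw [this]
    simp [hz']

lemma pdiam_of {A : Finset (Zd d)} {η : Traj d} {w : Zd d} (hw : w ∈ η) (hwA : w ∈ A) {h : ℝ}
    (h1 : ¬ far h (dW A η)) (h2 : ¬ far h (dW A η.reverse)) : pdiam (4 * h) η := by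
  obtain ⟨x, l, hxl, hxA, hxη⟩ := dW_head hw hwA
  obtain ⟨y, l', hyl, hyA, hyη⟩ := dW_head (η := η.reverse) (by simpa using hw) hwA
  have hx2 : x ∈ dW A η.reverse := mem_dW (by simpa using hxη) hxA
  have f1 : ∀ z ∈ dW A η, |((z (i0 d) : ℝ) - x (i0 d))| < h ∧ |((z (i1 d) : ℝ) - x (i1 d))| < h := by
    intro z hz
    by_contra hc
    refine h1 ⟨x, l, hxl, ?_⟩
    rw [not_and_or, not_lt, not_lt] at hc
    exact hc.imp (fun q => ⟨z, hz, q⟩) fun q => ⟨z, hz, q⟩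
  have f2 : ∀ z ∈ dW A η.reverse, |((z (i0 d) : ℝ) - y (i0 d))| < h ∧ |((z (i1 d) : ℝ) - y (i1 d))| < h := by
    intro z hz
    by_contra hc
    refine h2 ⟨y, l', hyl, ?_⟩
    rw [not_and_or, not_lt, not_lt] at hc
    exact hc.imp (fun q => ⟨z, hz, q⟩) fun q => ⟨z, hz, q⟩
  have f3 : ∀ z ∈ η, |((z (i0 d) : ℝ) - x (i0 d))| ≤ 2 * h ∧ |((z (i1 d) : ℝ) - x (i1 d))| ≤ 2 * h := by
    intro z hz
    have hxy := f2 x hx2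
    simp only [abs_lt] at hxy
    rcases mem_dW_or hw hwA hz with hz | hz
    · have := f1 z hz
      simp only [abs_lt, abs_le] at this ⊢
      refine ⟨⟨?_, ?_⟩, ?_, ?_⟩ <;> linarith [this.1.1, this.1.2, this.2.1, this.2.2]
    · have := f2 z hz
      simp only [abs_lt, abs_le] at this ⊢
      refine ⟨⟨?_, ?_⟩, ?_, ?_⟩ <;>
        linarith [this.1.1, this.1.2, this.2.1, this.2.2, hxy.1.1, hxy.1.2, hxy.2.1, hxy.2.2]
  intro p hp q hq
  have a1 := f3 p hp
  have a2 := f3 q hq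
  simp only [abs_le] at a1 a2 ⊢
  refine ⟨⟨?_, ?_⟩, ?_, ?_⟩ <;>
    linarith [a1.1.1, a1.1.2, a1.2.1, a1.2.2, a2.1.1, a2.1.2, a2.2.1, a2.2.2]

lemma far_prob {h : ℝ} (hh : 0 < h) (l : ℕ) (x : Zd d) :
    Ex l (fun s => ind (far h (tr x s))) ≤ l / h ^ 2 := by
  have e0 : Ex l (fun s => ind (∃ z ∈ tr x s, h ≤ |((z (i0 d) : ℝ) - x (i0 d))|)) ≤
      (((x (i0 d) : ℝ) - x (i0 d)) ^ 2 + l / d) / h ^ 2 := by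
    convert exit_le (i0 d) h hh l (x (i0 d)) x using 3
    unfold ind; congr
  have e1 : Ex l (fun s => ind (∃ z ∈ tr x s, h ≤ |((z (i1 d) : ℝ) - x (i1 d))|)) ≤
      (((x (i1 d) : ℝ) - x (i1 d)) ^ 2 + l / d) / h ^ 2 := by
    convert exit_le (i1 d) h hh l (x (i1 d)) x using 3
    unfold ind; congr
  have : Ex l (fun s => ind (far h (tr x s))) ≤
      Ex l (fun s => ind (∃ z ∈ tr x s, h ≤ |((z (i0 d) : ℝ) - x (i0 d))|) +
        ind (∃ z ∈ tr x s, h ≤ |((z (i1 d) : ℝ) - x (i1 d))|)) := by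
    refine Ex_mono fun s _ => ?_
    refine le_trans (ind_mono ?_) (ind_or _ _)
    rintro ⟨x', l', hx, h'⟩
    have : x' = x := by
      simp only [tr, List.cons.injEq] at hx
      exact hx.1.symm
    subst this
    exact h'
  refine this.trans ?_
  rw [Ex_add_fun]
  refine (add_le_add e0 e1).trans ?_
  rw [← add_div]
  refine div_le_div_of_nonneg_right ?_ (by positivity)
  have hd : (4 : ℝ) ≤ d := by exact_mod_cast (Fact.out : 4 ≤ d)
  have h3 : (l : ℝ) / d ≤ l / 4 := div_le_div_of_nonneg_left (by positivity) (by norm_num) hd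
  simp only [sub_self]
  nlinarith [(Nat.cast_nonneg l : (0:ℝ) ≤ l)]

lemma loss_diam {κ : ℕ → ℝ} (hκ : ∀ L, 0 ≤ κ L) (I : Finset ℕ) (A : Finset (Zd d)) (τ : ℕ) (hτ : 1 ≤ τ)
    {h Lm : ℝ} (hh : 0 < h) (hI : ∀ L ∈ I, (L : ℝ) ≤ Lm) (hLm : 0 ≤ Lm) :
    Lam κ I A (fun η => ind (¬ pdiam (4 * h) η)) ≤
      2 * ((∑ L ∈ I, κ L * L) * (tc τ A * (Lm / h ^ 2)) + (∑ L ∈ I, κ L) * (τ * A.card)) := by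
  have one : Lam κ I A (fun η => ind (far h (dW A η))) ≤
      (∑ L ∈ I, κ L * L) * (tc τ A * (Lm / h ^ 2)) + (∑ L ∈ I, κ L) * (τ * A.card) := by
    have := Lam_le hκ I A (fun η => ind (far h (dW A η))) (fun η => ind_le_one _) τ hτ (fun _ => Lm / h ^ 2)
      (fun _ => by positivity) ?_
    · rw [← Finset.sum_mul] at this
      exact this
    · intro x hx p hp l hl
      have h5 : (l : ℝ) ≤ Lm := le_trans (by push_cast; linarith [(Nat.cast_nonneg p.length : (0:ℝ) ≤ _)]) (hI _ hl)
      refine le_trans (le_of_eq (Ex_congr fun s _ => ?_)) ((far_prob hh l x).trans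
        (div_le_div_of_nonneg_right h5 (by positivity)))
      rw [dW_Th hx hp]
  have two : Lam κ I A (fun η => ind (¬ pdiam (4 * h) η)) ≤
      Lam κ I A (fun η => ind (far h (dW A η)) + ind (far h (dW A η.reverse))) := by
    refine Lam_mono hκ I A fun η hη => le_trans (ind_mono ?_) (ind_or _ _)
    obtain ⟨hv, hl, w, hw, hwA⟩ := mem_HPs.1 hη
    intro hn
    by_contra hc
    rw [not_or] at hc
    exact hn (pdiam_of hw (by simpa using hwA) hc.1 hc.2)
  rw [Lam_add, Lam_rev κ I A (fun η => ind (far h (dW A η)))] at two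
  linarith

/-- bad pair -/
def Qb (τ : ℕ) (q : ℝ) (F B : Finset (Zd d)) : Prop := q < Qt τ F B ∨ q < Qt τ B F

lemma Qb_symm {τ : ℕ} {q : ℝ} {F B : Finset (Zd d)} : Qb τ q F B ↔ Qb τ q B F := Or.comm

lemma not_Qb_empty {τ : ℕ} {q : ℝ} (hq : 0 ≤ q) (B : Finset (Zd d)) : ¬ Qb τ q ∅ B := by
  unfold Qb Qt HH
  simp
  exact hq

/-- child -/
def Fc (g β : ℕ) (A : Finset (Zd d)) (η : Traj d) : Finset (Zd d) := ch g β (dW A η)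

/-- uniform smallness of the probability of bad pairs -/
def QF (d : ℕ) [Fact (4 ≤ d)] (τ : ℕ) (q C : ℝ) (g β : ℕ) (Lm α : ℝ) : Prop := ∀ B : Finset (Zd d), tc τ B ≤ C →
  ∀ x : Zd d, ∀ l : ℕ, (l : ℝ) ≤ Lm → Ex l (fun s => ind (Qb τ q (ch g β (tr x s)) B)) ≤ α

lemma loss_Q {κ : ℕ → ℝ} (hκ : ∀ L, 0 ≤ κ L) (I : Finset ℕ) (A B : Finset (Zd d)) (τ : ℕ) (hτ : 1 ≤ τ)
    {q C Lm α : ℝ} {g β : ℕ} (hI : ∀ L ∈ I, (L : ℝ) ≤ Lm) (hα : 0 ≤ α) (hQ : QF d τ q C g β Lm α)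
    (hB : tc τ B ≤ C) :
    Lam κ I A (fun η => ind (Qb τ q (Fc g β A η) B)) ≤
      (∑ L ∈ I, κ L * L) * (tc τ A * α) + (∑ L ∈ I, κ L) * (τ * A.card) := by
  have := Lam_le hκ I A (fun η => ind (Qb τ q (Fc g β A η) B)) (fun η => ind_le_one _) τ hτ (fun _ => α)
      (fun _ => hα) ?_
  · rw [← Finset.sum_mul] at this
    exact this
  · intro x hx p hp l hl
    have h5 : (l : ℝ) ≤ Lm := le_trans (by push_cast; linarith [(Nat.cast_nonneg p.length : (0:ℝ) ≤ _)]) (hI _ hl)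
    refine le_trans (le_of_eq (Ex_congr fun s _ => ?_)) (hQ B hB x l h5)
    rw [Fc, dW_Th hx hp]

lemma loss_sib {κ : ℕ → ℝ} (hκ : ∀ L, 0 ≤ κ L) (I : Finset ℕ) (A : Finset (Zd d)) (τ : ℕ) (hτ : 1 ≤ τ)
    {q C Lm α : ℝ} {g g1 β : ℕ} (hI : ∀ L ∈ I, (L : ℝ) ≤ Lm) (hα : 0 ≤ α) (hq : 0 ≤ q)
    (hg1 : 1 ≤ g1) (hg : g1 ≤ g) (hQ : QF d τ q C (g - g1) β Lm α) :
    Lam κ I A (fun η => ind (tc τ (Fc g β A η.reverse) ≤ C ∧ Qb τ q (Fc g β A η) (Fc g β A η.reverse))) ≤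
      (∑ L ∈ I, κ L * L) * (tc τ A * (α + cp A * Gt d g1)) + (∑ L ∈ I, κ L) * (τ * A.card) := by
  have hα' : 0 ≤ α + cp A * Gt d g1 := add_nonneg hα (mul_nonneg (cp_nonneg A) (Gt_nonneg _))
  have := Lam_le hκ I A (fun η => ind (tc τ (Fc g β A η.reverse) ≤ C ∧ Qb τ q (Fc g β A η) (Fc g β A η.reverse)))
      (fun η => ind_le_one _) τ hτ (fun _ => α + cp A * Gt d g1) (fun _ => hα') ?_
  · rw [← Finset.sum_mul] at this
    exact this
  · intro x hx p hp l hl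
    have h5 : (l : ℝ) ≤ Lm := le_trans (by push_cast; linarith [(Nat.cast_nonneg p.length : (0:ℝ) ≤ _)]) (hI _ hl)
    by_cases hlg : l < g
    · refine Ex_le_const fun s hs => ?_
      rw [ind_neg]
      · exact hα'
      · rintro ⟨-, h2⟩
        have : Fc g β A (Th x p s) = ∅ := by
          rw [Fc, dW_Th hx hp, ch, List.drop_eq_nil_of_le (by rw [tr_length]; omega)]
          simp
        rw [this] at h2
        exact not_Qb_empty hq _ h2
    · obtain ⟨k, rfl⟩ := Nat.exists_eq_add_of_le (by omega : g1 ≤ l)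
      rw [Ex_append]
      refine le_trans (Ex_mono (F' := fun s1 => α + HH A (pos x s1)) fun s1 hs1 => ?_) ?_
      · set B := Fc g β A (Th x p s1).reverse with hBdef
        have key : Ex k (fun t => ind (tc τ (Fc g β A (Th x p (s1 ++ t)).reverse) ≤ C ∧
            Qb τ q (Fc g β A (Th x p (s1 ++ t))) (Fc g β A (Th x p (s1 ++ t)).reverse))) ≤
            Ex k (fun t => ind (tc τ B ≤ C ∧ Qb τ q (ch (g - g1) β (tr (pos x s1) t)) B)
              + ind (¬ av A (pos x s1) t)) := by
          refine Ex_mono fun t _ => le_trans (ind_mono ?_) (ind_or _ _)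
          rintro ⟨a1, a2⟩
          by_cases hav : av A (pos x s1) t
          · left
            have e1 : Fc g β A (Th x p (s1 ++ t)).reverse = B := by
              have : (Th x p (s1 ++ t)).reverse = (trT (pos x s1) t).reverse ++ (Th x p s1).reverse := by
                simp [Th, tr, trT_append]
              rw [hBdef, Fc, Fc, this, dW, dW, List.dropWhile_append_of_pos]
              intro z hz
              simpa using hav z (by simpa using hz)
            have e2 : Fc g β A (Th x p (s1 ++ t)) = ch (g - g1) β (tr (pos x s1) t) := by
              rw [Fc, dW_Th hx hp, ch_tr2 g1 g β x s1 t hs1 hg]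
            rw [e1] at a1 a2
            rw [e2] at a2
            exact ⟨a1, a2⟩
          · exact Or.inr hav
        refine key.trans ?_
        rw [Ex_add_fun]
        refine add_le_add ?_ (hit_le A k _)
        by_cases hB : tc τ B ≤ C
        · refine le_trans (Ex_mono fun t _ => ind_mono fun h => h.2) (hQ B hB _ k ?_)
          push_cast at h5
          linarith [(Nat.cast_nonneg g1 : (0:ℝ) ≤ _)]
        · refine Ex_le_const fun t _ => ?_
          rw [ind_neg (fun h => hB h.1)]
          exact hα
      · rw [Ex_add_fun, Ex_const]
        exact add_le_add le_rfl (Ex_HH A g1 hg1 x)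

end

section
variable {ι : Type*}

/-! ## F9: Bernoulli subsets -/

/-- probability of the subset `T` -/
def prB (p : ι → ℝ) (s T : Finset ι) : ℝ := ∏ a ∈ s, if a ∈ T then p a else 1 - p a

/-- expectation over Bernoulli subsets -/
def EB (p : ι → ℝ) (s : Finset ι) (f : Finset ι → ℝ) : ℝ := ∑ T ∈ s.powerset, prB p s T * f T

lemma EB_insert (p : ι → ℝ) {a : ι} {s : Finset ι} (ha : a ∉ s) (f : Finset ι → ℝ) :
    EB p (insert a s) f = (1 - p a) * EB p s f + p a * EB p s (fun T => f (insert a T)) := by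
  unfold EB
  rw [Finset.sum_powerset_insert ha, Finset.mul_sum, Finset.mul_sum]
  congr 1
  · refine Finset.sum_congr rfl fun T hT => ?_
    have haT : a ∉ T := fun h => ha (Finset.mem_powerset.1 hT h)
    rw [prB, Finset.prod_insert ha, if_neg haT, prB]
    ring
  · refine Finset.sum_congr rfl fun T hT => ?_
    rw [prB, Finset.prod_insert ha, if_pos (Finset.mem_insert_self _ _), prB]
    have : ∏ x ∈ s, (if x ∈ insert a T then p x else 1 - p x) = ∏ x ∈ s, (if x ∈ T then p x else 1 - p x) := by
      refine Finset.prod_congr rfl fun x hx => ?_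
      have : x ≠ a := fun h => ha (h ▸ hx)
      simp [Finset.mem_insert, this]
    rw [this]
    ring

lemma prB_nonneg {p : ι → ℝ} (h0 : ∀ a, 0 ≤ p a) (h1 : ∀ a, p a ≤ 1) (s T : Finset ι) : 0 ≤ prB p s T := by
  refine Finset.prod_nonneg fun a _ => ?_
  split_ifs
  · exact h0 a
  · linarith [h1 a]

lemma EB_mono {p : ι → ℝ} (h0 : ∀ a, 0 ≤ p a) (h1 : ∀ a, p a ≤ 1) (s : Finset ι) {f g : Finset ι → ℝ}
    (h : ∀ T, T ⊆ s → f T ≤ g T) : EB p s f ≤ EB p s g :=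
  Finset.sum_le_sum fun T hT => mul_le_mul_of_nonneg_left (h T (Finset.mem_powerset.1 hT)) (prB_nonneg h0 h1 _ _)

lemma EB_congr {p : ι → ℝ} {s : Finset ι} {f g : Finset ι → ℝ}
    (h : ∀ T, T ⊆ s → f T = g T) : EB p s f = EB p s g :=
  Finset.sum_congr rfl fun T hT => by rw [h T (Finset.mem_powerset.1 hT)]

lemma EB_add (p : ι → ℝ) (s : Finset ι) (f g : Finset ι → ℝ) :
    EB p s (fun T => f T + g T) = EB p s f + EB p s g := by
  simp only [EB, mul_add, Finset.sum_add_distrib]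

lemma EB_mul (p : ι → ℝ) (s : Finset ι) (c : ℝ) (f : Finset ι → ℝ) :
    EB p s (fun T => c * f T) = c * EB p s f := by
  simp only [EB, Finset.mul_sum]
  exact Finset.sum_congr rfl fun T _ => by ring

lemma EB_one (p : ι → ℝ) (s : Finset ι) : EB p s (fun _ => 1) = 1 := by
  induction s using Finset.induction_on with
  | empty => simp [EB, prB]
  | insert a s ha ih => rw [EB_insert p ha, ih]; ring

lemma EB_const (p : ι → ℝ) (s : Finset ι) (c : ℝ) : EB p s (fun _ => c) = c := by
  have := EB_mul p s c (fun _ => 1)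
  rw [EB_one] at this
  simpa using this

lemma EB_sum (p : ι → ℝ) (s : Finset ι) (X : ι → ℝ) :
    EB p s (fun T => ∑ a ∈ T, X a) = ∑ a ∈ s, p a * X a := by
  induction s using Finset.induction_on with
  | empty => simp [EB, prB]
  | insert a s ha ih =>
    rw [EB_insert p ha, ih, Finset.sum_insert ha]
    have : EB p s (fun T => ∑ b ∈ insert a T, X b) = EB p s (fun T => X a + ∑ b ∈ T, X b) :=
      EB_congr fun T hT => Finset.sum_insert fun h => ha (hT h)
    rw [this, EB_add, EB_const, ih]
    ring

lemma EB_var (p : ι → ℝ) (s : Finset ι) (X : ι → ℝ) :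
    EB p s (fun T => (∑ a ∈ T, X a - ∑ a ∈ s, p a * X a) ^ 2) = ∑ a ∈ s, p a * (1 - p a) * X a ^ 2 := by
  induction s using Finset.induction_on with
  | empty => simp [EB, prB]
  | insert a s ha ih =>
    rw [EB_insert p ha, Finset.sum_insert ha, Finset.sum_insert ha]
    set m := ∑ a ∈ s, p a * X a with hm
    have hz : EB p s (fun T => ∑ a ∈ T, X a - m) = 0 := by
      have := EB_add p s (fun T => ∑ a ∈ T, X a) (fun _ => -m)
      rw [EB_sum, EB_const] at this
      simpa [sub_eq_add_neg, ← hm] using this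
    have hgen : ∀ c : ℝ, EB p s (fun T => (∑ a ∈ T, X a - m + c) ^ 2) =
        ∑ a ∈ s, p a * (1 - p a) * X a ^ 2 + c ^ 2 := by
      intro c
      have : EB p s (fun T => (∑ a ∈ T, X a - m + c) ^ 2) =
          EB p s (fun T => (∑ a ∈ T, X a - m) ^ 2 + ((2 * c) * (∑ a ∈ T, X a - m) + c ^ 2)) :=
        EB_congr fun T _ => by ring
      rw [this, EB_add, EB_add, EB_mul, EB_const, hz, ih]
      ring
    have e1 : EB p s (fun T => (∑ b ∈ T, X b - (p a * X a + m)) ^ 2) = _ :=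
      (EB_congr fun T _ => by ring).trans (hgen (-(p a * X a)))
    have e2 : EB p s (fun T => (∑ b ∈ insert a T, X b - (p a * X a + m)) ^ 2) = _ :=
      (EB_congr fun T hT => by
        rw [Finset.sum_insert fun h => ha (hT h)]; ring).trans (hgen ((1 - p a) * X a))
    rw [e1, e2]
    ring

lemma EB_pairs {p : ι → ℝ} (s : Finset ι) (c : ι → ι → ℝ) :
    EB p s (fun T => ∑ a ∈ T, ∑ b ∈ T.erase a, c a b) = ∑ a ∈ s, ∑ b ∈ s.erase a, p a * p b * c a b := by
  have hins : ∀ (a : ι) (T : Finset ι), a ∉ T → ∀ c : ι → ι → ℝ, ∑ x ∈ insert a T, ∑ b ∈ (insert a T).erase x, c x b =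
      ∑ b ∈ T, (c a b + c b a) + ∑ x ∈ T, ∑ b ∈ T.erase x, c x b := by
    intro a T ha c
    rw [Finset.sum_insert ha, Finset.erase_insert ha, Finset.sum_add_distrib, add_assoc]
    congr 1
    rw [← Finset.sum_add_distrib]
    refine Finset.sum_congr rfl fun x hx => ?_
    have hxa : x ≠ a := fun h => ha (h ▸ hx)
    rw [Finset.erase_insert_of_ne (Ne.symm hxa), Finset.sum_insert]
    simp [ha]
  induction s using Finset.induction_on with
  | empty => simp [EB, prB]
  | insert a s ha ih =>
    rw [EB_insert p ha, hins a s ha]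
    have : EB p s (fun T => ∑ x ∈ insert a T, ∑ b ∈ (insert a T).erase x, c x b) =
        EB p s (fun T => ∑ b ∈ T, (c a b + c b a) + ∑ x ∈ T, ∑ b ∈ T.erase x, c x b) :=
      EB_congr fun T hT => hins a T (fun h => ha (hT h)) c
    rw [this, EB_add, EB_sum, ih]
    have e : ∑ b ∈ s, (p a * p b * c a b + p b * p a * c b a) = p a * ∑ b ∈ s, p b * (c a b + c b a) := by
      rw [Finset.mul_sum]
      exact Finset.sum_congr rfl fun b _ => by ring
    rw [e]
    ring

lemma EB_cheb {p : ι → ℝ} (h0 : ∀ a, 0 ≤ p a) (h1 : ∀ a, p a ≤ 1) (s : Finset ι) {X : ι → ℝ} {D : ℝ}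
    (hX0 : ∀ a ∈ s, 0 ≤ X a) (hXD : ∀ a ∈ s, X a ≤ D) {E0 G : ℝ} (hG : 0 ≤ G) (hGE : G < E0)
    (hE : E0 ≤ ∑ a ∈ s, p a * X a) :
    EB p s (fun T => ind (∑ a ∈ T, X a < G)) ≤ D * E0 / (E0 - G) ^ 2 := by
  set m := ∑ a ∈ s, p a * X a with hm
  have hmG : 0 < m - G := by linarith
  have hD : 0 ≤ D ∨ s = ∅ := by
    rcases s.eq_empty_or_nonempty with h | ⟨a, ha⟩
    · exact Or.inr h
    · exact Or.inl ((hX0 a ha).trans (hXD a ha))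
  have hD : 0 ≤ D := by
    rcases hD with h | h
    · exact h
    · subst h
      simp at hm
      linarith
  have h2 : EB p s (fun T => ind (∑ a ∈ T, X a < G)) ≤
      EB p s (fun T => (1 / (m - G) ^ 2) * (∑ a ∈ T, X a - m) ^ 2) := by
    refine EB_mono h0 h1 s fun T _ => ?_
    by_cases hlt : ∑ a ∈ T, X a < G
    · rw [ind_pos hlt, one_div, inv_mul_eq_div, le_div_iff₀ (by positivity)]
      nlinarith
    · rw [ind_neg hlt]
      positivity
  refine h2.trans ?_
  rw [EB_mul, EB_var]
  have h3 : ∑ a ∈ s, p a * (1 - p a) * X a ^ 2 ≤ D * m := by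
    rw [hm, Finset.mul_sum]
    refine Finset.sum_le_sum fun a ha => ?_
    have a1 := hX0 a ha
    have a2 := hXD a ha
    have a3 : X a ^ 2 ≤ D * X a := by nlinarith
    have a4 : p a * (1 - p a) ≤ p a := by nlinarith [h0 a]
    calc p a * (1 - p a) * X a ^ 2 ≤ p a * X a ^ 2 := mul_le_mul_of_nonneg_right a4 (sq_nonneg _)
      _ ≤ p a * (D * X a) := mul_le_mul_of_nonneg_left a3 (h0 a)
      _ = D * (p a * X a) := by ring
  calc 1 / (m - G) ^ 2 * ∑ a ∈ s, p a * (1 - p a) * X a ^ 2 ≤ 1 / (m - G) ^ 2 * (D * m) :=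
        mul_le_mul_of_nonneg_left h3 (by positivity)
    _ ≤ D * E0 / (E0 - G) ^ 2 := by
        rw [one_div, inv_mul_eq_div, div_le_div_iff₀ (by positivity) (by have : 0 < E0 - G := by linarith
                                                                         positivity)]
        have : m * (E0 - G) ^ 2 ≤ E0 * (m - G) ^ 2 := by
          have : 0 ≤ (m - E0) * (m * E0 - G ^ 2) := mul_nonneg (by linarith) (by nlinarith)
          nlinarith
        nlinarith

end

section
variable {d : ℕ} [Fact (4 ≤ d)]

/-! ## F10: generation step -/

/-- parameters of the exploration -/
structure Prm where
  I : Finset ℕ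
  τ : ℕ
  g : ℕ
  β : ℕ
  C : ℝ
  c : ℝ
  q : ℝ
  a : ℝ

/-- the two children of a trajectory -/
def Fd (P : Prm) (U : Finset (Zd d)) (i : Traj d × Bool) : Finset (Zd d) :=
  Fc P.g P.β U (if i.2 then i.1 else i.1.reverse)

/-- good sets -/
def Good (P : Prm) (ψ : Zd d → ℝ) (D : Finset (Finset (Zd d))) (F : Finset (Zd d)) : Prop :=
  tc P.τ F ≤ P.C ∧ P.c ≤ wt ψ F ∧ ∀ B ∈ D, ¬ Qb P.τ P.q F B

/-- union of the seeds -/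
def hull (A : Finset (Finset (Zd d))) : Finset (Zd d) := A.biUnion id

/-- examined trajectories -/
def cls (P : Prm) (A : Finset (Finset (Zd d))) (used : Finset (Traj d)) : Finset (Traj d) :=
  (A.biUnion (HPs P.I)).filter (fun η => (∀ B ∈ A, ∀ B' ∈ A, hits η (B : Set (Zd d)) → hits η (B' : Set (Zd d)) → B = B') ∧
    pdiam P.a η ∧ η ∉ used ∧ η.reverse ∉ used)

/-- good children -/
def kids (P : Prm) (ψ : Zd d → ℝ) (A D : Finset (Finset (Zd d))) (T : Finset (Traj d)) : Finset (Finset (Zd d)) :=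
  ((T ×ˢ (Finset.univ : Finset Bool)).filter (fun i => Good P ψ D (Fd P (hull A) i))).image (Fd P (hull A))

/-- successful generation -/
def Suc (P : Prm) (ψ : Zd d → ℝ) (A D : Finset (Finset (Zd d))) (G : ℝ) (T : Finset (Traj d)) : Prop :=
  (∀ F ∈ kids P ψ A D T, ∀ F' ∈ kids P ψ A D T, F ≠ F' → ¬ Qb P.τ P.q F F') ∧
    G ≤ ∑ F ∈ kids P ψ A D T, wt ψ F

lemma mem_cls {P : Prm} {A : Finset (Finset (Zd d))} {used : Finset (Traj d)} {η : Traj d} :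
    η ∈ cls P A used ↔ ValidTraj η ∧ len η ∈ P.I ∧ (∃ B ∈ A, hits η (B : Set (Zd d))) ∧
      (∀ B ∈ A, ∀ B' ∈ A, hits η (B : Set (Zd d)) → hits η (B' : Set (Zd d)) → B = B') ∧
      pdiam P.a η ∧ η ∉ used ∧ η.reverse ∉ used := by
  simp only [cls, Finset.mem_filter, Finset.mem_biUnion, mem_HPs]
  constructor
  · rintro ⟨⟨B, hB, h1, h2, h3⟩, h4⟩
    exact ⟨h1, h2, ⟨B, hB, h3⟩, h4⟩
  · rintro ⟨h1, h2, ⟨B, hB, h3⟩, h4⟩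
    exact ⟨⟨B, hB, h1, h2, h3⟩, h4⟩

lemma hits_rev {η : Traj d} {A : Set (Zd d)} : hits η.reverse A ↔ hits η A := by
  simp [hits]

lemma pdiam_rev {a : ℝ} {η : Traj d} : pdiam a η.reverse ↔ pdiam a η := by
  simp [pdiam]

lemma cls_rev {P : Prm} {A : Finset (Finset (Zd d))} {used : Finset (Traj d)} {η : Traj d}
    (h : η ∈ cls P A used) : η.reverse ∈ cls P A used := by
  rw [mem_cls] at h ⊢
  obtain ⟨h1, h2, h3, h4, h5, h6, h7⟩ := h
  refine ⟨valid_rev h1, by rw [len_rev]; exact h2, ?_, ?_, pdiam_rev.2 h5, h7, by simpa using h6⟩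
  · simpa only [hits_rev] using h3
  · simpa only [hits_rev] using h4

lemma dropWhile_congr' {α : Type*} {p q : α → Bool} {l : List α} (h : ∀ x ∈ l, p x = q x) :
    l.dropWhile p = l.dropWhile q := by
  induction l with
  | nil => rfl
  | cons a l ih =>
    rw [List.dropWhile_cons, List.dropWhile_cons, h a (by simp), ih (fun x hx => h x (by simp [hx]))]

lemma dW_hull {P : Prm} {A : Finset (Finset (Zd d))} {used : Finset (Traj d)} {η : Traj d}
    (h : η ∈ cls P A used) {B : Finset (Zd d)} (hB : B ∈ A) (hh : hits η (B : Set (Zd d))) :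
    dW (hull A) η = dW B η := by
  rw [mem_cls] at h
  refine dropWhile_congr' fun z hz => ?_
  have : z ∈ hull A ↔ z ∈ B := by
    simp only [hull, Finset.mem_biUnion, id]
    constructor
    · rintro ⟨B', hB', hz'⟩
      rw [h.2.2.2.1 B hB B' hB' hh ⟨z, hz, hz'⟩]
      exact hz'
    · exact fun hz' => ⟨B, hB, hz'⟩
  simp [this]

lemma cls_split {P : Prm} {A : Finset (Finset (Zd d))} {used : Finset (Traj d)} (f : Traj d → ℝ) :
    ∑ η ∈ cls P A used, f η = ∑ B ∈ A, ∑ η ∈ (cls P A used).filter (fun η => hits η (B : Set (Zd d))), f η := by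
  simp only [Finset.sum_filter]
  rw [Finset.sum_comm]
  refine Finset.sum_congr rfl fun η hη => ?_
  rw [mem_cls] at hη
  obtain ⟨B, hB, hh⟩ := hη.2.2.1
  rw [Finset.sum_eq_single B]
  · rw [if_pos hh]
  · intro B' hB' hne
    rw [if_neg]
    exact fun h' => hne (hη.2.2.2.1 B' hB' B hB h' hh)
  · exact fun h => absurd hB h

lemma cls_le {κ : ℕ → ℝ} (hκ : ∀ L, 0 ≤ κ L) {P : Prm} {A : Finset (Finset (Zd d))} {used : Finset (Traj d)}
    (f : Traj d → ℝ) (k : Finset (Zd d) → Traj d → ℝ) (hk : ∀ B η, 0 ≤ k B η)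
    (h : ∀ η ∈ cls P A used, ∀ B ∈ A, hits η (B : Set (Zd d)) → f η ≤ lam κ η * k B η) :
    ∑ η ∈ cls P A used, f η ≤ ∑ B ∈ A, Lam κ P.I B (k B) := by
  rw [cls_split]
  refine Finset.sum_le_sum fun B hB => ?_
  refine le_trans (Finset.sum_le_sum (g := fun η => lam κ η * k B η) ?_) ?_
  · intro η hη
    rw [Finset.mem_filter] at hη
    exact h η hη.1 B hB hη.2
  · unfold Lam
    refine Finset.sum_le_sum_of_subset_of_nonneg ?_ ?_
    · intro η hη
      rw [Finset.mem_filter, mem_cls] at hη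
      exact mem_HPs.2 ⟨hη.1.1, hη.1.2.1, hη.2⟩
    · exact fun η _ _ => mul_nonneg (lam_nonneg hκ η) (hk B η)

lemma Qt_self (τ : ℕ) (A : Finset (Zd d)) : Qt τ A A = tc τ A := by
  unfold Qt tc
  refine Finset.sum_congr rfl fun x hx => ?_
  rw [HH_eq_one hx, mul_one]

/-- standing assumptions on the parameters -/
structure GP (d : ℕ) [Fact (4 ≤ d)] (P : Prm) (κ : ℕ → ℝ) (p : Traj d → ℝ) (s Lm α h kl k0 : ℝ) (g1 : ℕ) : Prop where
  hκ : ∀ L, 0 ≤ κ L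
  hI : ∀ L ∈ P.I, (L : ℝ) ≤ Lm
  hLm : 0 ≤ Lm
  hkl : ∑ L ∈ P.I, κ L * L ≤ kl
  hk0 : ∑ L ∈ P.I, κ L ≤ k0
  hτ : 1 ≤ P.τ
  hα : 0 ≤ α
  hQ : QF d P.τ P.q P.C P.g P.β Lm α
  hQ1 : QF d P.τ P.q P.C (P.g - g1) P.β Lm α
  hg1 : 1 ≤ g1
  hg : g1 ≤ P.g
  hq : 0 ≤ P.q
  hqc : P.q < P.c
  hh : 0 < h
  ha : P.a = 4 * h
  hs0 : 0 ≤ s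
  hs1 : s ≤ 1
  hp0 : ∀ η, 0 ≤ p η
  hp1 : ∀ η, p η ≤ 1
  hpl : ∀ η, ValidTraj η → len η ∈ P.I → (1 - s) * lam κ η ≤ p η
  hpu : ∀ η, ValidTraj η → len η ∈ P.I → p η ≤ lam κ η

/-- assumptions on the weight function -/
structure GPsi (P : Prm) (φ : ℕ → ℝ) (Lm : ℝ) (ψ : Zd d → ℝ) : Prop where
  h0 : ∀ x, 0 ≤ ψ x
  h1 : ∀ x, ψ x ≤ 1
  hφ : ∀ l, 0 ≤ φ l
  core : ∀ (l : ℕ) (x : Zd d), (l : ℝ) ≤ Lm → φ l * ψ x ≤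
    Ex l (fun s => wt ψ (ch P.g P.β (tr x s)) * ind (tc P.τ (ch P.g P.β (tr x s)) ≤ P.C ∧ P.c ≤ wt ψ (ch P.g P.β (tr x s))))

/-- assumptions on the current seeds -/
structure GA (P : Prm) (A N D : Finset (Finset (Zd d))) (used : Finset (Traj d)) (cd n1 n2 : ℝ) : Prop where
  sub : A ⊆ D
  subN : N ⊆ D
  AN : A ⊆ N
  tcD : ∀ B ∈ D, tc P.τ B ≤ P.C
  cdD : ∀ B ∈ D, (B.card : ℝ) ≤ cd
  sep : ∀ B ∈ A, ∀ B' ∈ N, B ≠ B' → ¬ Qb P.τ P.q B B'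
  n1A : (A.card : ℝ) ≤ n1
  n2D : (D.card : ℝ) ≤ n2
  hu : ∀ η ∈ used, pdiam P.a η → ∀ B ∈ A, hits η (B : Set (Zd d)) → ∃ B' ∈ N, B' ≠ B ∧ hits η (B' : Set (Zd d))

section step
variable {P : Prm} {κ : ℕ → ℝ} {p : Traj d → ℝ} {s Lm α h kl k0 : ℝ} {g1 : ℕ}
  {φ : ℕ → ℝ} {ψ : Zd d → ℝ} {A N D : Finset (Finset (Zd d))} {used : Finset (Traj d)} {cd n1 n2 : ℝ}

lemma GP.kl0 (H : GP d P κ p s Lm α h kl k0 g1) : 0 ≤ kl :=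
  le_trans (Finset.sum_nonneg fun L _ => mul_nonneg (H.hκ L) (Nat.cast_nonneg L)) H.hkl
lemma GP.k00 (H : GP d P κ p s Lm α h kl k0 g1) : 0 ≤ k0 :=
  le_trans (Finset.sum_nonneg fun L _ => (H.hκ L)) H.hk0

lemma gp_bound (H : GP d P κ p s Lm α h kl k0 g1) {x y x' y' : ℝ} (hx : 0 ≤ x) (hy : 0 ≤ y) (hxx : x ≤ x') (hyy : y ≤ y') :
    (∑ L ∈ P.I, κ L * L) * x + (∑ L ∈ P.I, κ L) * y ≤ kl * x' + k0 * y' :=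
  add_le_add (mul_le_mul H.hkl hxx hx H.kl0) (mul_le_mul H.hk0 hyy hy H.k00)

lemma Lam_Q (H : GP d P κ p s Lm α h kl k0 g1) (HA : GA P A N D used cd n1 n2) {B F : Finset (Zd d)} (hB : B ∈ A)
    (hF : tc P.τ F ≤ P.C) :
    Lam κ P.I B (fun η => ind (Qb P.τ P.q (Fc P.g P.β B η) F)) ≤ kl * (P.C * α) + k0 * (P.τ * cd) := by
  refine (loss_Q H.hκ P.I B F P.τ H.hτ H.hI H.hα H.hQ hF).trans ?_
  have hα := H.hα
  have h1 := HA.tcD B (HA.sub hB)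
  have h2 := HA.cdD B (HA.sub hB)
  exact gp_bound H (mul_nonneg (tc_nonneg _ _) hα) (by positivity) (mul_le_mul_of_nonneg_right h1 hα) (by gcongr)

/-- error term for the mean -/
def errM (P : Prm) (kl k0 Lm h cd n2 α : ℝ) : ℝ :=
  2 * (kl * (P.C * (Lm / h ^ 2)) + k0 * (P.τ * cd)) + n2 * (kl * (2 * P.q) + k0 * (P.τ * (2 * cd))) +
    n2 * (kl * (P.C * α) + k0 * (P.τ * cd))

lemma Lam_main (H : GP d P κ p s Lm α h kl k0 g1) (Hψ : GPsi P φ Lm ψ) (HA : GA P A N D used cd n1 n2)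
    {B : Finset (Zd d)} (hB : B ∈ A) :
    (∑ L ∈ P.I, κ L * ∑ l ∈ Finset.range (L + 1), φ l) * wt ψ B - P.C * errM P kl k0 Lm h cd n2 α ≤
      Lam κ P.I B (fun η => wt ψ (Fc P.g P.β B η) * ind (Good P ψ D (Fc P.g P.β B η)) *
        ind (pdiam P.a η ∧ ∀ B' ∈ N, B' ≠ B → ¬ hits η (B' : Set (Zd d)))) := by
  have hC : 0 ≤ P.C := (tc_nonneg _ _).trans (HA.tcD B (HA.sub hB))
  have hcd : 0 ≤ cd := (Nat.cast_nonneg _).trans (HA.cdD B (HA.sub hB))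
  have hBt := HA.tcD B (HA.sub hB)
  have hBc := HA.cdD B (HA.sub hB)
  have hα := H.hα
  have hq := H.hq
  have hLm := H.hLm
  have hh := H.hh
  set w0 : Traj d → ℝ := fun η => wt ψ (Fc P.g P.β B η) * ind (tc P.τ (Fc P.g P.β B η) ≤ P.C ∧ P.c ≤ wt ψ (Fc P.g P.β B η)) with hw0
  set bad : Traj d → ℝ := fun η => ind (¬ pdiam (4 * h) η) + ∑ B' ∈ N.erase B, ind (hits η (B' : Set (Zd d))) +
    ∑ B' ∈ D, ind (Qb P.τ P.q (Fc P.g P.β B η) B') with hbad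
  have h1 : (∑ L ∈ P.I, κ L * ∑ l ∈ Finset.range (L + 1), φ l) * wt ψ B ≤ Lam κ P.I B w0 := by
    refine le_trans (le_of_eq ?_) (Lam_ge H.hκ P.I B w0 (fun l x => φ l * ψ x) (fun l x => mul_nonneg (Hψ.hφ l) (Hψ.h0 x)) ?_)
    · rw [Finset.sum_mul]
      refine Finset.sum_congr rfl fun L _ => ?_
      rw [mul_assoc]
      congr 1
      rw [wt, Finset.mul_sum]
      refine Finset.sum_congr rfl fun x _ => ?_
      rw [← Finset.sum_mul]
      ring
    · intro x hx q hq l hl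
      have hlm : (l : ℝ) ≤ Lm := le_trans (by push_cast; linarith [Nat.cast_nonneg (α := ℝ) q.length]) (H.hI _ hl)
      refine (Hψ.core l x hlm).trans (le_of_eq (Ex_congr fun s _ => ?_))
      simp only [hw0, Fc, dW_Th hx hq]
  have h2 : Lam κ P.I B bad ≤ errM P kl k0 Lm h cd n2 α := by
    simp only [hbad]
    rw [Lam_add, Lam_add, Lam_sum, Lam_sum]
    unfold errM
    refine add_le_add (add_le_add ?_ ?_) ?_
    · refine (loss_diam H.hκ P.I B P.τ H.hτ H.hh H.hI H.hLm).trans ?_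
      refine mul_le_mul_of_nonneg_left ?_ (by norm_num)
      exact gp_bound H (mul_nonneg (tc_nonneg _ _) (by positivity)) (by positivity)
        (mul_le_mul_of_nonneg_right hBt (by positivity)) (by gcongr)
    · have : ∀ B' ∈ N.erase B, Lam κ P.I B (fun η => ind (hits η (B' : Set (Zd d)))) ≤ kl * (2 * P.q) + k0 * (P.τ * (2 * cd)) := by
        intro B' hB'
        rw [Finset.mem_erase] at hB'
        refine (loss_hit H.hκ P.I B B' P.τ H.hτ).trans ?_
        have hs := HA.sep B hB B' hB'.2 (Ne.symm hB'.1)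
        unfold Qb at hs
        push Not at hs
        have := HA.cdD B' (HA.subN hB'.2)
        exact gp_bound H (add_nonneg (Qt_nonneg _ _ _) (Qt_nonneg _ _ _)) (by positivity) (by linarith [hs.1, hs.2])
          (mul_le_mul_of_nonneg_left (by linarith) (by positivity))
      refine (Finset.sum_le_card_nsmul _ _ _ this).trans ?_
      rw [nsmul_eq_mul]
      refine mul_le_mul_of_nonneg_right ?_ ?_
      · refine le_trans ?_ HA.n2D
        exact_mod_cast Finset.card_le_card ((Finset.erase_subset _ _).trans HA.subN)
      · have := H.kl0; have := H.k00; positivity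
    · have : ∀ B' ∈ D, Lam κ P.I B (fun η => ind (Qb P.τ P.q (Fc P.g P.β B η) B')) ≤ kl * (P.C * α) + k0 * (P.τ * cd) :=
        fun B' hB' => Lam_Q H HA hB (HA.tcD B' hB')
      refine (Finset.sum_le_card_nsmul _ _ _ this).trans ?_
      rw [nsmul_eq_mul]
      refine mul_le_mul_of_nonneg_right HA.n2D ?_
      have := H.kl0; have := H.k00; positivity
  have h3 : Lam κ P.I B w0 ≤ Lam κ P.I B (fun η => wt ψ (Fc P.g P.β B η) * ind (Good P ψ D (Fc P.g P.β B η)) *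
        ind (pdiam P.a η ∧ ∀ B' ∈ N, B' ≠ B → ¬ hits η (B' : Set (Zd d))) + P.C * bad η) := by
    refine Lam_mono H.hκ P.I B fun η hη => ?_
    have hw : 0 ≤ wt ψ (Fc P.g P.β B η) := wt_nonneg ψ Hψ.h0 _
    have b0 : 0 ≤ ind (¬ pdiam (4 * h) η) := ind_nonneg _
    have b1 : 0 ≤ ∑ B' ∈ N.erase B, ind (hits η (B' : Set (Zd d))) := Finset.sum_nonneg fun _ _ => ind_nonneg _
    have b2 : 0 ≤ ∑ B' ∈ D, ind (Qb P.τ P.q (Fc P.g P.β B η) B') := Finset.sum_nonneg fun _ _ => ind_nonneg _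
    have hl : 0 ≤ wt ψ (Fc P.g P.β B η) * ind (Good P ψ D (Fc P.g P.β B η)) *
        ind (pdiam P.a η ∧ ∀ B' ∈ N, B' ≠ B → ¬ hits η (B' : Set (Zd d))) :=
      mul_nonneg (mul_nonneg hw (ind_nonneg _)) (ind_nonneg _)
    simp only [hw0]
    by_cases hg : tc P.τ (Fc P.g P.β B η) ≤ P.C ∧ P.c ≤ wt ψ (Fc P.g P.β B η)
    · rw [ind_pos hg, mul_one]
      have hwC : wt ψ (Fc P.g P.β B η) ≤ P.C := (wt_le_cp ψ Hψ.h1 _).trans ((cp_le_tc P.τ _).trans hg.1)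
      have key : 1 ≤ bad η → wt ψ (Fc P.g P.β B η) ≤ P.C * bad η := fun hb => by nlinarith
      by_cases c0 : pdiam (4 * h) η
      · by_cases c1 : ∀ B' ∈ N, B' ≠ B → ¬ hits η (B' : Set (Zd d))
        · by_cases c2 : ∀ B' ∈ D, ¬ Qb P.τ P.q (Fc P.g P.β B η) B'
          · have e1 : Good P ψ D (Fc P.g P.β B η) := ⟨hg.1, hg.2, c2⟩
            rw [ind_pos e1, ind_pos ⟨by rw [H.ha]; exact c0, c1⟩]
            have : 0 ≤ P.C * bad η := mul_nonneg hC (by simp only [hbad]; positivity)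
            linarith
          · push Not at c2
            obtain ⟨B', hB', hQ⟩ := c2
            have : 1 ≤ ∑ B' ∈ D, ind (Qb P.τ P.q (Fc P.g P.β B η) B') := by
              rw [← ind_pos hQ]
              exact Finset.single_le_sum (f := fun B' => ind (Qb P.τ P.q (Fc P.g P.β B η) B')) (fun _ _ => ind_nonneg _) hB'
            linarith [key (by simp only [hbad]; linarith)]
        · push Not at c1
          obtain ⟨B', hB', hne, hQ⟩ := c1
          have : 1 ≤ ∑ B' ∈ N.erase B, ind (hits η (B' : Set (Zd d))) := by
            rw [← ind_pos hQ]
            exact Finset.single_le_sum (f := fun B' : Finset (Zd d) => ind (hits η (B' : Set (Zd d)))) (fun _ _ => ind_nonneg _)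
              (Finset.mem_erase.2 ⟨hne, hB'⟩)
          linarith [key (by simp only [hbad]; linarith)]
      · linarith [key (by simp only [hbad]; rw [ind_pos c0]; linarith)]
    · rw [ind_neg hg, mul_zero]
      have : 0 ≤ P.C * bad η := mul_nonneg hC (by simp only [hbad]; positivity)
      linarith
  rw [Lam_add, Lam_mul] at h3
  have := mul_le_mul_of_nonneg_left h2 hC
  linarith

/-- weight of the children -/
def Xw (P : Prm) (ψ : Zd d → ℝ) (A D : Finset (Finset (Zd d))) (η : Traj d) : ℝ :=
  ∑ b : Bool, wt ψ (Fd P (hull A) (η, b)) * ind (Good P ψ D (Fd P (hull A) (η, b)))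

lemma mean_ge (H : GP d P κ p s Lm α h kl k0 g1) (Hψ : GPsi P φ Lm ψ) (HA : GA P A N D used cd n1 n2) :
    2 * (1 - s) * ((∑ L ∈ P.I, κ L * ∑ l ∈ Finset.range (L + 1), φ l) * (∑ B ∈ A, wt ψ B) -
      A.card * (P.C * errM P kl k0 Lm h cd n2 α)) ≤ ∑ η ∈ cls P A used, p η * Xw P ψ A D η := by
  set v : Traj d → ℝ := fun η => wt ψ (Fc P.g P.β (hull A) η) * ind (Good P ψ D (Fc P.g P.β (hull A) η)) with hv
  have hv0 : ∀ η, 0 ≤ v η := fun η => mul_nonneg (wt_nonneg ψ Hψ.h0 _) (ind_nonneg _)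
  have hX : ∀ η, Xw P ψ A D η = v η + v η.reverse := by
    intro η
    simp [Xw, Fd, hv]
  have h1 : (1 - s) * (2 * ∑ η ∈ cls P A used, lam κ η * v η) ≤ ∑ η ∈ cls P A used, p η * Xw P ψ A D η := by
    have e : ∑ η ∈ cls P A used, lam κ η * v η.reverse = ∑ η ∈ cls P A used, lam κ η * v η := by
      refine Finset.sum_nbij' List.reverse List.reverse (fun η h => cls_rev h) (fun η h => cls_rev h)
        (by simp) (by simp) ?_
      intro η _
      rw [lam_rev]
    have : 2 * ∑ η ∈ cls P A used, lam κ η * v η = ∑ η ∈ cls P A used, lam κ η * Xw P ψ A D η := by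
      simp only [hX, mul_add, Finset.sum_add_distrib, e]
      ring
    rw [this, Finset.mul_sum]
    refine Finset.sum_le_sum fun η hη => ?_
    rw [mem_cls] at hη
    rw [← mul_assoc]
    refine mul_le_mul_of_nonneg_right (H.hpl η hη.1 hη.2.1) ?_
    rw [hX]
    exact add_nonneg (hv0 _) (hv0 _)
  have h2 : (∑ L ∈ P.I, κ L * ∑ l ∈ Finset.range (L + 1), φ l) * (∑ B ∈ A, wt ψ B) -
      A.card * (P.C * errM P kl k0 Lm h cd n2 α) ≤ ∑ η ∈ cls P A used, lam κ η * v η := by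
    have : (∑ L ∈ P.I, κ L * ∑ l ∈ Finset.range (L + 1), φ l) * (∑ B ∈ A, wt ψ B) -
      A.card * (P.C * errM P kl k0 Lm h cd n2 α) = ∑ B ∈ A, ((∑ L ∈ P.I, κ L * ∑ l ∈ Finset.range (L + 1), φ l) * wt ψ B -
        P.C * errM P kl k0 Lm h cd n2 α) := by
      rw [Finset.sum_sub_distrib, Finset.sum_const, nsmul_eq_mul, Finset.mul_sum]
    rw [this, cls_split]
    refine Finset.sum_le_sum fun B hB => (Lam_main H Hψ HA hB).trans ?_
    unfold Lam
    rw [← Finset.sum_subset (s₁ := (cls P A used).filter (fun η => hits η (B : Set (Zd d)))) (s₂ := HPs P.I B)]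
    · refine Finset.sum_le_sum fun η hη => ?_
      rw [Finset.mem_filter] at hη
      refine mul_le_mul_of_nonneg_left ?_ (lam_nonneg H.hκ η)
      simp only [hv, Fc, dW_hull hη.1 hB hη.2]
      refine mul_le_of_le_one_right (mul_nonneg (wt_nonneg ψ Hψ.h0 _) (ind_nonneg _)) (ind_le_one _)
    · intro η hη
      rw [Finset.mem_filter, mem_cls] at hη
      exact mem_HPs.2 ⟨hη.1.1, hη.1.2.1, hη.2⟩
    · intro η hη hn
      have hno : ¬ (pdiam P.a η ∧ ∀ B' ∈ N, B' ≠ B → ¬ hits η (B' : Set (Zd d))) := ?_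
      · simp only [ind_neg hno, mul_zero]
      rintro ⟨hd, hn2⟩
      apply hn
      rw [mem_HPs] at hη
      rw [Finset.mem_filter, mem_cls]
      refine ⟨⟨hη.1, hη.2.1, ⟨B, hB, hη.2.2⟩, ?_, hd, ?_, ?_⟩, hη.2.2⟩
      · have : ∀ B' ∈ A, hits η (B' : Set (Zd d)) → B' = B := by
          intro B' hB' hh
          by_contra hne
          exact hn2 B' (HA.AN hB') hne hh
        intro B1 h1 B2 h2 h3 h4
        rw [this B1 h1 h3, this B2 h2 h4]
      · intro hus
        obtain ⟨B', h1, h2, h3⟩ := HA.hu η hus hd B hB hη.2.2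
        exact hn2 B' h1 h2 h3
      · intro hus
        obtain ⟨B', h1, h2, h3⟩ := HA.hu _ hus (pdiam_rev.2 hd) B hB (hits_rev.2 hη.2.2)
        exact hn2 B' h1 h2 (hits_rev.1 h3)
  have hs : 0 ≤ 2 * (1 - s) := by linarith [H.hs1]
  have := mul_le_mul_of_nonneg_left h2 hs
  linarith

lemma sum_p_le (H : GP d P κ p s Lm α h kl k0 g1) (HA : GA P A N D used cd n1 n2) (hC : 0 ≤ P.C) (hcd : 0 ≤ cd) :
    ∑ η ∈ cls P A used, p η ≤ n1 * (kl * P.C + k0 * (P.τ * cd)) := by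
  have h1 := cls_le H.hκ p (fun _ _ => 1) (fun _ _ => zero_le_one) (P := P) (A := A) (used := used) (fun η hη B hB hh => by
    rw [mem_cls] at hη
    rw [mul_one]
    exact H.hpu η hη.1 hη.2.1)
  refine h1.trans ?_
  have : ∀ B ∈ A, Lam κ P.I B (fun _ => 1) ≤ kl * P.C + k0 * (P.τ * cd) := by
    intro B hB
    refine (Lam_le H.hκ P.I B (fun _ => 1) (fun _ => le_rfl) P.τ H.hτ (fun _ => 1) (fun _ => zero_le_one) ?_).trans ?_
    · intro x _ q _ l _
      rw [Ex_const]
    · have := HA.cdD B (HA.sub hB)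
      refine gp_bound H (Finset.sum_nonneg fun x _ => mul_nonneg (esc_nonneg _ _ _) zero_le_one) (by positivity) ?_ (by gcongr)
      simpa [tc] using HA.tcD B (HA.sub hB)
  refine (Finset.sum_le_card_nsmul _ _ _ this).trans ?_
  rw [nsmul_eq_mul]
  refine mul_le_mul_of_nonneg_right HA.n1A ?_
  have := H.kl0; have := H.k00; positivity

lemma sum_pQ_le (H : GP d P κ p s Lm α h kl k0 g1) (HA : GA P A N D used cd n1 n2) (hC : 0 ≤ P.C) (hcd : 0 ≤ cd)
    {F : Finset (Zd d)} (hF : tc P.τ F ≤ P.C) (b : Bool) :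
    ∑ η ∈ cls P A used, p η * ind (Qb P.τ P.q (Fd P (hull A) (η, b)) F) ≤ n1 * (kl * (P.C * α) + k0 * (P.τ * cd)) := by
  have hα := H.hα
  have fin : ∑ B ∈ A, Lam κ P.I B (fun η => ind (Qb P.τ P.q (Fc P.g P.β B η) F)) ≤ n1 * (kl * (P.C * α) + k0 * (P.τ * cd)) := by
    refine (Finset.sum_le_card_nsmul _ _ _ (fun B hB => Lam_Q H HA hB hF)).trans ?_
    rw [nsmul_eq_mul]
    refine mul_le_mul_of_nonneg_right HA.n1A ?_
    have := H.kl0; have := H.k00; positivity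
  refine le_trans ?_ fin
  cases b with
  | true =>
    refine cls_le H.hκ _ (fun B η => ind (Qb P.τ P.q (Fc P.g P.β B η) F)) (fun _ _ => ind_nonneg _) ?_
    intro η hη B hB hh
    have hm := mem_cls.1 hη
    simp only [Fd, if_true, Fc, dW_hull hη hB hh]
    exact mul_le_mul_of_nonneg_right (H.hpu η hm.1 hm.2.1) (ind_nonneg _)
  | false =>
    have := cls_le H.hκ (fun η => p η * ind (Qb P.τ P.q (Fd P (hull A) (η, false)) F))
      (fun B η => ind (Qb P.τ P.q (Fc P.g P.β B η.reverse) F)) (fun _ _ => ind_nonneg _) (P := P) (A := A) (used := used) ?_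
    · refine this.trans (le_of_eq (Finset.sum_congr rfl fun B _ => ?_))
      exact Lam_rev κ P.I B (fun η => ind (Qb P.τ P.q (Fc P.g P.β B η) F))
    · intro η hη B hB hh
      have hm := mem_cls.1 hη
      simp only [Fd, Fc, dW_hull (cls_rev hη) hB (hits_rev.2 hh), Bool.false_eq_true, if_false]
      exact mul_le_mul_of_nonneg_right (H.hpu η hm.1 hm.2.1) (ind_nonneg _)

lemma sum_sib_le (H : GP d P κ p s Lm α h kl k0 g1) (HA : GA P A N D used cd n1 n2) (hC : 0 ≤ P.C) (hcd : 0 ≤ cd) :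
    ∑ η ∈ cls P A used, p η * ind (tc P.τ (Fd P (hull A) (η, false)) ≤ P.C ∧
      Qb P.τ P.q (Fd P (hull A) (η, true)) (Fd P (hull A) (η, false))) ≤
      n1 * (kl * (P.C * (α + P.C * Gt d g1)) + k0 * (P.τ * cd)) := by
  have hα := H.hα
  have hG := Gt_nonneg (d := d) g1
  have h1 := cls_le H.hκ (fun η => p η * ind (tc P.τ (Fd P (hull A) (η, false)) ≤ P.C ∧
      Qb P.τ P.q (Fd P (hull A) (η, true)) (Fd P (hull A) (η, false))))
      (fun B η => ind (tc P.τ (Fc P.g P.β B η.reverse) ≤ P.C ∧ Qb P.τ P.q (Fc P.g P.β B η) (Fc P.g P.β B η.reverse)))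
      (fun _ _ => ind_nonneg _) (P := P) (A := A) (used := used) ?_
  · refine h1.trans ?_
    have : ∀ B ∈ A, Lam κ P.I B (fun η => ind (tc P.τ (Fc P.g P.β B η.reverse) ≤ P.C ∧ Qb P.τ P.q (Fc P.g P.β B η) (Fc P.g P.β B η.reverse)))
        ≤ (kl * (P.C * (α + P.C * Gt d g1)) + k0 * (P.τ * cd)) := by
      intro B hB
      have h1 := HA.tcD B (HA.sub hB)
      have h2 := HA.cdD B (HA.sub hB)
      have h3 : cp B ≤ P.C := (cp_le_tc P.τ B).trans h1
      have h4 := cp_nonneg B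
      have h5 := tc_nonneg P.τ B
      refine (loss_sib H.hκ P.I B P.τ H.hτ H.hI H.hα H.hq H.hg1 H.hg H.hQ1).trans ?_
      refine gp_bound H (by positivity) (by positivity) (by gcongr) (by gcongr)
    refine (Finset.sum_le_card_nsmul _ _ _ this).trans ?_
    rw [nsmul_eq_mul]
    refine mul_le_mul_of_nonneg_right HA.n1A ?_
    have := H.kl0; have := H.k00; positivity
  · intro η hη B hB hh
    have hm := mem_cls.1 hη
    simp only [Fd, Fc, dW_hull (cls_rev hη) hB (hits_rev.2 hh), dW_hull hη hB hh, Bool.false_eq_true, if_false, if_true]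
    exact mul_le_mul_of_nonneg_right (H.hpu η hm.1 hm.2.1) (ind_nonneg _)

lemma suc_of (hqc : P.q < P.c) (Hψ : GPsi P φ Lm ψ) {G : ℝ} {T : Finset (Traj d)}
    (hG : G ≤ ∑ η ∈ T, Xw P ψ A D η)
    (hNB : ∀ i ∈ T ×ˢ (Finset.univ : Finset Bool), ∀ j ∈ T ×ˢ (Finset.univ : Finset Bool), i ≠ j →
      Good P ψ D (Fd P (hull A) i) → Good P ψ D (Fd P (hull A) j) → ¬ Qb P.τ P.q (Fd P (hull A) i) (Fd P (hull A) j)) :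
    Suc P ψ A D G T := by
  constructor
  · intro F hF F' hF' hne
    simp only [kids, Finset.mem_image, Finset.mem_filter] at hF hF'
    obtain ⟨i, ⟨hi, hgi⟩, rfl⟩ := hF
    obtain ⟨j, ⟨hj, hgj⟩, rfl⟩ := hF'
    exact hNB i hi j hj (fun h => hne (by rw [h])) hgi hgj
  · refine hG.trans (le_of_eq ?_)
    rw [kids, Finset.sum_image, Finset.sum_filter, Finset.sum_product]
    · refine Finset.sum_congr rfl fun η _ => ?_
      refine Finset.sum_congr rfl fun b _ => ?_
      unfold ind
      split_ifs <;> simp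
    · intro i hi j hj hij
      simp only [Finset.coe_filter, Set.mem_ofPred_eq] at hi hj
      by_contra hne
      refine hNB i hi.1 j hj.1 hne hi.2 hj.2 ?_
      rw [← hij]
      left
      rw [Qt_self]
      exact hqc.trans_le (hi.2.2.1.trans ((wt_le_cp ψ Hψ.h1 _).trans (cp_le_tc _ _)))

lemma fail_prob (H : GP d P κ p s Lm α h kl k0 g1) (Hψ : GPsi P φ Lm ψ) (HA : GA P A N D used cd n1 n2)
    (hC : 0 ≤ P.C) (hcd : 0 ≤ cd) {G E0 : ℝ} (hG : 0 ≤ G) (hGE : G < E0)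
    (hE : E0 ≤ 2 * (1 - s) * ((∑ L ∈ P.I, κ L * ∑ l ∈ Finset.range (L + 1), φ l) * (∑ B ∈ A, wt ψ B) -
      A.card * (P.C * errM P kl k0 Lm h cd n2 α))) :
    EB p (cls P A used) (fun T => ind (¬ Suc P ψ A D G T)) ≤
      2 * P.C * E0 / (E0 - G) ^ 2 + n1 * (kl * (P.C * (α + P.C * Gt d g1)) + k0 * (P.τ * cd)) +
      (n1 * (kl * P.C + k0 * (P.τ * cd))) * (4 * (n1 * (kl * (P.C * α) + k0 * (P.τ * cd)))) := by
  set F := Fd P (hull A) with hF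
  set c1 : Traj d → ℝ := fun η => ind (tc P.τ (F (η, false)) ≤ P.C ∧ Qb P.τ P.q (F (η, true)) (F (η, false))) with hc1
  set c2 : Traj d → Traj d → ℝ := fun η η' => ∑ b' : Bool, ∑ b : Bool, ind (tc P.τ (F (η', b')) ≤ P.C) * ind (Qb P.τ P.q (F (η, b)) (F (η', b'))) with hc2
  have c2nn : ∀ η η', 0 ≤ c2 η η' := fun η η' => Finset.sum_nonneg fun _ _ => Finset.sum_nonneg fun _ _ =>
    mul_nonneg (ind_nonneg _) (ind_nonneg _)
  have main : ∀ T : Finset (Traj d), ind (¬ Suc P ψ A D G T) ≤ ind (∑ η ∈ T, Xw P ψ A D η < G) + (∑ η ∈ T, c1 η +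
      ∑ η ∈ T, ∑ η' ∈ T.erase η, c2 η η') := by
    intro T
    have n1 : 0 ≤ ∑ η ∈ T, c1 η := Finset.sum_nonneg fun _ _ => ind_nonneg _
    have n2 : 0 ≤ ∑ η ∈ T, ∑ η' ∈ T.erase η, c2 η η' := Finset.sum_nonneg fun _ _ => Finset.sum_nonneg fun _ _ => c2nn _ _
    have n0 := ind_nonneg (∑ η ∈ T, Xw P ψ A D η < G)
    by_cases hS : Suc P ψ A D G T
    · rw [ind_neg (not_not.2 hS)]
      linarith
    rw [ind_pos hS]
    by_cases hlt : ∑ η ∈ T, Xw P ψ A D η < G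
    · rw [ind_pos hlt]; linarith
    have : ¬ (∀ i ∈ T ×ˢ (Finset.univ : Finset Bool), ∀ j ∈ T ×ˢ (Finset.univ : Finset Bool), i ≠ j →
      Good P ψ D (Fd P (hull A) i) → Good P ψ D (Fd P (hull A) j) → ¬ Qb P.τ P.q (Fd P (hull A) i) (Fd P (hull A) j)) :=
      fun hNB => hS (suc_of H.hqc Hψ (not_lt.1 hlt) hNB)
    push Not at this
    obtain ⟨⟨η, b⟩, hi, ⟨η', b'⟩, hj, hne, hgi, hgj, hQ⟩ := this
    rw [Finset.mem_product] at hi hj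
    by_cases he : η = η'
    · subst he
      have hone : c1 η = 1 := by
        refine ind_pos ?_
        cases b <;> cases b'
        · exact absurd rfl hne
        · exact ⟨hgi.1, Qb_symm.1 hQ⟩
        · exact ⟨hgj.1, hQ⟩
        · exact absurd rfl hne
      have := Finset.single_le_sum (f := c1) (fun _ _ => ind_nonneg _) hi.1
      linarith
    · have hone : 1 ≤ c2 η η' := by
        have e : ind (tc P.τ (F (η', b')) ≤ P.C) * ind (Qb P.τ P.q (F (η, b)) (F (η', b'))) = 1 := by
          rw [ind_pos hgj.1, ind_pos hQ, mul_one]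
        rw [← e]
        refine le_trans ?_ (Finset.single_le_sum (f := fun b' => ∑ b : Bool, ind (tc P.τ (F (η', b')) ≤ P.C) * ind (Qb P.τ P.q (F (η, b)) (F (η', b'))))
          (fun _ _ => Finset.sum_nonneg fun _ _ => mul_nonneg (ind_nonneg _) (ind_nonneg _)) (Finset.mem_univ b'))
        exact Finset.single_le_sum (f := fun b => ind (tc P.τ (F (η', b')) ≤ P.C) * ind (Qb P.τ P.q (F (η, b)) (F (η', b'))))
          (fun _ _ => mul_nonneg (ind_nonneg _) (ind_nonneg _)) (Finset.mem_univ b)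
      have s1 := Finset.single_le_sum (f := fun η' => c2 η η') (fun _ _ => c2nn _ _) (Finset.mem_erase.2 ⟨Ne.symm he, hj.1⟩)
      have s2 := Finset.single_le_sum (f := fun η => ∑ η' ∈ T.erase η, c2 η η')
        (fun _ _ => Finset.sum_nonneg fun _ _ => c2nn _ _) hi.1
      simp only at s1 s2
      linarith
  refine (EB_mono H.hp0 H.hp1 _ (fun T _ => main T)).trans ?_
  have hpairs : EB p (cls P A used) (fun T => ∑ η ∈ T, ∑ η' ∈ T.erase η, c2 η η') =
      ∑ a ∈ cls P A used, ∑ b ∈ (cls P A used).erase a, p a * p b * c2 a b := by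
    convert EB_pairs (cls P A used) c2
  rw [EB_add, EB_add, EB_sum, hpairs, ← add_assoc]
  have hXC : ∀ η ∈ cls P A used, Xw P ψ A D η ≤ 2 * P.C := by
    intro η _
    have : ∀ b : Bool, wt ψ (Fd P (hull A) (η, b)) * ind (Good P ψ D (Fd P (hull A) (η, b))) ≤ P.C := by
      intro b
      by_cases hg : Good P ψ D (Fd P (hull A) (η, b))
      · rw [ind_pos hg, mul_one]
        exact (wt_le_cp ψ Hψ.h1 _).trans ((cp_le_tc P.τ _).trans hg.1)
      · rw [ind_neg hg, mul_zero]; exact hC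
    have h1 := this true
    have h2 := this false
    simp only [Xw, Fintype.sum_bool]
    linarith
  refine add_le_add (add_le_add ?_ (sum_sib_le H HA hC hcd)) ?_
  · exact EB_cheb H.hp0 H.hp1 _ (fun η _ => Finset.sum_nonneg fun _ _ => mul_nonneg (wt_nonneg ψ Hψ.h0 _) (ind_nonneg _))
      hXC hG hGE (hE.trans (mean_ge H Hψ HA))
  · have hb : ∀ η', ∑ η ∈ cls P A used, p η * c2 η η' ≤ 4 * (n1 * (kl * (P.C * α) + k0 * (P.τ * cd))) := by
      intro η'
      have hnn : 0 ≤ n1 * (kl * (P.C * α) + k0 * (P.τ * cd)) := by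
        have := H.kl0; have := H.k00; have := H.hα
        have : 0 ≤ n1 := le_trans (Nat.cast_nonneg _) HA.n1A
        positivity
      have : ∀ b b' : Bool, ∑ η ∈ cls P A used, p η * (ind (tc P.τ (F (η', b')) ≤ P.C) * ind (Qb P.τ P.q (F (η, b)) (F (η', b')))) ≤
          n1 * (kl * (P.C * α) + k0 * (P.τ * cd)) := by
        intro b b'
        by_cases ht : tc P.τ (F (η', b')) ≤ P.C
        · simp only [ind_pos ht, one_mul]
          exact sum_pQ_le H HA hC hcd ht b
        · simp only [ind_neg ht, zero_mul, mul_zero, Finset.sum_const_zero]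
          exact hnn
      simp only [hc2, Fintype.sum_bool, mul_add, Finset.sum_add_distrib]
      linarith [this true true, this true false, this false true, this false false]
    calc ∑ a ∈ cls P A used, ∑ b ∈ (cls P A used).erase a, p a * p b * c2 a b
        ≤ ∑ a ∈ cls P A used, ∑ b ∈ cls P A used, p a * p b * c2 a b := by
          refine Finset.sum_le_sum fun a _ => Finset.sum_le_sum_of_subset_of_nonneg (Finset.erase_subset _ _) ?_
          exact fun b _ _ => mul_nonneg (mul_nonneg (H.hp0 a) (H.hp0 b)) (c2nn a b)
      _ = ∑ b ∈ cls P A used, p b * ∑ a ∈ cls P A used, p a * c2 a b := by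
          rw [Finset.sum_comm]
          refine Finset.sum_congr rfl fun b _ => ?_
          rw [Finset.mul_sum]
          exact Finset.sum_congr rfl fun a _ => by ring
      _ ≤ ∑ b ∈ cls P A used, p b * (4 * (n1 * (kl * (P.C * α) + k0 * (P.τ * cd)))) :=
          Finset.sum_le_sum fun b _ => mul_le_mul_of_nonneg_left (hb b) (H.hp0 b)
      _ ≤ _ := by
          rw [← Finset.sum_mul]
          refine mul_le_mul_of_nonneg_right (sum_p_le H HA hC hcd) ?_
          have := H.kl0; have := H.k00; have := H.hα
          have : 0 ≤ n1 := le_trans (Nat.cast_nonneg _) HA.n1A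
          positivity

end step
end

section
variable {d : ℕ}

/-! ## F11: exploration lemma -/

/-- occupation probability -/
def pocc (ι : Traj d → ℝ) (η : Traj d) : ℝ := 1 - Real.exp (-(ι η))

lemma pocc_nonneg {ι : Traj d → ℝ} (hι : ∀ η, 0 ≤ ι η) (η : Traj d) : 0 ≤ pocc ι η := by
  have : Real.exp (-(ι η)) ≤ 1 := Real.exp_le_one_iff.2 (by linarith [hι η])
  unfold pocc; linarith

lemma pocc_le_one (ι : Traj d → ℝ) (η : Traj d) : pocc ι η ≤ 1 := by
  unfold pocc; linarith [Real.exp_pos (-(ι η))]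

/-- empty on `Z`, occupied on `O` -/
def ZO (Z O : Finset (Traj d)) : Set (Config d) := {ω | (∀ η ∈ Z, ω η = 0) ∧ ∀ η ∈ O, 0 < ω η}

lemma ZO_meas (Z O : Finset (Traj d)) : MeasurableSet (ZO Z O) := by
  have : ZO Z O = (⋂ η ∈ Z, {ω : Config d | ω η = 0}) ∩ ⋂ η ∈ O, {ω : Config d | 0 < ω η} := by
    ext ω
    simp [ZO]
  rw [this]
  refine MeasurableSet.inter ?_ ?_
  · refine Finset.measurableSet_biInter _ fun η _ => ?_
    exact (measurable_pi_apply η) (measurableSet_singleton 0)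
  · refine Finset.measurableSet_biInter _ fun η _ => ?_
    exact (measurable_pi_apply η) (MeasurableSet.of_discrete (s := {n : ℕ | 0 < n}))

lemma ZO_prob {ι : Traj d → ℝ} {P : Measure (Config d)} (hP : IsPoissonPP d ι P) (O : Finset (Traj d)) :
    ∀ Z : Finset (Traj d), Disjoint Z O →
      P.real (ZO Z O) = (∏ η ∈ Z, (1 - pocc ι η)) * ∏ η ∈ O, pocc ι η := by
  haveI := hP.1
  induction O using Finset.induction_on with
  | empty =>
    intro Z _
    have h := hP.2 Z (fun _ => 0)
    have e : ZO Z ∅ = {ω : Config d | ∀ η ∈ Z, ω η = 0} := by ext ω; simp [ZO]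
    rw [e, Measure.real, h, ENNReal.toReal_prod]
    simp only [poissonProb, pow_zero, mul_one, Nat.factorial_zero, Nat.cast_one, div_one, Finset.prod_empty, pocc, sub_sub_cancel]
    refine Finset.prod_congr rfl fun η _ => ?_
    rw [ENNReal.toReal_ofReal (Real.exp_pos _).le]
  | insert a O ha ih =>
    intro Z hZ
    rw [Finset.disjoint_insert_right] at hZ
    have e : ZO Z (insert a O) = ZO Z O \ ZO (insert a Z) O := by
      ext ω
      simp only [ZO, Set.mem_diff, Set.mem_ofPred_eq, Finset.forall_mem_insert, Nat.pos_iff_ne_zero]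
      tauto
    have hsub : ZO (insert a Z) O ⊆ ZO Z O := by
      rintro ω ⟨h1, h2⟩
      exact ⟨fun η hη => h1 η (Finset.mem_insert_of_mem hη), h2⟩
    rw [e, measureReal_diff hsub (ZO_meas _ _), ih Z hZ.2, ih (insert a Z) (Finset.disjoint_insert_left.2 ⟨ha, hZ.2⟩),
      Finset.prod_insert hZ.1, Finset.prod_insert ha]
    ring

/-- the set of configurations with occupied part `O` of `U` -/
def Cyl (U O : Finset (Traj d)) : Set (Config d) := ZO (U \ O) O

lemma Cyl_prob {ι : Traj d → ℝ} {P : Measure (Config d)} (hP : IsPoissonPP d ι P) {U O : Finset (Traj d)} (h : O ⊆ U) :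
    P (Cyl U O) = ENNReal.ofReal (prB (pocc ι) U O) := by
  haveI := hP.1
  have h1 := ZO_prob hP O (U \ O) Finset.sdiff_disjoint
  have h2 : prB (pocc ι) U O = (∏ η ∈ U \ O, (1 - pocc ι η)) * ∏ η ∈ O, pocc ι η := by
    unfold prB
    rw [← Finset.prod_sdiff h]
    congr 1
    · refine Finset.prod_congr rfl fun η hη => ?_
      rw [if_neg (Finset.mem_sdiff.1 hη).2]
    · exact Finset.prod_congr rfl fun η hη => if_pos hη
  rw [h2, ← h1, Cyl, ofReal_measureReal]

lemma prB_union (p : Traj d → ℝ) {U V O T : Finset (Traj d)} (hUV : Disjoint U V) (hO : O ⊆ U) (hT : T ⊆ V) :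
    prB p (U ∪ V) (O ∪ T) = prB p U O * prB p V T := by
  unfold prB
  rw [Finset.prod_union hUV]
  congr 1
  · refine Finset.prod_congr rfl fun η hη => ?_
    have : η ∉ T := fun h => (Finset.disjoint_left.1 hUV hη) (hT h)
    simp [this]
  · refine Finset.prod_congr rfl fun η hη => ?_
    have : η ∉ O := fun h => (Finset.disjoint_right.1 hUV hη) (hO h)
    simp [this]

section expl
variable {σ : Type*} (cl us : σ → Finset (Traj d)) (stp : σ → Finset (Traj d) → σ)

/-- observed set -/
def obs (ω : Config d) (s : σ) : Finset (Traj d) := (cl s).filter (fun η => 0 < ω η)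

/-- one step of the exploration -/
def nxt (ω : Config d) (s : σ) : σ := stp s (obs cl ω s)

lemma explore_aux {ι : Traj d → ℝ} (hι : ∀ η, 0 ≤ ι η) {P : Measure (Config d)} (hP : IsPoissonPP d ι P)
    (Inv : σ → Prop) (Bad : σ → Finset (Traj d) → Prop) {δ : ℝ} (hδ : 0 ≤ δ)
    (hcl : ∀ s, Inv s → Disjoint (us s) (cl s))
    (hus : ∀ s T, Inv s → T ⊆ cl s → us (stp s T) = us s ∪ cl s)
    (hinv : ∀ s T, Inv s → T ⊆ cl s → Inv (stp s T))
    (hbad : ∀ s, Inv s → EB (pocc ι) (cl s) (fun T => ind (Bad s T)) ≤ δ) (n : ℕ) :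
    ∀ (S : ℕ → Bool) (s : σ) (O : Finset (Traj d)), Inv s → O ⊆ us s →
      P (Cyl (us s) O ∩ {ω | ∀ k < n, S k = true → Bad ((nxt cl stp ω)^[k] s) (obs cl ω ((nxt cl stp ω)^[k] s))}) ≤
        ENNReal.ofReal (prB (pocc ι) (us s) O * δ ^ (∑ k ∈ Finset.range n, if S k then 1 else 0)) := by
  have hp0 := pocc_nonneg hι
  have hp1 := pocc_le_one ι
  induction n with
  | zero =>
    intro S s O hs hO
    refine (measure_mono Set.inter_subset_left).trans ?_
    rw [Cyl_prob hP hO]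
    simp
  | succ n ih =>
    intro S s O hs hO
    set m := ∑ k ∈ Finset.range n, if S (k + 1) then 1 else 0 with hm
    set 𝒯 := (cl s).powerset.filter (fun T => S 0 = true → Bad s T) with h𝒯
    have hsub : (Cyl (us s) O ∩ {ω | ∀ k < n + 1, S k = true → Bad ((nxt cl stp ω)^[k] s) (obs cl ω ((nxt cl stp ω)^[k] s))}) ⊆
        ⋃ T ∈ 𝒯, (Cyl (us (stp s T)) (O ∪ T) ∩ {ω | ∀ k < n, S (k + 1) = true →
          Bad ((nxt cl stp ω)^[k] (stp s T)) (obs cl ω ((nxt cl stp ω)^[k] (stp s T)))}) := by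
      rintro ω ⟨⟨h1, h2⟩, h3⟩
      have hT : obs cl ω s ⊆ cl s := Finset.filter_subset _ _
      refine Set.mem_iUnion₂.2 ⟨obs cl ω s, ?_, ⟨?_, ?_⟩, ?_⟩
      · rw [h𝒯, Finset.mem_filter, Finset.mem_powerset]
        exact ⟨hT, fun h0 => h3 0 (by omega) h0⟩
      · intro η hη
        rw [hus s _ hs hT, Finset.mem_sdiff, Finset.mem_union, Finset.mem_union] at hη
        push Not at hη
        rcases hη.1 with h | h
        · exact h1 η (Finset.mem_sdiff.2 ⟨h, hη.2.1⟩)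
        · have := hη.2.2
          simp only [obs, Finset.mem_filter, not_and, not_lt] at this
          exact Nat.le_zero.1 (this h)
      · intro η hη
        rcases Finset.mem_union.1 hη with h | h
        · exact h2 η h
        · exact (Finset.mem_filter.1 h).2
      · intro k hk hS
        have := h3 (k + 1) (by omega) hS
        rw [Function.iterate_succ_apply] at this
        exact this
    refine (measure_mono hsub).trans ((measure_biUnion_finset_le _ _).trans ?_)
    have hterm : ∀ T ∈ 𝒯, P (Cyl (us (stp s T)) (O ∪ T) ∩ {ω | ∀ k < n, S (k + 1) = true →
          Bad ((nxt cl stp ω)^[k] (stp s T)) (obs cl ω ((nxt cl stp ω)^[k] (stp s T)))}) ≤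
        ENNReal.ofReal (prB (pocc ι) (us s) O * prB (pocc ι) (cl s) T * δ ^ m) := by
      intro T hT
      rw [h𝒯, Finset.mem_filter, Finset.mem_powerset] at hT
      refine (ih (fun k => S (k + 1)) (stp s T) (O ∪ T) (hinv s T hs hT.1) ?_).trans (le_of_eq ?_)
      · rw [hus s T hs hT.1]
        exact Finset.union_subset_union hO hT.1
      · rw [hus s T hs hT.1, prB_union _ (hcl s hs) hO hT.1]
    refine (Finset.sum_le_sum hterm).trans ?_
    rw [← ENNReal.ofReal_sum_of_nonneg]
    · refine ENNReal.ofReal_le_ofReal ?_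
      rw [Finset.sum_range_succ']
      have e : ∑ T ∈ 𝒯, prB (pocc ι) (us s) O * prB (pocc ι) (cl s) T * δ ^ m =
          prB (pocc ι) (us s) O * δ ^ m * ∑ T ∈ 𝒯, prB (pocc ι) (cl s) T := by
        rw [Finset.mul_sum]
        exact Finset.sum_congr rfl fun T _ => by ring
      rw [e, pow_add, ← mul_assoc]
      refine mul_le_mul_of_nonneg_left ?_ (mul_nonneg (prB_nonneg hp0 hp1 _ _) (pow_nonneg hδ _))
      by_cases h0 : S 0 = true
      · simp only [h0, if_true, pow_one]
        refine le_trans (le_of_eq ?_) (hbad s hs)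
        rw [h𝒯, Finset.sum_filter, EB]
        refine Finset.sum_congr rfl fun T _ => ?_
        unfold ind
        by_cases hB : Bad s T <;> simp [h0, hB]
      · simp only [h0, Bool.false_eq_true, if_false, pow_zero]
        rw [← EB_one (pocc ι) (cl s), EB]
        simp only [mul_one]
        exact Finset.sum_le_sum_of_subset_of_nonneg (Finset.filter_subset _ _) fun T _ _ => prB_nonneg hp0 hp1 _ _
    · intro T _
      exact mul_nonneg (mul_nonneg (prB_nonneg hp0 hp1 _ _) (prB_nonneg hp0 hp1 _ _)) (pow_nonneg hδ _)

lemma explore {ι : Traj d → ℝ} (hι : ∀ η, 0 ≤ ι η) {P : Measure (Config d)} (hP : IsPoissonPP d ι P)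
    (Inv : σ → Prop) (Bad : σ → Finset (Traj d) → Prop) {δ : ℝ} (hδ : 0 ≤ δ)
    (hcl : ∀ s, Inv s → Disjoint (us s) (cl s))
    (hus : ∀ s T, Inv s → T ⊆ cl s → us (stp s T) = us s ∪ cl s)
    (hinv : ∀ s T, Inv s → T ⊆ cl s → Inv (stp s T))
    (hbad : ∀ s, Inv s → EB (pocc ι) (cl s) (fun T => ind (Bad s T)) ≤ δ) (s : σ) (hs : Inv s) (h0 : us s = ∅)
    (S : Finset ℕ) :
    P {ω | ∀ k ∈ S, Bad ((nxt cl stp ω)^[k] s) (obs cl ω ((nxt cl stp ω)^[k] s))} ≤ ENNReal.ofReal (δ ^ S.card) := by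
  obtain ⟨n, hn⟩ : ∃ n, S ⊆ Finset.range n := by
    refine ⟨S.sup id + 1, fun x hx => ?_⟩
    rw [Finset.mem_range, Nat.lt_succ_iff]
    exact Finset.le_sup (f := id) hx
  have h := explore_aux cl us stp hι hP Inv Bad hδ hcl hus hinv hbad n (fun k => decide (k ∈ S)) s ∅ hs (by simp)
  have hc : ∑ k ∈ Finset.range n, (if decide (k ∈ S) = true then 1 else 0) = S.card := by
    simp only [decide_eq_true_eq]
    rw [← Finset.sum_filter, Finset.sum_const, smul_eq_mul, mul_one]
    congr 1
    ext k
    simp only [Finset.mem_filter]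
    exact ⟨fun h => h.2, fun h => ⟨hn h, h⟩⟩
  rw [hc, h0] at h
  have hp : prB (pocc ι) (∅ : Finset (Traj d)) ∅ = 1 := by simp [prB]
  rw [hp, one_mul] at h
  refine le_trans (measure_mono ?_) h
  intro ω hω
  refine ⟨by constructor <;> simp, ?_⟩
  intro k _ hk
  exact hω k (by simpa using hk)

end expl
end

/-! ## F12: Lipschitz paths of good sites -/

/-- sites reached from below -/
inductive Reach (Bd : ℕ × ℕ → Prop) : ℕ × ℕ → Prop
  | base (i : ℕ) : Reach Bd (i, 0)
  | up (i h : ℕ) : Reach Bd (i, h) → Bd (i, h) → Reach Bd (i, h + 1)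
  | down (i h : ℕ) : Reach Bd (i, h + 1) → Reach Bd (i, h)
  | right (i h : ℕ) : Reach Bd (i, h + 1) → Reach Bd (i + 1, h)
  | left (i h : ℕ) : Reach Bd (i + 1, h + 1) → Reach Bd (i, h)

lemma Reach_le {Bd : ℕ × ℕ → Prop} (hB : ∀ i h, Bd (i, h) → h ≤ i) {x : ℕ × ℕ} (h : Reach Bd x) : x.2 ≤ x.1 + 1 := by
  induction h with
  | base i => simp
  | up i h _ hb _ => have := hB i h hb; simp; omega
  | down i h _ ih => simp at *; omega
  | right i h _ ih => simp at *; omega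
  | left i h _ ih => simp at *; omega

lemma path_of_not_reach {Bd : ℕ × ℕ → Prop} (hB : ∀ i h, Bd (i, h) → h ≤ i) (h0 : ¬ Reach Bd (0, 1)) :
    ∃ f : ℕ → ℕ, f 0 = 0 ∧ (∀ i, f (i + 1) ≤ f i + 1 ∧ f i ≤ f (i + 1) + 1) ∧ ∀ i, f i ≤ i ∧ ¬ Bd (i, f i) := by
  set f : ℕ → ℕ := fun i => Nat.findGreatest (fun h => Reach Bd (i, h)) (i + 1) with hf
  have hR : ∀ i, Reach Bd (i, f i) := fun i =>
    Nat.findGreatest_spec (P := fun h => Reach Bd (i, h)) (Nat.zero_le _) (Reach.base i)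
  have hm : ∀ i h, Reach Bd (i, h) → h ≤ f i := fun i h hr =>
    Nat.le_findGreatest (P := fun h => Reach Bd (i, h)) (Reach_le hB hr) hr
  have hlip : ∀ i, f (i + 1) ≤ f i + 1 ∧ f i ≤ f (i + 1) + 1 := by
    intro i
    constructor
    · have := hR (i + 1)
      rcases hfi : f (i + 1) with _ | n
      · omega
      · rw [hfi] at this
        have := hm i n (Reach.left i n this)
        omega
    · have := hR i
      rcases hfi : f i with _ | n
      · omega
      · rw [hfi] at this
        have := hm (i + 1) n (Reach.right i n this)
        omega
  have hf0 : f 0 = 0 := by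
    have h1 := hR 0
    have h2 := Reach_le hB h1
    simp at h2
    rcases hfi : f 0 with _ | n
    · rfl
    · rw [hfi] at h1 h2
      have : n = 0 := by omega
      subst this
      exact absurd h1 h0
  refine ⟨f, hf0, hlip, fun i => ⟨?_, fun hb => ?_⟩⟩
  · induction i with
    | zero => omega
    | succ i ih => have := (hlip i).1; omega
  · have := hm i (f i + 1) (Reach.up i (f i) (hR i) hb)
    omega

/-- backward neighbours -/
def nbk (m : Fin 4) (x : ℕ × ℕ) : ℕ × ℕ :=
  if m = 0 then (x.1, x.2 - 1) else if m = 1 then (x.1, x.2 + 1) else if m = 2 then (x.1 - 1, x.2 + 1) else (x.1 + 1, x.2 + 1)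

/-- one backward step -/
def Bstep (Bd : ℕ × ℕ → Prop) (a b : ℕ × ℕ) : Prop :=
  (1 ≤ a.2 ∧ b = (a.1, a.2 - 1) ∧ Bd b) ∨ (b.2 = a.2 + 1 ∧ ∃ m, b = nbk m a)

lemma Bstep_nbk {Bd : ℕ × ℕ → Prop} {a b : ℕ × ℕ} (h : Bstep Bd a b) : ∃ m, b = nbk m a := by
  rcases h with ⟨_, h, _⟩ | ⟨_, h⟩
  · exact ⟨0, by simp [nbk, h]⟩
  · exact h

lemma Reach_list {Bd : ℕ × ℕ → Prop} {x : ℕ × ℕ} (h : Reach Bd x) :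
    ∃ l : List (ℕ × ℕ), (x :: l).Nodup ∧ (x :: l).IsChain (Bstep Bd) ∧ ((x :: l).getLast (by simp)).2 = 0 := by
  have key : ∀ x y : ℕ × ℕ, Bstep Bd y x →
      (∃ l : List (ℕ × ℕ), (x :: l).Nodup ∧ (x :: l).IsChain (Bstep Bd) ∧ ((x :: l).getLast (by simp)).2 = 0) →
      ∃ l : List (ℕ × ℕ), (y :: l).Nodup ∧ (y :: l).IsChain (Bstep Bd) ∧ ((y :: l).getLast (by simp)).2 = 0 := by
    rintro x y hs ⟨l, h1, h2, h3⟩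
    by_cases hy : y ∈ x :: l
    · obtain ⟨l1, l2, hl⟩ := List.append_of_mem hy
      refine ⟨l2, ?_, ?_, ?_⟩
      · rw [hl] at h1
        exact (List.nodup_append.1 h1).2.1
      · rw [hl] at h2
        exact (List.isChain_append.1 h2).2.1
      · simp only [hl] at h3
        rw [List.getLast_append_of_ne_nil _ (by simp)] at h3
        exact h3
    · refine ⟨x :: l, List.nodup_cons.2 ⟨hy, h1⟩, ?_, ?_⟩
      · rw [List.isChain_cons_cons]
        exact ⟨hs, h2⟩
      · rw [List.getLast_cons (by simp)]
        exact h3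
  induction h with
  | base i => exact ⟨[], by simp, by simp, by simp⟩
  | up i h _ hb ih => exact key _ _ (Or.inl ⟨by simp, by simp, by simpa using hb⟩) ih
  | down i h _ ih => exact key _ _ (Or.inr ⟨by simp, 1, by simp [nbk]⟩) ih
  | right i h _ ih => exact key _ _ (Or.inr ⟨by simp, 2, by simp [nbk]⟩) ih
  | left i h _ ih => exact key _ _ (Or.inr ⟨by simp, 3, by simp [nbk]⟩) ih

/-- candidate lists -/
def Cand : ℕ → ℕ × ℕ → Finset (List (ℕ × ℕ))
  | 0, x => {[x]}
  | n + 1, x => (Finset.univ : Finset (Fin 4)).biUnion (fun m => (Cand n (nbk m x)).image (fun l => x :: l))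

lemma Cand_card (n : ℕ) : ∀ x, (Cand n x).card ≤ 4 ^ n := by
  induction n with
  | zero => intro x; simp [Cand]
  | succ n ih =>
    intro x
    rw [Cand]
    refine Finset.card_biUnion_le.trans ?_
    calc _ ≤ ∑ m : Fin 4, 4 ^ n := Finset.sum_le_sum fun m _ => Finset.card_image_le.trans (ih _)
      _ = _ := by simp [pow_succ]; ring

lemma mem_Cand {Bd : ℕ × ℕ → Prop} (l : List (ℕ × ℕ)) : ∀ x, (x :: l).IsChain (Bstep Bd) → x :: l ∈ Cand l.length x := by
  induction l with
  | nil => intro x _; simp [Cand]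
  | cons y l ih =>
    intro x h
    rw [List.isChain_cons_cons] at h
    obtain ⟨m, hm⟩ := Bstep_nbk h.1
    rw [List.length_cons, Cand, Finset.mem_biUnion]
    refine ⟨m, Finset.mem_univ _, Finset.mem_image.2 ⟨y :: l, ?_, rfl⟩⟩
    rw [← hm]
    exact ih y h.2

/-- bad sites forced by the list -/
def ups : List (ℕ × ℕ) → Finset (ℕ × ℕ)
  | [] => ∅
  | [_] => ∅
  | a :: b :: l => if b.2 < a.2 then insert b (ups (b :: l)) else ups (b :: l)

lemma ups_sub : ∀ (a : ℕ × ℕ) (l : List (ℕ × ℕ)), ∀ z ∈ ups (a :: l), z ∈ l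
  | a, [] => by simp [ups]
  | a, b :: l => by
    intro z hz
    have ih := ups_sub b l
    rw [ups] at hz
    split_ifs at hz
    · rcases Finset.mem_insert.1 hz with h | h
      · simp [h]
      · exact List.mem_cons_of_mem _ (ih z h)
    · exact List.mem_cons_of_mem _ (ih z hz)

lemma ups_spec {Bd : ℕ × ℕ → Prop} : ∀ (l : List (ℕ × ℕ)) (a : ℕ × ℕ), (a :: l).Nodup → (a :: l).IsChain (Bstep Bd) →
    ((a :: l).getLast (by simp)).2 = 0 → (∀ z ∈ ups (a :: l), Bd z) ∧ l.length + a.2 = 2 * (ups (a :: l)).card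
  | [], a => by
    intro _ _ h
    simp at h
    simp [ups, h]
  | b :: l, a => by
    intro h1 h2 h3
    rw [List.isChain_cons_cons] at h2
    rw [List.getLast_cons (by simp)] at h3
    have h1' := List.nodup_cons.1 h1
    obtain ⟨i1, i2⟩ := ups_spec l b h1'.2 h2.2 h3
    rw [ups]
    rcases h2.1 with ⟨ha, hb, hBd⟩ | ⟨hb, _⟩
    · have hlt : b.2 < a.2 := by rw [hb]; simp; omega
      rw [if_pos hlt]
      have hnb : b ∉ ups (b :: l) := fun hh => (List.nodup_cons.1 h1'.2).1 (ups_sub b l b hh)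
      refine ⟨?_, ?_⟩
      · intro z hz
        rcases Finset.mem_insert.1 hz with h | h
        · rw [h]; exact hBd
        · exact i1 z h
      · rw [Finset.card_insert_of_notMem hnb, List.length_cons]
        have : b.2 = a.2 - 1 := by rw [hb]
        omega
    · rw [if_neg (by omega)]
      refine ⟨i1, ?_⟩
      rw [List.length_cons]
      omega

lemma reach_prob {Ω : Type*} [MeasurableSpace Ω] (P : Measure Ω) (Bd : Ω → ℕ × ℕ → Prop) {e : ℝ≥0∞} (he : e ≤ 1 / 16)
    (h : ∀ S : Finset (ℕ × ℕ), P {ω | ∀ z ∈ S, Bd ω z} ≤ (e ^ 2) ^ S.card) : P {ω | Reach (Bd ω) (0, 1)} ≤ 1 / 4 := by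
  have he1 : e ≤ 1 := he.trans (by simp)
  have hsub : {ω | Reach (Bd ω) (0, 1)} ⊆ ⋃ n : ℕ, ⋃ l ∈ (Cand n (0, 1)).filter (fun l => n + 1 ≤ 2 * (ups l).card),
      {ω | ∀ z ∈ ups l, Bd ω z} := by
    intro ω hω
    obtain ⟨l, h1, h2, h3⟩ := Reach_list hω
    obtain ⟨u1, u2⟩ := ups_spec l _ h1 h2 h3
    refine Set.mem_iUnion.2 ⟨l.length, Set.mem_iUnion₂.2 ⟨(0, 1) :: l, ?_, u1⟩⟩
    rw [Finset.mem_filter]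
    exact ⟨mem_Cand l _ h2, by simp at u2; omega⟩
  refine (measure_mono hsub).trans ((measure_iUnion_le _).trans ?_)
  have hn : ∀ n : ℕ, P (⋃ l ∈ (Cand n (0, 1)).filter (fun l => n + 1 ≤ 2 * (ups l).card),
      {ω | ∀ z ∈ ups l, Bd ω z}) ≤ (1 / 16) * (1 / 2) ^ n := by
    intro n
    refine (measure_biUnion_finset_le _ _).trans ?_
    have : ∀ l ∈ (Cand n (0, 1)).filter (fun l => n + 1 ≤ 2 * (ups l).card), P {ω | ∀ z ∈ ups l, Bd ω z} ≤ (1 / 16) ^ (n + 1) := by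
      intro l hl
      refine (h _).trans ?_
      rw [← pow_mul]
      refine (pow_le_pow_right_of_le_one' he1 (Finset.mem_filter.1 hl).2).trans ?_
      gcongr
    refine (Finset.sum_le_card_nsmul _ _ _ this).trans ?_
    rw [nsmul_eq_mul]
    calc (((Cand n (0, 1)).filter (fun l => n + 1 ≤ 2 * (ups l).card)).card : ℝ≥0∞) * (1 / 16) ^ (n + 1)
        ≤ (4 ^ n : ℕ) * (1 / 16) ^ (n + 1) := by
          gcongr
          exact (Finset.card_filter_le _ _).trans (Cand_card n _)
      _ = (1 / 16) * (4 * (1 / 16)) ^ n := by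
          push_cast
          rw [mul_pow, pow_succ]
          ring
      _ ≤ _ := by
          gcongr
          rw [ENNReal.le_div_iff_mul_le (by simp) (by simp)]
          rw [mul_assoc, mul_comm (1 / 16 : ℝ≥0∞), ← mul_assoc, mul_one_div]
          refine ENNReal.div_le_of_le_mul ?_
          norm_num
  refine (ENNReal.tsum_le_tsum hn).trans ?_
  rw [ENNReal.tsum_mul_left, ENNReal.tsum_geometric]
  have : (1 - 1 / 2 : ℝ≥0∞)⁻¹ = 2 := by
    rw [one_div, ENNReal.one_sub_inv_two, inv_inv]
  rw [this]
  rw [ENNReal.le_div_iff_mul_le (by simp) (by simp), mul_assoc, one_div, mul_comm, ← div_eq_mul_inv]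
  refine ENNReal.div_le_of_le_mul ?_
  norm_num

section
variable {d : ℕ} [Fact (4 ≤ d)]

/-! ## F13: the exploration as a state machine -/

/-- data of the exploration -/
structure Sys (d : ℕ) where
  P : Prm
  tg : ℕ → Finset ℕ
  ψ : ℕ → Zd d → ℝ
  th : ℕ → ℝ
  thn : ℕ → ℝ
  nm : ℕ
  nN : ℕ → Finset ℕ
  nD : ℕ → Finset ℕ
  reg : ℕ → Zd d → Prop

/-- states of the exploration -/
structure St (d : ℕ) where
  t : ℕ
  fam : ℕ → Finset (Finset (Zd d))
  used : Finset (Traj d)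

/-- admissible assignment of children to the targets -/
def OKN (S : Sys d) (t : ℕ) (K : Finset (Finset (Zd d))) (N' : ℕ → Finset (Finset (Zd d))) : Prop :=
  (∀ t' ∈ S.tg t, N' t' ⊆ K ∧ (N' t').card ≤ S.nm ∧ S.th t' ≤ ∑ B ∈ N' t', wt (S.ψ t') B) ∧
  (∀ t1 ∈ S.tg t, ∀ t2 ∈ S.tg t, t1 ≠ t2 → Disjoint (N' t1) (N' t2)) ∧
  (∀ F ∈ K, ∀ F' ∈ K, F ≠ F' → ¬ Qb S.P.τ S.P.q F F')

/-- children seen from a state -/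
def Sys.K (S : Sys d) (s : St d) (T : Finset (Traj d)) : Finset (Finset (Zd d)) :=
  kids S.P (S.ψ s.t) (s.fam s.t) ((S.nD s.t).biUnion s.fam) T

/-- examined trajectories at a state -/
def Sys.cl (S : Sys d) (s : St d) : Finset (Traj d) := cls S.P (s.fam s.t) s.used

/-- transition -/
def Sys.stp (S : Sys d) (s : St d) (T : Finset (Traj d)) : St d :=
  if h : s.fam s.t ≠ ∅ ∧ ∃ N', OKN S s.t (S.K s T) N' then
    ⟨s.t + 1, fun t' => if t' ∈ S.tg s.t then h.2.choose t' else s.fam t', s.used ∪ S.cl s⟩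
  else ⟨s.t + 1, s.fam, s.used ∪ S.cl s⟩

/-- failure at a state -/
def Sys.Bad (S : Sys d) (s : St d) (T : Finset (Traj d)) : Prop :=
  s.fam s.t ≠ ∅ ∧ ¬ ∃ N', OKN S s.t (S.K s T) N'

/-- invariant -/
structure Sys.Inv (S : Sys d) (cd : ℝ) (s : St d) : Prop where
  tcC : ∀ t', ∀ B ∈ s.fam t', tc S.P.τ B ≤ S.P.C ∧ (B.card : ℝ) ≤ cd ∧ S.P.q < tc S.P.τ B ∧ ∀ x ∈ B, S.reg t' x
  card : ∀ t', (s.fam t').card ≤ S.nm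
  thr : ∀ t', s.fam t' ≠ ∅ → S.th t' ≤ ∑ B ∈ s.fam t', wt (S.ψ t') B
  sep : ∀ t1, ∀ t2 ∈ S.nN t1, ∀ B1 ∈ s.fam t1, ∀ B2 ∈ s.fam t2, (t1 ≠ t2 ∨ B1 ≠ B2) → ¬ Qb S.P.τ S.P.q B1 B2
  us : ∀ η ∈ s.used, ∃ t0 < s.t, ∃ B ∈ s.fam t0, hits η (B : Set (Zd d))

/-- standing assumptions on the data -/
structure Sys.OK (S : Sys d) (p : Traj d → ℝ) (cd n2 δ : ℝ) : Prop where
  gt : ∀ t, ∀ t' ∈ S.tg t, t < t'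
  nsym : ∀ t1 t2, t2 ∈ S.nN t1 → t1 ∈ S.nN t2
  nself : ∀ t, t ∈ S.nN t
  nsub : ∀ t, S.nN t ⊆ S.nD t
  ntg : ∀ t, ∀ t' ∈ S.tg t, S.nN t' ⊆ S.nD t
  ncard : ∀ t, ((S.nD t).card : ℝ) * S.nm ≤ n2
  reg1 : ∀ t t0 x y, S.reg t x → S.reg t0 y → |((x (i0 d) : ℝ) - y (i0 d))| ≤ S.P.a → |((x (i1 d) : ℝ) - y (i1 d))| ≤ S.P.a → t0 ∈ S.nN t
  reg2 : ∀ t, ∀ t' ∈ S.tg t, ∀ x y, 0 < S.ψ t x → |((y (i0 d) : ℝ) - x (i0 d))| ≤ S.P.a → |((y (i1 d) : ℝ) - x (i1 d))| ≤ S.P.a → S.reg t' y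
  th0 : ∀ t, 0 < S.th t
  ψ0 : ∀ t x, 0 ≤ S.ψ t x
  ψ1 : ∀ t x, S.ψ t x ≤ 1
  q0 : 0 ≤ S.P.q
  qc : S.P.q < S.P.c
  cdL : ∀ L ∈ S.P.I, (L : ℝ) + 1 ≤ cd
  δ0 : 0 ≤ δ
  hstep : ∀ t (A N D : Finset (Finset (Zd d))) used, GA S.P A N D used cd S.nm n2 → A ≠ ∅ → S.th t ≤ ∑ B ∈ A, wt (S.ψ t) B →
    EB p (cls S.P A used) (fun T => ind (¬ Suc S.P (S.ψ t) A D (S.thn t) T)) ≤ δ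
  hsel : ∀ t (K : Finset (Finset (Zd d))), (∀ F ∈ K, S.P.c ≤ wt (S.ψ t) F ∧ tc S.P.τ F ≤ S.P.C) → S.thn t ≤ ∑ F ∈ K, wt (S.ψ t) F →
    (∀ F ∈ K, ∀ F' ∈ K, F ≠ F' → ¬ Qb S.P.τ S.P.q F F') → ∃ N', OKN S t K N'

variable {S : Sys d} {p : Traj d → ℝ} {cd n2 δ : ℝ}

lemma stp_t (s : St d) (T : Finset (Traj d)) : (S.stp s T).t = s.t + 1 := by
  unfold Sys.stp; split_ifs <;> rfl

lemma stp_used (s : St d) (T : Finset (Traj d)) : (S.stp s T).used = s.used ∪ S.cl s := by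
  unfold Sys.stp; split_ifs <;> rfl

lemma stp_fam (s : St d) (T : Finset (Traj d)) : (S.stp s T).fam = s.fam ∨ ∃ N', OKN S s.t (S.K s T) N' ∧
    (S.stp s T).fam = fun t' => if t' ∈ S.tg s.t then N' t' else s.fam t' := by
  unfold Sys.stp
  split_ifs with h
  · exact Or.inr ⟨h.2.choose, h.2.choose_spec, rfl⟩
  · exact Or.inl rfl

lemma stp_fam' (s : St d) (T : Finset (Traj d)) (h1 : s.fam s.t ≠ ∅) (h2 : ¬ S.Bad s T) : ∃ N', OKN S s.t (S.K s T) N' ∧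
    (S.stp s T).fam = fun t' => if t' ∈ S.tg s.t then N' t' else s.fam t' := by
  have : ∃ N', OKN S s.t (S.K s T) N' := by
    by_contra h; exact h2 ⟨h1, h⟩
  unfold Sys.stp
  rw [dif_pos ⟨h1, this⟩]
  exact ⟨_, this.choose_spec, rfl⟩


lemma ch_sub' {g β : ℕ} {l : Traj d} : ∀ x ∈ ch g β l, x ∈ l := by
  intro x hx
  unfold ch at hx
  rw [List.mem_toFinset] at hx
  exact List.mem_of_mem_drop (List.mem_of_mem_take hx)

lemma Fd_mem {P : Prm} {U : Finset (Zd d)} {i : Traj d × Bool} {x : Zd d} (hx : x ∈ Fd P U i) : x ∈ i.1 := by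
  unfold Fd Fc at hx
  have := dW_sub (ch_sub' _ hx)
  split_ifs at this with h
  · exact this
  · simpa using this

lemma Fd_card {P : Prm} {U : Finset (Zd d)} {i : Traj d × Bool} : (Fd P U i).card ≤ i.1.length := by
  refine (Finset.card_le_card (t := i.1.toFinset) ?_).trans (List.toFinset_card_le _)
  intro x hx
  rw [List.mem_toFinset]
  exact Fd_mem hx

lemma mem_K {s : St d} {T : Finset (Traj d)} {F : Finset (Zd d)} (hF : F ∈ S.K s T) : ∃ η ∈ T, (∀ x ∈ F, x ∈ η) ∧ F.card ≤ η.length ∧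
    Good S.P (S.ψ s.t) ((S.nD s.t).biUnion s.fam) F := by
  unfold Sys.K kids at hF
  rw [Finset.mem_image] at hF
  obtain ⟨i, hi, rfl⟩ := hF
  rw [Finset.mem_filter, Finset.mem_product] at hi
  exact ⟨i.1, hi.1.1, fun x hx => Fd_mem hx, Fd_card, hi.2⟩

lemma wt_pos_mem {ψ : Zd d → ℝ} {F : Finset (Zd d)} (h : 0 < wt ψ F) : ∃ x ∈ F, 0 < ψ x := by
  by_contra hc
  push Not at hc
  have : wt ψ F ≤ 0 := Finset.sum_nonpos fun x hx => mul_nonpos_of_nonneg_of_nonpos (eqm_nonneg _ _) (hc x hx)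
  linarith

lemma K_inv (H : S.OK p cd n2 δ) {s : St d} {T : Finset (Traj d)} (hT : T ⊆ S.cl s) {F : Finset (Zd d)} (hF : F ∈ S.K s T) :
    tc S.P.τ F ≤ S.P.C ∧ (F.card : ℝ) ≤ cd ∧ S.P.q < tc S.P.τ F ∧ ∀ t' ∈ S.tg s.t, ∀ x ∈ F, S.reg t' x := by
  obtain ⟨η, hη, h1, h2, hG⟩ := mem_K hF
  have hc := mem_cls.1 (hT hη)
  have hw : S.P.c ≤ tc S.P.τ F := hG.2.1.trans ((wt_le_cp _ (H.ψ1 _) _).trans (cp_le_tc _ _))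
  refine ⟨hG.1, ?_, H.qc.trans_le hw, ?_⟩
  · have := H.cdL _ hc.2.1
    refine le_trans ?_ this
    have h3 : η.length = len η + 1 := by
      have := List.length_pos_iff.2 hc.1.1
      unfold len; omega
    rw [h3] at h2
    exact_mod_cast h2
  · intro t' ht' y hy
    obtain ⟨x, hx, hψ⟩ := wt_pos_mem (lt_of_lt_of_le (lt_of_le_of_lt H.q0 H.qc) hG.2.1)
    have := hc.2.2.2.2.1 y (h1 y hy) x (h1 x hx)
    exact H.reg2 s.t t' ht' x y hψ this.1 this.2

lemma inv_step (H : S.OK p cd n2 δ) {s : St d} {T : Finset (Traj d)} (hT : T ⊆ S.cl s) (hs : S.Inv cd s) : S.Inv cd (S.stp s T) := by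
  have hus : ∀ η ∈ s.used ∪ S.cl s, ∃ t0 < s.t + 1, ∃ B ∈ s.fam t0, hits η (B : Set (Zd d)) := by
    intro η hη
    rcases Finset.mem_union.1 hη with h | h
    · obtain ⟨t0, h0, h1⟩ := hs.us η h
      exact ⟨t0, by omega, h1⟩
    · obtain ⟨B, hB, h1⟩ := (mem_cls.1 h).2.2.1
      exact ⟨s.t, by omega, B, hB, h1⟩
  rcases stp_fam (S := S) s T with hf | ⟨N', hN, hf⟩
  · refine ⟨?_, ?_, ?_, ?_, ?_⟩
    · rw [hf]; exact hs.tcC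
    · rw [hf]; exact hs.card
    · rw [hf]; exact hs.thr
    · rw [hf]; exact hs.sep
    · rw [hf, stp_used, stp_t]; exact hus
  · refine ⟨?_, ?_, ?_, ?_, ?_⟩
    · rw [hf]
      intro t' B hB
      by_cases h : t' ∈ S.tg s.t
      · simp only [h, if_true] at hB
        have := K_inv H hT ((hN.1 t' h).1 hB)
        exact ⟨this.1, this.2.1, this.2.2.1, this.2.2.2 t' h⟩
      · simp only [h, if_false] at hB
        exact hs.tcC t' B hB
    · rw [hf]
      intro t'
      by_cases h : t' ∈ S.tg s.t
      · simp only [h, if_true]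
        exact (hN.1 t' h).2.1
      · simp only [h, if_false]
        exact hs.card t'
    · rw [hf]
      intro t'
      by_cases h : t' ∈ S.tg s.t
      · simp only [h, if_true]
        exact fun _ => (hN.1 t' h).2.2
      · simp only [h, if_false]
        exact hs.thr t'
    · rw [hf]
      intro t1 t2 ht2 B1 hB1 B2 hB2 hne
      by_cases h1 : t1 ∈ S.tg s.t <;> by_cases h2 : t2 ∈ S.tg s.t
      · simp only [h1, h2, if_true] at hB1 hB2
        have k1 := (hN.1 t1 h1).1 hB1
        have k2 := (hN.1 t2 h2).1 hB2
        refine hN.2.2 _ k1 _ k2 ?_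
        rintro rfl
        rcases hne with h | h
        · exact Finset.disjoint_left.1 (hN.2.1 t1 h1 t2 h2 h) hB1 hB2
        · exact h rfl
      · simp only [h1, h2, if_true, if_false] at hB1 hB2
        have k1 := (hN.1 t1 h1).1 hB1
        obtain ⟨η, _, _, _, hG⟩ := mem_K k1
        exact hG.2.2 B2 (Finset.mem_biUnion.2 ⟨t2, H.ntg _ _ h1 ht2, hB2⟩)
      · simp only [h1, h2, if_true, if_false] at hB1 hB2
        have k2 := (hN.1 t2 h2).1 hB2
        obtain ⟨η, _, _, _, hG⟩ := mem_K k2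
        rw [Qb_symm]
        exact hG.2.2 B1 (Finset.mem_biUnion.2 ⟨t1, H.ntg _ _ h2 (H.nsym _ _ ht2), hB1⟩)
      · simp only [h1, h2, if_false] at hB1 hB2
        exact hs.sep t1 t2 ht2 B1 hB1 B2 hB2 hne
    · rw [hf, stp_used, stp_t]
      intro η hη
      obtain ⟨t0, h0, B, hB, h1⟩ := hus η hη
      refine ⟨t0, h0, B, ?_, h1⟩
      have : t0 ∉ S.tg s.t := fun h => by have := H.gt _ _ h; omega
      simpa only [this, if_false] using hB

lemma GA_of (H : S.OK p cd n2 δ) {s : St d} (hs : S.Inv cd s) :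
    GA S.P (s.fam s.t) ((S.nN s.t).biUnion s.fam) ((S.nD s.t).biUnion s.fam) s.used cd S.nm n2 where
  sub := fun B hB => Finset.mem_biUnion.2 ⟨s.t, H.nsub _ (H.nself _), hB⟩
  subN := fun B hB => by
    obtain ⟨t, ht, h⟩ := Finset.mem_biUnion.1 hB
    exact Finset.mem_biUnion.2 ⟨t, H.nsub _ ht, h⟩
  AN := fun B hB => Finset.mem_biUnion.2 ⟨s.t, H.nself _, hB⟩
  tcD := fun B hB => by
    obtain ⟨t, ht, h⟩ := Finset.mem_biUnion.1 hB
    exact (hs.tcC t B h).1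
  cdD := fun B hB => by
    obtain ⟨t, ht, h⟩ := Finset.mem_biUnion.1 hB
    exact (hs.tcC t B h).2.1
  sep := fun B hB B' hB' hne => by
    obtain ⟨t, ht, h⟩ := Finset.mem_biUnion.1 hB'
    exact hs.sep s.t t ht B hB B' h (Or.inr hne)
  n1A := by exact_mod_cast hs.card s.t
  n2D := by
    refine le_trans ?_ (H.ncard s.t)
    have := Finset.card_biUnion_le_card_mul (S.nD s.t) s.fam S.nm (fun t _ => hs.card t)
    exact_mod_cast this
  hu := fun η hη hp B hB hh => by
    obtain ⟨t0, h0, B', hB', hh'⟩ := hs.us η hη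
    obtain ⟨x, hx, hxB⟩ := hh
    obtain ⟨y, hy, hyB⟩ := hh'
    have hn := H.reg1 s.t t0 x y ((hs.tcC _ B hB).2.2.2 x hxB) ((hs.tcC _ B' hB').2.2.2 y hyB) (hp x hx y hy).1 (hp x hx y hy).2
    refine ⟨B', Finset.mem_biUnion.2 ⟨t0, hn, hB'⟩, ?_, y, hy, hyB⟩
    rintro rfl
    refine hs.sep s.t t0 hn B' hB B' hB' (Or.inl (by omega)) (Or.inl ?_)
    rw [Qt_self]
    exact (hs.tcC _ B' hB).2.2.1

lemma bad_prob (H : S.OK p cd n2 δ) (hp0 : ∀ η, 0 ≤ p η) (hp1 : ∀ η, p η ≤ 1) {s : St d} (hs : S.Inv cd s) :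
    EB p (S.cl s) (fun T => ind (S.Bad s T)) ≤ δ := by
  by_cases h0 : s.fam s.t = ∅
  · have : ∀ T, ind (S.Bad s T) = 0 := fun T => ind_neg (fun h => h.1 h0)
    simp only [this]
    rw [EB_const]
    exact H.δ0
  · refine le_trans (EB_mono hp0 hp1 _ ?_) (H.hstep s.t _ _ _ s.used (GA_of H hs) h0 (hs.thr _ h0))
    intro T hT
    refine ind_mono fun hB hSuc => hB.2 ?_
    refine H.hsel _ _ ?_ hSuc.2 hSuc.1
    intro F hF
    obtain ⟨_, _, _, _, hG⟩ := mem_K (S := S) (s := s) (T := T) hF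
    exact ⟨hG.2.1, hG.1⟩

lemma sys_explore {ι : Traj d → ℝ} (H : S.OK (pocc ι) cd n2 δ) (hι : ∀ η, 0 ≤ ι η) {P : Measure (Config d)} (hP : IsPoissonPP d ι P)
    {s : St d} (hs : S.Inv cd s) (h0 : s.used = ∅) (K : Finset ℕ) :
    P {ω | ∀ k ∈ K, S.Bad ((nxt S.cl S.stp ω)^[k] s) (obs S.cl ω ((nxt S.cl S.stp ω)^[k] s))} ≤ ENNReal.ofReal (δ ^ K.card) := by
  refine explore S.cl St.used S.stp hι hP (S.Inv cd) S.Bad H.δ0 ?_ ?_ ?_ ?_ s hs h0 K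
  · intro s _
    rw [Finset.disjoint_right]
    intro η hη
    exact (mem_cls.1 hη).2.2.2.2.2.1
  · intro s T _ _
    exact stp_used s T
  · intro s T hs hT
    exact inv_step H hT hs
  · intro s hs
    exact bad_prob H (pocc_nonneg hι) (pocc_le_one ι) hs

/-! ### pathwise statements -/

lemma edge_symm {ω : Config d} {x y : Zd d} (h : EdgeOpen ω x y) : EdgeOpen ω y x := by
  obtain ⟨η, h0, i, h⟩ := h
  exact ⟨η, h0, i, h.symm⟩

lemma traj_conn {ω : Config d} {η : Traj d} (h : 0 < ω η) {w x : Zd d} (hw : w ∈ η) (hx : x ∈ η) :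
    Relation.ReflTransGen (EdgeOpen ω) w x := by
  have key : ∀ i j : ℕ, i ≤ j → ∀ a b, η[i]? = some a → η[j]? = some b → Relation.ReflTransGen (EdgeOpen ω) a b ∧
      Relation.ReflTransGen (EdgeOpen ω) b a := by
    intro i j hij
    induction j, hij using Nat.le_induction with
    | base => 
      intro a b ha hb
      rw [ha] at hb
      obtain rfl := Option.some.inj hb
      exact ⟨.refl, .refl⟩
    | succ j hij ih =>
      intro a b ha hb
      have hj : j + 1 < η.length := (List.getElem?_eq_some_iff.1 hb).1
      have hc : η[j]? = some (η[j]'(by omega)) := List.getElem?_eq_getElem (by omega)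
      obtain ⟨h1, h2⟩ := ih a _ ha hc
      have e : EdgeOpen ω (η[j]'(by omega)) b := ⟨η, h, j, Or.inl ⟨hc, hb⟩⟩
      exact ⟨h1.tail e, Relation.ReflTransGen.head (edge_symm e) h2⟩
  obtain ⟨i, hi⟩ := List.mem_iff_getElem?.1 hw
  obtain ⟨j, hj⟩ := List.mem_iff_getElem?.1 hx
  rcases le_total i j with h' | h'
  · exact (key i j h' _ _ hi hj).1
  · exact (key j i h' _ _ hj hi).2

/-- all seeds are connected to the initial points -/
def Cn (ω : Config d) (V0 : Finset (Zd d)) (s : St d) : Prop :=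
  ∀ t', ∀ B ∈ s.fam t', ∀ x ∈ B, ∃ a ∈ V0, x ∈ Cluster ω a

lemma Cn_step {ω : Config d} {V0 : Finset (Zd d)} {s : St d} (h : Cn ω V0 s) : Cn ω V0 (nxt S.cl S.stp ω s) := by
  unfold nxt
  rcases stp_fam (S := S) s (obs S.cl ω s) with hf | ⟨N', hN, hf⟩
  · unfold Cn; rw [hf]; exact h
  · unfold Cn
    rw [hf]
    intro t' B hB x hx
    by_cases ht : t' ∈ S.tg s.t
    · simp only [ht, if_true] at hB
      obtain ⟨η, hη, h1, _, _⟩ := mem_K ((hN.1 t' ht).1 hB)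
      unfold obs at hη
      rw [Finset.mem_filter] at hη
      obtain ⟨B0, hB0, w, hw, hwB⟩ := (mem_cls.1 hη.1).2.2.1
      obtain ⟨a, ha, hc⟩ := h s.t B0 hB0 w hwB
      exact ⟨a, ha, Relation.ReflTransGen.trans hc (traj_conn hη.2 hw (h1 x hx))⟩
    · simp only [ht, if_false] at hB
      exact h t' B hB x hx

lemma nonempty_step (H : S.OK p cd n2 δ) {s : St d} (T : Finset (Traj d)) {t' : ℕ} (h : s.fam t' ≠ ∅) : (S.stp s T).fam t' ≠ ∅ := by
  rcases stp_fam (S := S) s T with hf | ⟨N', hN, hf⟩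
  · rw [hf]; exact h
  · rw [hf]
    by_cases ht : t' ∈ S.tg s.t
    · simp only [ht, if_true]
      intro h0
      have := (hN.1 t' ht).2.2
      rw [h0, Finset.sum_empty] at this
      exact absurd this (not_le.2 (H.th0 t'))
    · simpa only [ht, if_false] using h

lemma good_step (H : S.OK p cd n2 δ) {s : St d} (T : Finset (Traj d)) (h1 : s.fam s.t ≠ ∅) (h2 : ¬ S.Bad s T) {t' : ℕ} (ht : t' ∈ S.tg s.t) :
    (S.stp s T).fam t' ≠ ∅ := by
  obtain ⟨N', hN, hf⟩ := stp_fam' s T h1 h2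
  rw [hf]
  simp only [ht, if_true]
  intro h0
  have := (hN.1 t' ht).2.2
  rw [h0, Finset.sum_empty] at this
  exact absurd this (not_le.2 (H.th0 t'))

/-- the `k`-th state -/
def Sys.run (S : Sys d) (s : St d) (ω : Config d) (k : ℕ) : St d := (nxt S.cl S.stp ω)^[k] s

lemma run_succ (s : St d) (ω : Config d) (k : ℕ) : S.run s ω (k + 1) = S.stp (S.run s ω k) (obs S.cl ω (S.run s ω k)) := by
  unfold Sys.run
  rw [Function.iterate_succ_apply']
  rfl

lemma run_t (s : St d) (h0 : s.t = 0) (ω : Config d) (k : ℕ) : (S.run s ω k).t = k := by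
  induction k with
  | zero => exact h0
  | succ k ih => rw [run_succ, stp_t, ih]

lemma run_inv (H : S.OK p cd n2 δ) {s : St d} (hs : S.Inv cd s) (ω : Config d) (k : ℕ) : S.Inv cd (S.run s ω k) := by
  induction k with
  | zero => exact hs
  | succ k ih => rw [run_succ]; exact inv_step H (Finset.filter_subset _ _) ih

lemma run_Cn {V0 : Finset (Zd d)} {s : St d} {ω : Config d} (hs : Cn ω V0 s) (k : ℕ) : Cn ω V0 (S.run s ω k) := by
  induction k with
  | zero => exact hs
  | succ k ih => rw [run_succ]; exact Cn_step ih

/-- failure at time `k` -/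
def Sys.BadAt (S : Sys d) (s : St d) (ω : Config d) (k : ℕ) : Prop := S.Bad (S.run s ω k) (obs S.cl ω (S.run s ω k))

lemma run_target (H : S.OK p cd n2 δ) {s : St d} (h0 : s.t = 0) (ω : Config d) {t t' : ℕ} (h1 : (S.run s ω t).fam t ≠ ∅)
    (h2 : ¬ S.BadAt s ω t) (ht : t' ∈ S.tg t) : (S.run s ω t').fam t' ≠ ∅ := by
  have hlt := H.gt _ _ ht
  have key : ∀ n, (S.run s ω (t + 1 + n)).fam t' ≠ ∅ := by
    intro n
    induction n with
    | zero =>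
      rw [add_zero, run_succ]
      have e := run_t (S := S) s h0 ω t
      exact good_step H _ (by rw [e]; exact h1) h2 (by rw [e]; exact ht)
    | succ n ih => rw [← add_assoc, run_succ]; exact nonempty_step H _ ih
  have := key (t' - (t + 1))
  rwa [show t + 1 + (t' - (t + 1)) = t' by omega] at this

end

section
variable {d : ℕ} [Fact (4 ≤ d)]

/-! ## F14: percolation from the state machine -/

/-- column of a time -/
def Xc (J t : ℕ) : ℕ := Nat.sqrt (t / J)

/-- height of a time -/
def Yc (J t : ℕ) : ℤ := ((t / J : ℕ) : ℤ) - (Xc J t) ^ 2 - Xc J t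

/-- targets of a time -/
def tgJ (J t : ℕ) : Finset ℕ := if t % J + 1 < J then {t + 1} else
  {(t / J + 2 * Xc J t + 1) * J, (t / J + 2 * Xc J t + 2) * J, (t / J + 2 * Xc J t + 3) * J}

lemma sqrt_eq' {k i : ℕ} (h1 : i ^ 2 ≤ k) (h2 : k ≤ i ^ 2 + 2 * i) : Nat.sqrt k = i := by
  refine le_antisymm ?_ ?_
  · rw [← Nat.lt_succ_iff, Nat.sqrt_lt']
    calc k ≤ i ^ 2 + 2 * i := h2
      _ < (i + 1) ^ 2 := by ring_nf; omega
  · rw [Nat.le_sqrt']; exact h1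

lemma Xc_spec (J t : ℕ) : (Xc J t) ^ 2 ≤ t / J ∧ t / J ≤ (Xc J t) ^ 2 + 2 * Xc J t := by
  unfold Xc
  refine ⟨Nat.sqrt_le' _, ?_⟩
  have := Nat.sqrt_le_add (t / J)
  nlinarith [this]

lemma tgJ_spec {J t t' : ℕ} (hJ : 1 ≤ J) (h : t' ∈ tgJ J t) : t < t' ∧ (Xc J t' = Xc J t ∨ Xc J t' = Xc J t + 1) ∧
    |Yc J t' - Yc J t| ≤ 1 ∧ ((t % J + 1 < J ∧ t' % J = t % J + 1 ∧ t' / J = t / J) ∨ (¬ t % J + 1 < J ∧ t' % J = 0)) := by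
  unfold tgJ at h
  have hdm := Nat.div_add_mod t J
  have hml := Nat.mod_lt t hJ
  split_ifs at h with hj
  · rw [Finset.mem_singleton] at h
    subst h
    have e1 : (t + 1) / J = t / J := by
      rw [Nat.div_eq_iff (by omega)]
      constructor
      · rw [mul_comm]; omega
      · rw [mul_comm]; omega
    have e2 : (t + 1) % J = t % J + 1 := by
      have := Nat.div_add_mod (t + 1) J
      rw [e1] at this
      omega
    have e3 : Xc J (t + 1) = Xc J t := by unfold Xc; rw [e1]
    refine ⟨by omega, Or.inl e3, ?_, Or.inl ⟨hj, e2, e1⟩⟩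
    unfold Yc
    rw [e1, e3]
    simp
  · have : ∃ e : ℕ, e ≤ 2 ∧ t' = (t / J + 2 * Xc J t + 1 + e) * J := by
      simp only [Finset.mem_insert, Finset.mem_singleton] at h
      rcases h with h | h | h
      · exact ⟨0, by omega, by rw [h]⟩
      · exact ⟨1, by omega, by rw [h]⟩
      · exact ⟨2, by omega, by rw [h]⟩
    obtain ⟨e, he, rfl⟩ := this
    obtain ⟨s1, s2⟩ := Xc_spec J t
    have e1 : (t / J + 2 * Xc J t + 1 + e) * J / J = t / J + 2 * Xc J t + 1 + e := Nat.mul_div_cancel _ (by omega)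
    have e3 : Xc J ((t / J + 2 * Xc J t + 1 + e) * J) = Xc J t + 1 := by
      change Nat.sqrt ((t / J + 2 * Xc J t + 1 + e) * J / J) = _
      rw [e1]
      apply sqrt_eq' <;> nlinarith
    refine ⟨?_, Or.inr e3, ?_, Or.inr ⟨hj, by simp⟩⟩
    · calc t < J * (t / J) + J := by omega
        _ = (t / J + 1) * J := by ring
        _ ≤ _ := Nat.mul_le_mul_right _ (by omega)
    · unfold Yc
      rw [e1, e3]
      push_cast
      rw [abs_le]
      constructor <;> ring_nf <;> omega

/-- times near a given time -/
def nrJ (J b t : ℕ) : Finset ℕ := (Finset.range ((Xc J t + b + 1) ^ 2 * J)).filter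
  (fun t' => |(Xc J t' : ℤ) - Xc J t| ≤ b ∧ |Yc J t' - Yc J t| ≤ b)

lemma mem_nrJ {J b t t' : ℕ} (hJ : 1 ≤ J) : t' ∈ nrJ J b t ↔ |(Xc J t' : ℤ) - Xc J t| ≤ b ∧ |Yc J t' - Yc J t| ≤ b := by
  unfold nrJ
  rw [Finset.mem_filter, Finset.mem_range, and_iff_right_iff_imp]
  rintro ⟨h, _⟩
  rw [← Nat.div_lt_iff_lt_mul (by omega)]
  have h1 := (Xc_spec J t').2
  have h2 : Xc J t' ≤ Xc J t + b := by have := (abs_le.1 h).2; omega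
  nlinarith

lemma nrJ_card {J b t : ℕ} (hJ : 1 ≤ J) : (nrJ J b t).card ≤ (2 * b + 1) * ((2 * b + 1) * J) := by
  have : (nrJ J b t).card ≤ ((Finset.Icc (-(b : ℤ)) b) ×ˢ ((Finset.Icc (-(b : ℤ)) b) ×ˢ (Finset.range J))).card := by
    refine Finset.card_le_card_of_injOn (fun t' => ((Xc J t' : ℤ) - Xc J t, Yc J t' - Yc J t, t' % J)) ?_ ?_
    · intro t' ht'
      have := (mem_nrJ hJ).1 ht'
      simp only [Finset.coe_product, Set.mem_prod, Finset.coe_Icc, Set.mem_Icc, Finset.coe_range, Set.mem_Iio]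
      exact ⟨abs_le.1 this.1, abs_le.1 this.2, Nat.mod_lt _ hJ⟩
    · intro t1 _ t2 _ h
      simp only [Prod.mk.injEq] at h
      obtain ⟨h1, h2, h3⟩ := h
      have e1 : Xc J t1 = Xc J t2 := by omega
      have e2 : Yc J t1 = Yc J t2 := by omega
      unfold Yc at e2
      rw [e1] at e2
      have e3 : t1 / J = t2 / J := by omega
      rw [← Nat.div_add_mod t1 J, ← Nat.div_add_mod t2 J, e3, h3]
  refine this.trans ?_
  rw [Finset.card_product, Finset.card_product, Int.card_Icc, Finset.card_range]
  have : ((b : ℤ) + 1 - -(b : ℤ)).toNat = 2 * b + 1 := by omega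
  rw [this]

/-- index of a site -/
def sidx (z : ℕ × ℕ) : ℕ := z.1 ^ 2 + z.1 + z.2

lemma sidx_sqrt {z : ℕ × ℕ} (h : z.2 ≤ z.1) : Nat.sqrt (sidx z) = z.1 := by
  apply sqrt_eq' <;> unfold sidx <;> omega

lemma sidx_inj {z z' : ℕ × ℕ} (h : z.2 ≤ z.1) (h' : z'.2 ≤ z'.1) (e : sidx z = sidx z') : z = z' := by
  have h1 : z.1 = z'.1 := by rw [← sidx_sqrt h, ← sidx_sqrt h', e]
  unfold sidx at e
  rw [h1] at e
  exact Prod.ext h1 (by omega)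

lemma site_prob {Ω : Type*} [MeasurableSpace Ω] (P : Measure Ω) [IsProbabilityMeasure P] (Bt : Ω → ℕ → Prop) {δ : ℝ} (hδ : 0 ≤ δ) {J : ℕ} (hJ : 1 ≤ J)
    (h : ∀ K : Finset ℕ, P {ω | ∀ k ∈ K, Bt ω k} ≤ ENNReal.ofReal (δ ^ K.card)) (S : Finset (ℕ × ℕ)) :
    P {ω | ∀ z ∈ S, z.2 ≤ z.1 ∧ ∃ j < J, Bt ω (sidx z * J + j)} ≤ (ENNReal.ofReal (J * δ)) ^ S.card := by
  by_cases hS : ∀ z ∈ S, z.2 ≤ z.1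
  swap
  · push Not at hS
    obtain ⟨z, hz, hlt⟩ := hS
    have : {ω | ∀ z ∈ S, z.2 ≤ z.1 ∧ ∃ j < J, Bt ω (sidx z * J + j)} = ∅ := by
      ext ω
      simp only [Set.mem_ofPred_eq, Set.mem_empty_iff_false, iff_false]
      intro hω
      have := (hω z hz).1
      omega
    rw [this]
    simp
  have hsub : {ω | ∀ z ∈ S, z.2 ≤ z.1 ∧ ∃ j < J, Bt ω (sidx z * J + j)} ⊆
      ⋃ f ∈ (Finset.univ : Finset (S → Fin J)), {ω | ∀ k ∈ (Finset.univ : Finset S).image (fun z => sidx z.1 * J + (f z : ℕ)), Bt ω k} := by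
    intro ω hω
    have : ∀ z : S, ∃ j : Fin J, Bt ω (sidx z.1 * J + j) := by
      intro z
      obtain ⟨j, hj, hb⟩ := (hω z.1 z.2).2
      exact ⟨⟨j, hj⟩, hb⟩
    choose f hf using this
    refine Set.mem_iUnion₂.2 ⟨f, Finset.mem_univ _, ?_⟩
    intro k hk
    obtain ⟨z, _, rfl⟩ := Finset.mem_image.1 hk
    exact hf z
  refine (measure_mono hsub).trans ((measure_biUnion_finset_le _ _).trans ?_)
  have hb : ∀ f ∈ (Finset.univ : Finset (S → Fin J)), P {ω | ∀ k ∈ (Finset.univ : Finset S).image (fun z => sidx z.1 * J + (f z : ℕ)), Bt ω k} ≤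
      ENNReal.ofReal (δ ^ S.card) := by
    intro f _
    refine (h _).trans (le_of_eq ?_)
    congr 2
    rw [Finset.card_image_of_injective, Finset.card_univ, Fintype.card_coe]
    intro z z' e
    have e' : sidx z.1 * J + (f z : ℕ) = sidx z'.1 * J + (f z' : ℕ) := e
    have e1 : sidx z.1 = sidx z'.1 := by
      have h1 : (sidx z.1 * J + (f z : ℕ)) / J = sidx z.1 := by
        rw [mul_comm, Nat.mul_add_div (by omega), Nat.div_eq_of_lt (f z).2, add_zero]
      have h2 : (sidx z'.1 * J + (f z' : ℕ)) / J = sidx z'.1 := by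
        rw [mul_comm, Nat.mul_add_div (by omega), Nat.div_eq_of_lt (f z').2, add_zero]
      rw [← h1, ← h2, e']
    exact Subtype.ext (sidx_inj (hS _ z.2) (hS _ z'.2) e1)
  refine (Finset.sum_le_card_nsmul _ _ _ hb).trans ?_
  rw [nsmul_eq_mul, Finset.card_univ, Fintype.card_fun, Fintype.card_coe, Fintype.card_fin, ENNReal.ofReal_mul (by positivity),
    mul_pow, ENNReal.ofReal_pow hδ, ENNReal.ofReal_natCast]
  push_cast
  exact le_rfl

lemma perc_of_sys {S : Sys d} {cd n2 δ : ℝ} {ι : Traj d → ℝ} (H : S.OK (pocc ι) cd n2 δ) (hι : ∀ η, 0 ≤ ι η) {P : Measure (Config d)}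
    (hP : IsPoissonPP d ι P) {J : ℕ} (hJ : 1 ≤ J) (htg : S.tg = tgJ J) {w ρ : ℝ} (hw : 0 < w)
    (hreg : ∀ t x, S.reg t x → w * Xc J t - ρ ≤ x (i0 d)) (hδ : J * δ ≤ (1 / 16) ^ 2)
    {A0 : Finset (Finset (Zd d))} (hA0 : A0 ≠ ∅) (hs : S.Inv cd ⟨0, fun t => if t = 0 then A0 else ∅, ∅⟩) :
    ∃ a, 0 < P {ω | (Cluster ω a).Infinite} := by
  have := hP.1
  set s : St d := ⟨0, fun t => if t = 0 then A0 else ∅, ∅⟩ with hsdef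
  set Bd : Config d → ℕ × ℕ → Prop := fun ω z => z.2 ≤ z.1 ∧ ∃ j < J, S.BadAt s ω (sidx z * J + j) with hBd
  have h1 : P {ω | Reach (Bd ω) (0, 1)} ≤ 1 / 4 := by
    refine reach_prob P Bd (e := 1 / 16) le_rfl fun K => ?_
    refine (site_prob P (fun ω k => S.BadAt s ω k) H.δ0 hJ (fun K => sys_explore H hι hP hs rfl K) K).trans ?_
    gcongr
    calc ENNReal.ofReal (J * δ) ≤ ENNReal.ofReal ((1 / 16) ^ 2) := ENNReal.ofReal_le_ofReal hδ
      _ = (1 / 16) ^ 2 := by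
        rw [ENNReal.ofReal_pow (by norm_num), ENNReal.ofReal_div_of_pos (by norm_num)]
        simp
  have h2 : ∀ ω, ¬ Reach (Bd ω) (0, 1) → ∃ a ∈ hull A0, (Cluster ω a).Infinite := by
    intro ω hω
    obtain ⟨f, f0, f1, f2⟩ := path_of_not_reach (fun i h hb => hb.1) hω
    have hgood : ∀ i, ∀ j < J, ¬ S.BadAt s ω (sidx (i, f i) * J + j) := by
      intro i j hj hb
      exact (f2 i).2 ⟨(f2 i).1, j, hj, hb⟩
    have hdiv : ∀ i j, j < J → (sidx (i, f i) * J + j) / J = sidx (i, f i) := by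
      intro i j hj
      rw [mul_comm, Nat.mul_add_div (by omega), Nat.div_eq_of_lt hj, add_zero]
    have hmod : ∀ i j, j < J → (sidx (i, f i) * J + j) % J = j := by
      intro i j hj
      rw [mul_comm, Nat.mul_add_mod, Nat.mod_eq_of_lt hj]
    have hX : ∀ i j, j < J → Xc J (sidx (i, f i) * J + j) = i := by
      intro i j hj
      unfold Xc
      rw [hdiv i j hj]
      exact sidx_sqrt (z := (i, f i)) (f2 i).1
    have inner : ∀ i, (S.run s ω (sidx (i, f i) * J)).fam (sidx (i, f i) * J) ≠ ∅ → ∀ j < J,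
        (S.run s ω (sidx (i, f i) * J + j)).fam (sidx (i, f i) * J + j) ≠ ∅ := by
      intro i hi j
      induction j with
      | zero => intro _; exact hi
      | succ j ih =>
        intro hj
        refine run_target H rfl ω (ih (by omega)) (hgood i j (by omega)) ?_
        rw [htg]
        unfold tgJ
        rw [hmod i j (by omega), if_pos hj]
        simp [add_assoc]
    have outer : ∀ i, (S.run s ω (sidx (i, f i) * J)).fam (sidx (i, f i) * J) ≠ ∅ := by
      intro i
      induction i with
      | zero =>
        have : sidx (0, f 0) * J = 0 := by rw [f0]; simp [sidx]
        rw [this]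
        exact hA0
      | succ i ih =>
        have hl := inner i ih (J - 1) (by omega)
        refine run_target H rfl ω hl (hgood i (J - 1) (by omega)) ?_
        rw [htg]
        unfold tgJ
        rw [hmod i (J - 1) (by omega), hdiv i (J - 1) (by omega), hX i (J - 1) (by omega), if_neg (by omega)]
        have e : sidx (i + 1, f (i + 1)) = i ^ 2 + 3 * i + 2 + f (i + 1) := by unfold sidx; ring
        have e' : sidx (i, f i) = i ^ 2 + i + f i := rfl
        have hf := f1 i
        simp only [Finset.mem_insert, Finset.mem_singleton]
        have : f (i + 1) + 1 = f i ∨ f (i + 1) = f i ∨ f (i + 1) = f i + 1 := by omega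
        rcases this with h | h | h
        · left; congr 1; rw [e, e']; omega
        · right; left; congr 1; rw [e, e']; omega
        · right; right; congr 1; rw [e, e']; omega
    have hCn : Cn ω (hull A0) s := by
      intro t B hB x hx
      by_cases ht : t = 0
      · simp only [hsdef, ht, if_true] at hB
        exact ⟨x, Finset.mem_biUnion.2 ⟨B, hB, hx⟩, Relation.ReflTransGen.refl⟩
      · simp [hsdef, ht] at hB
    have pts : ∀ i : ℕ, ∃ x : Zd d, (∃ a ∈ hull A0, x ∈ Cluster ω a) ∧ w * i - ρ ≤ x (i0 d) := by
      intro i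
      set t := sidx (i, f i) * J with ht
      obtain ⟨B, hB⟩ := Finset.nonempty_iff_ne_empty.2 (outer i)
      have hI := (run_inv H hs ω t).tcC _ B hB
      have hne : B.Nonempty := by
        rw [Finset.nonempty_iff_ne_empty]
        rintro rfl
        have := hI.2.2.1
        simp [tc] at this
        exact absurd H.q0 (not_le.2 this)
      obtain ⟨x, hx⟩ := hne
      refine ⟨x, run_Cn hCn t _ B hB x hx, ?_⟩
      have := hreg _ x (hI.2.2.2 x hx)
      have e := hX i 0 (by omega)
      rw [add_zero] at e
      rwa [e] at this
    by_contra hfin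
    push Not at hfin
    have hF : (⋃ a ∈ hull A0, Cluster ω a).Finite := Set.Finite.biUnion (hull A0).finite_toSet (fun a ha => by
      have := hfin a ha
      first | exact Set.not_infinite.1 this | exact this)
    obtain ⟨M, hM⟩ := (hF.image (fun x : Zd d => (x (i0 d) : ℝ))).bddAbove
    obtain ⟨i, hi⟩ := exists_nat_gt ((M + ρ) / w)
    rw [div_lt_iff₀ hw] at hi
    obtain ⟨x, ⟨a, ha, hx⟩, hx2⟩ := pts i
    have := hM ⟨x, Set.mem_iUnion₂.2 ⟨a, ha, hx⟩, rfl⟩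
    simp only at this
    nlinarith
  by_contra hc
  push Not at hc
  have h3 : P (⋃ a ∈ hull A0, {ω | (Cluster ω a).Infinite}) = 0 := by
    refine le_antisymm ((measure_biUnion_finset_le _ _).trans ?_) zero_le
    refine Finset.sum_nonpos fun a _ => hc a
  have h4 : (Set.univ : Set (Config d)) ⊆ {ω | Reach (Bd ω) (0, 1)} ∪ ⋃ a ∈ hull A0, {ω | (Cluster ω a).Infinite} := by
    intro ω _
    by_cases h : Reach (Bd ω) (0, 1)
    · exact Or.inl h
    · obtain ⟨a, ha, hi⟩ := h2 ω h
      exact Or.inr (Set.mem_iUnion₂.2 ⟨a, ha, hi⟩)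
  have h5 := (measure_mono h4).trans (measure_union_le (μ := P) _ _)
  rw [measure_univ, h3, add_zero] at h5
  have h6 := h5.trans h1
  have : (1 / 4 : ℝ≥0∞) < 1 := by
    rw [one_div]
    exact ENNReal.inv_lt_one.2 (by norm_num)
  exact absurd h6 (not_le.2 this)

/-! ### translation invariance -/

/-- translation of trajectories -/
def shT (a : Zd d) : Traj d ≃ Traj d where
  toFun η := η.map (· + a)
  invFun η := η.map (· - a)
  left_inv η := by simp [Function.comp_def]
  right_inv η := by simp [Function.comp_def]

lemma shT_valid (a : Zd d) (η : Traj d) : ValidTraj (shT a η) ↔ ValidTraj η := by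
  unfold ValidTraj shT
  simp only [Equiv.coe_fn_mk, ne_eq, List.map_eq_nil_iff]
  refine and_congr Iff.rfl ?_
  show List.IsChain IsNN _ ↔ List.IsChain IsNN _
  rw [List.isChain_map]
  refine iff_of_eq ?_
  congr 1
  funext x y
  simp [IsNN]

lemma pp_unique {ι : Traj d → ℝ} {P Q : Measure (Config d)} (hP : IsPoissonPP d ι P) (hQ : IsPoissonPP d ι Q) : P = Q := by
  have := hP.1
  have := hQ.1
  have h : ∀ F : Finset (Traj d), P.map F.restrict = Q.map F.restrict := by
    intro F
    refine Measure.ext_of_singleton fun k => ?_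
    rw [Measure.map_apply (by fun_prop) (measurableSet_singleton _), Measure.map_apply (by fun_prop) (measurableSet_singleton _)]
    have : (F.restrict (π := fun _ : Traj d => ℕ)) ⁻¹' {k} = {ω : Config d | ∀ η ∈ F, ω η = (fun η => if h : η ∈ F then k ⟨η, h⟩ else 0) η} := by
      ext ω
      simp only [Set.mem_preimage, Set.mem_singleton_iff, Set.mem_ofPred_eq]
      constructor
      · rintro rfl η hη
        simp [hη]
      · intro h
        funext η
        have := h η.1 η.2
        simpa using this
    rw [this, hP.2, hQ.2]
  exact IsProjectiveLimit.unique (P := fun F => Q.map F.restrict) (fun F => h F) (fun F => rfl)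

lemma pp_shift {ι : Traj d → ℝ} {P : Measure (Config d)} (hP : IsPoissonPP d ι P) (a : Zd d) (hι : ∀ η, ι (shT a η) = ι η) :
    P {ω | (Cluster ω a).Infinite} = P (PercEvent d) := by
  have := hP.1
  set θ : Config d → Config d := fun ω η => ω (shT a η) with hθ
  have hm : Measurable θ := by
    rw [measurable_pi_iff]
    intro η
    exact measurable_pi_apply _
  set θe : Config d ≃ᵐ Config d :=
    { toFun := θ, invFun := fun ω η => ω ((shT a).symm η), left_inv := fun ω => by funext η; simp [hθ],
      right_inv := fun ω => by funext η; simp [hθ], measurable_toFun := hm,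
      measurable_invFun := by
        rw [measurable_pi_iff]
        intro η
        exact measurable_pi_apply _ } with hθe
  have hQ : IsPoissonPP d ι (P.map θ) := by
    refine ⟨Measure.isProbabilityMeasure_map hm.aemeasurable, fun F k => ?_⟩
    rw [Measure.map_apply hm (by
      have : {ω : Config d | ∀ η ∈ F, ω η = k η} = ⋂ η ∈ F, (fun ω : Config d => ω η) ⁻¹' {k η} := by
        ext ω; simp
      rw [this]
      exact Finset.measurableSet_biInter _ fun η _ => measurable_pi_apply η (measurableSet_singleton _))]
    have e : θ ⁻¹' {ω | ∀ η ∈ F, ω η = k η} = {ω | ∀ η ∈ F.map (shT a).toEmbedding, ω η = k ((shT a).symm η)} := by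
      ext ω
      simp only [hθ, Set.mem_preimage, Set.mem_ofPred_eq, Finset.mem_map_equiv]
      constructor
      · intro h η hη
        have := h _ hη
        rwa [Equiv.apply_symm_apply] at this
      · intro h η hη
        have := h (shT a η) (by rwa [Equiv.symm_apply_apply])
        rwa [Equiv.symm_apply_apply] at this
    rw [e, hP.2, Finset.prod_map]
    refine Finset.prod_congr rfl fun η _ => ?_
    simp [hι]
  have he := pp_unique hQ hP
  have h1 : (P.map θ) (PercEvent d) = P (θ ⁻¹' PercEvent d) := θe.map_apply _
  rw [he] at h1
  rw [h1]
  congr 1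
  ext ω
  simp only [Set.mem_ofPred_eq, Set.mem_preimage, PercEvent]
  have hedge : ∀ x y, EdgeOpen (θ ω) x y ↔ EdgeOpen ω (x + a) (y + a) := by
    intro x y
    have key : ∀ (η : Traj d) (i : ℕ) (z : Zd d), (shT a η)[i]? = some (z + a) ↔ η[i]? = some z := by
      intro η i z
      simp [shT]
    constructor
    · rintro ⟨η, h0, i, h⟩
      refine ⟨shT a η, h0, i, ?_⟩
      simpa only [key] using h
    · rintro ⟨η, h0, i, h⟩
      refine ⟨(shT a).symm η, by simpa [hθ] using h0, i, ?_⟩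
      have k := key ((shT a).symm η)
      rw [Equiv.apply_symm_apply] at k
      simpa only [k] using h
  have hc : Cluster ω a = (fun x => x + a) '' (Cluster (θ ω) 0) := by
    ext y
    constructor
    · intro hy
      refine ⟨y - a, ?_, by simp⟩
      have : ∀ z, Relation.ReflTransGen (EdgeOpen ω) a z → Relation.ReflTransGen (EdgeOpen (θ ω)) 0 (z - a) := by
        intro z hz
        induction hz with
        | refl => rw [sub_self]
        | tail _ h ih =>
          refine ih.tail ?_
          rw [hedge]
          simpa using h
      exact this y hy
    · rintro ⟨x, hx, rfl⟩
      have : ∀ z, Relation.ReflTransGen (EdgeOpen (θ ω)) 0 z → Relation.ReflTransGen (EdgeOpen ω) a (z + a) := by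
        intro z hz
        induction hz with
        | refl => rw [zero_add]
        | tail _ h ih =>
          refine ih.tail ?_
          rw [← hedge]
          exact h
      exact this x hx
  rw [hc, Set.infinite_image_iff (add_left_injective a).injOn]

end

section
variable {d : ℕ} [Fact (4 ≤ d)]

/-! ## F15: the concrete exploration -/

lemma pos_coord (s : List (Dir d)) (i : Fin d) : |pos (0 : Zd d) s i| ≤ s.length := by
  induction s with
  | nil => simp
  | cons e s ih =>
    rw [pos_cons, pos_eq]
    simp only [Pi.add_apply, zero_add, List.length_cons]
    have h1 : |dv e i| ≤ 1 := by
      unfold dv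
      by_cases hi : i = e.1
      · subst hi
        simp only [Pi.single_eq_same]
        split_ifs <;> simp
      · simp [Pi.single_eq_of_ne hi]
    have := abs_add_le (dv e i) (pos 0 s i)
    push_cast
    linarith

lemma hk_far {k : ℕ} {z : Zd d} {i : Fin d} (h : (k : ℤ) < |z i|) : hk k z = 0 := by
  unfold hk
  refine (Ex_congr (F' := fun _ => 0) fun s hs => ?_).trans (Ex_const (d := d) k 0)
  rw [if_neg]
  rintro rfl
  have := pos_coord s i
  rw [hs] at this
  omega

lemma gr_far {t : ℕ} (ht : 1 ≤ t) {z : Zd d} {i : Fin d} (h : (t : ℤ) ≤ |z i|) : gr z ≤ Gt d t := by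
  refine le_trans (le_of_eq ?_) (hk_tail_le z t ht)
  unfold gr
  rw [← (hk_summable z).sum_add_tsum_nat_add t, Finset.sum_eq_zero, zero_add]
  intro k hk
  rw [Finset.mem_range] at hk
  exact hk_far (lt_of_lt_of_le (by exact_mod_cast hk) h)

lemma Gt_small {e : ℝ} (he : 0 < e) : ∃ t : ℕ, 1 ≤ t ∧ Gt d t ≤ e := by
  obtain ⟨t, ht⟩ := exists_nat_gt (GC d / e + 1)
  have hG := GC_pos (d := d)
  have h1 : (1 : ℝ) < t := by
    have : 0 < GC d / e := by positivity
    linarith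
  refine ⟨t, by exact_mod_cast h1.le, ?_⟩
  unfold Gt
  have h2 : (1 : ℝ) ≤ rr d t := by
    unfold rr
    split_ifs
    · exact le_rfl
    · rw [Real.one_le_sqrt]; exact h1.le
  rw [div_le_iff₀ (by positivity)]
  have h3 : GC d < t * e := by
    rw [← div_lt_iff₀ he]; linarith
  nlinarith [mul_pos (by linarith : (0 : ℝ) < t) he]

lemma gr0_pos : 1 ≤ gr (0 : Zd d) := by
  have := (hk_summable (0 : Zd d)).le_tsum 0 (fun k _ => hk_nonneg k 0)
  rw [hk_zero, if_pos rfl] at this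
  exact this

/-- a family of well separated artificial seeds -/
lemma seeds (τ : ℕ) {C c q : ℝ} (hq : 0 < q) (hc : 0 < c) (hC : 2 * gr (0 : Zd d) * c + 1 ≤ C) (ng : ℕ) :
    ∃ A0 : Finset (Finset (Zd d)), A0.card = ng ∧ (∀ B ∈ A0, tc τ B ≤ C ∧ (B.card : ℝ) ≤ C ∧ c ≤ cp B ∧
      ∀ x ∈ B, x (i0 d) = 0 ∧ x (i1 d) = 0) ∧ ∀ B ∈ A0, ∀ B' ∈ A0, B ≠ B' → ¬ Qb τ q B B' := by
  have hg := gr0_pos (d := d)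
  set Nv : ℕ := ⌈2 * gr (0 : Zd d) * c⌉₊ with hNv
  have hNv1 : 2 * gr (0 : Zd d) * c ≤ Nv := Nat.le_ceil _
  have hNv2 : (Nv : ℝ) ≤ C := (Nat.ceil_lt_add_one (by positivity)).le.trans hC
  have hNv0 : (0 : ℝ) < Nv := lt_of_lt_of_le (by positivity) hNv1
  have hNv0' : 0 < Nv := by exact_mod_cast hNv0
  obtain ⟨Λ, hΛ, hG⟩ := Gt_small (d := d) (e := min (1 / (2 * Nv)) (q / (Nv * Nv))) (by positivity)
  set y : ℕ → Zd d := fun k => Pi.single (i2 d) ((k : ℤ) * Λ) with hy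
  have hyd : ∀ k l : ℕ, k ≠ l → gr (y k - y l) ≤ min (1 / (2 * (Nv : ℝ))) (q / (Nv * Nv)) := by
    intro k l hkl
    refine (gr_far hΛ (i := i2 d) ?_).trans hG
    simp only [hy, Pi.sub_apply, Pi.single_eq_same]
    rw [← sub_mul, abs_mul, abs_of_nonneg (by positivity : (0 : ℤ) ≤ (Λ : ℤ))]
    have : 1 ≤ |(k : ℤ) - l| := Int.one_le_abs (by omega)
    nlinarith
  have yinj : Function.Injective y := by
    intro k l h
    have := congrFun h (i2 d)
    simp only [hy, Pi.single_eq_same] at this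
    have hΛ0 : (Λ : ℤ) ≠ 0 := by omega
    exact_mod_cast mul_right_cancel₀ hΛ0 this
  set Bk : ℕ → Finset (Zd d) := fun m => (Finset.Ico (m * Nv) ((m + 1) * Nv)).image y with hBk
  have hcard : ∀ m, (Bk m).card = Nv := by
    intro m
    rw [hBk]
    simp only
    rw [Finset.card_image_of_injective _ yinj, Nat.card_Ico, add_mul, one_mul, Nat.add_sub_cancel_left]
  have heq : ∀ m, ∀ x ∈ Bk m, 1 / (2 * gr (0 : Zd d)) ≤ eqm (Bk m) x := by
    intro m x hx
    have h1 := HH_eq_one hx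
    unfold HH at h1
    rw [← Finset.add_sum_erase _ _ hx, sub_self] at h1
    have h2 : ∑ z ∈ (Bk m).erase x, eqm (Bk m) z * gr (z - x) ≤ ∑ z ∈ (Bk m).erase x, 1 / (2 * (Nv : ℝ)) := by
      refine Finset.sum_le_sum fun z hz => ?_
      obtain ⟨hne, hz⟩ := Finset.mem_erase.1 hz
      obtain ⟨k, _, rfl⟩ := Finset.mem_image.1 hz
      obtain ⟨l, _, rfl⟩ := Finset.mem_image.1 hx
      have h3 := (hyd k l (fun h => hne (by rw [h]))).trans (min_le_left _ _)
      calc _ ≤ 1 * gr (y k - y l) := mul_le_mul_of_nonneg_right (eqm_le_one _ _) (gr_nonneg _)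
        _ ≤ _ := by rw [one_mul]; exact h3
    rw [Finset.sum_const, nsmul_eq_mul] at h2
    have h4 : (((Bk m).erase x).card : ℝ) ≤ Nv := by
      rw [← hcard m]; exact_mod_cast Finset.card_le_card (Finset.erase_subset _ _)
    have h5 : (((Bk m).erase x).card : ℝ) * (1 / (2 * Nv)) ≤ 1 / 2 := by
      calc _ ≤ (Nv : ℝ) * (1 / (2 * Nv)) := by gcongr
        _ = 1 / 2 := by field_simp
    rw [div_le_iff₀ (by positivity)]
    linarith
  have hcp : ∀ m, c ≤ cp (Bk m) := by
    intro m
    have h1 : ∑ x ∈ Bk m, 1 / (2 * gr (0 : Zd d)) ≤ cp (Bk m) := Finset.sum_le_sum fun x hx => heq m x hx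
    rw [Finset.sum_const, hcard, nsmul_eq_mul] at h1
    refine le_trans ?_ h1
    rw [mul_one_div, le_div_iff₀ (by positivity)]
    linarith
  have hdisj : ∀ m m', m ≠ m' → ∀ x ∈ Bk m, ∀ z ∈ Bk m', gr (z - x) ≤ q / (Nv * Nv) := by
    intro m m' hm x hx z hz
    obtain ⟨k, hk, rfl⟩ := Finset.mem_image.1 hz
    obtain ⟨l, hl, rfl⟩ := Finset.mem_image.1 hx
    refine (hyd k l ?_).trans (min_le_right _ _)
    rintro rfl
    rw [Finset.mem_Ico] at hk hl
    apply hm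
    have e1 : k / Nv = m := Nat.div_eq_of_lt_le hl.1 (by linarith [hl.2])
    have e2 : k / Nv = m' := Nat.div_eq_of_lt_le hk.1 (by linarith [hk.2])
    rw [← e1, e2]
  have hQ : ∀ m m', m ≠ m' → Qt τ (Bk m) (Bk m') ≤ q := by
    intro m m' hm
    unfold Qt HH
    calc _ ≤ ∑ x ∈ Bk m, ∑ z ∈ Bk m', q / ((Nv : ℝ) * Nv) := by
          refine Finset.sum_le_sum fun x hx => ?_
          have h1 : ∑ z ∈ Bk m', eqm (Bk m') z * gr (z - x) ≤ ∑ z ∈ Bk m', q / ((Nv : ℝ) * Nv) := by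
            refine Finset.sum_le_sum fun z hz => ?_
            calc _ ≤ 1 * gr (z - x) := mul_le_mul_of_nonneg_right (eqm_le_one _ _) (gr_nonneg _)
              _ ≤ _ := by rw [one_mul]; exact hdisj m m' hm x hx z hz
          calc _ ≤ 1 * ∑ z ∈ Bk m', eqm (Bk m') z * gr (z - x) :=
                mul_le_mul_of_nonneg_right (esc_le_one _ _ _) (Finset.sum_nonneg fun z _ => mul_nonneg (eqm_nonneg _ _) (gr_nonneg _))
            _ ≤ _ := by rw [one_mul]; exact h1
      _ = q := by
        simp only [Finset.sum_const, hcard, nsmul_eq_mul]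
        field_simp
  have Binj : Function.Injective Bk := by
    intro m m' h
    by_contra hm
    have hx : y (m * Nv) ∈ Bk m := Finset.mem_image_of_mem _ (by rw [Finset.mem_Ico]; constructor <;> nlinarith)
    have hx' := hx
    rw [h] at hx'
    have h1 := hdisj m m' hm _ hx _ hx'
    rw [sub_self] at h1
    have h2 : 1 ≤ Nv := hNv0'
    obtain ⟨k, hk, e⟩ := Finset.mem_image.1 hx'
    have := yinj e
    rw [Finset.mem_Ico] at hk
    subst this
    apply hm
    have e1 : m * Nv / Nv = m := Nat.mul_div_cancel _ hNv0'
    have e2 : m * Nv / Nv = m' := Nat.div_eq_of_lt_le hk.1 (by linarith [hk.2])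
    rw [← e1, e2]
  refine ⟨(Finset.range ng).image Bk, by rw [Finset.card_image_of_injective _ Binj, Finset.card_range], ?_, ?_⟩
  · intro B hB
    obtain ⟨m, _, rfl⟩ := Finset.mem_image.1 hB
    refine ⟨(tc_le_card _ _).trans (by rw [hcard]; exact hNv2), by rw [hcard]; exact hNv2, hcp m, ?_⟩
    intro x hx
    obtain ⟨k, _, rfl⟩ := Finset.mem_image.1 hx
    simp only [hy]
    rw [Pi.single_eq_of_ne i02, Pi.single_eq_of_ne i12]
    exact ⟨rfl, rfl⟩
  · intro B hB B' hB' hne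
    obtain ⟨m, _, rfl⟩ := Finset.mem_image.1 hB
    obtain ⟨m', _, rfl⟩ := Finset.mem_image.1 hB'
    have hm : m ≠ m' := fun h => hne (by rw [h])
    rintro (h | h)
    · exact absurd (hQ m m' hm) (not_le.2 h)
    · exact absurd (hQ m' m hm.symm) (not_le.2 h)

lemma sel1 {α : Type*} (w : α → ℝ) {c C X : ℝ} (hc : 0 < c) (hC : 0 ≤ C) (hX : 0 ≤ X) (K : Finset α)
    (hw : ∀ F ∈ K, c ≤ w F ∧ w F ≤ C) (h : X ≤ ∑ F ∈ K, w F) :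
    ∃ S ⊆ K, X ≤ ∑ F ∈ S, w F ∧ ∑ F ∈ S, w F ≤ X + C ∧ (S.card : ℝ) ≤ X / c + 1 := by
  induction K using Finset.strongInduction with
  | H K ih =>
    by_cases hex : ∃ e ∈ K, X ≤ ∑ F ∈ K.erase e, w F
    · obtain ⟨e, he, h2⟩ := hex
      obtain ⟨S, hS, h3⟩ := ih (K.erase e) (Finset.erase_ssubset he) (fun F hF => hw F (Finset.mem_of_mem_erase hF)) h2
      exact ⟨S, hS.trans (Finset.erase_subset _ _), h3⟩
    push Not at hex
    refine ⟨K, subset_rfl, h, ?_⟩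
    rcases K.eq_empty_or_nonempty with rfl | ⟨e, he⟩
    · simp only [Finset.sum_empty, Finset.card_empty, Nat.cast_zero]
      constructor <;> positivity
    have h1 := hex e he
    have h2 := Finset.add_sum_erase K w he
    have h3 : ((K.erase e).card : ℝ) * c ≤ ∑ F ∈ K.erase e, w F := by
      rw [← nsmul_eq_mul]
      exact Finset.card_nsmul_le_sum _ _ _ fun F hF => (hw F (Finset.mem_of_mem_erase hF)).1
    have h4 : (K.card : ℝ) = (K.erase e).card + 1 := by
      exact_mod_cast (Finset.card_erase_add_one he).symm
    refine ⟨by linarith [(hw e he).2], ?_⟩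
    rw [h4]
    gcongr
    rw [le_div_iff₀ hc]
    linarith

lemma sel_many {α : Type*} (w : α → ℝ) {c C X : ℝ} (hc : 0 < c) (hC : 0 ≤ C) (hX : 0 ≤ X) (T : Finset ℕ) (K : Finset α)
    (hw : ∀ F ∈ K, c ≤ w F ∧ w F ≤ C) (h : T.card * (X + C) ≤ ∑ F ∈ K, w F + C) :
    ∃ N' : ℕ → Finset α, (∀ t ∈ T, N' t ⊆ K ∧ X ≤ ∑ F ∈ N' t, w F ∧ ((N' t).card : ℝ) ≤ X / c + 1) ∧
      ∀ t1 ∈ T, ∀ t2 ∈ T, t1 ≠ t2 → Disjoint (N' t1) (N' t2) := by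
  induction T using Finset.induction_on generalizing K with
  | empty => exact ⟨fun _ => ∅, by simp, by simp⟩
  | insert t T ht ih =>
    rw [Finset.card_insert_of_notMem ht] at h
    push_cast at h
    have h0 : 0 ≤ (T.card : ℝ) * (X + C) := by positivity
    obtain ⟨S, hS, h1, h2, h3⟩ := sel1 w hc hC hX K hw (by linarith)
    have h4 := Finset.sum_sdiff hS (f := w)
    obtain ⟨N', hN, hD⟩ := ih (K \ S) (fun F hF => hw F (Finset.sdiff_subset hF)) (by linarith)
    have hne : ∀ t' ∈ T, t' ≠ t := fun t' h' e => ht (e ▸ h')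
    refine ⟨fun t' => if t' = t then S else N' t', ?_, ?_⟩
    · intro t' ht'
      rcases Finset.mem_insert.1 ht' with rfl | ht'
      · simp only [if_true]; exact ⟨hS, h1, h3⟩
      · simp only [if_neg (hne t' ht')]
        exact ⟨(hN t' ht').1.trans Finset.sdiff_subset, (hN t' ht').2⟩
    · have hd : ∀ t' ∈ T, Disjoint S (N' t') := fun t' h' =>
        Finset.disjoint_of_subset_right (hN t' h').1 Finset.disjoint_sdiff
      intro t1 ht1 t2 ht2 h12
      rcases Finset.mem_insert.1 ht1 with e1 | ht1' <;> rcases Finset.mem_insert.1 ht2 with e2 | ht2'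
      · exact absurd (e1.trans e2.symm) h12
      · simp only [if_pos e1, if_neg (hne t2 ht2')]; exact hd t2 ht2'
      · simp only [if_pos e2, if_neg (hne t1 ht1')]; exact (hd t1 ht1').symm
      · simp only [if_neg (hne t1 ht1'), if_neg (hne t2 ht2')]; exact hD t1 ht1' t2 ht2' h12

/-- thresholds -/
def thr (T0 γ : ℝ) (j : ℕ) : ℝ := T0 * (1 + γ) ^ j

lemma wt_centre {R r v c C : ℝ} (hr : 0 < r) (hv : 0 < v) (τ : ℕ) {c1 c2 e1 e2 : ℝ} (h1 : |c1 - e1| ≤ v) (h2 : |c2 - e2| ≤ v)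
    (hvc : 6 * v / r * C ≤ c / 2) {F : Finset (Zd d)} (hF : c ≤ wt (psi R r c1 c2) F) (hC : tc τ F ≤ C) :
    wt (psi R r c1 c2) F ≤ 2 * wt (psi R r e1 e2) F := by
  have h3 : wt (psi R r c1 c2) F ≤ wt (psi R r e1 e2) F + 6 * v / r * cp F := by
    unfold wt cp
    rw [Finset.mul_sum, ← Finset.sum_add_distrib]
    refine Finset.sum_le_sum fun x _ => ?_
    have h4 := (abs_le.1 (psi_centre (R := R) hr c1 c2 e1 e2 x)).2
    have h5 : 3 / r * (|c1 - e1| + |c2 - e2|) ≤ 6 * v / r := by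
      calc _ ≤ 3 / r * (v + v) := by gcongr
        _ = _ := by ring
    have := eqm_nonneg F x
    nlinarith
  have h4 : 6 * v / r * cp F ≤ 6 * v / r * C := by
    have := (cp_le_tc τ F).trans hC
    gcongr
  linarith

set_option maxHeartbeats 1600000 in
theorem perc_concrete {P : Prm} {κ φ : ℕ → ℝ} {ι : Traj d → ℝ} {s Lm α h kl k0 : ℝ} {g1 : ℕ}
    (H : GP d P κ (pocc ι) s Lm α h kl k0 g1) {R r v T0 γ ρ cd n2 : ℝ} {J nm b : ℕ}
    (Hψ : ∀ c1 c2, GPsi P φ Lm (psi (d := d) R r c1 c2)) (hι : ∀ η, 0 ≤ ι η) {M : Measure (Config d)} (hM : IsPoissonPP d ι M)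
    (hR : 0 < R) (hr : 0 < r) (hv : 0 < v) (hJ : 1 ≤ J) (hT0 : 0 < T0) (hγ : 0 < γ) (hq : 0 < P.q)
    (hvc : 6 * v / r * P.C ≤ P.c / 2) (h6 : 6 * T0 + 3 * P.C ≤ T0 * (1 + γ) ^ J) (hnm : T0 * (1 + γ) ^ J / P.c + 1 ≤ nm)
    (hρ : r * R + P.a + v * R ≤ ρ * R) (hb : 2 * (ρ * R) + P.a < v * R * (b + 1)) (hcd : ∀ L ∈ P.I, (L : ℝ) + 1 ≤ cd) (hCcd : P.C ≤ cd)
    (hn2 : ((2 * (b + 1) + 1 : ℕ) : ℝ) * (((2 * (b + 1) + 1 : ℕ) : ℝ) * J) * nm ≤ n2)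
    (hΦ : 1 + 4 * γ ≤ 2 * (1 - s) * ∑ L ∈ P.I, κ L * ∑ l ∈ Finset.range (L + 1), φ l)
    (hC1 : 2 * gr (0 : Zd d) * P.c + 1 ≤ P.C)
    (herr : nm * (P.C * errM P kl k0 Lm h cd n2 α) ≤ γ * T0) {δ : ℝ}
    (hδ : 2 * P.C * (1 + 2 * γ) / (γ ^ 2 * T0) + nm * (kl * (P.C * (α + P.C * Gt d g1)) + k0 * (P.τ * cd)) +
      (nm * (kl * P.C + k0 * (P.τ * cd))) * (4 * (nm * (kl * (P.C * α) + k0 * (P.τ * cd)))) ≤ δ)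
    (hJδ : J * δ ≤ (1 / 16) ^ 2) : ∃ a, 0 < M {ω | (Cluster ω a).Infinite} := by
  have hc : 0 < P.c := H.hq.trans_lt H.hqc
  have hg0 := gr0_pos (d := d)
  have hC0 : 0 < P.C := by
    have : 0 < 2 * gr (0 : Zd d) * P.c := by positivity
    linarith
  have hcd0 : 0 ≤ cd := hC0.le.trans hCcd
  have hkl := H.kl0
  have hk0 := H.k00
  have hα := H.hα
  have hs0 := H.hs0
  have hs1 := H.hs1
  have ha0 : 0 < P.a := by rw [H.ha]; have := H.hh; positivity
  have hn20 : 0 ≤ n2 := le_trans (by positivity) hn2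
  have hGt := Gt_nonneg (d := d) g1
  have hLm := H.hLm
  have hδ0 : 0 ≤ δ := le_trans (by positivity) hδ
  have herr0 : 0 ≤ errM P kl k0 Lm h cd n2 α := by unfold errM; positivity
  have thr_mono : ∀ i j, i ≤ j → thr T0 γ i ≤ thr T0 γ j := by
    intro i j hij
    unfold thr
    gcongr
    linarith
  have thr_ge : ∀ j, T0 ≤ thr T0 γ j := by
    intro j
    have := thr_mono 0 j (Nat.zero_le _)
    simpa [thr] using this
  have hρ0 : 0 < ρ * R := lt_of_lt_of_le (by positivity) hρ
  set S : Sys d := ⟨P, tgJ J, fun t => psi R r (v * Xc J t) (v * Yc J t), fun t => thr T0 γ (t % J), fun t => thr T0 γ (t % J + 1), nm,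
    nrJ J b, nrJ J (b + 1), fun t x => |(x (i0 d) : ℝ) - v * Xc J t * R| ≤ ρ * R ∧ |(x (i1 d) : ℝ) - v * Yc J t * R| ≤ ρ * R⟩ with hS
  have tgX : ∀ t, ∀ t' ∈ tgJ J t, |v * (Xc J t : ℝ) - v * Xc J t'| ≤ v ∧ |v * (Yc J t : ℝ) - v * Yc J t'| ≤ v := by
    intro t t' ht'
    obtain ⟨_, h1, h2, _⟩ := tgJ_spec hJ ht'
    constructor
    · rw [← mul_sub, abs_mul, abs_of_pos hv]
      refine mul_le_of_le_one_right hv.le ?_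
      rcases h1 with h1 | h1 <;> rw [h1] <;> push_cast <;> simp
    · rw [← mul_sub, abs_mul, abs_of_pos hv]
      refine mul_le_of_le_one_right hv.le ?_
      rw [abs_sub_comm]
      exact_mod_cast h2
  have OK : S.OK (pocc ι) cd n2 δ := by
    refine ⟨fun t t' ht' => (tgJ_spec hJ ht').1, ?_, ?_, ?_, ?_, ?_, ?_, ?_, ?_, ?_, ?_, H.hq, H.hqc, hcd, hδ0, ?_, ?_⟩
    · intro t1 t2 h
      simp only [hS] at h ⊢
      rw [mem_nrJ hJ] at h ⊢
      rwa [abs_sub_comm, abs_sub_comm (Yc J t1)]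
    · intro t
      simp only [hS]
      rw [mem_nrJ hJ]
      simp
    · intro t x hx
      simp only [hS] at hx ⊢
      rw [mem_nrJ hJ] at hx ⊢
      push_cast
      omega
    · intro t t' ht' x hx
      simp only [hS] at ht' hx ⊢
      obtain ⟨_, h1, h2, _⟩ := tgJ_spec hJ ht'
      rw [mem_nrJ hJ] at hx ⊢
      push_cast
      have e1 := abs_le.1 hx.1
      have e2 := abs_le.1 hx.2
      have e3 := abs_le.1 h2
      exact ⟨abs_le.2 ⟨by omega, by omega⟩, abs_le.2 ⟨by omega, by omega⟩⟩
    · intro t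
      refine le_trans ?_ hn2
      refine mul_le_mul_of_nonneg_right ?_ (Nat.cast_nonneg _)
      have := nrJ_card (J := J) (b := b + 1) (t := t) hJ
      exact_mod_cast this
    · intro t t0 x y hx hy h1 h2
      simp only [hS] at hx hy h1 h2 ⊢
      rw [mem_nrJ hJ]
      have key : ∀ (z z' : ℤ) (p p' : ℝ), |p - v * z * R| ≤ ρ * R → |p' - v * z' * R| ≤ ρ * R → |p - p'| ≤ P.a → |z' - z| ≤ b := by
        intro z z' p p' a1 a2 a3
        rw [abs_le] at a1 a2 a3
        have u1 : v * R * ((z' : ℝ) - z) < v * R * (b + 1) := by linarith [a1.1, a1.2, a2.1, a2.2, a3.1, a3.2]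
        have u2 : v * R * ((z : ℝ) - z') < v * R * (b + 1) := by linarith [a1.1, a1.2, a2.1, a2.2, a3.1, a3.2]
        have u3 := lt_of_mul_lt_mul_left u1 (by positivity)
        have u4 := lt_of_mul_lt_mul_left u2 (by positivity)
        have u5 : z' - z < b + 1 := by exact_mod_cast u3
        have u6 : z - z' < b + 1 := by exact_mod_cast u4
        rw [abs_le]; constructor <;> omega
      refine ⟨key _ _ _ _ (by simpa using hx.1) (by simpa using hy.1) h1, key _ _ _ _ hx.2 hy.2 h2⟩
    · intro t t' ht' x y hx h1 h2
      simp only [hS] at ht' hx h1 h2 ⊢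
      obtain ⟨b1, b2⟩ := psi_pos_bound hR hr hx.ne'
      obtain ⟨b3, b4⟩ := tgX t t' ht'
      rw [abs_le] at b1 b2 b3 b4 h1 h2
      have g1 := mul_le_mul_of_nonneg_right b3.1 hR.le
      have g2 := mul_le_mul_of_nonneg_right b3.2 hR.le
      have g3 := mul_le_mul_of_nonneg_right b4.1 hR.le
      have g4 := mul_le_mul_of_nonneg_right b4.2 hR.le
      constructor <;> rw [abs_le] <;> constructor <;> linarith [b1.1, b1.2, b2.1, b2.2, h1.1, h1.2, h2.1, h2.2]
    · intro t; exact hT0.trans_le (thr_ge _)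
    · intro t x; exact psi_nonneg _ _ _ _ _
    · intro t x; exact psi_le_one _ _ _ _ _
    · intro t A N D used HA hA hth
      simp only [hS] at HA hth ⊢
      set W := ∑ B ∈ A, wt (psi R r (v * Xc J t) (v * Yc J t)) B with hW
      set θ := thr T0 γ (t % J) with hθ
      have hθ0 : T0 ≤ θ := thr_ge _
      have hθp : 0 < θ := hT0.trans_le hθ0
      have hγθ : 0 < γ * θ := mul_pos hγ hθp
      have hθ1 : thr T0 γ (t % J + 1) = (1 + γ) * θ := by rw [hθ]; unfold thr; ring
      rw [hθ1]
      refine (fail_prob H (Hψ _ _) HA hC0.le hcd0 (G := (1 + γ) * θ) (E0 := (1 + 2 * γ) * θ) (by positivity) (by linarith) ?_).trans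
        (le_trans ?_ hδ)
      · rw [mul_sub, ← mul_assoc, ← hW]
        have e1 : (1 + 4 * γ) * θ ≤ (2 * (1 - s) * ∑ L ∈ P.I, κ L * ∑ l ∈ Finset.range (L + 1), φ l) * W := by
          refine mul_le_mul hΦ hth (by linarith) (by linarith)
        have e2 : 2 * (1 - s) * ((A.card : ℝ) * (P.C * errM P kl k0 Lm h cd n2 α)) ≤ 2 * (γ * T0) := by
          have e3 : (A.card : ℝ) * (P.C * errM P kl k0 Lm h cd n2 α) ≤ γ * T0 := by
            refine le_trans ?_ herr
            have := HA.n1A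
            gcongr
          have e4 : 0 ≤ (A.card : ℝ) * (P.C * errM P kl k0 Lm h cd n2 α) := by positivity
          calc _ ≤ 2 * 1 * ((A.card : ℝ) * (P.C * errM P kl k0 Lm h cd n2 α)) := by
                gcongr
                linarith
            _ ≤ _ := by linarith
        have e5 : γ * T0 ≤ γ * θ := by gcongr
        linarith
      · gcongr ?_ + _ + _
        have e1 : (1 + 2 * γ) * θ - (1 + γ) * θ = γ * θ := by ring
        rw [e1]
        have : 2 * P.C * ((1 + 2 * γ) * θ) / (γ * θ) ^ 2 = 2 * P.C * (1 + 2 * γ) / (γ ^ 2 * θ) := by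
          have : θ ≠ 0 := by linarith
          field_simp
        rw [this]
        gcongr
    · intro t K hK hsum hQ
      simp only [hS] at hK hsum hQ ⊢
      set w := wt (psi (d := d) R r (v * Xc J t) (v * Yc J t)) with hw
      have hw1 : ∀ F ∈ K, P.c ≤ w F ∧ w F ≤ P.C := fun F hF =>
        ⟨(hK F hF).1, (wt_le_cp _ (psi_le_one _ _ _ _) _).trans ((cp_le_tc P.τ F).trans (hK F hF).2)⟩
      by_cases hj : t % J + 1 < J
      · have htg : tgJ J t = {t + 1} := if_pos hj
        obtain ⟨N', h1, h2⟩ := sel_many w hc hC0.le (X := thr T0 γ (t % J + 1)) (hT0.le.trans (thr_ge _)) (tgJ J t) K hw1 (by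
          rw [htg]; simp only [Finset.card_singleton, Nat.cast_one]; linarith)
        refine ⟨N', ?_, h2, hQ⟩
        intro t' ht'
        obtain ⟨_, _, _, h3⟩ := tgJ_spec hJ ht'
        rcases h3 with ⟨_, h4, h5⟩ | ⟨h4, _⟩
        · refine ⟨(h1 t' ht').1, ?_, ?_⟩
          · have e1 := (h1 t' ht').2.2
            have e2 : thr T0 γ (t % J + 1) / P.c ≤ T0 * (1 + γ) ^ J / P.c := by
              gcongr
              exact thr_mono _ _ hj.le
            have : ((N' t').card : ℝ) ≤ nm := by linarith
            exact_mod_cast this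
          · have e1 : Xc J t' = Xc J t := by unfold Xc; rw [h5]
            have e2 : Yc J t' = Yc J t := by unfold Yc; rw [h5, e1]
            simp only
            rw [e1, e2, h4]
            exact (h1 t' ht').2.1
        · exact absurd hj h4
      · have hcard : (tgJ J t).card ≤ 3 := by
          unfold tgJ
          rw [if_neg hj]
          exact Finset.card_le_three
        have hJt : t % J + 1 = J := by have := Nat.mod_lt t hJ; omega
        rw [hJt] at hsum
        have hcard' : ((tgJ J t).card : ℝ) ≤ 3 := by exact_mod_cast hcard
        have hcm : ((tgJ J t).card : ℝ) * (2 * T0 + P.C) ≤ 3 * (2 * T0 + P.C) := by gcongr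
        have hthr : thr T0 γ J = T0 * (1 + γ) ^ J := rfl
        obtain ⟨N', h1, h2⟩ := sel_many w hc hC0.le (X := 2 * T0) (by positivity) (tgJ J t) K hw1 (by linarith)
        refine ⟨N', ?_, h2, hQ⟩
        intro t' ht'
        obtain ⟨_, _, _, h3⟩ := tgJ_spec hJ ht'
        have hsub := (h1 t' ht').1
        rcases h3 with ⟨h4, _⟩ | ⟨_, h4⟩
        · exact absurd h4 hj
        refine ⟨hsub, ?_, ?_⟩
        · have e1 := (h1 t' ht').2.2
          have e2 : 2 * T0 / P.c ≤ T0 * (1 + γ) ^ J / P.c :=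
            div_le_div_of_nonneg_right (by linarith) hc.le
          have : ((N' t').card : ℝ) ≤ nm := by linarith
          exact_mod_cast this
        · simp only
          rw [h4]
          obtain ⟨t1, t2⟩ := tgX t t' ht'
          have e1 : ∑ F ∈ N' t', w F ≤ ∑ F ∈ N' t', 2 * wt (psi (d := d) R r (v * Xc J t') (v * Yc J t')) F :=
            Finset.sum_le_sum fun F hF => wt_centre hr hv P.τ t1 t2 hvc (hK F (hsub hF)).1 (hK F (hsub hF)).2
          rw [← Finset.mul_sum] at e1
          have := (h1 t' ht').2.1
          have e3 : thr T0 γ 0 = T0 := by simp [thr]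
          rw [e3]
          linarith
  obtain ⟨A0, hA1, hA2, hA3⟩ := seeds (d := d) P.τ hq hc hC1 ⌈T0 / P.c⌉₊
  have hng : 0 < ⌈T0 / P.c⌉₊ := Nat.ceil_pos.2 (by positivity)
  have X0 : Xc J 0 = 0 := by simp [Xc]
  have Y0 : Yc J 0 = 0 := by simp [Yc, X0]
  refine perc_of_sys OK hι hM hJ rfl (w := v * R) (ρ := ρ * R) (by positivity) ?_ hJδ (A0 := A0) ?_ ?_
  · intro t x hx
    have := (abs_le.1 hx.1).1
    linarith
  · rintro rfl
    simp at hA1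
    omega
  · refine ⟨?_, ?_, ?_, ?_, ?_⟩
    · intro t' B hB
      simp only [hS] at hB ⊢
      split_ifs at hB with ht
      · subst ht
        obtain ⟨b1, b2, b3, b4⟩ := hA2 B hB
        refine ⟨b1, b2.trans hCcd, H.hqc.trans_le (b3.trans (cp_le_tc _ _)), fun x hx => ?_⟩
        rw [(b4 x hx).1, (b4 x hx).2, X0, Y0]
        simp [hρ0.le]
      · simp at hB
    · intro t'
      simp only [hS]
      split_ifs
      · rw [hA1]
        have h1 := Nat.ceil_lt_add_one (show 0 ≤ T0 / P.c by positivity)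
        have h2 : T0 / P.c ≤ T0 * (1 + γ) ^ J / P.c := by
          gcongr
          linarith
        have : ((⌈T0 / P.c⌉₊ : ℕ) : ℝ) ≤ nm := by linarith
        exact_mod_cast this
      · simp
    · intro t' hne
      simp only [hS] at hne ⊢
      split_ifs at hne ⊢ with ht
      · subst ht
        have e3 : thr T0 γ (0 % J) = T0 := by simp [thr]
        rw [e3, X0, Y0]
        have h1 : ∀ B ∈ A0, P.c ≤ wt (psi (d := d) R r (v * (0 : ℕ)) (v * (0 : ℤ))) B := by
          intro B hB
          obtain ⟨b1, b2, b3, b4⟩ := hA2 B hB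
          refine b3.trans (le_of_eq ?_)
          unfold cp wt
          refine Finset.sum_congr rfl fun x hx => ?_
          rw [show psi (d := d) R r (v * (0 : ℕ)) (v * (0 : ℤ)) x = 1 by
            unfold psi bf
            rw [(b4 x hx).1, (b4 x hx).2]
            simp, mul_one]
        have h2 := Finset.card_nsmul_le_sum _ _ _ h1
        rw [hA1, nsmul_eq_mul] at h2
        refine le_trans ?_ h2
        have := Nat.le_ceil (T0 / P.c)
        rwa [div_le_iff₀ hc] at this
      · exact absurd rfl hne
    · intro t1 t2 _ B1 h1 B2 h2 hne
      simp only at h1 h2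
      have a1 : t1 = 0 := by
        by_contra a1
        rw [if_neg a1] at h1
        simp at h1
      have a2 : t2 = 0 := by
        by_contra a2
        rw [if_neg a2] at h2
        simp at h2
      rw [if_pos a1] at h1
      rw [if_pos a2] at h2
      refine hA3 B1 h1 B2 h2 ?_
      rcases hne with hne | hne
      · omega
      · exact hne
    · simp

end

section
variable {d : ℕ} [Fact (4 ≤ d)]

/-! ## F16: estimates at a fixed scale -/

lemma ch_short {g β l : ℕ} (h : l < g) (x : Zd d) {s : List (Dir d)} (hs : s.length = l) : ch g β (tr x s) = ∅ := by
  unfold ch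
  rw [List.drop_eq_nil_of_le (by simp [tr, hs]; omega)]
  simp

lemma qf_main {τ b Nb g : ℕ} {q C Lm E : ℝ} (hg : 1 ≤ g) (hq : 0 < q) (hC : 0 ≤ C) (hE : 0 ≤ E)
    (hN : ∀ N : ℕ, ((N * (Nb * b) : ℕ) : ℝ) ≤ Lm → ((N * Nb : ℕ) : ℝ) * etc d τ b + 1 ≤ E) :
    QF d τ q C g (Nb * b) Lm (2 * E * C * Gt d g / q) := by
  intro B hB x l hl
  have hG := Gt_nonneg (d := d) g
  by_cases hlg : l < g
  · have : Ex l (fun s => ind (Qb τ q (ch g (Nb * b) (tr x s)) B)) = 0 := by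
      refine (Ex_congr (F' := fun _ => 0) fun s hs => ?_).trans (Ex_const (d := d) l 0)
      rw [ch_short hlg x hs]
      exact ind_neg (not_Qb_empty hq.le B)
    rw [this]
    positivity
  push Not at hlg
  rw [Ex_ch g (Nb * b) l hlg x (fun F => ind (Qb τ q F B))]
  set N := (l - g) / (Nb * b) with hNdef
  have hNl : ((N * (Nb * b) : ℕ) : ℝ) ≤ Lm := by
    refine le_trans ?_ hl
    have : N * (Nb * b) ≤ l - g := Nat.div_mul_le_self _ _
    exact_mod_cast this.trans (Nat.sub_le _ _)
  have h1 := hN N hNl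
  have hassoc : N * (Nb * b) = (N * Nb) * b := (mul_assoc _ _ _).symm
  have bd1 : Ex g (fun s => Ex (N * (Nb * b)) (fun t => Qt τ (trF (pos x s) t) B)) ≤ E * (C * Gt d g) := by
    rw [hassoc]
    refine (BL τ b (HH B) (HH_nonneg B) x (C * Gt d g) (N * Nb) g ?_).trans ?_
    · intro t ht _ w _
      refine (Ex_HH B t (hg.trans ht) _).trans ?_
      exact mul_le_mul ((cp_le_tc τ B).trans hB) (Gt_anti hg ht) (Gt_nonneg _) hC
    · gcongr
  have bd2 : Ex g (fun s => Ex (N * (Nb * b)) (fun t => Qt τ B (trF (pos x s) t))) ≤ C * (E * Gt d g) := by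
    have e1 : ∀ y : Zd d, Ex g (fun s => Ex (N * (Nb * b)) (fun t => HH (trF (pos x s) t) y)) ≤ E * Gt d g := by
      intro y
      rw [hassoc]
      refine le_trans (Ex_mono fun s _ => Ex_mono fun t _ => wt_le_tcf τ (fun z => gr (z - y)) (fun _ => gr_nonneg _) _) ?_
      refine (BL τ b (fun z => gr (z - y)) (fun _ => gr_nonneg _) x (Gt d g) (N * Nb) g ?_).trans ?_
      · intro t ht _ w _
        refine le_trans (le_of_eq (Ex_congr fun s _ => ?_)) ((Ex_gr_le t (hg.trans ht) (x + w) y).trans (Gt_anti hg ht))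
        rw [← gr_symm, neg_sub]
      · gcongr
    unfold Qt
    have e2 : Ex g (fun s => Ex (N * (Nb * b)) (fun t => ∑ y ∈ B, esc B τ y * HH (trF (pos x s) t) y)) =
        ∑ y ∈ B, esc B τ y * Ex g (fun s => Ex (N * (Nb * b)) (fun t => HH (trF (pos x s) t) y)) := by
      simp only [Ex_sum, Ex_mul_left]
    rw [e2]
    calc _ ≤ ∑ y ∈ B, esc B τ y * (E * Gt d g) :=
          Finset.sum_le_sum fun y _ => mul_le_mul_of_nonneg_left (e1 y) (esc_nonneg _ _ _)
      _ = tc τ B * (E * Gt d g) := by rw [← Finset.sum_mul]; rfl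
      _ ≤ _ := mul_le_mul_of_nonneg_right hB (by positivity)
  have hpt : ∀ F : Finset (Zd d), ind (Qb τ q F B) ≤ (1 / q) * (Qt τ F B + Qt τ B F) := by
    intro F
    have n1 := Qt_nonneg τ F B
    have n2 := Qt_nonneg τ B F
    by_cases h : Qb τ q F B
    · rw [ind_pos h, div_mul_eq_mul_div, one_mul, le_div_iff₀ hq]
      rcases h with h | h <;> linarith
    · rw [ind_neg h]; positivity
  refine le_trans (Ex_mono fun s _ => Ex_mono fun t _ => hpt _) ?_
  simp only [Ex_mul_left, Ex_add_fun]
  rw [div_mul_eq_mul_div, one_mul]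
  gcongr
  linarith

set_option maxHeartbeats 1000000 in
lemma core_main {P : Prm} {b Nb : ℕ} {μ ℓ R r s s1 K sp c0 C1 εd Ce e E1 : ℝ} (hμ : 0 < μ) (hℓ : 1 ≤ ℓ) (hR0 : 0 < R) (hR : R ^ 2 = μ) (hr : 1 ≤ r)
    (hs : 0 < s) (hs' : s ≤ 1 / 2) (hs1 : 0 < s1) (hK : 0 < K) (hsp : 0 < sp) (hc0 : 0 < c0) (hεd : 0 < εd) (hCe : 0 ≤ Ce) (he : 0 < e)
    (hbump : ∀ t : ℕ, 1 ≤ t → s1 * R ^ 2 ≤ t → t ≤ K * R ^ 2 → ∀ c1 c2 : ℝ, ∀ x : Zd d, 0 < psi R r c1 c2 x →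
        (1 - s) * psi R r c1 c2 x ≤ Ex t (fun w => psi R r c1 c2 (pos x w)) - sp)
    (hPβ : P.β = Nb * b) (hPC : P.C = C1 * (μ / ℓ)) (hPc : P.c = c0 * (μ / ℓ))
    (hg1 : s1 * μ ≤ P.g) (hg2 : P.g ≤ s1 * μ + 2) (hg : 1 ≤ P.g) (hβ0 : 0 < Nb * b) (hβs : ((Nb * b : ℕ) : ℝ) + 2 ≤ s1 * μ / 2)
    (hetc : etc d P.τ b ≤ Ce * b / ℓ) (hE1 : E1 = K * Ce + 1)
    (hE : ∀ T : ℕ, ((Nb * b : ℕ) : ℝ) ≤ T → T ≤ K * μ → |ecap d T - εd * T / ℓ| ≤ e * T / ℓ)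
    (hes : e ≤ s * εd) (heK : 2 * e * K ≤ c0) (hz : E1 * (6 / (r * R) * (b + Real.sqrt ((Nb * b : ℕ) : ℝ))) ≤ c0 / 2)
    (hM : 2 ≤ c0 * (μ / ℓ)) (hM1 : 1 ≤ μ / ℓ) (hbM : (b : ℝ) + 1 ≤ μ / ℓ) (hNM : K * μ ≤ μ / ℓ * ((Nb * b : ℕ) : ℝ))
    (hc0s : 5 * c0 ≤ (1 - s) * εd * (s1 / 2) * sp) (hC1 : 2 * E1 ^ 2 / c0 ≤ C1) (c1 c2 : ℝ) :
    GPsi P (fun l => (1 - s) ^ 2 * (εd / ℓ) * max 0 (l - 2 * s1 * μ)) (K * μ) (psi (d := d) R r c1 c2) := by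
  have hℓ0 : 0 < ℓ := by linarith
  set M := μ / ℓ with hMd
  have hM0 : 0 < M := by positivity
  have hE10 : 1 ≤ E1 := by rw [hE1]; nlinarith [mul_nonneg hK.le hCe]
  have hC10 : 0 < C1 := lt_of_lt_of_le (by positivity) hC1
  refine ⟨psi_nonneg _ _ _ _, psi_le_one _ _ _ _, fun l => ?_, ?_⟩
  · have : 0 ≤ (1 - s) ^ 2 := sq_nonneg _
    positivity
  intro l x hl
  set ψ := psi (d := d) R r c1 c2 with hψ
  set RHS := Ex l (fun s => wt ψ (ch P.g P.β (tr x s)) * ind (tc P.τ (ch P.g P.β (tr x s)) ≤ P.C ∧ P.c ≤ wt ψ (ch P.g P.β (tr x s)))) with hRHS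
  have hRHS0 : 0 ≤ RHS := Ex_nonneg fun t _ => mul_nonneg (wt_nonneg _ (psi_nonneg _ _ _ _) _) (ind_nonneg _)
  by_cases hl2 : (l : ℝ) ≤ 2 * s1 * μ
  · rw [max_eq_left (by linarith)]
    simpa using hRHS0
  push Not at hl2
  rcases (psi_nonneg R r c1 c2 x).eq_or_lt with hx | hx
  · rw [hψ, ← hx]; simpa using hRHS0
  rw [max_eq_right (by linarith)]
  have hs1μ : 0 < s1 * μ := by positivity
  have hlg : P.g ≤ l := by
    have : (P.g : ℝ) ≤ l := by
      have : (0 : ℝ) ≤ ((Nb * b : ℕ) : ℝ) := Nat.cast_nonneg _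
      linarith
    exact_mod_cast this
  set N := (l - P.g) / P.β with hN
  set β := Nb * b with hβ
  have hNl : ((N * β : ℕ) : ℝ) ≤ l - P.g := by
    have h1 : N * β ≤ l - P.g := by rw [hN, hPβ]; exact Nat.div_mul_le_self _ _
    have h2 : N * β + P.g ≤ l := by omega
    have : ((N * β + P.g : ℕ) : ℝ) ≤ l := by exact_mod_cast h2
    push_cast at this ⊢
    linarith
  have hNu : (l : ℝ) - P.g ≤ (N : ℝ) * β + β := by
    have h1 : l - P.g < (N + 1) * β := by
      rw [hN, hPβ]
      have := Nat.lt_div_mul_add (a := l - P.g) hβ0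
      linarith
    have h2 : l ≤ (N + 1) * β + P.g := by omega
    have : (l : ℝ) ≤ (((N + 1) * β + P.g : ℕ) : ℝ) := by exact_mod_cast h2
    push_cast at this
    linarith
  have hβR : (0 : ℝ) < (β : ℝ) := by exact_mod_cast hβ0
  have hNβ : (l : ℝ) - 2 * s1 * μ + s1 * μ / 2 ≤ (N : ℝ) * β := by linarith
  have hN1 : 1 ≤ N := by
    by_contra h
    have : N = 0 := Nat.lt_one_iff.1 (not_le.1 h)
    rw [this] at hNβ
    simp at hNβ
    linarith
  have hgn : (0 : ℝ) ≤ P.g := Nat.cast_nonneg _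
  have hNβK : ((N * β : ℕ) : ℝ) ≤ K * μ := by linarith
  have hNβK' : (N : ℝ) * β ≤ K * μ := by exact_mod_cast hNβK
  have hNM' : (N : ℝ) ≤ M := by
    have : (N : ℝ) * β ≤ M * β := hNβK'.trans hNM
    exact le_of_mul_le_mul_right this hβR
  have hetc0 := etc_nonneg (d := d) P.τ b
  have hNe : (N : ℝ) * (Nb * etc d P.τ b) ≤ K * Ce * M := by
    calc (N : ℝ) * (Nb * etc d P.τ b) ≤ N * (Nb * (Ce * b / ℓ)) := by gcongr
      _ = (N * β) * (Ce / ℓ) := by rw [hβ]; push_cast; ring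
      _ ≤ (K * μ) * (Ce / ℓ) := by gcongr
      _ = _ := by rw [hMd]; ring
  have hE1M : K * Ce * M + M = E1 * M := by rw [hE1]; ring
  -- the first moment
  have h1 := core1 (d := d) P.τ b Nb N P.g hR0 (by linarith : 0 < r) c1 c2 x
  rw [← hβ, ← hψ] at h1
  set z := 6 / (r * R) * ((b : ℝ) + Real.sqrt (β : ℝ)) with hzd
  have hz0 : 0 ≤ z := by positivity
  have herr : (N : ℝ) * ((Nb * etc d P.τ b + 1) * z) ≤ c0 / 2 * M := by
    calc (N : ℝ) * ((Nb * etc d P.τ b + 1) * z) = (N * (Nb * etc d P.τ b) + N) * z := by ring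
      _ ≤ (K * Ce * M + M) * z := by gcongr
      _ = (E1 * z) * M := by rw [hE1M]; ring
      _ ≤ _ := by gcongr
  have hsum : (N : ℝ) * ((1 - s) * ψ x + sp) ≤ ∑ i ∈ Finset.range N, Ex (P.g + i * β) (fun s => ψ (pos x s)) := by
    have : ∑ i ∈ Finset.range N, ((1 - s) * ψ x + sp) ≤ ∑ i ∈ Finset.range N, Ex (P.g + i * β) (fun s => ψ (pos x s)) := by
      refine Finset.sum_le_sum fun i hi => ?_
      rw [Finset.mem_range] at hi
      have h3 : ((i * β : ℕ) : ℝ) ≤ ((N * β : ℕ) : ℝ) := by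
        exact_mod_cast Nat.mul_le_mul_right β hi.le
      have h4 := hbump (P.g + i * β) (by omega) (by
        rw [hR]
        have : (0 : ℝ) ≤ ((i * β : ℕ) : ℝ) := Nat.cast_nonneg _
        push_cast at this ⊢; linarith) (by
        rw [hR]; push_cast at h3 hNl ⊢; linarith) c1 c2 x hx
      linarith
    rw [Finset.sum_const, Finset.card_range, nsmul_eq_mul] at this
    exact this
  have hEβ := abs_le.1 (hE β le_rfl (by
    have : ((β : ℕ) : ℝ) ≤ N * β := le_mul_of_one_le_left hβR.le (by exact_mod_cast hN1)
    linarith))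
  have hENβ := abs_le.1 (hE (N * β) (by exact_mod_cast Nat.le_mul_of_pos_left β hN1) hNβK)
  have hdiff : -(c0 * M) ≤ ecap d (N * β) - N * ecap d β := by
    have a1 := mul_le_mul_of_nonneg_left hEβ.2 (Nat.cast_nonneg N : (0 : ℝ) ≤ N)
    have a2 := hENβ.1
    push_cast at a2
    have a3 : e * ((N : ℝ) * β) / ℓ ≤ e * (K * μ) / ℓ := by gcongr
    have a4 : e * (K * μ) / ℓ = e * K * M := by rw [hMd]; ring
    have a5 : 2 * e * K * M ≤ c0 * M := by gcongr
    have a6 : (N : ℝ) * (ecap d β - εd * β / ℓ) = N * ecap d β - εd * (N * β) / ℓ := by ring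
    have a7 : (N : ℝ) * (e * β / ℓ) = e * (N * β) / ℓ := by ring
    linarith
  have hlow : (1 - s) * (εd / ℓ) * β ≤ ecap d β := by
    have a1 := hEβ.1
    have a2 : e * β / ℓ ≤ s * εd * β / ℓ := by gcongr
    have a3 : (1 - s) * (εd / ℓ) * β = εd * β / ℓ - s * εd * β / ℓ := by ring
    linarith
  have hψx : 0 ≤ ψ x := hx.le
  have h1s : 0 < 1 - s := by linarith
  have hmain : (1 - s) ^ 2 * (εd / ℓ) * (l - 2 * s1 * μ) * ψ x + 5 * c0 * M ≤
      ecap d β * ∑ i ∈ Finset.range N, Ex (P.g + i * β) (fun s => ψ (pos x s)) := by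
    calc _ ≤ (1 - s) * (εd / ℓ) * (N * β) * ((1 - s) * ψ x + sp) := by
          have a1 : (1 - s) * (εd / ℓ) * (l - 2 * s1 * μ) * ((1 - s) * ψ x) ≤ (1 - s) * (εd / ℓ) * (N * β) * ((1 - s) * ψ x) := by
            gcongr
            linarith
          have a2 : (1 - s) * (εd / ℓ) * (s1 * μ / 2) * sp ≤ (1 - s) * (εd / ℓ) * (N * β) * sp := by
            gcongr
            linarith
          have a3 : (1 - s) * (εd / ℓ) * (s1 * μ / 2) * sp = (1 - s) * εd * (s1 / 2) * sp * M := by rw [hMd]; ring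
          have a4 : 5 * c0 * M ≤ (1 - s) * εd * (s1 / 2) * sp * M := by gcongr
          linarith
      _ = (1 - s) * (εd / ℓ) * β * (N * ((1 - s) * ψ x + sp)) := by ring
      _ ≤ _ := mul_le_mul hlow hsum (by positivity) (ecap_nonneg _)
  -- truncation
  have hC : 0 < P.C := by rw [hPC]; positivity
  have hpt : ∀ F : Finset (Zd d), wt ψ F - (1 / P.C) * tc P.τ F ^ 2 - P.c ≤ wt ψ F * ind (tc P.τ F ≤ P.C ∧ P.c ≤ wt ψ F) := by
    intro F
    have n0 : 0 ≤ wt ψ F := wt_nonneg _ (psi_nonneg _ _ _ _) _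
    have n1 : wt ψ F ≤ tc P.τ F := (wt_le_cp _ (psi_le_one _ _ _ _) _).trans (cp_le_tc _ _)
    have n2 : 0 ≤ (1 / P.C) * tc P.τ F ^ 2 := by positivity
    have n3 : 0 ≤ P.c := by rw [hPc]; positivity
    by_cases hA : tc P.τ F ≤ P.C ∧ P.c ≤ wt ψ F
    · rw [ind_pos hA, mul_one]; linarith
    · rw [ind_neg hA, mul_zero]
      by_cases hB : tc P.τ F ≤ P.C
      · have : wt ψ F < P.c := by
          by_contra h
          exact hA ⟨hB, not_lt.1 h⟩
        linarith
      · push Not at hB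
        have : tc P.τ F ≤ (1 / P.C) * tc P.τ F ^ 2 := by
          rw [div_mul_eq_mul_div, one_mul, le_div_iff₀ hC]
          rw [sq]; exact mul_le_mul_of_nonneg_left hB.le (hC.le.trans hB.le)
        linarith
  have hRHS' : RHS = Ex P.g (fun s => Ex (N * β) (fun t => wt ψ (trF (pos x s) t) *
      ind (tc P.τ (trF (pos x s) t) ≤ P.C ∧ P.c ≤ wt ψ (trF (pos x s) t)))) := by
    rw [hRHS, Ex_ch P.g P.β l hlg x (fun F => wt ψ F * ind (tc P.τ F ≤ P.C ∧ P.c ≤ wt ψ F)), hN, hPβ]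
  have hge : Ex P.g (fun s => Ex (N * β) (fun t => wt ψ (trF (pos x s) t) - (1 / P.C) * tc P.τ (trF (pos x s) t) ^ 2 - P.c)) ≤ RHS := by
    rw [hRHS']
    exact Ex_mono fun s _ => Ex_mono fun t _ => hpt _
  simp only [Ex_sub_fun, Ex_mul_left, Ex_const] at hge
  have hm2 : Ex P.g (fun s => Ex (N * β) (fun t => tc P.τ (trF (pos x s) t) ^ 2)) ≤ 2 * E1 ^ 2 * M ^ 2 := by
    refine Ex_le_const fun s _ => ?_
    have e1 : N * β = (N * Nb) * b := by rw [hβ, mul_assoc]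
    rw [e1]
    refine (tc_mom2 P.τ b (N * Nb) (pos x s)).trans ?_
    push_cast
    have e2 : (N : ℝ) * Nb * etc d P.τ b ≤ K * Ce * M := by rw [mul_assoc]; exact hNe
    have e3 : (N : ℝ) * Nb * etc d P.τ b + 1 ≤ E1 * M := by linarith
    have e4 : (N : ℝ) * Nb * (((b : ℝ) + 1) * etc d P.τ b) ≤ E1 * M * M := by
      calc (N : ℝ) * Nb * (((b : ℝ) + 1) * etc d P.τ b) = (N * Nb * etc d P.τ b) * (b + 1) := by ring
        _ ≤ (E1 * M) * M := mul_le_mul (by linarith) hbM (by positivity) (by positivity)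
    have e5 : ((N : ℝ) * Nb * etc d P.τ b + 1) ^ 2 ≤ (E1 * M) ^ 2 := by gcongr
    have e6 : E1 * M * M ≤ E1 ^ 2 * M ^ 2 := by
      have : E1 ≤ E1 ^ 2 := by rw [sq]; exact le_mul_of_one_le_left (by linarith) hE10
      calc E1 * M * M = E1 * M ^ 2 := by ring
        _ ≤ E1 ^ 2 * M ^ 2 := by gcongr
    calc _ ≤ (E1 * M) ^ 2 + E1 ^ 2 * M ^ 2 := by linarith
      _ = 2 * E1 ^ 2 * M ^ 2 := by ring
  have hm2' : (1 / P.C) * Ex P.g (fun s => Ex (N * β) (fun t => tc P.τ (trF (pos x s) t) ^ 2)) ≤ c0 * M := by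
    rw [div_mul_eq_mul_div, one_mul, div_le_iff₀ hC, hPC]
    rw [div_le_iff₀ hc0] at hC1
    calc _ ≤ 2 * E1 ^ 2 * M ^ 2 := hm2
      _ ≤ (C1 * c0) * M ^ 2 := by gcongr
      _ = _ := by ring
  rw [hPc] at hge
  linarith

end

section
variable {d : ℕ} [Fact (4 ≤ d)]

/-! ## F17: asymptotics -/

lemma lF_ge {x : ℝ} (hx : 1 ≤ x) : 1 ≤ logFour d x := by
  unfold logFour
  split_ifs
  · linarith [Real.log_nonneg hx]
  · simp

lemma scale (d : ℕ) [Fact (4 ≤ d)] (A : ℝ) : ∀ᶠ μ : ℝ in atTop, ∃ y : ℝ, A ≤ y ∧ 2 ≤ y ∧ μ = y ^ 8 ∧ 1 ≤ logFour d μ ∧ logFour d μ ≤ y := by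
  have hy : Tendsto (fun μ : ℝ => μ ^ (1 / 8 : ℝ)) atTop atTop := tendsto_rpow_atTop (by norm_num)
  have hl := (isLittleO_log_rpow_atTop (show (0 : ℝ) < 1 / 8 by norm_num)).bound (show (0 : ℝ) < 1 / 2 by norm_num)
  filter_upwards [hy.eventually_ge_atTop A, hy.eventually_ge_atTop 2, hl, eventually_ge_atTop 1] with μ h1 h2 h3 h4
  refine ⟨_, h1, h2, ?_, lF_ge h4, ?_⟩
  · rw [← Real.rpow_natCast, ← Real.rpow_mul (by linarith)]
    norm_num
  · rw [Real.norm_of_nonneg (Real.log_nonneg h4), Real.norm_of_nonneg (by linarith)] at h3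
    unfold logFour
    split_ifs <;> linarith

lemma Gt_scale (d : ℕ) [Fact (4 ≤ d)] {s1 e : ℝ} (hs1 : 0 < s1) (he : 0 < e) :
    ∀ᶠ μ : ℝ in atTop, ∀ g1 : ℕ, s1 * μ / 2 ≤ g1 → μ / logFour d μ * Gt d g1 ≤ e := by
  have hG := GC_pos (d := d)
  set A := 2 * GC d / (s1 * e) with hA
  have key : ∀ᶠ μ : ℝ in atTop, ∀ g1 : ℕ, s1 * μ / 2 ≤ g1 → A ≤ logFour d μ * rr d g1 := by
    unfold logFour rr
    by_cases hd : d = 4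
    · simp only [hd, if_true]
      filter_upwards [Real.tendsto_log_atTop.eventually_ge_atTop A] with μ h g1 _
      linarith
    · simp only [hd, if_false]
      filter_upwards [eventually_ge_atTop (2 * A ^ 2 / s1)] with μ h g1 hg
      rw [add_zero, one_mul]
      apply Real.le_sqrt_of_sq_le
      rw [div_le_iff₀ hs1] at h
      linarith
  filter_upwards [key, eventually_ge_atTop 1] with μ h hμ g1 hg
  have hℓ : 1 ≤ logFour d μ := lF_ge hμ
  have hg0 : (0 : ℝ) < g1 := lt_of_lt_of_le (by positivity) hg
  have hr := rr_pos (d := d) hg0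
  unfold Gt
  have h1 := h g1 hg
  rw [hA, div_le_iff₀ (by positivity)] at h1
  rw [div_mul_div_comm, div_le_iff₀ (by positivity)]
  calc μ * GC d = (2 * GC d) * (μ / 2) := by ring
    _ ≤ logFour d μ * rr d g1 * (s1 * e) * (μ / 2) := by gcongr
    _ = e * (logFour d μ * ((s1 * μ / 2) * rr d g1)) := by ring
    _ ≤ _ := by gcongr

lemma lF_near (d : ℕ) {a K δ : ℝ} (ha : 0 < a) (hδ : 0 < δ) :
    ∀ᶠ μ : ℝ in atTop, ∀ T : ℕ, a * μ ≤ T → T ≤ K * μ → 1 ≤ logFour d T ∧ |logFour d μ - logFour d T| ≤ δ * logFour d T := by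
  by_cases hd : d = 4
  · have ht : Tendsto (fun μ : ℝ => Real.log (a * μ)) atTop atTop :=
      Real.tendsto_log_atTop.comp (tendsto_id.const_mul_atTop ha)
    set D := max |Real.log a| |Real.log K| with hD
    have hD0 : 0 ≤ D := le_max_of_le_left (abs_nonneg _)
    filter_upwards [ht.eventually_ge_atTop (D / δ), eventually_gt_atTop 0] with μ h1 h2 T h3 h4
    have haμ : 0 < a * μ := by positivity
    have hT : (0 : ℝ) < T := by linarith
    have hK : 0 < K := by
      by_contra h
      have := mul_nonpos_of_nonpos_of_nonneg (not_lt.1 h) h2.le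
      linarith
    have l1 := Real.log_le_log haμ h3
    have l2 := Real.log_le_log hT h4
    rw [Real.log_mul ha.ne' h2.ne'] at l1
    rw [Real.log_mul hK.ne' h2.ne'] at l2
    rw [Real.log_mul ha.ne' h2.ne'] at h1
    unfold logFour
    simp only [hd, if_true]
    have hDδ : 0 ≤ D / δ := by positivity
    refine ⟨by linarith, ?_⟩
    have b1 : D ≤ δ * (1 + Real.log T) := by
      rw [div_le_iff₀ hδ] at h1
      calc D ≤ (Real.log a + Real.log μ) * δ := h1
        _ ≤ (1 + Real.log T) * δ := mul_le_mul_of_nonneg_right (by linarith) hδ.le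
        _ = _ := mul_comm _ _
    refine le_trans ?_ b1
    have c1 := neg_abs_le (Real.log a)
    have c2 := le_abs_self (Real.log K)
    have c3 : |Real.log a| ≤ D := le_max_left _ _
    have c4 : |Real.log K| ≤ D := le_max_right _ _
    rw [abs_le]
    constructor <;> linarith
  · refine Eventually.of_forall fun μ T _ _ => ?_
    unfold logFour
    simp only [hd, if_false]
    simp [hδ.le]

lemma ecap_near {εd : ℝ} (hε : 0 < εd) (hlim : Tendsto (fun T : ℕ => ecap d T * logFour d T / (T : ℝ)) atTop (𝓝 εd))
    {a K e : ℝ} (ha : 0 < a) (he : 0 < e) :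
    ∀ᶠ μ : ℝ in atTop, ∀ T : ℕ, a * μ ≤ T → T ≤ K * μ → |ecap d T - εd * T / logFour d μ| ≤ e * T / logFour d μ := by
  set δ := min 1 (e / (4 * εd)) with hδ
  have hδ0 : 0 < δ := by positivity
  have hδe : εd * δ ≤ e / 4 := by
    calc εd * δ ≤ εd * (e / (4 * εd)) := by gcongr; exact min_le_right _ _
      _ = e / 4 := by field_simp
  have h1 := (Metric.tendsto_nhds.1 hlim (e / 4) (by positivity))
  obtain ⟨T0, hT0⟩ := eventually_atTop.1 h1
  filter_upwards [lF_near d (K := K) ha hδ0, eventually_ge_atTop ((T0 : ℝ) / a), eventually_ge_atTop 1] with μ h2 h3 h4 T h5 h6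
  obtain ⟨l1, l2⟩ := h2 T h5 h6
  have hTT : T0 ≤ T := by
    rw [div_le_iff₀ ha] at h3
    have : (T0 : ℝ) ≤ T := by linarith
    exact_mod_cast this
  have hx := hT0 T hTT
  rw [Real.dist_eq] at hx
  have hT : (0 : ℝ) < T := lt_of_lt_of_le (by positivity) h5
  have hℓ : 1 ≤ logFour d μ := lF_ge h4
  set ℓ := logFour d μ
  set lT := logFour d T
  set x := ecap d T * lT / T with hxd
  have hlT : 0 < lT := by linarith
  have hℓ0 : 0 < ℓ := by linarith
  have e1 : ecap d T - εd * T / ℓ = ((x - εd) * ℓ + εd * (ℓ - lT)) / lT * (T / ℓ) := by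
    rw [hxd]; field_simp; ring
  have hℓ2 : ℓ ≤ 2 * lT := by
    have := (abs_le.1 l2).2
    have : δ * lT ≤ 1 * lT := by gcongr; exact min_le_left _ _
    linarith
  have e2 : |(x - εd) * ℓ + εd * (ℓ - lT)| ≤ e * lT := by
    calc _ ≤ |(x - εd) * ℓ| + |εd * (ℓ - lT)| := abs_add_le _ _
      _ = |x - εd| * ℓ + εd * |ℓ - lT| := by rw [abs_mul, abs_mul, abs_of_pos hℓ0, abs_of_pos hε]
      _ ≤ e / 4 * (2 * lT) + εd * (δ * lT) := by gcongr
      _ = e / 4 * (2 * lT) + (εd * δ) * lT := by ring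
      _ ≤ e / 4 * (2 * lT) + (e / 4) * lT := by gcongr
      _ ≤ _ := by nlinarith [mul_pos he hlT]
  rw [e1, abs_mul, abs_div, abs_of_pos hlT, abs_of_pos (div_pos hT hℓ0), mul_div_assoc]
  gcongr
  rwa [div_le_iff₀ hlT]

lemma etc_near {εd : ℝ} (hε : 0 < εd) (hlim : Tendsto (fun T : ℕ => ecap d T * logFour d T / (T : ℝ)) atTop (𝓝 εd)) :
    ∃ A : ℝ, ∀ y ℓ : ℝ, A ≤ y → 2 ≤ y → ℓ = logFour d (y ^ 8) → 1 ≤ ℓ → ℓ ≤ y →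
      ∀ b : ℕ, y / 2 ≤ b → b ≤ y → etc d (b ^ 2) b ≤ (32 * εd + 8 * GC d) * b / ℓ := by
  have hG := GC_pos (d := d)
  obtain ⟨T0, hT0⟩ := eventually_atTop.1 (hlim.eventually (gt_mem_nhds (show εd < 2 * εd by linarith)))
  refine ⟨2 * T0, fun y ℓ hA hy hℓd hℓ hℓy b hb1 hb2 => ?_⟩
  have hbT : T0 ≤ b := by
    have : (T0 : ℝ) ≤ b := by linarith
    exact_mod_cast this
  have hb1' : (1 : ℝ) ≤ b := by linarith
  have hbn : 1 ≤ b := by exact_mod_cast hb1'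
  have hb0 : (0 : ℝ) < b := by linarith
  have hlb : 1 ≤ logFour d b := lF_ge hb1'
  have hl16 : ℓ ≤ 16 * logFour d b := by
    rw [hℓd]
    unfold logFour
    split_ifs
    · have h1 : Real.log (y / 2) ≤ Real.log b := Real.log_le_log (by linarith) hb1
      rw [Real.log_div (by linarith) (by norm_num)] at h1
      rw [Real.log_pow]
      have := Real.log_two_lt_d9
      have := Real.log_nonneg (by linarith : 1 ≤ y)
      push_cast
      linarith
    · norm_num
  have h1 := hT0 b hbT
  rw [div_lt_iff₀ hb0] at h1
  have h2 : ecap d b ≤ 32 * εd * b / ℓ := by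
    rw [le_div_iff₀ (by linarith)]
    calc ecap d b * ℓ ≤ ecap d b * (16 * logFour d b) := by gcongr; exact ecap_nonneg _
      _ = 16 * (ecap d b * logFour d b) := by ring
      _ ≤ 16 * (2 * εd * b) := by gcongr
      _ = _ := by ring
  have hGt : Gt d (b ^ 2) ≤ GC d / b ^ 2 := by
    unfold Gt
    have h3 : (1 : ℝ) ≤ rr d ((b ^ 2 : ℕ) : ℝ) := by
      unfold rr
      split_ifs
      · exact le_rfl
      · rw [Real.one_le_sqrt]; push_cast; nlinarith
    push_cast at h3 ⊢
    gcongr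
    exact le_mul_of_one_le_right (by positivity) h3
  have h4 : etc d (b ^ 2) b ≤ ecap d b + 4 * GC d := by
    rw [← Ex_cp_trF b (0 : Zd d)]
    unfold etc
    rw [← Ex_const (d := d) b (4 * GC d), ← Ex_add_fun]
    refine Ex_mono fun s hs => ?_
    refine (tc_le_cp _ (b ^ 2) (Nat.one_le_pow _ _ hbn)).trans ?_
    have hc : (((trF (0 : Zd d) s).card : ℕ) : ℝ) ≤ 2 * b := by
      have : (trF (0 : Zd d) s).card ≤ b + 1 := by
        unfold trF
        refine (List.toFinset_card_le _).trans ?_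
        simp [tr, hs]
      have : (((trF (0 : Zd d) s).card : ℕ) : ℝ) ≤ b + 1 := by exact_mod_cast this
      linarith
    refine add_le_add le_rfl ?_
    calc _ ≤ (2 * (b : ℝ)) ^ 2 * (GC d / b ^ 2) :=
          mul_le_mul (pow_le_pow_left₀ (Nat.cast_nonneg _) hc 2) hGt (Gt_nonneg _) (by positivity)
      _ = 4 * GC d := by field_simp; ring
  have h5 : 4 * GC d ≤ 8 * GC d * b / ℓ := by
    rw [le_div_iff₀ (by linarith)]
    calc 4 * GC d * ℓ ≤ 4 * GC d * (2 * b) := by gcongr; linarith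
      _ = _ := by ring
  calc _ ≤ 32 * εd * b / ℓ + 8 * GC d * b / ℓ := by linarith
    _ = _ := by ring

end

section
variable {d : ℕ} [Fact (4 ≤ d)]

/-! ## F18: choice of scales, and moments of the length distribution -/

lemma QF_mono {τ g β : ℕ} {q C Lm α α' : ℝ} (h : QF d τ q C g β Lm α) (hα : α ≤ α') : QF d τ q C g β Lm α' :=
  fun B hB x l hl => (h B hB x l hl).trans hα

lemma floors {y μ p K : ℝ} (hy : 2 ≤ y) (hμy : μ = y ^ 8) (hp : 1 ≤ p) (hK : 1 ≤ K) (hyp : 2 * p ^ 2 * K ≤ y) :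
    ∃ b Nb : ℕ, 1 ≤ b ∧ y / 2 ≤ b ∧ b ≤ y ∧ ((Nb * b : ℕ) : ℝ) ≤ μ / p ^ 2 ∧ 1 / (2 * p ^ 2) * μ ≤ ((Nb * b : ℕ) : ℝ) := by
  have hy0 : 0 < y := by linarith
  have hμ0 : 0 < μ := by rw [hμy]; positivity
  obtain ⟨b, hb⟩ : ∃ b, b = ⌊y⌋₊ := ⟨_, rfl⟩
  have hb2 : (b : ℝ) ≤ y := by rw [hb]; exact Nat.floor_le hy0.le
  have hb1 : y / 2 ≤ b := by
    have := Nat.lt_floor_add_one y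
    rw [← hb] at this
    linarith
  have hb0 : (0 : ℝ) < b := by linarith
  have hbn : 1 ≤ b := by
    have : (0 : ℝ) < b := hb0
    exact_mod_cast this
  obtain ⟨Nb, hNb⟩ : ∃ b', b' = ⌊μ / (p ^ 2 * b)⌋₊ := ⟨_, rfl⟩
  refine ⟨b, Nb, hbn, hb1, hb2, ?_, ?_⟩
  · push_cast
    calc (Nb : ℝ) * b ≤ μ / (p ^ 2 * b) * b := by gcongr; rw [hNb]; exact Nat.floor_le (by positivity)
      _ = μ / p ^ 2 := by field_simp
  · have hpp : 2 * p ^ 2 * y ≤ μ := by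
      have h1 : 2 * p ^ 2 ≤ y ^ 7 := by
        have a1 : 2 * p ^ 2 ≤ 2 * p ^ 2 * K := le_mul_of_one_le_right (by positivity) hK
        have a2 : y ≤ y ^ 7 := le_self_pow₀ (by linarith) (by norm_num)
        linarith
      calc 2 * p ^ 2 * y ≤ y ^ 7 * y := by gcongr
        _ = μ := by rw [hμy]; ring
    have h1 := Nat.lt_floor_add_one (μ / (p ^ 2 * b))
    rw [← hNb] at h1
    have h2 : μ / p ^ 2 ≤ (Nb + 1) * b := by
      calc μ / p ^ 2 = μ / (p ^ 2 * b) * b := by field_simp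
        _ ≤ _ := by gcongr
    have h3 : y ≤ 1 / (2 * p ^ 2) * μ := by
      rw [div_mul_eq_mul_div, one_mul, le_div_iff₀ (by positivity)]; linarith
    have h4 : μ / p ^ 2 = 2 * (1 / (2 * p ^ 2) * μ) := by field_simp
    push_cast
    linarith

lemma stage1_qf {θ M C1 K μ ℓ η Ce E1 : ℝ} {b Nb g g1 : ℕ} (hℓ : 0 < ℓ) (hM : M = μ / ℓ) (hM1 : 1 ≤ M) (hθ : 0 < θ) (hC1 : 0 < C1)
    (hE10 : 0 < E1) (hCe : 0 ≤ Ce) (hE1 : E1 = K * Ce + 1) (hetc : etc d (b ^ 2) b ≤ Ce * b / ℓ)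
    (hg1 : 1 ≤ g1) (hg : g1 ≤ g) (hMG : M * Gt d g1 ≤ η * θ / (2 * E1 * C1)) :
    QF d (b ^ 2) (θ * M) (C1 * M) g (Nb * b) (K * μ) η := by
  have hM0 : 0 < M := by linarith
  refine QF_mono (qf_main (E := E1 * M) (hg1.trans hg) (by positivity) (by positivity) (by positivity) ?_) ?_
  · intro N hN
    have h1 : ((N * Nb : ℕ) : ℝ) * etc d (b ^ 2) b ≤ K * Ce * M := by
      calc ((N * Nb : ℕ) : ℝ) * etc d (b ^ 2) b ≤ ((N * Nb : ℕ) : ℝ) * (Ce * b / ℓ) := by gcongr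
        _ = ((N * (Nb * b) : ℕ) : ℝ) * (Ce / ℓ) := by push_cast; ring
        _ ≤ (K * μ) * (Ce / ℓ) := by gcongr
        _ = _ := by rw [hM]; ring
    have h2 : E1 * M = K * Ce * M + M := by rw [hE1]; ring
    linarith
  · have h1 : M * Gt d g ≤ η * θ / (2 * E1 * C1) :=
      le_trans (mul_le_mul_of_nonneg_left (Gt_anti hg1 hg) hM0.le) hMG
    rw [le_div_iff₀ (by positivity)] at h1
    rw [div_le_iff₀ (by positivity)]
    calc 2 * (E1 * M) * (C1 * M) * Gt d g = (M * Gt d g * (2 * E1 * C1)) * M := by ring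
      _ ≤ (η * θ) * M := by gcongr
      _ = _ := by ring

lemma stage1_psi {εd s s1 K r sp c0 C1 E1 Ce e p y μ ℓ M θ a : ℝ} {b Nb g1 : ℕ} {I : Finset ℕ} (hε : 0 < εd)
    (hs : 0 < s) (hs' : s ≤ 1 / 2) (hs1 : 0 < s1) (hK : 1 ≤ K) (hr : 1 ≤ r) (hsp : 0 < sp)
    (hbump : ∀ R : ℝ, 0 < R → ∀ t : ℕ, 1 ≤ t → s1 * R ^ 2 ≤ t → t ≤ K * R ^ 2 →
      ∀ c1 c2 : ℝ, ∀ x : Zd d, 0 < psi R r c1 c2 x → (1 - s) * psi R r c1 c2 x ≤ Ex t (fun w => psi R r c1 c2 (pos x w)) - sp)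
    (hc0 : 0 < c0) (hc0s : 5 * c0 ≤ (1 - s) * εd * (s1 / 2) * sp) (hCe : 0 ≤ Ce) (hE1 : E1 = K * Ce + 1) (hE10 : 0 < E1)
    (hC1 : 2 * E1 ^ 2 / c0 ≤ C1)
    (hp1 : 1 ≤ p) (hp2 : 4 / s1 ≤ p) (hp3 : 24 * E1 / c0 ≤ p) (he0 : 0 < e) (hes : e ≤ s * εd) (heK : e ≤ c0 / (2 * K))
    (hy : 2 ≤ y) (hμy : μ = y ^ 8) (hℓ1 : 1 ≤ ℓ) (hM : M = μ / ℓ) (hMy : y ^ 7 ≤ M)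
    (yB : 2 * p ^ 2 * K ≤ y) (yC : 2 / c0 ≤ y) (yD : 8 / s1 ≤ y)
    (hb2 : b ≤ y) (hβ2 : ((Nb * b : ℕ) : ℝ) ≤ μ / p ^ 2) (hβ1 : 1 / (2 * p ^ 2) * μ ≤ ((Nb * b : ℕ) : ℝ))
    (hg1l : s1 * μ / 2 ≤ g1) (hg1u : (g1 : ℝ) ≤ s1 * μ / 2 + 1) (hg1n : 1 ≤ g1)
    (hetc : etc d (b ^ 2) b ≤ Ce * b / ℓ)
    (hec : ∀ T : ℕ, 1 / (2 * p ^ 2) * μ ≤ T → T ≤ K * μ → |ecap d T - εd * T / ℓ| ≤ e * T / ℓ) (c1 c2 : ℝ) :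
    GPsi ⟨I, b ^ 2, 2 * g1, Nb * b, C1 * M, c0 * M, θ * M, a⟩
      (fun l => (1 - s) ^ 2 * (εd / ℓ) * max 0 (l - 2 * s1 * μ)) (K * μ) (psi (d := d) (Real.sqrt μ) r c1 c2) := by
  have hy0 : 0 < y := by linarith
  have hy1 : 1 ≤ y := by linarith
  have hp0 : 0 < p := by linarith
  have hμ0 : 0 < μ := by rw [hμy]; positivity
  have hy7 : y ≤ y ^ 7 := le_self_pow₀ hy1 (by norm_num)
  have hMy1 : y ≤ M := hy7.trans hMy
  have hM0 : 0 < M := by linarith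
  have hμge : y ≤ μ := by rw [hμy]; exact le_self_pow₀ hy1 (by norm_num)
  have hR0 : 0 < Real.sqrt μ := Real.sqrt_pos.2 hμ0
  have hR : Real.sqrt μ ^ 2 = μ := Real.sq_sqrt hμ0.le
  have hRy : Real.sqrt μ = y ^ 4 := by
    rw [hμy, show y ^ 8 = (y ^ 4) ^ 2 by ring, Real.sqrt_sq (by positivity)]
  have hpp1 : p ≤ p ^ 2 := le_self_pow₀ hp1 (by norm_num)
  have hp2K : p ^ 2 ≤ p ^ 2 * K := le_mul_of_one_le_right (by positivity) hK
  have hβ0 : 0 < Nb * b := by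
    have : (0 : ℝ) < ((Nb * b : ℕ) : ℝ) := lt_of_lt_of_le (by positivity) hβ1
    exact_mod_cast this
  have hs1μ : 8 ≤ s1 * μ := by
    rw [div_le_iff₀ hs1] at yD
    calc 8 ≤ y * s1 := yD
      _ ≤ μ * s1 := by gcongr
      _ = _ := mul_comm _ _
  have hNM : K * μ ≤ M * ((Nb * b : ℕ) : ℝ) := by
    calc K * μ = (2 * p ^ 2 * K) * (1 / (2 * p ^ 2) * μ) := by field_simp
      _ ≤ M * ((Nb * b : ℕ) : ℝ) := mul_le_mul (by linarith) hβ1 (by positivity) hM0.le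
  have g4 : ((Nb * b : ℕ) : ℝ) + 2 ≤ s1 * μ / 2 := by
    have h1 : μ / p ^ 2 ≤ s1 * μ / 4 := by
      rw [div_le_iff₀ (by positivity)]
      rw [div_le_iff₀ hs1] at hp2
      calc μ = 4 * (μ / 4) := by ring
        _ ≤ (p * s1) * (μ / 4) := by gcongr
        _ ≤ (p ^ 2 * s1) * (μ / 4) := by gcongr
        _ = _ := by ring
    linarith
  have g6 : 2 * e * K ≤ c0 := by
    rw [le_div_iff₀ (by positivity)] at heK
    linarith
  have g7 : E1 * (6 / (r * Real.sqrt μ) * (b + Real.sqrt ((Nb * b : ℕ) : ℝ))) ≤ c0 / 2 := by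
    have h1 : Real.sqrt ((Nb * b : ℕ) : ℝ) ≤ y ^ 4 / p := by
      rw [← Real.sqrt_sq (by positivity : 0 ≤ y ^ 4 / p)]
      apply Real.sqrt_le_sqrt
      refine hβ2.trans (le_of_eq ?_)
      rw [hμy, div_pow]
      ring
    have h2 : (b : ℝ) ≤ y ^ 4 / p := by
      rw [le_div_iff₀ hp0]
      have h3 : p ≤ y := by linarith
      calc (b : ℝ) * p ≤ y * y := by gcongr
        _ = y ^ 2 := by ring
        _ ≤ y ^ 4 := by gcongr; norm_num
    rw [hRy]
    rw [div_le_iff₀ hc0] at hp3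
    calc E1 * (6 / (r * y ^ 4) * (b + Real.sqrt ((Nb * b : ℕ) : ℝ))) ≤ E1 * (6 / (1 * y ^ 4) * (y ^ 4 / p + y ^ 4 / p)) := by gcongr
      _ = 24 * E1 / (2 * p) := by field_simp; ring
      _ ≤ (p * c0) / (2 * p) := by gcongr
      _ = c0 / 2 := by field_simp
  have g8 : 2 ≤ c0 * M := by
    rw [div_le_iff₀ hc0] at yC
    calc 2 ≤ y * c0 := yC
      _ ≤ M * c0 := by gcongr
      _ = _ := mul_comm _ _
  have g9 : (b : ℝ) + 1 ≤ M := by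
    have : y ^ 2 ≤ y ^ 7 := by gcongr; norm_num
    have : 2 * y ≤ y ^ 2 := by rw [sq]; gcongr
    linarith
  have g10 : 1 ≤ M := by linarith
  refine core_main (d := d) (P := ⟨I, b ^ 2, 2 * g1, Nb * b, C1 * M, c0 * M, θ * M, a⟩) (b := b) (Nb := Nb) (ℓ := ℓ) (Ce := Ce) (e := e) (E1 := E1)
    hμ0 hℓ1 hR0 hR hr hs hs' hs1 (by linarith) hsp hc0 hε
    hCe he0 (hbump _ hR0) rfl (by rw [hM]) (by rw [hM]) ?_ ?_ ?_ hβ0 g4 hetc hE1 (fun T h1 h2 => hec T (hβ1.trans h1) h2) hes g6 g7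
    (hM ▸ g8) (hM ▸ g10) (hM ▸ g9) (hM ▸ hNM) hc0s hC1 c1 c2
  · show s1 * μ ≤ ((2 * g1 : ℕ) : ℝ)
    push_cast; linarith
  · show ((2 * g1 : ℕ) : ℝ) ≤ s1 * μ + 2
    push_cast; linarith
  · show 1 ≤ 2 * g1
    omega

lemma stage1 {εd : ℝ} (hε : 0 < εd) (hlim : Tendsto (fun T : ℕ => ecap d T * logFour d T / (T : ℝ)) atTop (𝓝 εd))
    {s s1 K r sp c0 C1 θ η η' E1 : ℝ} (hs : 0 < s) (hs' : s ≤ 1 / 2) (hs1 : 0 < s1) (hK : 1 ≤ K) (hr : 1 ≤ r) (hsp : 0 < sp)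
    (hbump : ∀ R : ℝ, 0 < R → ∀ t : ℕ, 1 ≤ t → s1 * R ^ 2 ≤ t → t ≤ K * R ^ 2 →
      ∀ c1 c2 : ℝ, ∀ x : Zd d, 0 < psi R r c1 c2 x → (1 - s) * psi R r c1 c2 x ≤ Ex t (fun w => psi R r c1 c2 (pos x w)) - sp)
    (hc0 : 0 < c0) (hc0s : 5 * c0 ≤ (1 - s) * εd * (s1 / 2) * sp) (hE1 : E1 = K * (32 * εd + 8 * GC d) + 1)
    (hC1 : 2 * E1 ^ 2 / c0 ≤ C1) (hθ : 0 < θ) (hη : 0 < η) (hη' : 0 < η') :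
    ∀ᶠ μ : ℝ in atTop, ∀ ℓ M : ℝ, ℓ = logFour d μ → M = μ / ℓ → ∃ τ g1 β : ℕ, 1 ≤ τ ∧ (τ : ℝ) * ℓ ≤ η' * μ ∧ 1 ≤ g1 ∧
      C1 * (M * Gt d g1) ≤ η ∧ QF d τ (θ * M) (C1 * M) g1 β (K * μ) η ∧ QF d τ (θ * M) (C1 * M) (2 * g1) β (K * μ) η ∧
      ∀ (I : Finset ℕ) (a c1 c2 : ℝ), GPsi ⟨I, τ, 2 * g1, β, C1 * M, c0 * M, θ * M, a⟩
          (fun l => (1 - s) ^ 2 * (εd / ℓ) * max 0 (l - 2 * s1 * μ)) (K * μ) (psi (d := d) (Real.sqrt μ) r c1 c2) := by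
  have hG := GC_pos (d := d)
  obtain ⟨Ce, hCe⟩ : ∃ x, x = 32 * εd + 8 * GC d := ⟨_, rfl⟩
  have hCe0 : 0 ≤ Ce := by rw [hCe]; positivity
  rw [← hCe] at hE1
  have hE10 : 1 ≤ E1 := by
    have : 0 ≤ K * Ce := by positivity
    linarith
  have hC10 : 0 < C1 := lt_of_lt_of_le (by positivity) hC1
  obtain ⟨p, hp⟩ : ∃ p, p = max (24 * E1 / c0) (max (4 / s1) 1) := ⟨_, rfl⟩
  have hp1 : 1 ≤ p := hp ▸ (le_max_right _ _).trans (le_max_right _ _)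
  have hp2 : 4 / s1 ≤ p := hp ▸ (le_max_left _ _).trans (le_max_right _ _)
  have hp3 : 24 * E1 / c0 ≤ p := hp ▸ le_max_left _ _
  obtain ⟨e, he⟩ : ∃ e, e = min (s * εd) (c0 / (2 * K)) := ⟨_, rfl⟩
  have he0 : 0 < e := by rw [he]; positivity
  have he2 : e ≤ s * εd := he ▸ min_le_left _ _
  have he3 : e ≤ c0 / (2 * K) := he ▸ min_le_right _ _
  obtain ⟨e1, he1⟩ : ∃ e1, e1 = min (η / C1) (η * θ / (2 * E1 * C1)) := ⟨_, rfl⟩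
  have he10 : 0 < e1 := by rw [he1]; positivity
  have he12 : e1 ≤ η / C1 := he1 ▸ min_le_left _ _
  have he13 : e1 ≤ η * θ / (2 * E1 * C1) := he1 ▸ min_le_right _ _
  clear hp he he1
  obtain ⟨A, hA⟩ := etc_near hε hlim
  rw [← hCe] at hA
  filter_upwards [scale d (max A (max (2 * p ^ 2 * K) (max (2 / c0) (max (8 / s1) (1 / η'))))), Gt_scale d hs1 he10,
    ecap_near hε hlim (K := K) (show 0 < 1 / (2 * p ^ 2) by positivity) he0]
    with μ ⟨y, yy, y2, hμy, hℓ1, hℓy⟩ hGt hec ℓ M hℓ hM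
  rw [← hℓ] at hℓ1 hℓy hGt hec
  simp only [max_le_iff] at yy
  obtain ⟨yA, yB, yC, yD, yE⟩ := yy
  have hy0 : 0 < y := by linarith
  have hy1 : 1 ≤ y := by linarith
  have hμ0 : 0 < μ := by rw [hμy]; positivity
  have hℓ0 : 0 < ℓ := by linarith
  have hMy : y ^ 7 ≤ M := by
    rw [hM, le_div_iff₀ hℓ0]
    calc y ^ 7 * ℓ ≤ y ^ 7 * y := by gcongr
      _ = μ := by rw [hμy]; ring
  have hy7 : y ≤ y ^ 7 := le_self_pow₀ hy1 (by norm_num)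
  obtain ⟨b, Nb, hbn, hb1, hb2, hβ2, hβ1⟩ := floors y2 hμy hp1 hK yB
  obtain ⟨g1, hg1⟩ : ∃ g, g = ⌈s1 * μ / 2⌉₊ := ⟨_, rfl⟩
  have hg1l : s1 * μ / 2 ≤ g1 := hg1 ▸ Nat.le_ceil _
  have hg1u : (g1 : ℝ) ≤ s1 * μ / 2 + 1 := hg1 ▸ (Nat.ceil_lt_add_one (by positivity)).le
  have hg1n : 1 ≤ g1 := by rw [hg1]; exact Nat.ceil_pos.2 (by positivity)
  have hMG := hGt g1 hg1l
  rw [← hM] at hMG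
  have hetc := hA y ℓ yA y2 (by rw [hℓ, hμy]) hℓ1 hℓy b hb1 hb2
  refine ⟨b ^ 2, g1, Nb * b, Nat.one_le_pow _ _ hbn, ?_, hg1n, ?_,
    stage1_qf hℓ0 hM (by linarith) hθ hC10 (by linarith) hCe0 hE1 hetc hg1n le_rfl (hMG.trans he13),
    stage1_qf hℓ0 hM (by linarith) hθ hC10 (by linarith) hCe0 hE1 hetc hg1n (by omega) (hMG.trans he13), fun I a c1 c2 =>
    stage1_psi hε hs hs' hs1 hK hr hsp hbump hc0 hc0s hCe0 hE1 (by linarith) hC1 hp1 hp2 hp3 he0 he2 he3 y2 hμy hℓ1 hM hMy yB yC yD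
      hb2 hβ2 hβ1 hg1l hg1u hg1n hetc hec c1 c2⟩
  · rw [div_le_iff₀ hη'] at yE
    push_cast
    calc (b : ℝ) ^ 2 * ℓ ≤ y ^ 2 * y := by gcongr
      _ = y ^ 3 * 1 := by ring
      _ ≤ y ^ 3 * (y * η') := by gcongr
      _ = η' * y ^ 4 := by ring
      _ ≤ η' * μ := by rw [hμy]; gcongr; norm_num
  · have h1 := hMG.trans he12
    rw [le_div_iff₀ hC10] at h1
    linarith

/-! ### moments -/

lemma rmom1 {ρ : ℕ → ℝ} (hρ : IsDist ρ) (h2 : Summable fun l : ℕ => (l : ℝ) ^ 2 * ρ l) : Summable fun l : ℕ => (l : ℝ) * ρ l := by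
  refine Summable.of_nonneg_of_le (fun l => mul_nonneg (Nat.cast_nonneg _) (hρ.1 l)) (fun l => ?_) h2
  refine mul_le_mul_of_nonneg_right ?_ (hρ.1 l)
  have : l ≤ l ^ 2 := Nat.le_self_pow (by norm_num) l
  exact_mod_cast this

lemma rmom_sq {ρ : ℕ → ℝ} (hρ : IsDist ρ) (h2 : Summable fun l : ℕ => (l : ℝ) ^ 2 * ρ l) : mu 1 ρ ^ 2 ≤ mu 2 ρ := by
  have h1 := rmom1 hρ h2
  have e1 : HasSum (fun l : ℕ => (l : ℝ) * ρ l) (mu 1 ρ) := by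
    have := h1.hasSum; unfold mu; simpa using this
  have e2 : HasSum (fun l : ℕ => (l : ℝ) ^ 2 * ρ l) (mu 2 ρ) := h2.hasSum
  have e3 := (e2.sub (e1.mul_left (2 * mu 1 ρ))).add (hρ.2.mul_left (mu 1 ρ ^ 2))
  have := e3.nonneg (fun l => by
    have := mul_nonneg (sq_nonneg ((l : ℝ) - mu 1 ρ)) (hρ.1 l)
    refine le_of_le_of_eq this ?_
    ring)
  nlinarith

/-- admissible lengths -/
def Ien (k K μ : ℝ) : Finset ℕ := (Finset.range (⌊K * μ⌋₊ + 1)).filter (fun L => k * μ ≤ L)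

lemma mem_Ien {k K μ : ℝ} (h : 0 ≤ K * μ) {L : ℕ} : L ∈ Ien k K μ ↔ (L : ℝ) ≤ K * μ ∧ k * μ ≤ L := by
  unfold Ien
  rw [Finset.mem_filter, Finset.mem_range, Nat.lt_succ_iff, Nat.le_floor_iff h]

lemma mom_I {ρ : ℕ → ℝ} (hρ : IsDist ρ) (h2 : Summable fun l : ℕ => (l : ℝ) ^ 2 * ρ l) {C K s : ℝ} (hs : 0 < s) (hs1 : s ≤ 1) (hμ : 0 < mu 1 ρ)
    (hCK : C ≤ K) (hK : 0 ≤ K)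
    (ht : (∑' L : ℕ, if C * mu 1 ρ ≤ (L : ℝ) then (L : ℝ) ^ 2 * ρ L / mu 2 ρ else 0) ≤ s) :
    (1 - 2 * s) * mu 2 ρ ≤ ∑ L ∈ Ien s K (mu 1 ρ), (L : ℝ) ^ 2 * ρ L := by
  have hm := rmom_sq hρ h2
  set μ := mu 1 ρ with hμd
  set m2 := mu 2 ρ with hm2
  have hm0 : 0 < m2 := lt_of_lt_of_le (by positivity) hm
  set I := Ien s K μ with hI
  have hn : ∀ l : ℕ, 0 ≤ (l : ℝ) ^ 2 * ρ l := fun l => mul_nonneg (by positivity) (hρ.1 l)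
  have e2 : HasSum (fun l : ℕ => (l : ℝ) ^ 2 * ρ l) m2 := h2.hasSum
  have s3 : Summable (fun L : ℕ => if C * μ ≤ (L : ℝ) then (L : ℝ) ^ 2 * ρ L / m2 else 0) := by
    refine Summable.of_nonneg_of_le (fun L => ?_) (fun L => ?_) (h2.div_const m2)
    · split_ifs
      · exact div_nonneg (hn L) hm0.le
      · exact le_rfl
    · split_ifs
      · exact le_rfl
      · exact div_nonneg (hn L) hm0.le
  have e3 := s3.hasSum.mul_left m2
  have e4 := hρ.2.mul_left (s ^ 2 * μ ^ 2)
  have e1 : HasSum (fun L : ℕ => if L ∈ I then (L : ℝ) ^ 2 * ρ L else 0) (∑ L ∈ I, (L : ℝ) ^ 2 * ρ L) := by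
    have h3 : ∑ L ∈ I, (L : ℝ) ^ 2 * ρ L = ∑ L ∈ I, if L ∈ I then (L : ℝ) ^ 2 * ρ L else 0 :=
      Finset.sum_congr rfl fun L hL => by rw [if_pos hL]
    rw [h3]
    exact hasSum_sum_of_ne_finset_zero fun L hL => if_neg hL
  have h := hasSum_le (fun L => ?_) e2 ((e1.add e3).add e4)
  · have a1 : m2 * (∑' L : ℕ, if C * μ ≤ (L : ℝ) then (L : ℝ) ^ 2 * ρ L / m2 else 0) ≤ m2 * s := by gcongr
    have a2 : s ^ 2 * μ ^ 2 * 1 ≤ s * m2 := by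
      rw [mul_one]
      exact mul_le_mul (by rw [sq]; exact mul_le_of_le_one_left hs.le hs1) hm (by positivity) hs.le
    linarith
  · have b1 : 0 ≤ (if L ∈ I then (L : ℝ) ^ 2 * ρ L else 0) := by split_ifs; exacts [hn L, le_rfl]
    have b2 : 0 ≤ m2 * (if C * μ ≤ (L : ℝ) then (L : ℝ) ^ 2 * ρ L / m2 else 0) := by
      refine mul_nonneg hm0.le ?_
      split_ifs
      exacts [div_nonneg (hn L) hm0.le, le_rfl]
    have b3 : 0 ≤ s ^ 2 * μ ^ 2 * ρ L := mul_nonneg (by positivity) (hρ.1 L)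
    by_cases c1 : L ∈ I
    · rw [if_pos c1] at b1 ⊢; linarith
    · by_cases c2 : C * μ ≤ L
      · rw [if_pos c2] at b2 ⊢
        rw [mul_div_cancel₀ _ hm0.ne'] at b2 ⊢
        linarith
      · have c3 : (L : ℝ) ≤ s * μ := by
          rw [hI, mem_Ien (by positivity)] at c1
          have : (L : ℝ) ≤ K * μ := by
            have := mul_le_mul_of_nonneg_right hCK hμ.le
            linarith
          by_contra h
          exact c1 ⟨this, (not_le.1 h).le⟩
        have : (L : ℝ) ^ 2 * ρ L ≤ s ^ 2 * μ ^ 2 * ρ L := by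
          rw [← mul_pow]
          exact mul_le_mul_of_nonneg_right (pow_le_pow_left₀ (Nat.cast_nonneg _) c3 2) (hρ.1 L)
        linarith

lemma ramp {L : ℕ} {z s : ℝ} (hL : 1 ≤ L) (hz : 0 ≤ z) (hzL : 4 * z ≤ s * L) :
    (1 - s) * (L : ℝ) ^ 2 / 2 ≤ ∑ l ∈ Finset.range (L + 1), max 0 ((l : ℝ) - z) := by
  have h1 : ∑ l ∈ Finset.range (L + 1), ((l : ℝ) - z) = (L : ℝ) * (L + 1) / 2 - (L + 1) * z := by
    clear hL hzL
    induction L with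
    | zero => simp
    | succ n ih => rw [Finset.sum_range_succ, ih]; push_cast; ring
  have h2 : ∑ l ∈ Finset.range (L + 1), ((l : ℝ) - z) ≤ ∑ l ∈ Finset.range (L + 1), max 0 ((l : ℝ) - z) :=
    Finset.sum_le_sum fun l _ => le_max_right _ _
  have hL' : (1 : ℝ) ≤ L := by exact_mod_cast hL
  have h3 : ((L : ℝ) + 1) * z ≤ (2 * L) * (s * L / 4) := by
    refine mul_le_mul (by linarith) (by linarith) hz (by positivity)
  nlinarith

end

section
variable {d : ℕ} [Fact (4 ≤ d)]

/-! ## F19: assembly -/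

lemma phi_lower {ρ : ℕ → ℝ} (hρ : IsDist ρ) (h2 : Summable fun l : ℕ => (l : ℝ) ^ 2 * ρ l) {μ ℓ εd ε s u C K : ℝ} (hμ : μ = mu 1 ρ)
    (hε0 : 0 < ε) (hε1 : ε < 1 / 2) (hs : s = ε / 20) (hμs : 1 ≤ s * μ) (hℓ : 0 < ℓ) (hεd : 0 < εd)
    (hu : u = (1 + ε) * (μ * ℓ / (εd * mu 2 ρ))) (hK : 1 ≤ K) (hCK : C ≤ K)
    (ht : (∑' L : ℕ, if C * μ ≤ (L : ℝ) then (L : ℝ) ^ 2 * ρ L / mu 2 ρ else 0) ≤ s) :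
    1 + 4 * (ε / 16) ≤ 2 * (1 - s) * ∑ L ∈ Ien s K μ, (u * ρ L / (μ + 1)) *
      ∑ l ∈ Finset.range (L + 1), (1 - s) ^ 2 * (εd / ℓ) * max 0 ((l : ℝ) - 2 * (s ^ 2 / 8) * μ) := by
  have hs0 : 0 < s := by linarith
  have hs1 : s < 1 / 40 := by linarith
  have h1s : 0 < 1 - s := by linarith
  have hμ0 : 0 < μ := pos_of_mul_pos_right (by linarith) hs0.le
  have hI := mom_I hρ h2 hs0 (by linarith) (hμ ▸ hμ0) hCK (by linarith) (hμ ▸ ht)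
  have hsq := rmom_sq hρ h2
  rw [← hμ] at hI hsq
  have hm0 : 0 < mu 2 ρ := lt_of_lt_of_le (by positivity) hsq
  have hu0 : 0 < u := by rw [hu]; positivity
  have step : ∑ L ∈ Ien s K μ, (u / (μ + 1) * ((1 - s) ^ 3 * (εd / ℓ) / 2)) * ((L : ℝ) ^ 2 * ρ L) ≤
      ∑ L ∈ Ien s K μ, (u * ρ L / (μ + 1)) *
      ∑ l ∈ Finset.range (L + 1), (1 - s) ^ 2 * (εd / ℓ) * max 0 ((l : ℝ) - 2 * (s ^ 2 / 8) * μ) := by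
    refine Finset.sum_le_sum fun L hL => ?_
    rw [mem_Ien (by positivity)] at hL
    have hL1 : 1 ≤ L := by
      have : (1 : ℝ) ≤ L := by linarith
      exact_mod_cast this
    have hr := ramp (L := L) (z := 2 * (s ^ 2 / 8) * μ) (s := s) hL1 (by positivity) (by
      calc 4 * (2 * (s ^ 2 / 8) * μ) = s * (s * μ) := by ring
        _ ≤ s * L := by gcongr; exact hL.2)
    rw [← Finset.mul_sum]
    have hρL := hρ.1 L
    calc _ = (u * ρ L / (μ + 1)) * ((1 - s) ^ 2 * (εd / ℓ) * ((1 - s) * (L : ℝ) ^ 2 / 2)) := by ring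
      _ ≤ _ := by gcongr
  rw [← Finset.mul_sum] at step
  have hμ1 : 1 - s ≤ μ / (μ + 1) := by
    rw [le_div_iff₀ (by linarith)]
    nlinarith
  have fin : 1 + 4 * (ε / 16) ≤ (1 + ε) * ((1 - s) ^ 4 * (1 - s) * (1 - 2 * s)) := by
    have b1 := one_add_mul_le_pow (show (-2 : ℝ) ≤ -s by linarith) 5
    have b2 : (1 - 5 * s) * (1 - 2 * s) ≤ (1 - s) ^ 4 * (1 - s) * (1 - 2 * s) := by
      refine mul_le_mul_of_nonneg_right ?_ (by linarith)
      calc 1 - 5 * s = 1 + ((5 : ℕ) : ℝ) * -s := by push_cast; ring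
        _ ≤ (1 + -s) ^ 5 := b1
        _ = _ := by ring
    calc 1 + 4 * (ε / 16) ≤ (1 + ε) * ((1 - 5 * s) * (1 - 2 * s)) := by rw [hs]; nlinarith [sq_nonneg ε, mul_pos hε0 hε0]
      _ ≤ _ := by gcongr
  calc 1 + 4 * (ε / 16) ≤ (1 + ε) * ((1 - s) ^ 4 * (1 - s) * (1 - 2 * s)) := fin
    _ ≤ (1 + ε) * ((1 - s) ^ 4 * (μ / (μ + 1)) * (1 - 2 * s)) := by
        have : 0 ≤ 1 - 2 * s := by linarith
        gcongr
    _ = 2 * (1 - s) * ((u / (μ + 1) * ((1 - s) ^ 3 * (εd / ℓ) / 2)) * ((1 - 2 * s) * mu 2 ρ)) := by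
        rw [hu]; field_simp
    _ ≤ 2 * (1 - s) * ((u / (μ + 1) * ((1 - s) ^ 3 * (εd / ℓ) / 2)) * ∑ L ∈ Ien s K μ, (L : ℝ) ^ 2 * ρ L) := by gcongr
    _ ≤ _ := by gcongr

lemma one_sub_exp_ge {x s : ℝ} (h0 : 0 ≤ x) (hs : x ≤ s) : (1 - s) * x ≤ 1 - Real.exp (-x) := by
  have h1 : 1 + x ≤ Real.exp x := by linarith [Real.add_one_le_exp x]
  have h2 : Real.exp (-x) ≤ 1 / (1 + x) := by
    rw [Real.exp_neg, ← one_div]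
    exact one_div_le_one_div_of_le (by linarith) h1
  have h3 : (1 - x) * x ≤ 1 - 1 / (1 + x) := by
    rw [le_sub_iff_add_le, ← le_sub_iff_add_le', div_le_iff₀ (by linarith)]
    nlinarith [mul_nonneg (mul_nonneg h0 h0) h0]
  have h4 : (1 - s) * x ≤ (1 - x) * x := by gcongr
  linarith

lemma gp_mk {ρ : ℕ → ℝ} (hρ : IsDist ρ) (h2 : Summable fun l : ℕ => (l : ℝ) ^ 2 * ρ l) {μ s u K C c q h α : ℝ} {τ g1 β : ℕ}
    (hμ : μ = mu 1 ρ) (hs : 0 < s) (hs1 : s ≤ 1) (hμ0 : 0 < μ) (hu0 : 0 ≤ u) (hus : u ≤ s) (hK : 0 ≤ K) (hτ : 1 ≤ τ) (hα : 0 ≤ α)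
    (hQ1 : QF d τ q C g1 β (K * μ) α) (hQ : QF d τ q C (2 * g1) β (K * μ) α) (hg1 : 1 ≤ g1) (hq : 0 ≤ q) (hqc : q < c) (hh : 0 < h) :
    GP d ⟨Ien s K μ, τ, 2 * g1, β, C, c, q, 4 * h⟩ (fun L => u * ρ L / (μ + 1)) (pocc (friIntensity d u ρ)) s (K * μ) α h u (u / (s * μ)) g1 := by
  have hKμ : 0 ≤ K * μ := by positivity
  have hκ : ∀ L, 0 ≤ u * ρ L / (μ + 1) := fun L => div_nonneg (mul_nonneg hu0 (hρ.1 L)) (by linarith)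
  have hι : ∀ η : Traj d, 0 ≤ friIntensity d u ρ η := by
    intro η
    unfold friIntensity
    split_ifs
    · rw [← hμ]
      exact mul_nonneg (hκ _) (by positivity)
    · exact le_rfl
  have hlam : ∀ η : Traj d, ValidTraj η → friIntensity d u ρ η = lam (fun L => u * ρ L / (μ + 1)) η := by
    intro η hη
    unfold friIntensity lam
    rw [if_pos hη, hμ]
  have hρ1 : ∀ L, ρ L ≤ 1 := fun L => le_hasSum hρ.2 L (fun j _ => hρ.1 j)
  have hkl : ∑ L ∈ Ien s K μ, u * ρ L / (μ + 1) * L ≤ u := by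
    have e1 : HasSum (fun l : ℕ => (l : ℝ) * ρ l) μ := by
      have := (rmom1 hρ h2).hasSum
      rw [hμ]; unfold mu; simpa using this
    have e2 := sum_le_hasSum (Ien s K μ) (fun L _ => mul_nonneg (Nat.cast_nonneg L) (hρ.1 L)) e1
    calc ∑ L ∈ Ien s K μ, u * ρ L / (μ + 1) * L = u / (μ + 1) * ∑ L ∈ Ien s K μ, (L : ℝ) * ρ L := by
          rw [Finset.mul_sum]; exact Finset.sum_congr rfl fun L _ => by ring
      _ ≤ u / (μ + 1) * μ := by gcongr
      _ = u * (μ / (μ + 1)) := by ring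
      _ ≤ u * 1 := by gcongr; rw [div_le_one (by linarith)]; linarith
      _ = u := mul_one u
  refine ⟨hκ, fun L hL => ((mem_Ien hKμ).1 hL).1, hKμ, hkl, ?_, hτ, hα, hQ, ?_, hg1, ?_, hq, hqc, hh, rfl, hs.le, hs1,
    pocc_nonneg hι, fun η => pocc_le_one _ η, fun η hη _ => ?_, fun η hη _ => ?_⟩
  · show ∑ L ∈ Ien s K μ, u * ρ L / (μ + 1) ≤ _
    rw [le_div_iff₀ (by positivity), Finset.sum_mul]
    refine le_trans (Finset.sum_le_sum fun L hL => ?_) hkl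
    exact mul_le_mul_of_nonneg_left ((mem_Ien hKμ).1 hL).2 (hκ L)
  · show QF d τ q C (2 * g1 - g1) β (K * μ) α
    rw [show 2 * g1 - g1 = g1 by omega]
    exact hQ1
  · show g1 ≤ 2 * g1
    omega
  · unfold pocc
    rw [← hlam η hη]
    refine one_sub_exp_ge (hι η) (le_trans ?_ hus)
    rw [hlam η hη]
    unfold lam
    have a1 : (1 / (2 * (d : ℝ))) ^ (len η) ≤ 1 := by
      refine pow_le_one₀ (by positivity) ?_
      have h4 : (4 : ℝ) ≤ d := by exact_mod_cast (Fact.out : 4 ≤ d)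
      rw [div_le_one (by linarith)]
      linarith
    calc u * ρ (len η) / (μ + 1) * (1 / (2 * (d : ℝ))) ^ (len η) ≤ u * ρ (len η) / (μ + 1) * 1 := mul_le_mul_of_nonneg_left a1 (hκ _)
      _ ≤ u * 1 / 1 * 1 := by
          rw [mul_one, mul_one]
          have := hρ1 (len η)
          have := hρ.1 (len η)
          exact div_le_div₀ (by linarith) (by gcongr) one_pos (by linarith)
      _ = u := by ring
  · unfold pocc
    rw [← hlam η hη]
    linarith [Real.add_one_le_exp (-(friIntensity d u ρ η))]

lemma consts {C1 c0 K r X γ : ℝ} (hC1 : 0 < C1) (hc0 : 0 < c0) (hK : 0 < K) (hr : 0 < r) (hX : 0 < X) (hγ : 0 < γ) :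
    ∃ (J nm b : ℕ) (KT H v ρ' n2 θ η δ : ℝ), 1 ≤ J ∧ 0 < KT ∧ 0 < H ∧ 0 < v ∧ 0 < θ ∧ θ < c0 ∧ 0 < η ∧ 6 * v / r * C1 ≤ c0 / 2 ∧
      6 * KT + 3 * C1 ≤ KT * (1 + γ) ^ J ∧ KT * (1 + γ) ^ J / c0 + 1 ≤ nm ∧ r + 4 * H + v ≤ ρ' ∧ 2 * ρ' + 4 * H < v * (b + 1) ∧
      ((2 * (b + 1) + 1 : ℕ) : ℝ) * (((2 * (b + 1) + 1 : ℕ) : ℝ) * J) * nm ≤ n2 ∧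
      nm * (C1 * (2 * (X * C1 * K / H ^ 2 + η) + n2 * (2 * θ * X + 2 * η) + n2 * (X * C1 * η + η))) ≤ γ * KT ∧
      2 * C1 * (1 + 2 * γ) / (γ ^ 2 * KT) + nm * (X * C1 * (2 * η) + η) + (nm * (X * C1 + η)) * (4 * (nm * (X * C1 * η + η))) ≤ δ ∧
      J * δ ≤ (1 / 16) ^ 2 := by
  obtain ⟨J, hJ⟩ : ∃ J : ℕ, 9 < (1 + γ) ^ J := pow_unbounded_of_one_lt 9 (by linarith)
  have hJ1 : 1 ≤ J := by
    rcases Nat.eq_zero_or_pos J with h | h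
    · rw [h] at hJ; norm_num at hJ
    · exact h
  have hJ0 : (0 : ℝ) < J := by exact_mod_cast hJ1
  obtain ⟨δ, hδ⟩ : ∃ δ : ℝ, δ = (1 / 16) ^ 2 / J := ⟨_, rfl⟩
  have hδ0 : 0 < δ := by rw [hδ]; positivity
  obtain ⟨KT, hKT⟩ : ∃ KT : ℝ, KT = C1 + 4 * C1 * (1 + 2 * γ) / (γ ^ 2 * δ) := ⟨_, rfl⟩
  have hKT1 : C1 ≤ KT := by rw [hKT]; exact le_add_of_nonneg_right (by positivity)
  have hKT0 : 0 < KT := by linarith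
  have hch : 2 * C1 * (1 + 2 * γ) / (γ ^ 2 * KT) < δ := by
    rw [div_lt_iff₀ (by positivity)]
    have : δ * (γ ^ 2 * KT) = δ * γ ^ 2 * C1 + 4 * C1 * (1 + 2 * γ) := by rw [hKT]; field_simp
    rw [this]
    have h1 : 0 < δ * γ ^ 2 * C1 := by positivity
    have h2 : 0 < C1 * (1 + 2 * γ) := by positivity
    linarith
  obtain ⟨nm, hnm⟩ := exists_nat_ge (KT * (1 + γ) ^ J / c0 + 1)
  have hnm0 : (0 : ℝ) ≤ nm := Nat.cast_nonneg _
  obtain ⟨Y, hY⟩ : ∃ Y : ℝ, Y = nm * (C1 * (2 * (X * C1 * K))) := ⟨_, rfl⟩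
  have hY0 : 0 ≤ Y := by rw [hY]; positivity
  obtain ⟨H, hH⟩ : ∃ H : ℝ, H = 1 + Y / (γ * KT) := ⟨_, rfl⟩
  have hH1 : 1 ≤ H := by rw [hH]; exact le_add_of_nonneg_right (by positivity)
  have hH0 : 0 < H := by linarith
  have hYH : Y / H ^ 2 < γ * KT := by
    rw [div_lt_iff₀ (by positivity)]
    have : γ * KT * H = γ * KT + Y := by rw [hH]; field_simp
    have h2 : γ * KT * H ≤ γ * KT * H ^ 2 := by gcongr; exact le_self_pow₀ hH1 (by norm_num)
    have h3 : 0 < γ * KT := by positivity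
    linarith
  obtain ⟨v, hv⟩ : ∃ v : ℝ, v = c0 * r / (12 * C1) := ⟨_, rfl⟩
  have hv0 : 0 < v := by rw [hv]; positivity
  obtain ⟨b, hb⟩ := exists_nat_gt ((2 * (r + 4 * H + v) + 4 * H) / v)
  rw [div_lt_iff₀ hv0] at hb
  obtain ⟨n2, hn2⟩ : ∃ n2 : ℝ, n2 = ((2 * (b + 1) + 1 : ℕ) : ℝ) * (((2 * (b + 1) + 1 : ℕ) : ℝ) * J) * nm := ⟨_, rfl⟩
  have hθ : ∃ θ : ℝ, 0 < θ ∧ θ < c0 ∧ nm * (C1 * (2 * (X * C1 * K / H ^ 2) + n2 * (2 * θ * X))) < γ * KT := by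
    have hc : Continuous fun θ : ℝ => nm * (C1 * (2 * (X * C1 * K / H ^ 2) + n2 * (2 * θ * X))) := by fun_prop
    have h1 : nm * (C1 * (2 * (X * C1 * K / H ^ 2) + n2 * (2 * 0 * X))) < γ * KT := by
      refine lt_of_eq_of_lt ?_ hYH
      rw [hY]; ring
    have h2 := ((hc.tendsto 0).eventually (gt_mem_nhds h1)).filter_mono (nhdsWithin_le_nhds (s := Set.Ioi 0))
    have h3 : ∀ᶠ θ : ℝ in 𝓝[>] 0, θ < c0 := (gt_mem_nhds hc0 : ∀ᶠ θ : ℝ in 𝓝 0, θ < c0).filter_mono nhdsWithin_le_nhds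
    obtain ⟨θ, h4, h5, h6⟩ := (h2.and (h3.and self_mem_nhdsWithin)).exists
    exact ⟨θ, h6, h5, h4⟩
  obtain ⟨θ, hθ0, hθc, hθ1⟩ := hθ
  have hη : ∃ η : ℝ, 0 < η ∧
      nm * (C1 * (2 * (X * C1 * K / H ^ 2 + η) + n2 * (2 * θ * X + 2 * η) + n2 * (X * C1 * η + η))) < γ * KT ∧
      2 * C1 * (1 + 2 * γ) / (γ ^ 2 * KT) + nm * (X * C1 * (2 * η) + η) + (nm * (X * C1 + η)) * (4 * (nm * (X * C1 * η + η))) < δ := by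
    have hc : Continuous fun η : ℝ => nm * (C1 * (2 * (X * C1 * K / H ^ 2 + η) + n2 * (2 * θ * X + 2 * η) + n2 * (X * C1 * η + η))) := by
      fun_prop
    have hc' : Continuous fun η : ℝ => 2 * C1 * (1 + 2 * γ) / (γ ^ 2 * KT) + nm * (X * C1 * (2 * η) + η) +
        (nm * (X * C1 + η)) * (4 * (nm * (X * C1 * η + η))) := by
      fun_prop
    have h1 := ((hc.tendsto 0).eventually (gt_mem_nhds (lt_of_eq_of_lt (by ring) hθ1))).filter_mono (nhdsWithin_le_nhds (s := Set.Ioi 0))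
    have h2 := ((hc'.tendsto 0).eventually (gt_mem_nhds (lt_of_eq_of_lt (by ring) hch))).filter_mono (nhdsWithin_le_nhds (s := Set.Ioi 0))
    obtain ⟨η, h4, h5, h6⟩ := (h1.and (h2.and self_mem_nhdsWithin)).exists
    exact ⟨η, h6, h4, h5⟩
  obtain ⟨η, hη0, hη1, hη2⟩ := hη
  refine ⟨J, nm, b, KT, H, v, r + 4 * H + v, n2, θ, η, δ, hJ1, hKT0, hH0, hv0, hθ0, hθc, hη0, ?_, ?_, hnm, le_rfl, ?_, hn2.ge, hη1.le, hη2.le, ?_⟩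
  · rw [hv]
    refine le_of_eq ?_
    field_simp
    ring
  · have : KT * 9 ≤ KT * (1 + γ) ^ J := by gcongr
    linarith
  · have : v * (b + 1) = b * v + v := by ring
    linarith
  · rw [hδ]
    refine le_of_eq ?_
    field_simp

end

section
variable {d : ℕ} [Fact (4 ≤ d)]

/-! ## F20: conclusion -/

lemma fixed_perc {ρ : ℕ → ℝ} (hρ : IsDist ρ) (h2 : Summable fun l : ℕ => (l : ℝ) ^ 2 * ρ l) {μ ℓ M εd ε s u C K X : ℝ} (hμ : μ = mu 1 ρ)
    (hε0 : 0 < ε) (hε1 : ε < 1 / 2) (hs : s = ε / 20) (hμs : 1 ≤ s * μ) (hℓ : 1 ≤ ℓ) (hεd : 0 < εd) (hM : M = μ / ℓ) (hM1 : 1 ≤ M)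
    (hu : u = (1 + ε) * (μ * ℓ / (εd * mu 2 ρ))) (hus : u ≤ s) (hK : 1 ≤ K) (hCK : C ≤ K) (hX : u * M ≤ X)
    (ht : (∑' L : ℕ, if C * μ ≤ (L : ℝ) then (L : ℝ) ^ 2 * ρ L / mu 2 ρ else 0) ≤ s)
    {C1 c0 r : ℝ} (hC1 : 0 < C1) (hc0 : 0 < c0) (hr : 0 < r) (hC1g : 2 * gr (0 : Zd d) * c0 + 1 ≤ C1)
    {J nm b : ℕ} {KT H v ρ' n2 θ η δ : ℝ} (hJ : 1 ≤ J) (hKT : 0 < KT) (hH : 0 < H) (hv : 0 < v) (hθ : 0 < θ) (hθc : θ < c0) (hη : 0 < η)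
    (k1 : 6 * v / r * C1 ≤ c0 / 2)
    (k2 : 6 * KT + 3 * C1 ≤ KT * (1 + (ε / 16)) ^ J) (k3 : KT * (1 + (ε / 16)) ^ J / c0 + 1 ≤ nm) (k4 : r + 4 * H + v ≤ ρ')
    (k5 : 2 * ρ' + 4 * H < v * (b + 1))
    (k6 : ((2 * (b + 1) + 1 : ℕ) : ℝ) * (((2 * (b + 1) + 1 : ℕ) : ℝ) * J) * nm ≤ n2)
    (k7 : nm * (C1 * (2 * (X * C1 * K / H ^ 2 + η) + n2 * (2 * θ * X + 2 * η) + n2 * (X * C1 * η + η))) ≤ (ε / 16) * KT)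
    (k8 : 2 * C1 * (1 + 2 * (ε / 16)) / ((ε / 16) ^ 2 * KT) + nm * (X * C1 * (2 * η) + η) +
      (nm * (X * C1 + η)) * (4 * (nm * (X * C1 * η + η))) ≤ δ)
    (k9 : J * δ ≤ (1 / 16) ^ 2) {τ g1 β : ℕ} (hτ : 1 ≤ τ) (hg1 : 1 ≤ g1) (hG : C1 * (M * Gt d g1) ≤ η)
    (hQ1 : QF d τ (θ * M) (C1 * M) g1 β (K * μ) η) (hQ : QF d τ (θ * M) (C1 * M) (2 * g1) β (K * μ) η)
    (hψ : ∀ (I : Finset ℕ) (a c1 c2 : ℝ), GPsi ⟨I, τ, 2 * g1, β, C1 * M, c0 * M, θ * M, a⟩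
          (fun l => (1 - s) ^ 2 * (εd / ℓ) * max 0 (l - 2 * (s ^ 2 / 8) * μ)) (K * μ) (psi (d := d) (Real.sqrt μ) r c1 c2))
    (hw : u / (s * μ) * (τ * (K * μ + 1 + C1 * M)) ≤ η) {m : Measure (Config d)} (hm : IsPoissonPP d (friIntensity d u ρ) m) :
    ∃ a, 0 < m {ω | (Cluster ω a).Infinite} := by
  have hs0 : 0 < s := by linarith
  have hμ0 : 0 < μ := pos_of_mul_pos_right (by linarith) hs0.le
  have hR0 : 0 < Real.sqrt μ := Real.sqrt_pos.2 hμ0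
  have hR : Real.sqrt μ ^ 2 = μ := Real.sq_sqrt hμ0.le
  have hM0 : 0 < M := by linarith
  have hsq := rmom_sq hρ h2
  rw [← hμ] at hsq
  have hm0 : 0 < mu 2 ρ := lt_of_lt_of_le (by positivity) hsq
  have hu0 : 0 ≤ u := by rw [hu]; positivity
  have hΦ := phi_lower hρ h2 hμ hε0 hε1 hs hμs (by linarith) hεd hu hK hCK ht
  have hGP := gp_mk (d := d) (c := c0 * M) (h := H * Real.sqrt μ) hρ h2 hμ hs0 (by linarith) hμ0 hu0 hus (by linarith) hτ hη.le hQ1 hQ hg1 (by positivity)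
    (by gcongr) (by positivity)
  have hn20 : 0 ≤ n2 := le_trans (by positivity) k6
  have hι : ∀ η : Traj d, 0 ≤ friIntensity d u ρ η := by
    intro η
    unfold friIntensity
    split_ifs
    · rw [← hμ]
      exact mul_nonneg (div_nonneg (mul_nonneg hu0 (hρ.1 _)) (by linarith)) (by positivity)
    · exact le_rfl
  obtain ⟨w, hwd⟩ : ∃ w : ℝ, w = u / (s * μ) * (τ * (K * μ + 1 + C1 * M)) := ⟨_, rfl⟩
  rw [← hwd] at hw
  have hw0 : 0 ≤ w := by rw [hwd]; positivity
  have hU0 : 0 ≤ u * M := by positivity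
  have hX0 : 0 ≤ X := hU0.trans hX
  have hG0 : 0 ≤ M * Gt d g1 := mul_nonneg hM0.le (Gt_nonneg _)
  refine perc_concrete hGP (R := Real.sqrt μ) (r := r) (v := v) (T0 := KT * M) (γ := ε / 16) (ρ := ρ') (cd := K * μ + 1 + C1 * M) (n2 := n2)
    (J := J) (nm := nm) (b := b) (δ := δ) (hψ _ _) hι hm hR0 hr hv hJ (by positivity) (by positivity) (by positivity)
    ?_ ?_ ?_ ?_ ?_ ?_ ?_ k6 hΦ ?_ ?_ ?_ k9
  · show 6 * v / r * (C1 * M) ≤ c0 * M / 2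
    calc 6 * v / r * (C1 * M) = (6 * v / r * C1) * M := by ring
      _ ≤ (c0 / 2) * M := by gcongr
      _ = _ := by ring
  · show 6 * (KT * M) + 3 * (C1 * M) ≤ KT * M * (1 + (ε / 16)) ^ J
    calc 6 * (KT * M) + 3 * (C1 * M) = (6 * KT + 3 * C1) * M := by ring
      _ ≤ (KT * (1 + (ε / 16)) ^ J) * M := by gcongr
      _ = _ := by ring
  · show KT * M * (1 + (ε / 16)) ^ J / (c0 * M) + 1 ≤ nm
    refine le_of_eq_of_le ?_ k3
    field_simp
  · show r * Real.sqrt μ + 4 * (H * Real.sqrt μ) + v * Real.sqrt μ ≤ ρ' * Real.sqrt μ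
    calc _ = (r + 4 * H + v) * Real.sqrt μ := by ring
      _ ≤ _ := by gcongr
  · show 2 * (ρ' * Real.sqrt μ) + 4 * (H * Real.sqrt μ) < v * Real.sqrt μ * (b + 1)
    calc _ = (2 * ρ' + 4 * H) * Real.sqrt μ := by ring
      _ < (v * (b + 1)) * Real.sqrt μ := by gcongr
      _ = _ := by ring
  · intro L hL
    have h1 := ((mem_Ien (by positivity)).1 hL).1
    have : 0 ≤ C1 * M := by positivity
    linarith
  · show C1 * M ≤ K * μ + 1 + C1 * M
    have : 0 ≤ K * μ := by positivity
    linarith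
  · show 2 * gr (0 : Zd d) * (c0 * M) + 1 ≤ C1 * M
    calc 2 * gr (0 : Zd d) * (c0 * M) + 1 ≤ 2 * gr (0 : Zd d) * (c0 * M) + M := by linarith
      _ = (2 * gr (0 : Zd d) * c0 + 1) * M := by ring
      _ ≤ _ := by gcongr
  · unfold errM
    show nm * (C1 * M * (2 * (u * (C1 * M * (K * μ / (H * Real.sqrt μ) ^ 2)) + u / (s * μ) * (τ * (K * μ + 1 + C1 * M))) +
      n2 * (u * (2 * (θ * M)) + u / (s * μ) * (τ * (2 * (K * μ + 1 + C1 * M)))) +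
      n2 * (u * (C1 * M * η) + u / (s * μ) * (τ * (K * μ + 1 + C1 * M))))) ≤ ε / 16 * (KT * M)
    have e1 : u * (C1 * M * (K * μ / (H * Real.sqrt μ) ^ 2)) = (u * M) * C1 * K / H ^ 2 := by
      rw [mul_pow, hR]; field_simp
    have e2 : u / (s * μ) * (τ * (2 * (K * μ + 1 + C1 * M))) = 2 * w := by rw [hwd]; ring
    rw [e1, e2, ← hwd]
    calc _ = (nm * (C1 * (2 * ((u * M) * C1 * K / H ^ 2 + w) + n2 * (2 * θ * (u * M) + 2 * w) + n2 * ((u * M) * C1 * η + w)))) * M := by ring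
      _ ≤ (nm * (C1 * (2 * (X * C1 * K / H ^ 2 + η) + n2 * (2 * θ * X + 2 * η) + n2 * (X * C1 * η + η)))) * M := by gcongr
      _ ≤ ((ε / 16) * KT) * M := by gcongr
      _ = _ := by ring
  · show 2 * (C1 * M) * (1 + 2 * (ε / 16)) / ((ε / 16) ^ 2 * (KT * M)) +
      nm * (u * (C1 * M * (η + C1 * M * Gt d g1)) + u / (s * μ) * (τ * (K * μ + 1 + C1 * M))) +
      (nm * (u * (C1 * M) + u / (s * μ) * (τ * (K * μ + 1 + C1 * M)))) *
        (4 * (nm * (u * (C1 * M * η) + u / (s * μ) * (τ * (K * μ + 1 + C1 * M))))) ≤ δ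
    rw [← hwd]
    refine le_trans ?_ k8
    have e1 : 2 * (C1 * M) * (1 + 2 * (ε / 16)) / ((ε / 16) ^ 2 * (KT * M)) = 2 * C1 * (1 + 2 * (ε / 16)) / ((ε / 16) ^ 2 * KT) := by
      field_simp
    have e2 : u * (C1 * M * (η + C1 * M * Gt d g1)) = (u * M) * C1 * (η + C1 * (M * Gt d g1)) := by ring
    have e3 : u * (C1 * M) = (u * M) * C1 := by ring
    have e4 : u * (C1 * M * η) = (u * M) * C1 * η := by ring
    rw [e1, e2, e3, e4]
    have f1 : (u * M) * C1 * (η + C1 * (M * Gt d g1)) ≤ X * C1 * (2 * η) := by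
      refine mul_le_mul (by gcongr) (by linarith) (by positivity) (by positivity)
    gcongr

theorem perc_main {εd : ℝ} (hεd : 0 < εd) (hlim : Tendsto (fun T : ℕ => ecap d T * logFour d T / (T : ℝ)) atTop (𝓝 εd))
    {ε C : ℝ} (hε0 : 0 < ε) (hε1 : ε < 1 / 2) :
    ∀ᶠ μ : ℝ in atTop, ∀ ρ : ℕ → ℝ, IsDist ρ → (Summable fun l : ℕ => (l : ℝ) ^ 2 * ρ l) → μ = mu 1 ρ →
      (∑' L : ℕ, if C * μ ≤ (L : ℝ) then (L : ℝ) ^ 2 * ρ L / mu 2 ρ else 0) ≤ ε / 20 →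
      ∀ m : Measure (Config d), IsFRI d ((1 + ε) * uN d εd ρ) ρ m → 0 < m (PercEvent d) := by
  obtain ⟨s, hs⟩ : ∃ s : ℝ, s = ε / 20 := ⟨_, rfl⟩
  have hs0 : 0 < s := by linarith
  obtain ⟨K, hKd⟩ : ∃ K : ℝ, K = max C 1 := ⟨_, rfl⟩
  have hCK : C ≤ K := hKd ▸ le_max_left _ _
  have hK : 1 ≤ K := hKd ▸ le_max_right _ _
  obtain ⟨r, sp, hr, hsp, hbump⟩ := bump d (s := s) (s1 := s ^ 2 / 8) (K := K) hs0 (by linarith) (by positivity) (by linarith)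
  have h1s : 0 < 1 - s := by linarith
  obtain ⟨c0, hc0d⟩ : ∃ c0 : ℝ, c0 = (1 - s) * εd * (s ^ 2 / 8 / 2) * sp / 5 := ⟨_, rfl⟩
  have hc0 : 0 < c0 := by rw [hc0d]; positivity
  obtain ⟨E1, hE1⟩ : ∃ E1 : ℝ, E1 = K * (32 * εd + 8 * GC d) + 1 := ⟨_, rfl⟩
  obtain ⟨C1, hC1d⟩ : ∃ C1 : ℝ, C1 = max (2 * E1 ^ 2 / c0) (2 * gr (0 : Zd d) * c0 + 1) := ⟨_, rfl⟩
  have hC1a : 2 * E1 ^ 2 / c0 ≤ C1 := hC1d ▸ le_max_left _ _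
  have hC1b : 2 * gr (0 : Zd d) * c0 + 1 ≤ C1 := hC1d ▸ le_max_right _ _
  have hC1 : 0 < C1 := by
    have h1 := gr0_pos (d := d)
    have : 0 < 2 * gr (0 : Zd d) * c0 := by positivity
    linarith
  obtain ⟨X, hXd⟩ : ∃ X : ℝ, X = 2 / εd := ⟨_, rfl⟩
  have hX : 0 < X := by rw [hXd]; positivity
  obtain ⟨J, nm, b, KT, H, v, ρ', n2, θ, η, δ, hJ, hKT, hH, hv, hθ, hθc, hη, k1, k2, k3, k4, k5, k6, k7, k8, k9⟩ :=
    consts (γ := ε / 16) hC1 hc0 (by linarith : 0 < K) (by linarith : 0 < r) hX (by positivity)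
  have hst := stage1 (η' := η * s / (X * (K + 1 + C1))) hεd hlim hs0 (by linarith) (by positivity) hK hr hsp hbump hc0
    (by rw [hc0d]; linarith) hE1 hC1a hθ hη (by positivity)
  filter_upwards [hst, scale d (max (1 / s) (X / s)), eventually_ge_atTop (1 / s), eventually_ge_atTop 1] with
    μ h1 ⟨y, hy, hy2, hμy, hℓ1, hℓy⟩ hμs hμ1 ρ hρ h2 hμ ht m hm
  obtain ⟨ℓ, hℓ⟩ : ∃ ℓ, ℓ = logFour d μ := ⟨_, rfl⟩
  obtain ⟨M, hM⟩ : ∃ M, M = μ / ℓ := ⟨_, rfl⟩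
  obtain ⟨τ, g1, β, hτ, hτℓ, hg1, hG, hQ1, hQ, hψ⟩ := h1 ℓ M hℓ hM
  rw [← hℓ] at hℓ1 hℓy
  have hℓ0 : 0 < ℓ := by linarith
  have hμ0 : 0 < μ := by linarith
  have hMy : y ≤ M := by
    rw [hM, le_div_iff₀ hℓ0]
    calc y * ℓ ≤ y * y := by gcongr
      _ = y ^ 2 := by ring
      _ ≤ y ^ 8 := by gcongr; linarith; norm_num
      _ = μ := hμy.symm
  have hM0 : 0 < M := by linarith
  have hsq := rmom_sq hρ h2
  rw [← hμ] at hsq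
  have hm0 : 0 < mu 2 ρ := lt_of_lt_of_le (by positivity) hsq
  obtain ⟨u, hud⟩ : ∃ u, u = (1 + ε) * uN d εd ρ := ⟨_, rfl⟩
  rw [← hud] at hm
  have hu : u = (1 + ε) * (μ * ℓ / (εd * mu 2 ρ)) := by rw [hud, uN, hℓ, hμ]
  have hu0 : 0 ≤ u := by rw [hu]; positivity
  have huM : u * M ≤ X := by
    calc u * M = (1 + ε) / εd * (μ ^ 2 / mu 2 ρ) := by rw [hu, hM]; field_simp
      _ ≤ 2 / εd * 1 := by
          have : μ ^ 2 / mu 2 ρ ≤ 1 := (div_le_one hm0).2 hsq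
          gcongr
          linarith
      _ = X := by rw [hXd, mul_one]
  have hyX := (le_max_right _ _).trans hy
  have hus : u ≤ s := by
    rw [div_le_iff₀ hs0] at hyX
    have h3 : u * M ≤ s * M := by
      calc u * M ≤ X := huM
        _ ≤ y * s := hyX
        _ ≤ M * s := by gcongr
        _ = s * M := mul_comm _ _
    exact le_of_mul_le_mul_right h3 hM0
  have hMμ : M ≤ μ := by rw [hM]; exact div_le_self hμ0.le hℓ1
  have hw : u / (s * μ) * (τ * (K * μ + 1 + C1 * M)) ≤ η := by
    have a1 : u * τ ≤ X * (η * s / (X * (K + 1 + C1))) := by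
      have a2 : (u * M) * (τ * ℓ) ≤ X * (η * s / (X * (K + 1 + C1)) * μ) := by gcongr
      have a3 : (u * M) * (τ * ℓ) = (u * τ) * μ := by rw [hM]; field_simp
      rw [a3, ← mul_assoc] at a2
      exact le_of_mul_le_mul_right a2 hμ0
    calc u / (s * μ) * (τ * (K * μ + 1 + C1 * M)) = (u * τ) * ((K * μ + 1 + C1 * M) / (s * μ)) := by ring
      _ ≤ (X * (η * s / (X * (K + 1 + C1)))) * ((K * μ + μ + C1 * μ) / (s * μ)) := by gcongr
      _ = η := by field_simp
  have hμs' : 1 ≤ s * μ := by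
    rw [div_le_iff₀ hs0] at hμs
    linarith
  rw [← hs] at ht
  have hm' : IsPoissonPP d (friIntensity d u ρ) m := hm
  obtain ⟨a, ha⟩ := fixed_perc hρ h2 hμ hε0 hε1 hs hμs' hℓ1 hεd hM (by linarith) hu hus hK hCK huM ht hC1 hc0 (by linarith) hC1b
    hJ hKT hH hv hθ hθc hη k1 k2 k3 k4 k5 k6 k7 k8 k9 hτ hg1 hG hQ1 hQ hψ hw hm'
  rwa [pp_shift hm' a] at ha
  intro η
  unfold friIntensity
  have hl : len (shT a η) = len η := by simp [len, shT]
  simp only [shT_valid, hl]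

end

theorem fri_supercritical_above
    (d : ℕ) (hd : 4 ≤ d)
    (ρ : ℕ → ℕ → ℝ) (hρ : Appropriate ρ)
    (Pw : Zd d → Measure (ℕ → Zd d)) (hPw : IsSRWFamily d Pw)
    (εd : ℝ) (hεd : IsCapLimit d Pw εd)
    (ε : ℝ) (hε0 : 0 < ε) (hε1 : ε < 1 / 2)
    (X : ℕ → ℝ → Measure (Config d))
    (hX : ∀ n : ℕ, ∀ u : ℝ, 0 ≤ u → IsFRI d u (ρ n) (X n u)) :
    ∀ᶠ n in atTop,
      0 < X n ((1 + ε) * uN d εd (ρ n)) (PercEvent d) ∧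
        uStar d (X n) ≤ (1 + ε) * uN d εd (ρ n) := by
  have : Fact (4 ≤ d) := ⟨hd⟩
  obtain ⟨hdist, hsum, hmu, htail⟩ := hρ
  obtain ⟨C, hC⟩ := htail (ε / 20) (by positivity)
  have hlim : Tendsto (fun T : ℕ => ecap d T * logFour d T / (T : ℝ)) atTop (𝓝 εd) := by
    simpa only [capExpect_eq hPw] using hεd.2
  filter_upwards [hmu.eventually (perc_main hεd.1 hlim (C := C) hε0 hε1), hmu.eventually_ge_atTop 1] with n h1 h2
  have hm2 : 0 ≤ mu 2 (ρ n) := (sq_nonneg _).trans (rmom_sq (hdist n) (hsum n))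
  have hl : 1 ≤ logFour d (mu 1 (ρ n)) := lF_ge h2
  have hε := hεd.1
  have hu : 0 ≤ (1 + ε) * uN d εd (ρ n) := by
    unfold uN
    positivity
  have h3 := h1 (ρ n) (hdist n) (hsum n) rfl (hC n) _ (hX n _ hu)
  refine ⟨h3, csInf_le ⟨0, fun u hu => hu.1⟩ ⟨hu, h3⟩⟩

end FRIPaper
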